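/- Let p ≥ q ≥ 1 and n = p + q. An element (γ, s, t) with γ = (γ₁ ≥ … ≥ γ_n ≥ 0) ∈ ℝⁿ, s = (s₁ ≥ … ≥ s_q ≥ 0) ∈ ℝ^q, t = (t₁ ≥ … ≥ t_q ≥ 0) ∈ ℝ^q belongs to S(p,q) if and only if: (i) γ_k ≥ s_k and γ_k ≥ t_k for all k ∈ [q]; and (ii) |γ|_{A∩[n]} − |γ|_{A^o∩[n]} ≥ |s|_{B∩[q]} − |s|_{B^o∩[q]} + |t|_{C∩[q]} − |t|_{C^o∩[q]} for every triple (A,B,C) where B and C are strict subsets of [n], A ⊂ [2n] with #A = #B + #C, and (μ(A), μ(B), μ(C)) ∈ LR(#B, #C); here A^o = {2n+1−a : a ∈ A} is taken relative to [2n] and B^o, C^o are taken relative to [n]. -/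

import Mathlib

open Matrix

/-- Eigenvalues of a (Hermitian) complex matrix, listed in decreasing order. -/
noncomputable def eigVec {k : ℕ} (X : Matrix (Fin k) (Fin k) ℂ) (hX : X.IsHermitian) :
    Fin k → ℝ :=
  fun i => hX.eigenvalues (Tuple.sort hX.eigenvalues i.rev)

/-- The `i`-th (0-based) singular value of a rectangular complex matrix:
the square root of the `i`-th largest eigenvalue of `Y * Yᴴ` (and `0` for `i ≥ a`). -/
noncomputable def sval {a b : ℕ} (Y : Matrix (Fin a) (Fin b) ℂ) (i : ℕ) : ℝ :=
  if h : i < a then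
    Real.sqrt (eigVec (Y * Yᴴ) (Matrix.isHermitian_mul_conjTranspose_self Y) ⟨i, h⟩)
  else 0

/-- The Horn cone `Horn(k)`. -/
def Horn (k : ℕ) : Set ((Fin k → ℝ) × (Fin k → ℝ) × (Fin k → ℝ)) :=
  { v | ∃ (X Y : Matrix (Fin k) (Fin k) ℂ) (hX : X.IsHermitian) (hY : Y.IsHermitian),
      v.1 = eigVec X hX ∧ v.2.1 = eigVec Y hY ∧ v.2.2 = eigVec (X + Y) (hX.add hY) }

/-- The Littlewood–Richardson cone `LR(m,n)`. -/
def LRcone (m n : ℕ) : Set ((Fin (m + n) → ℝ) × (Fin m → ℝ) × (Fin n → ℝ)) :=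
  { v | ∃ (M : Matrix (Fin (m + n)) (Fin (m + n)) ℂ) (hM : M.IsHermitian),
      v.1 = eigVec M hM ∧
      v.2.1 = eigVec (M.submatrix (Fin.castAdd n) (Fin.castAdd n))
        (hM.submatrix (Fin.castAdd n)) ∧
      v.2.2 = eigVec (M.submatrix (Fin.natAdd m) (Fin.natAdd m))
        (hM.submatrix (Fin.natAdd m)) }

/-- Top-left `p × p` block. -/
def blockTL (p q : ℕ) (X : Matrix (Fin (p + q)) (Fin (p + q)) ℂ) : Matrix (Fin p) (Fin p) ℂ :=
  X.submatrix (Fin.castAdd q) (Fin.castAdd q)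

/-- Top-right `p × q` block. -/
def blockTR (p q : ℕ) (X : Matrix (Fin (p + q)) (Fin (p + q)) ℂ) : Matrix (Fin p) (Fin q) ℂ :=
  X.submatrix (Fin.castAdd q) (Fin.natAdd p)

/-- Bottom-left `q × p` block. -/
def blockBL (p q : ℕ) (X : Matrix (Fin (p + q)) (Fin (p + q)) ℂ) : Matrix (Fin q) (Fin p) ℂ :=
  X.submatrix (Fin.natAdd p) (Fin.castAdd q)

/-- Bottom-right `q × q` block. -/
def blockBR (p q : ℕ) (X : Matrix (Fin (p + q)) (Fin (p + q)) ℂ) : Matrix (Fin q) (Fin q) ℂ :=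
  X.submatrix (Fin.natAdd p) (Fin.natAdd p)

/-- `λ* = (−λ_k, …, −λ_1)`. -/
def starVec {k : ℕ} (x : Fin k → ℝ) : Fin k → ℝ := fun i => -x i.rev

/-- `ŝ^{p,q} = (s₁, …, s_q, 0, …, 0, −s_q, …, −s₁) ∈ ℝ^{p+q}` (with `p − q` middle zeros). -/
noncomputable def hatPQ (p q : ℕ) (s : Fin q → ℝ) : Fin (p + q) → ℝ :=
  fun i =>
    if h : (i : ℕ) < q then s ⟨i, h⟩
    else if h' : (i : ℕ) < p then 0
    else -s ⟨p + q - 1 - i, by have := i.isLt; omega⟩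

/-- The cone `A(p,q)`: pairs `(e(X), s(X₁₂))` for `X` Hermitian of size `p+q`. -/
def coneA (p q : ℕ) : Set ((Fin (p + q) → ℝ) × (Fin q → ℝ)) :=
  { v | ∃ (X : Matrix (Fin (p + q)) (Fin (p + q)) ℂ) (hX : X.IsHermitian),
      v.1 = eigVec X hX ∧ ∀ i : Fin q, v.2 i = sval (blockTR p q X) (i : ℕ) }

/-- The cone `S(p,q)`: triples `(s(X), s(X₁₂), s(X₂₁))`. -/
def coneS (p q : ℕ) : Set ((Fin (p + q) → ℝ) × (Fin q → ℝ) × (Fin q → ℝ)) :=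
  { v | ∃ X : Matrix (Fin (p + q)) (Fin (p + q)) ℂ,
      (∀ i : Fin (p + q), v.1 i = sval X (i : ℕ)) ∧
      (∀ i : Fin q, v.2.1 i = sval (blockTR p q X) (i : ℕ)) ∧
      (∀ i : Fin q, v.2.2 i = sval (blockBL p q X) (i : ℕ)) }

/-- The cone `T(p,q)`: triples `(s(X), s(X₁₁), s(X₂₂))`. -/
def coneT (p q : ℕ) : Set ((Fin (p + q) → ℝ) × (Fin p → ℝ) × (Fin q → ℝ)) :=
  { v | ∃ X : Matrix (Fin (p + q)) (Fin (p + q)) ℂ,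
      (∀ i : Fin (p + q), v.1 i = sval X (i : ℕ)) ∧
      (∀ i : Fin p, v.2.1 i = sval (blockTL p q X) (i : ℕ)) ∧
      (∀ i : Fin q, v.2.2 i = sval (blockBR p q X) (i : ℕ)) }

/-- `μ(A) = (a_r − r ≥ … ≥ a₂ − 2 ≥ a₁ − 1)` as a decreasing real vector, for
`A = {a₁ < … < a_r}` a subset of `[n]` (0-based indexing internally). -/
noncomputable def muVec {n r : ℕ} (A : Finset (Fin n)) (h : A.card = r) : Fin r → ℝ :=
  fun k => (((A.orderIsoOfFin h k.rev : Fin n) : ℕ) : ℝ) - ((k.rev : ℕ) : ℝ)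

/-- `A^o = {ℓ + 1 − a : a ∈ A}` inside `[ℓ]`. -/
def opp {n : ℕ} (A : Finset (Fin n)) : Finset (Fin n) := A.image Fin.rev

/-- `|s|_{K ∩ [q]}` where `K ⊆ [n]`, `s ∈ ℝ^q` and `[q]` is viewed inside `[n]`. -/
noncomputable def sumRestr {n q : ℕ} (s : Fin q → ℝ) (K : Finset (Fin n)) : ℝ :=
  ∑ i ∈ K, (if h : (i : ℕ) < q then s ⟨i, h⟩ else 0)

/-- The augmented matrix `Ŷ^{p,q} = [[0, Y], [Yᴴ, 0]]` of size `p + q`. -/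
def hatM (p q : ℕ) (Y : Matrix (Fin p) (Fin q) ℂ) : Matrix (Fin (p + q)) (Fin (p + q)) ℂ :=
  Matrix.reindex finSumFinEquiv finSumFinEquiv (Matrix.fromBlocks 0 Y Yᴴ 0)

namespace HornRect

open Module (finrank)

/-- Square complex matrices. -/
abbrev SqMat (P : Type*) := Matrix P P ℂ

section Basic

set_option linter.unusedSectionVars false

/-- A finite disjoint union of chains: comparability is transitive. -/
class ChainPoset (P : Type*) [PartialOrder P] : Prop where
  trans : ∀ i j k : P, (i ≤ j ∨ j ≤ i) → (j ≤ k ∨ k ≤ j) → (i ≤ k ∨ k ≤ i)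

instance {P : Type*} [LinearOrder P] : ChainPoset P := ⟨fun i _ k _ _ => le_total i k⟩

instance {P Q : Type*} [LinearOrder P] [LinearOrder Q] : ChainPoset (P ⊕ Q) := by
  refine ⟨?_⟩
  rintro (i | i) (j | j) (k | k) <;> simp [le_total]

/-- Comparability. -/
def Comp {P : Type*} [PartialOrder P] (i j : P) : Prop := i ≤ j ∨ j ≤ i

theorem Comp.symm {P : Type*} [PartialOrder P] {i j : P} (h : Comp i j) : Comp j i := Or.symm h

theorem Comp.refl {P : Type*} [PartialOrder P] (i : P) : Comp i i := Or.inl le_rfl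

theorem Comp.trans {P : Type*} [PartialOrder P] [ChainPoset P] {i j k : P} (h : Comp i j)
    (h' : Comp j k) : Comp i k := ChainPoset.trans i j k h h'

variable {K : Type*} [Field K] {P Q R : Type*}

/-- The coordinate subspace spanned by the basis vectors in `X`. -/
def coord (K : Type*) [Field K] {P : Type*} (X : Finset P) : Submodule K (P → K) where
  carrier := {v | ∀ i, i ∉ X → v i = 0}
  add_mem' := by intro a b ha hb i hi; simp [ha i hi, hb i hi]
  zero_mem' := by intro i _; rfl
  smul_mem' := by intro c a ha i hi; simp [ha i hi]

theorem mem_coord {X : Finset P} {v : P → K} : v ∈ coord K X ↔ ∀ i, i ∉ X → v i = 0 := Iff.rfl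

theorem coord_mono {X Y : Finset P} (h : X ⊆ Y) : coord K X ≤ coord K Y :=
  fun _ hv i hi => hv i fun h' => hi (h h')

theorem coord_univ [Fintype P] : coord K (Finset.univ : Finset P) = ⊤ := by
  ext v; simp [mem_coord]

theorem finrank_map_of_injective {V V' : Type*} [AddCommGroup V] [Module K V] [AddCommGroup V']
    [Module K V'] (f : V →ₗ[K] V') (hf : Function.Injective f) (W : Submodule K V) :
    finrank K (W.map f) = finrank K W :=
  (LinearEquiv.finrank_eq (Submodule.equivMapOfInjective f hf W)).symm

theorem coord_inf [DecidableEq P] (X Y : Finset P) : coord K X ⊓ coord K Y = coord K (X ∩ Y) := by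
  ext v
  simp only [Submodule.mem_inf, mem_coord, Finset.mem_inter]
  constructor
  · rintro ⟨h1, h2⟩ i hi
    by_cases h : i ∈ X
    · exact h2 i fun h' => hi ⟨h, h'⟩
    · exact h1 i h
  · intro h
    exact ⟨fun i hi => h i fun h' => hi h'.1, fun i hi => h i fun h' => hi h'.2⟩

/-- Coordinate subspaces are function spaces. -/
noncomputable def coordEquiv [DecidableEq P] (X : Finset P) : coord K X ≃ₗ[K] (X → K) where
  toFun v i := v.1 i
  invFun w := ⟨fun i => if h : i ∈ X then w ⟨i, h⟩ else 0, fun i hi => by simp [hi]⟩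
  left_inv v := by
    ext i
    by_cases h : i ∈ X
    · simp [h]
    · simp [h, v.2 i h]
  right_inv w := by ext i; simp
  map_add' _ _ := rfl
  map_smul' _ _ := rfl

theorem finrank_coord [DecidableEq P] (X : Finset P) : finrank K (coord K X) = X.card := by
  rw [(coordEquiv (K := K) X).finrank_eq]; simp

/-- Matrices supported on `S`. -/
def SM (K : Type*) [Field K] {P Q : Type*} (S : Finset (P × Q)) : Submodule K (Matrix P Q K) where
  carrier := {M | ∀ i j, (i, j) ∉ S → M i j = 0}
  add_mem' := by intro a b ha hb i j hi; simp [ha i j hi, hb i j hi]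
  zero_mem' := by intro i j _; rfl
  smul_mem' := by intro c a ha i j hi; simp [ha i j hi]

theorem mem_SM {S : Finset (P × Q)} {M : Matrix P Q K} :
    M ∈ SM K S ↔ ∀ i j, (i, j) ∉ S → M i j = 0 := Iff.rfl

theorem SM_ne {S : Finset (P × Q)} {M : Matrix P Q K} (h : M ∈ SM K S) {i : P} {j : Q}
    (hij : M i j ≠ 0) : (i, j) ∈ S := by
  by_contra h'; exact hij (h i j h')

theorem mem_SM_of {S : Finset (P × Q)} {M : Matrix P Q K}
    (h : ∀ i j, M i j ≠ 0 → (i, j) ∈ S) : M ∈ SM K S := by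
  intro i j hij; by_contra h'; exact hij (h i j h')

theorem SM_mono {S S' : Finset (P × Q)} (h : S ⊆ S') : SM K S ≤ SM K S' :=
  fun _ hv i j hi => hv i j fun h' => hi (h h')

/-- Spaces of matrices with prescribed support are function spaces. -/
noncomputable def SMEquiv [DecidableEq P] [DecidableEq Q] (S : Finset (P × Q)) :
    SM K S ≃ₗ[K] (S → K) where
  toFun v i := v.1 i.1.1 i.1.2
  invFun w := ⟨fun i j => if h : (i, j) ∈ S then w ⟨(i, j), h⟩ else 0, fun i j hi => by simp [hi]⟩
  left_inv v := by
    ext i j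
    by_cases h : (i, j) ∈ S
    · simp [h]
    · simp [h, v.2 i j h]
  right_inv w := by ext i; simp
  map_add' _ _ := rfl
  map_smul' _ _ := rfl

theorem finrank_SM [DecidableEq P] [DecidableEq Q] (S : Finset (P × Q)) :
    finrank K (SM K S) = S.card := by
  rw [(SMEquiv (K := K) S).finrank_eq]; simp

theorem SM_mul [Fintype Q] {S : Finset (P × Q)} {S' : Finset (Q × R)} {S'' : Finset (P × R)}
    {M : Matrix P Q K} {N : Matrix Q R K} (hM : M ∈ SM K S) (hN : N ∈ SM K S')
    (h : ∀ i j k, (i, j) ∈ S → (j, k) ∈ S' → (i, k) ∈ S'') : M * N ∈ SM K S'' := by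
  intro i k hik
  rw [Matrix.mul_apply]
  refine Finset.sum_eq_zero fun j _ => ?_
  by_contra h'
  exact hik (h i j k (SM_ne hM (left_ne_zero_of_mul h')) (SM_ne hN (right_ne_zero_of_mul h')))

theorem SM_mulVec [Fintype Q] {S : Finset (P × Q)} {X : Finset Q} {Y : Finset P}
    {M : Matrix P Q K} {v : Q → K} (hM : M ∈ SM K S) (hv : v ∈ coord K X)
    (h : ∀ i j, (i, j) ∈ S → j ∈ X → i ∈ Y) : M *ᵥ v ∈ coord K Y := by
  intro i hi
  rw [mulVec, dotProduct]
  refine Finset.sum_eq_zero fun j _ => ?_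
  by_contra h'
  refine hi (h i j (SM_ne hM (left_ne_zero_of_mul h')) ?_)
  by_contra h2
  exact right_ne_zero_of_mul h' (hv j h2)

theorem SM_mul_eq_zero [Fintype Q] {S : Finset (P × Q)} {S' : Finset (Q × R)}
    {M : Matrix P Q K} {N : Matrix Q R K} (hM : M ∈ SM K S) (hN : N ∈ SM K S')
    (h : ∀ i j k, (i, j) ∈ S → (j, k) ∈ S' → False) : M * N = 0 := by
  have : M * N ∈ SM K (∅ : Finset (P × R)) := SM_mul hM hN fun i j k h1 h2 => (h i j k h1 h2).elim
  ext i j; exact this i j (by simp)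

open Classical in
/-- The pairs `(d, b) ∈ D × B` with `d ≤ b`. -/
noncomputable def tri [PartialOrder P] (D B : Finset P) : Finset (P × P) :=
  (D ×ˢ B).filter fun x => x.1 ≤ x.2

theorem mem_tri [PartialOrder P] {D B : Finset P} {i j : P} :
    (i, j) ∈ tri D B ↔ i ∈ D ∧ j ∈ B ∧ i ≤ j := by
  simp [tri, and_assoc]

theorem tri_mono [PartialOrder P] {D B D' B' : Finset P} (h : D ⊆ D') (h' : B ⊆ B') :
    tri D B ⊆ tri D' B' := by
  rintro ⟨i, j⟩ hij
  rw [mem_tri] at *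
  exact ⟨h hij.1, h' hij.2.1, hij.2.2⟩

/-- Diagonal projection on the coordinates in `X`. -/
def mask (K : Type*) [CommRing K] {P : Type*} [DecidableEq P] (X : Finset P) : Matrix P P K :=
  Matrix.diagonal fun i => if i ∈ X then 1 else 0

theorem mask_mulVec_apply [Fintype P] [DecidableEq P] (X : Finset P) (v : P → K) (i : P) :
    (mask K X *ᵥ v) i = if i ∈ X then v i else 0 := by
  simp [mask, mulVec_diagonal]

theorem mask_mul_apply [Fintype P] [DecidableEq P] (X : Finset P) (M : Matrix P Q K) (i : P)
    (j : Q) : (mask K X * M) i j = if i ∈ X then M i j else 0 := by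
  simp [mask, Matrix.diagonal_mul]

theorem mul_mask_apply [Fintype P] [DecidableEq P] (X : Finset P) (M : Matrix Q P K) (i : Q)
    (j : P) : (M * mask K X) i j = if j ∈ X then M i j else 0 := by
  simp [mask, Matrix.mul_diagonal]

theorem mask_mulVec_mem [Fintype P] [DecidableEq P] (X : Finset P) (v : P → K) :
    mask K X *ᵥ v ∈ coord K X := by
  intro i hi; simp [mask_mulVec_apply, hi]

theorem mask_mulVec_of_mem [Fintype P] [DecidableEq P] {X : Finset P} {v : P → K}
    (hv : v ∈ coord K X) : mask K X *ᵥ v = v := by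
  ext i
  rw [mask_mulVec_apply]
  split_ifs with h
  · rfl
  · exact (hv i h).symm

/-- A subspace is graded if it is the sum of its components on the chains. -/
def Graded [PartialOrder P] (W : Submodule K (P → K)) : Prop :=
  ∀ v ∈ W, ∀ i w, (∀ j, Comp i j → w j = v j) → (∀ j, ¬ Comp i j → w j = 0) → w ∈ W

theorem graded_of_linear [LinearOrder P] (W : Submodule K (P → K)) : Graded W := by
  intro v hv i w h _
  have : w = v := funext fun j => h j (le_total i j)
  rwa [this]

theorem graded_coord [PartialOrder P] (X : Finset P) : Graded (coord K X) := by
  intro v hv i w h h' j hj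
  by_cases hc : Comp i j
  · rw [h j hc, hv j hj]
  · exact h' j hc

theorem Graded.inf [PartialOrder P] {W W' : Submodule K (P → K)} (h : Graded W) (h' : Graded W') :
    Graded (W ⊓ W') :=
  fun v hv i w h1 h2 => ⟨h v hv.1 i w h1 h2, h' v hv.2 i w h1 h2⟩

theorem Graded.sup [PartialOrder P] {W W' : Submodule K (P → K)} (h : Graded W) (h' : Graded W') :
    Graded (W ⊔ W') := by
  classical
  intro v hv i w h1 h2
  obtain ⟨a, ha, b, hb, rfl⟩ := Submodule.mem_sup.1 hv
  have hw : w = (fun j => if Comp i j then a j else 0) + (fun j => if Comp i j then b j else 0) := by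
    ext j
    by_cases hc : Comp i j
    · simp [hc, h1 j hc]
    · simp [hc, h2 j hc]
  rw [hw]
  refine Submodule.add_mem_sup (h a ha i _ (fun j hj => by simp [hj]) (fun j hj => by simp [hj]))
    (h' b hb i _ (fun j hj => by simp [hj]) (fun j hj => by simp [hj]))

/-- A matrix is graded if its nonzero entries have comparable indices. -/
def GradedMat [PartialOrder P] (M : Matrix P P K) : Prop := ∀ i j, M i j ≠ 0 → Comp i j

theorem gradedMat_of_tri [PartialOrder P] {D B : Finset P} {M : Matrix P P K}
    (h : M ∈ SM K (tri D B)) : GradedMat M :=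
  fun _ _ hij => Or.inl (mem_tri.1 (SM_ne h hij)).2.2

theorem GradedMat.mulVec_restrict [Fintype P] [PartialOrder P] [ChainPoset P] {M : Matrix P P K}
    (hM : GradedMat M) {v v' w : P → K} {i : P}
    (h : ∀ j, Comp i j → w j = (M *ᵥ v) j) (h' : ∀ j, ¬ Comp i j → w j = 0)
    (hv : ∀ j, Comp i j → v' j = v j) (hv' : ∀ j, ¬ Comp i j → v' j = 0) : w = M *ᵥ v' := by
  ext j
  by_cases hc : Comp i j
  · rw [h j hc, mulVec, dotProduct, mulVec, dotProduct]
    refine Finset.sum_congr rfl fun k _ => ?_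
    by_cases hM0 : M j k = 0
    · simp [hM0]
    · rw [hv k (hc.trans (hM j k hM0))]
  · rw [h' j hc, mulVec, dotProduct]
    refine (Finset.sum_eq_zero fun k _ => ?_).symm
    by_cases hM0 : M j k = 0
    · simp [hM0]
    · rw [hv' k fun hk => hc (hk.trans (hM j k hM0).symm), mul_zero]

theorem Graded.map [Fintype P] [DecidableEq P] [PartialOrder P] [ChainPoset P] {M : Matrix P P K}
    (hM : GradedMat M) {W : Submodule K (P → K)} (hW : Graded W) :
    Graded (W.map (toLin' M)) := by
  classical
  rintro _ ⟨v, hv, rfl⟩ i w h h'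
  refine ⟨fun j => if Comp i j then v j else 0,
    hW v hv i _ (fun j hj => by simp [hj]) (fun j hj => by simp [hj]), ?_⟩
  rw [toLin'_apply] at *
  exact (hM.mulVec_restrict h h' (fun j hj => by simp [hj]) (fun j hj => by simp [hj])).symm

theorem Graded.comap [Fintype P] [DecidableEq P] [PartialOrder P] [ChainPoset P] {M : Matrix P P K}
    (hM : GradedMat M) {W : Submodule K (P → K)} (hW : Graded W) :
    Graded (W.comap (toLin' M)) := by
  classical
  intro v hv i w h h'
  rw [Submodule.mem_comap, toLin'_apply] at *
  have : (fun j => if Comp i j then (M *ᵥ v) j else 0) = M *ᵥ w :=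
    hM.mulVec_restrict (v := v) (i := i) (fun j hj => by simp [hj]) (fun j hj => by simp [hj]) h h'
  rw [← this]
  exact hW _ hv i _ (fun j hj => by simp [hj]) (fun j hj => by simp [hj])

theorem gradedMat_one [DecidableEq P] [PartialOrder P] : GradedMat (1 : Matrix P P K) := by
  intro i j h
  by_cases hij : i = j
  · subst hij; exact Comp.refl _
  · simp [hij] at h

theorem GradedMat.add [PartialOrder P] {M N : Matrix P P K} (hM : GradedMat M) (hN : GradedMat N) :
    GradedMat (M + N) := by
  intro i j h
  by_cases h1 : M i j = 0
  · exact hN i j fun h2 => h (by simp [h1, h2])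
  · exact hM i j h1

theorem GradedMat.neg [PartialOrder P] {M : Matrix P P K} (hM : GradedMat M) :
    GradedMat (-M) := fun i j h => hM i j (by simpa using h)

theorem GradedMat.sub [PartialOrder P] {M N : Matrix P P K} (hM : GradedMat M) (hN : GradedMat N) :
    GradedMat (M - N) := by rw [sub_eq_add_neg]; exact hM.add hN.neg

theorem GradedMat.mul [Fintype P] [PartialOrder P] [ChainPoset P] {M N : Matrix P P K}
    (hM : GradedMat M) (hN : GradedMat N) : GradedMat (M * N) := by
  intro i k h
  rw [Matrix.mul_apply] at h
  obtain ⟨j, -, hj⟩ := Finset.exists_ne_zero_of_sum_ne_zero h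
  exact (hM i j (left_ne_zero_of_mul hj)).trans (hN j k (right_ne_zero_of_mul hj))

end Basic

section Echelon

set_option linter.unusedSectionVars false

variable {K : Type*} [Field K] {P : Type*} [Fintype P] [DecidableEq P] [PartialOrder P]

theorem tri_mul_self {D B : Finset P} (h : Disjoint D B) {φ ψ : Matrix P P K}
    (hφ : φ ∈ SM K (tri D B)) (hψ : ψ ∈ SM K (tri D B)) : φ * ψ = 0 :=
  SM_mul_eq_zero hφ hψ fun _ _ _ h1 h2 =>
    Finset.disjoint_left.1 h (mem_tri.1 h2).1 (mem_tri.1 h1).2.1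

theorem one_add_mul_one_sub {φ : Matrix P P K} (h : φ * φ = 0) : (1 + φ) * (1 - φ) = 1 := by
  noncomm_ring; simp [h]

theorem one_sub_mul_one_add {φ : Matrix P P K} (h : φ * φ = 0) : (1 - φ) * (1 + φ) = 1 := by
  noncomm_ring; simp [h]

theorem disjoint_compl_left' (B : Finset P) : Disjoint Bᶜ B := disjoint_compl_left

/-- Triangular matrices preserve coordinate subspaces of lower sets. -/
theorem tri_mulVec_mem {D B X : Finset P} (hX : IsLowerSet (X : Set P)) {φ : Matrix P P K}
    (hφ : φ ∈ SM K (tri D B)) {v : P → K} (hv : v ∈ coord K X) : φ *ᵥ v ∈ coord K X :=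
  SM_mulVec hφ hv fun _ _ h1 h2 => hX (mem_tri.1 h1).2.2 h2

/-- The graph subspace `(1+φ) K^B`. -/
noncomputable def ech (B : Finset P) (φ : Matrix P P K) : Submodule K (P → K) :=
  (coord K B).map (toLin' (1 + φ))

theorem mem_ech' {B : Finset P} {φ : Matrix P P K} {v : P → K} :
    v ∈ ech B φ ↔ ∃ w ∈ coord K B, v = w + φ *ᵥ w := by
  simp only [ech, Submodule.mem_map, toLin'_apply, add_mulVec, one_mulVec]
  exact ⟨fun ⟨w, h, h'⟩ => ⟨w, h, h'.symm⟩, fun ⟨w, h, h'⟩ => ⟨w, h, h'.symm⟩⟩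

theorem toLin'_injective {M N : Matrix P P K} (h : N * M = 1) :
    Function.Injective (toLin' M) := by
  intro v w hvw
  have := congrArg (fun x => N *ᵥ x) hvw
  simpa [toLin'_apply, mulVec_mulVec, h] using this

theorem one_add_injective {D B : Finset P} (h : Disjoint D B) {φ : Matrix P P K}
    (hφ : φ ∈ SM K (tri D B)) : Function.Injective (toLin' (1 + φ)) :=
  toLin'_injective (one_sub_mul_one_add (tri_mul_self h hφ hφ))

theorem finrank_ech {B : Finset P} {φ : Matrix P P K} (hφ : φ ∈ SM K (tri Bᶜ B)) :
    finrank K (ech B φ) = B.card := by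
  rw [ech, finrank_map_of_injective _ (one_add_injective disjoint_compl_left hφ), finrank_coord]

theorem ech_inf_coord {B X : Finset P} (hX : IsLowerSet (X : Set P)) {φ : Matrix P P K}
    (hφ : φ ∈ SM K (tri Bᶜ B)) :
    ech B φ ⊓ coord K X = (coord K (B ∩ X)).map (toLin' (1 + φ)) := by
  ext v
  rw [Submodule.mem_inf]
  constructor
  · rintro ⟨h, hv⟩
    obtain ⟨w, hw, rfl⟩ := mem_ech'.1 h
    refine ⟨w, fun i hi => ?_, by simp [add_mulVec]⟩
    by_cases hB : i ∈ B
    · have hiX : i ∉ X := fun h => hi (by simp [hB, h])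
      have h1 := hv i hiX
      have h2 : (φ *ᵥ w) i = 0 :=
        SM_mulVec hφ hw (Y := Bᶜ) (fun i j h _ => (mem_tri.1 h).1) i (by simpa using hB)
      simpa [h2] using h1
    · exact hw i hB
  · rintro ⟨w, hw, rfl⟩
    simp only [SetLike.mem_coe] at hw
    have hwX : w ∈ coord K X := coord_mono Finset.inter_subset_right hw
    refine ⟨⟨w, coord_mono Finset.inter_subset_left hw, rfl⟩, ?_⟩
    simp only [toLin'_apply, add_mulVec, one_mulVec]
    exact add_mem hwX (tri_mulVec_mem hX hφ hwX)

theorem finrank_ech_inf {B X : Finset P} (hX : IsLowerSet (X : Set P)) {φ : Matrix P P K}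
    (hφ : φ ∈ SM K (tri Bᶜ B)) :
    finrank K (ech B φ ⊓ coord K X : Submodule K (P → K)) = (B ∩ X).card := by
  rw [ech_inf_coord hX hφ, finrank_map_of_injective _ (one_add_injective disjoint_compl_left hφ), finrank_coord]

theorem graded_ech [ChainPoset P] {B : Finset P} {φ : Matrix P P K} (hφ : φ ∈ SM K (tri Bᶜ B)) :
    Graded (ech B φ) :=
  (graded_coord B).map (gradedMat_one.add (gradedMat_of_tri hφ))

theorem exists_reduced (W : Submodule K (P → K)) (B : Finset P)
    (hB : ∀ i, i ∈ B → ∃ w ∈ W, w i = 1 ∧ ∀ j, w j ≠ 0 → j ≤ i) :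
    ∀ i, i ∈ B → ∃ w ∈ W, w i = 1 ∧ (∀ j, w j ≠ 0 → j ≤ i) ∧ ∀ j ∈ B, j ≠ i → w j = 0 := by
  classical
  intro i
  induction i using WellFoundedLT.induction with
  | ind i ih =>
    intro hi
    obtain ⟨w, hw, h1, h2⟩ := hB i hi
    choose! r hr1 hr2 hr3 hr4 using ih
    refine ⟨w - ∑ j ∈ B.filter (· < i), w j • r j, ?_, ?_, ?_, ?_⟩
    · refine sub_mem hw (sum_mem fun j hj => W.smul_mem _ ?_)
      simp only [Finset.mem_filter] at hj
      exact hr1 j hj.2 hj.1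
    · rw [Pi.sub_apply, h1, Finset.sum_apply, Finset.sum_eq_zero, sub_zero]
      intro j hj
      simp only [Finset.mem_filter] at hj
      have : r j i = 0 := by
        by_contra h
        exact absurd (hr3 j hj.2 hj.1 i h) (not_le_of_gt hj.2)
      simp [this]
    · intro k hk
      by_contra hki
      have hwk : w k = 0 := by
        by_contra h; exact hki (h2 k h)
      apply hk
      rw [Pi.sub_apply, hwk, Finset.sum_apply, Finset.sum_eq_zero, sub_zero]
      intro j hj
      simp only [Finset.mem_filter] at hj
      have : r j k = 0 := by
        by_contra h
        exact hki ((hr3 j hj.2 hj.1 k h).trans hj.2.le)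
      simp [this]
    · intro k hk hki
      by_cases hlt : k < i
      · rw [Pi.sub_apply, Finset.sum_apply, Finset.sum_eq_single k]
        · simp [hr2 k hlt hk]
        · intro j hj hjk
          simp only [Finset.mem_filter] at hj
          simp [hr4 j hj.2 hj.1 k hk (Ne.symm hjk)]
        · intro h
          exact absurd (Finset.mem_filter.2 ⟨hk, hlt⟩) h
      · have hnle : ¬ k ≤ i := fun h => hlt (lt_of_le_of_ne h hki)
        have hwk : w k = 0 := by
          by_contra h; exact hnle (h2 k h)
        rw [Pi.sub_apply, hwk, Finset.sum_apply, Finset.sum_eq_zero, sub_zero]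
        intro j hj
        simp only [Finset.mem_filter] at hj
        have : r j k = 0 := by
          by_contra h
          exact hnle ((hr3 j hj.2 hj.1 k h).trans hj.2.le)
        simp [this]

/-- Echelon form of graded subspaces. -/
theorem exists_ech (W : Submodule K (P → K)) (hW : Graded W) :
    ∃ (B : Finset P) (φ : Matrix P P K), φ ∈ SM K (tri Bᶜ B) ∧ W = ech B φ ∧
      ∀ X : Finset P, W ≤ coord K X → B ⊆ X ∧ φ ∈ SM K (tri (X \ B) B) := by
  classical
  let B : Finset P := Finset.univ.filter fun i => ∃ w ∈ W, w i = 1 ∧ ∀ j, w j ≠ 0 → j ≤ i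
  have hB : ∀ i, i ∈ B ↔ ∃ w ∈ W, w i = 1 ∧ ∀ j, w j ≠ 0 → j ≤ i := by simp [B]
  have hred := exists_reduced W B fun i hi => (hB i).1 hi
  choose! r hr1 hr2 hr3 hr4 using hred
  let φ : Matrix P P K := fun i j => if j ∈ B ∧ i ∉ B then r j i else 0
  have hφ : φ ∈ SM K (tri Bᶜ B) := mem_SM_of fun i j h => by
    simp only [φ, ne_eq, ite_eq_right_iff, Classical.not_imp] at h
    rw [mem_tri]
    exact ⟨by simpa using h.1.2, h.1.1, hr3 j h.1.1 i h.2⟩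
  have hinj : ∀ v ∈ W, (∀ i ∈ B, v i = 0) → v = 0 := by
    intro v hv h0
    by_contra hne
    obtain ⟨i0, hi0⟩ := Function.ne_iff.1 hne
    obtain ⟨i, hi⟩ := (Finset.univ.filter fun i => v i ≠ 0).exists_maximal ⟨i0, by simpa using hi0⟩
    have hiv : v i ≠ 0 := by simpa using hi.1
    refine hiv (h0 i ((hB i).2 ⟨fun j => if Comp i j then (v i)⁻¹ * v j else 0, ?_, ?_, ?_⟩))
    · exact hW _ (W.smul_mem (v i)⁻¹ hv) i _ (fun j hj => by simp [hj]) (fun j hj => by simp [hj])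
    · simp [Comp.refl, hiv]
    · intro j hj
      have hc : Comp i j := by
        by_contra h; simp [h] at hj
      have hvj : v j ≠ 0 := by
        intro h; simp [h] at hj
      rcases hc with h | h
      · exact hi.2 (by simpa using hvj) h
      · exact h
  have hcol : ∀ j ∈ B, ∀ i, r j i = (if i = j then 1 else 0) + φ i j := by
    intro j hj i
    by_cases hij : i = j
    · subst hij; simp [φ, hj, hr2 i hj]
    · by_cases hi : i ∈ B
      · simp [φ, hij, hi, hr4 j hj i hi hij]
      · simp [φ, hij, hi, hj]
  have hcomb : ∀ w ∈ coord K B, w + φ *ᵥ w = ∑ j ∈ B, w j • r j := by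
    intro w hw
    ext i
    rw [Pi.add_apply, Finset.sum_apply, mulVec, dotProduct,
      ← Finset.sum_subset (Finset.subset_univ B)]
    · have : w i = ∑ j ∈ B, w j * (if i = j then 1 else 0) := by
        by_cases hi : i ∈ B <;> simp [hi, hw i]
      rw [this, ← Finset.sum_add_distrib]
      refine Finset.sum_congr rfl fun j hj => ?_
      rw [Pi.smul_apply, smul_eq_mul, hcol j hj]
      ring
    · intro j _ hj; simp [hw j hj]
  refine ⟨B, φ, hφ, ?_, ?_⟩
  · ext v
    rw [mem_ech']
    constructor
    · intro hv
      refine ⟨mask K B *ᵥ v, mask_mulVec_mem _ _, ?_⟩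
      have hmem : mask K B *ᵥ v + φ *ᵥ (mask K B *ᵥ v) ∈ W := by
        rw [hcomb _ (mask_mulVec_mem _ _)]
        exact sum_mem fun j hj => W.smul_mem _ (hr1 j hj)
      rw [← sub_eq_zero]
      refine hinj _ (sub_mem hv hmem) fun i hi => ?_
      have h2 : (φ *ᵥ (mask K B *ᵥ v)) i = 0 :=
        SM_mulVec hφ (mask_mulVec_mem B v) (Y := Bᶜ) (fun i j h _ => (mem_tri.1 h).1) i
          (by simpa using hi)
      rw [Pi.sub_apply, Pi.add_apply, h2, mask_mulVec_apply, if_pos hi]; simp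
    · rintro ⟨w, hw, rfl⟩
      rw [hcomb w hw]
      exact sum_mem fun j hj => W.smul_mem _ (hr1 j hj)
  · intro X hX
    refine ⟨fun j hj => ?_, mem_SM_of fun i j h => ?_⟩
    · by_contra h
      have := hX (hr1 j hj) j h
      rw [hr2 j hj] at this
      exact one_ne_zero this
    · have ht := mem_tri.1 (SM_ne hφ h)
      refine mem_tri.2 ⟨?_, ht.2⟩
      rw [Finset.mem_sdiff]
      refine ⟨?_, by simpa using ht.1⟩
      by_contra hi
      have h0 := hX (hr1 j ht.2.1) i hi
      have h3 : i ∉ B := by simpa using ht.1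
      simp [φ, ht.2.1, h3, h0] at h

end Echelon

section Frames

variable {P T : Type*} [Fintype P] [DecidableEq P] [Fintype T] [DecidableEq T]

theorem exists_frame (V : Submodule ℂ (P → ℂ)) (b : ℕ) (hb : b ≤ finrank ℂ V) :
    ∃ v : Matrix P (Fin b) ℂ, vᴴ * v = 1 ∧ ∀ x, v *ᵥ x ∈ V := by
  let e := (WithLp.linearEquiv 2 ℂ (P → ℂ)).symm
  let V' : Submodule ℂ (EuclideanSpace ℂ P) := V.map e.toLinearMap
  have hV' : finrank ℂ V' = finrank ℂ V := finrank_map_of_injective _ e.injective V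
  let o := stdOrthonormalBasis ℂ V'
  let f : Fin b → V' := fun i => o (Fin.castLE (hV' ▸ hb) i)
  have hf : Orthonormal ℂ f := o.orthonormal.comp _ (Fin.castLE_injective _)
  refine ⟨Matrix.of fun i j => (f j).1 i, ?_, ?_⟩
  · ext i j
    have h := (orthonormal_iff_ite.1 hf) i j
    rw [Submodule.coe_inner, PiLp.inner_apply] at h
    rw [Matrix.mul_apply, Matrix.one_apply, ← h]
    refine Finset.sum_congr rfl fun k _ => ?_
    simp [conjTranspose_apply, mul_comm]
  · intro x
    have hm : ∀ j, (WithLp.linearEquiv 2 ℂ (P → ℂ)) (f j).1 ∈ V := by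
      intro j
      obtain ⟨w, hw, h⟩ := (f j).2
      rw [← h]
      simpa [e] using hw
    have : (Matrix.of fun i j => (f j).1 i : Matrix P (Fin b) ℂ) *ᵥ x
        = ∑ j, x j • (WithLp.linearEquiv 2 ℂ (P → ℂ)) (f j).1 := by
      ext i
      simp [mulVec, dotProduct, Finset.sum_apply, mul_comm]
    rw [this]
    exact sum_mem fun j _ => V.smul_mem _ (hm j)

theorem mulVec_injective_of_left_inv {m n : Type*} [Fintype m] [Fintype n] [DecidableEq n]
    {R : Type*} [CommRing R] {M : Matrix m n R} {N : Matrix n m R} (h : N * M = 1) :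
    Function.Injective (toLin' M) := by
  intro v w hvw
  have := congrArg (fun x => N *ᵥ x) hvw
  simpa [toLin'_apply, mulVec_mulVec, h] using this

theorem finrank_of_frame {b : ℕ} {v : Matrix P (Fin b) ℂ} (hv : vᴴ * v = 1)
    {V : Submodule ℂ (P → ℂ)} (h : ∀ x, v *ᵥ x ∈ V) : b ≤ finrank ℂ V := by
  have hle : LinearMap.range (toLin' v) ≤ V := by
    rintro _ ⟨x, rfl⟩; exact h x
  calc b = finrank ℂ (LinearMap.range (toLin' v)) := by
        rw [LinearMap.finrank_range_of_inj (mulVec_injective_of_left_inv hv)]; simp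
    _ ≤ _ := Submodule.finrank_mono hle

theorem isCompact_frames (b : ℕ) : IsCompact {v : Matrix P (Fin b) ℂ | vᴴ * v = 1} := by
  have hc : IsCompact (Set.univ.pi fun _ : P => Set.univ.pi fun _ : Fin b =>
      Metric.closedBall (0 : ℂ) 1) :=
    isCompact_univ_pi fun _ => isCompact_univ_pi fun _ => isCompact_closedBall _ _
  refine hc.of_isClosed_subset ?_ ?_
  · refine isClosed_eq ?_ continuous_const
    exact (Continuous.matrix_conjTranspose continuous_id).matrix_mul continuous_id
  · intro (v : Matrix P (Fin b) ℂ) hv i _ j _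
    have h := congrFun (congrFun hv j) j
    rw [Matrix.mul_apply, Matrix.one_apply_eq] at h
    have h2 : ∑ k, ‖v k j‖ ^ 2 = 1 := by
      have h3 : ((∑ k, ‖v k j‖ ^ 2 : ℝ) : ℂ) = 1 := by
        rw [← h]
        push_cast
        refine Finset.sum_congr rfl fun k _ => ?_
        rw [conjTranspose_apply, Complex.star_def, ← Complex.normSq_eq_conj_mul_self,
          Complex.normSq_eq_norm_sq]
        push_cast; rfl
      exact_mod_cast h3
    have h4 : ‖v i j‖ ^ 2 ≤ 1 := by
      rw [← h2]
      exact Finset.single_le_sum (f := fun k => ‖v k j‖ ^ 2) (fun k _ => by positivity)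
        (Finset.mem_univ i)
    rw [mem_closedBall_zero_iff]
    nlinarith [norm_nonneg (v i j)]

/-- The orthogonal projection onto a graded subspace is a graded matrix. -/
theorem gradedMat_proj [PartialOrder P] {W : Submodule ℂ (P → ℂ)} (hW : Graded W)
    {Q : Matrix P P ℂ} (hQ : Qᴴ = Q) (h1 : ∀ x, Q *ᵥ x ∈ W) (h2 : ∀ x ∈ W, Q *ᵥ x = x) :
    GradedMat Q := by
  classical
  intro i j hij
  by_contra hc
  apply hij
  let m : Matrix P P ℂ := Matrix.diagonal fun k => if Comp i k then 1 else 0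
  have hm : mᴴ = m := by
    simp only [m, Matrix.diagonal_conjTranspose]
    congr 1; ext k; by_cases h : Comp i k <;> simp [h]
  have h3 : Q * (m * Q) = m * Q := by
    refine ext_of_mulVec_single fun k => ?_
    rw [← mulVec_mulVec]
    refine h2 _ ?_
    rw [← mulVec_mulVec]
    refine hW _ (h1 (Pi.single k 1)) i _ (fun j hj => ?_) (fun j hj => ?_)
    · simp only [m, mulVec_diagonal, hj, if_true, one_mul]
    · simp only [m, mulVec_diagonal, hj, if_false, zero_mul]
  have h4 : Q * m = m * Q := by
    have := congrArg conjTranspose h3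
    simp only [conjTranspose_mul, hm, hQ] at this
    rw [← this, Matrix.mul_assoc, h3]
  have h5 := congrFun (congrFun h4 i) j
  simp only [m, Matrix.mul_diagonal, Matrix.diagonal_mul, hc, if_false, Comp.refl, if_true,
    mul_zero, one_mul] at h5
  exact h5.symm

theorem isClosed_proj {E F : Type*} [TopologicalSpace E] [TopologicalSpace F] {C : Set E}
    (hC : IsCompact C) {Z : Set (E × F)} (hZ : IsClosed Z) :
    IsClosed {y : F | ∃ e ∈ C, (e, y) ∈ Z} := by
  haveI : CompactSpace C := isCompact_iff_compactSpace.1 hC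
  have h := isClosedMap_snd_of_compactSpace (X := C) (Y := F)
    ((fun x : C × F => ((x.1 : E), x.2)) ⁻¹' Z) (hZ.preimage (by fun_prop))
  convert h using 1
  ext y
  constructor
  · rintro ⟨e, he, hy⟩; exact ⟨(⟨e, he⟩, y), hy, rfl⟩
  · rintro ⟨⟨⟨e, he⟩, y'⟩, hy, rfl⟩; exact ⟨e, he, hy⟩

/-- Tuples of frames. -/
abbrev FrameData (P T : Type*) (r : ℕ) {ι κ : Type*} (b : ι → ℕ) (a : κ → ℕ) : Type _ :=
  Matrix P (Fin r) ℂ × ((i : ι) → Matrix P (Fin (b i)) ℂ) × ((k : κ) → Matrix T (Fin (a k)) ℂ)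

/-- Existence of a graded subspace with prescribed incidences is a closed condition. -/
theorem isClosed_incidence [PartialOrder P] [ChainPoset P] (r : ℕ) {ι κ : Type*}
    (G : ι → Submodule ℂ (P → ℂ)) (b : ι → ℕ) (F : κ → Submodule ℂ (T → ℂ)) (a : κ → ℕ) :
    IsClosed {y : Matrix P T ℂ | ∃ W : Submodule ℂ (P → ℂ), Graded W ∧ finrank ℂ W = r ∧
      (∀ i, b i ≤ finrank ℂ (W ⊓ G i : Submodule ℂ (P → ℂ))) ∧
      ∀ k, a k ≤ finrank ℂ (F k ⊓ W.comap (toLin' y) : Submodule ℂ (T → ℂ))} := by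
  let C : Set (FrameData P T r b a) := {w | w.1ᴴ * w.1 = 1} ∩ {w | ∀ i, (w.2.1 i)ᴴ * w.2.1 i = 1} ∩
    {w | ∀ k, (w.2.2 k)ᴴ * w.2.2 k = 1}
  have hC : IsCompact C := by
    have h := (isCompact_frames (P := P) r).prod
      ((isCompact_univ_pi fun i : ι => isCompact_frames (P := P) (b i)).prod
      (isCompact_univ_pi fun k : κ => isCompact_frames (P := T) (a k)))
    convert h using 1
    ext w
    simp only [C, Set.mem_inter_iff, Set.mem_setOf_eq, and_assoc]
    refine Iff.trans ?_ Set.mem_prod.symm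
    refine and_congr Iff.rfl (Iff.trans ?_ Set.mem_prod.symm)
    simp [Set.mem_pi]
  let Z : Set (FrameData P T r b a × Matrix P T ℂ) := {e | ∀ i j, ¬ Comp i j → (e.1.1 * e.1.1ᴴ) i j = 0} ∩
    {e | ∀ i, e.1.1 * e.1.1ᴴ * e.1.2.1 i = e.1.2.1 i} ∩
    {e | ∀ i x, (e.1.2.1 i) *ᵥ x ∈ G i} ∩
    {e | ∀ k, e.1.1 * e.1.1ᴴ * (e.2 * e.1.2.2 k) = e.2 * e.1.2.2 k} ∩
    {e | ∀ k x, (e.1.2.2 k) *ᵥ x ∈ F k}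
  have hZ : IsClosed Z := by
    have c1 : Continuous fun e : FrameData P T r b a × Matrix P T ℂ => e.1.1 * e.1.1ᴴ := by fun_prop
    refine ((((?_ : IsClosed _).inter ?_).inter ?_).inter ?_).inter ?_
    · simp only [Set.setOf_forall]
      refine isClosed_iInter fun i => isClosed_iInter fun j => isClosed_iInter fun _ => ?_
      exact isClosed_eq (c1.matrix_elem i j) continuous_const
    · simp only [Set.setOf_forall]
      exact isClosed_iInter fun i => isClosed_eq (by fun_prop) (by fun_prop)
    · simp only [Set.setOf_forall]
      refine isClosed_iInter fun i => isClosed_iInter fun x => ?_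
      exact (Submodule.closed_of_finiteDimensional (G i)).preimage (by fun_prop)
    · simp only [Set.setOf_forall]
      exact isClosed_iInter fun i => isClosed_eq (by fun_prop) (by fun_prop)
    · simp only [Set.setOf_forall]
      refine isClosed_iInter fun i => isClosed_iInter fun x => ?_
      exact (Submodule.closed_of_finiteDimensional (F i)).preimage (by fun_prop)
  convert isClosed_proj hC hZ using 1
  ext y
  constructor
  · rintro ⟨W, hW, hr, hG, hF⟩
    obtain ⟨w, hw, hwW⟩ := exists_frame W r hr.ge
    have hrange : LinearMap.range (toLin' w) = W := by
      refine Submodule.eq_of_le_of_finrank_eq ?_ ?_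
      · rintro _ ⟨x, rfl⟩; exact hwW x
      · rw [LinearMap.finrank_range_of_inj (mulVec_injective_of_left_inv hw), hr]; simp
    have hid : ∀ x ∈ W, (w * wᴴ) *ᵥ x = x := by
      intro x hx
      rw [← hrange] at hx
      obtain ⟨z, rfl⟩ := hx
      rw [toLin'_apply, mulVec_mulVec, Matrix.mul_assoc, hw, Matrix.mul_one]
    have hid' : ∀ {c : ℕ} {R : Type _} [Fintype R] (v : Matrix P (Fin c) ℂ), (∀ x, v *ᵥ x ∈ W) →
        w * wᴴ * v = v := by
      intro c R _ v hv
      refine ext_of_mulVec_single fun k => ?_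
      rw [← mulVec_mulVec, hid _ (hv _)]
    choose v hv hvm using fun i => exists_frame _ _ (hG i)
    choose x hx hxm using fun k => exists_frame _ _ (hF k)
    refine ⟨(w, v, x), ⟨⟨hw, hv⟩, hx⟩, ?_⟩
    refine ⟨⟨⟨⟨?_, ?_⟩, ?_⟩, ?_⟩, ?_⟩
    · intro i j hij
      by_contra hne
      refine hij (gradedMat_proj hW (Q := w * wᴴ) (by simp) (fun z => ?_) hid i j hne)
      rw [← mulVec_mulVec]; exact hwW _
    · exact fun i => hid' (R := Fin 0) _ fun z => (hvm i z).1
    · exact fun i z => (hvm i z).2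
    · refine fun k => hid' (R := Fin 0) _ fun z => ?_
      rw [← mulVec_mulVec]
      exact (hxm k z).2
    · exact fun k z => (hxm k z).1
  · rintro ⟨⟨w, v, x⟩, ⟨⟨hw, hv⟩, hx⟩, ⟨⟨⟨⟨h1, h2⟩, h3⟩, h4⟩, h5⟩⟩
    simp only [Set.mem_setOf_eq] at hw hv hx h1 h2 h3 h4 h5
    refine ⟨LinearMap.range (toLin' w), ?_, ?_, ?_, ?_⟩
    · have : LinearMap.range (toLin' w) = (⊤ : Submodule ℂ (P → ℂ)).map
          (toLin' (w * wᴴ)) := by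
        rw [Submodule.map_top]
        refine le_antisymm ?_ ?_
        · rintro _ ⟨z, rfl⟩
          refine ⟨w *ᵥ z, ?_⟩
          simp only [toLin'_apply, mulVec_mulVec]
          rw [Matrix.mul_assoc, hw, Matrix.mul_one]
        · rintro _ ⟨z, rfl⟩
          exact ⟨wᴴ *ᵥ z, by simp only [toLin'_apply, mulVec_mulVec]⟩
      rw [this]
      refine Graded.map (fun i j hij => ?_) (by rw [← coord_univ]; exact graded_coord _)
      by_contra hc
      exact hij (h1 i j hc)
    · rw [LinearMap.finrank_range_of_inj (mulVec_injective_of_left_inv hw)]; simp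
    · refine fun i => finrank_of_frame (hv i) fun z => ⟨⟨wᴴ *ᵥ (v i *ᵥ z), ?_⟩, h3 i z⟩
      rw [toLin'_apply, mulVec_mulVec, mulVec_mulVec, h2 i]
    · refine fun k => finrank_of_frame (hx k) fun z => ⟨h5 k z, ⟨wᴴ *ᵥ (y *ᵥ (x k *ᵥ z)), ?_⟩⟩
      simp only [toLin'_apply]
      rw [mulVec_mulVec, mulVec_mulVec, mulVec_mulVec]
      conv_rhs => rw [mulVec_mulVec, ← h4 k]
      congr 1
      simp only [Matrix.mul_assoc]

end Frames

section Polynomials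

variable {σ : Type*}

theorem exists_eval_ne_zero {q : MvPolynomial σ ℂ} (hq : q ≠ 0) :
    ∃ x, MvPolynomial.eval x q ≠ 0 := by
  by_contra h
  push Not at h
  exact hq (MvPolynomial.funext fun x => by simp [h x])

/-- The nonvanishing locus of a nonzero polynomial is dense. -/
theorem dense_eval_ne_zero {q : MvPolynomial σ ℂ} (hq : q ≠ 0) :
    Dense {x : σ → ℂ | MvPolynomial.eval x q ≠ 0} := by
  obtain ⟨x1, h1⟩ := exists_eval_ne_zero hq
  intro x0
  rw [mem_closure_iff]
  intro U hU hx0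
  let p : Polynomial ℂ := MvPolynomial.aeval
    (fun i => Polynomial.C (x0 i) + Polynomial.X * Polynomial.C (x1 i - x0 i)) q
  have hp : ∀ z, p.eval z = MvPolynomial.eval (fun i => x0 i + z * (x1 i - x0 i)) q := by
    intro z
    have := MvPolynomial.map_aeval
      (fun i => Polynomial.C (x0 i) + Polynomial.X * Polynomial.C (x1 i - x0 i))
      (Polynomial.evalRingHom z) q
    simp only [Polynomial.coe_evalRingHom] at this
    rw [show p.eval z = _ from this, MvPolynomial.eval, ]
    congr 1
    · congr 1
      · ext <;> simp
      · ext i; simp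
  have hp0 : p ≠ 0 := by
    intro h
    have h2 := hp 1
    rw [h] at h2
    apply h1
    simpa using h2.symm
  have hfin : {z | p.IsRoot z}.Finite := by
    refine (p.roots.toFinset.finite_toSet).subset fun z hz => ?_
    simpa [hp0] using hz
  have hd : Dense {z | p.IsRoot z}ᶜ := hfin.countable.dense_compl ℂ
  have hV : IsOpen {z : ℂ | (fun i => x0 i + z * (x1 i - x0 i)) ∈ U} :=
    hU.preimage (by fun_prop)
  obtain ⟨z, hz, hz'⟩ := hd.inter_open_nonempty _ hV ⟨0, by simpa using hx0⟩
  refine ⟨_, hz, ?_⟩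
  rw [Set.mem_setOf_eq, ← hp]
  exact hz'

theorem eq_zero_of_eval_eq_zero_on_open {q : MvPolynomial σ ℂ} {U : Set (σ → ℂ)} (hU : IsOpen U)
    (hne : U.Nonempty) (h : ∀ x ∈ U, MvPolynomial.eval x q = 0) : q = 0 := by
  by_contra hq
  obtain ⟨x, hx, hx'⟩ := (dense_eval_ne_zero hq).inter_open_nonempty U hU hne
  exact hx' (h x hx)

/-- Common denominators. -/
theorem exists_clear {A L ι : Type*} [CommRing A] [IsDomain A] [Field L] [Algebra A L]
    [IsFractionRing A L] [Finite ι] (f : ι → L) :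
    ∃ q : A, q ≠ 0 ∧ ∃ g : ι → A, ∀ i, algebraMap A L (g i) = algebraMap A L q * f i := by
  obtain ⟨b, hb⟩ := IsLocalization.exist_integer_multiples_of_finite (nonZeroDivisors A) f
  choose g hg using hb
  exact ⟨b, nonZeroDivisors.ne_zero b.2, g, fun i => by rw [hg, Algebra.smul_def]⟩

end Polynomials

section LinAlg

variable {K : Type*} [Field K]

theorem finrank_map_add_inf_ker {V V' : Type*} [AddCommGroup V] [Module K V] [FiniteDimensional K V]
    [AddCommGroup V'] [Module K V'] (f : V →ₗ[K] V') (S : Submodule K V) :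
    finrank K (S.map f) + finrank K (S ⊓ LinearMap.ker f : Submodule K V)
      = finrank K S := by
  have h := LinearMap.finrank_range_add_finrank_ker (f.domRestrict S)
  have h1 : LinearMap.range (f.domRestrict S) = S.map f := by
    ext x
    simp only [LinearMap.mem_range, LinearMap.domRestrict_apply, Submodule.mem_map]
    exact ⟨fun ⟨y, hy⟩ => ⟨y.1, y.2, hy⟩, fun ⟨y, hy, h⟩ => ⟨⟨y, hy⟩, h⟩⟩
  have h2 : (LinearMap.ker (f.domRestrict S)).map S.subtype = S ⊓ LinearMap.ker f := by
    ext x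
    simp only [Submodule.mem_map, LinearMap.mem_ker, LinearMap.domRestrict_apply,
      Submodule.mem_inf, Submodule.subtype_apply]
    exact ⟨fun ⟨y, hy, h⟩ => h ▸ ⟨y.2, hy⟩, fun ⟨h, h'⟩ => ⟨⟨x, h⟩, h', rfl⟩⟩
  rw [← h, h1, ← h2, finrank_map_of_injective _ S.injective_subtype]

theorem finrank_submodule_prod {V V' : Type*} [AddCommGroup V] [Module K V] [FiniteDimensional K V]
    [AddCommGroup V'] [Module K V'] [FiniteDimensional K V'] (S : Submodule K V)
    (S' : Submodule K V') :
    finrank K (S.prod S') = finrank K S + finrank K S' := by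
  rw [← Module.finrank_prod]
  exact LinearEquiv.finrank_eq
    { toFun := fun x => (⟨x.1.1, x.2.1⟩, ⟨x.1.2, x.2.2⟩)
      invFun := fun x => ⟨(x.1.1, x.2.1), x.1.2, x.2.2⟩
      left_inv := fun _ => rfl
      right_inv := fun _ => rfl
      map_add' := fun _ _ => rfl
      map_smul' := fun _ _ => rfl }

variable {P T : Type*} [Fintype P] [DecidableEq P] [Fintype T] [DecidableEq T]

theorem exists_left_factor {S : Type*} [Fintype S] [DecidableEq S] (u : Matrix T S K)
    (h : Matrix P S K) (hk : ∀ v, u *ᵥ v = 0 → h *ᵥ v = 0) : ∃ X : Matrix P T K, X * u = h := by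
  have hle : LinearMap.ker (toLin' u).rangeRestrict ≤ LinearMap.ker (toLin' h) := by
    intro v hv
    rw [LinearMap.ker_rangeRestrict, LinearMap.mem_ker, toLin'_apply] at hv
    rw [LinearMap.mem_ker, toLin'_apply]
    exact hk v hv
  obtain ⟨s, hs⟩ := LinearMap.exists_rightInverse_of_surjective _
    (LinearMap.range_rangeRestrict (toLin' u))
  obtain ⟨g, hg⟩ := LinearMap.exists_extend ((toLin' h).comp s)
  refine ⟨LinearMap.toMatrix' g, ?_⟩
  refine ext_of_mulVec_single fun k => ?_
  rw [← mulVec_mulVec, ← toLin'_apply, Matrix.toLin'_toMatrix']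
  have h1 := LinearMap.congr_fun hg ((toLin' u).rangeRestrict (Pi.single k 1))
  change g (u *ᵥ Pi.single k 1) = h *ᵥ (s ((toLin' u).rangeRestrict (Pi.single k 1))) at h1
  rw [h1, ← sub_eq_zero, ← mulVec_sub]
  refine hk _ ?_
  have h2 := LinearMap.congr_fun hs ((toLin' u).rangeRestrict (Pi.single k 1))
  have h3 := congrArg Subtype.val h2
  change u *ᵥ (s ((toLin' u).rangeRestrict (Pi.single k 1))) = u *ᵥ Pi.single k 1 at h3
  rw [mulVec_sub, h3, sub_self]

/-- Kernels of maps of maximal rank in a linear family. -/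
theorem mulVec_mem_range_of_max_rank [Infinite K] {φ ψ : Matrix P T K}
    (hmax : ∀ t : K, (φ + t • ψ).rank ≤ φ.rank) {w : T → K} (hw : φ *ᵥ w = 0) :
    ∃ x, ψ *ᵥ w = φ *ᵥ x := by
  by_contra hne
  let Rg := LinearMap.range (toLin' φ)
  let r := finrank K Rg
  let b : Module.Basis (Fin r) K Rg := Module.finBasis K Rg
  have hb : ∀ i, ∃ x, φ *ᵥ x = (b i : P → K) := fun i => by
    obtain ⟨x, hx⟩ := (b i).2
    exact ⟨x, hx⟩
  choose x hx using hb
  have hli : LinearIndependent K (Fin.cons (ψ *ᵥ w) (fun i => φ *ᵥ x i) : Fin (r + 1) → P → K) := by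
    rw [linearIndependent_finCons]
    constructor
    · simp only [hx]
      exact b.linearIndependent.map' Rg.subtype (Submodule.ker_subtype _)
    · intro h
      have : Submodule.span K (Set.range fun i => φ *ᵥ x i) ≤ Rg := by
        rw [Submodule.span_le]
        rintro _ ⟨i, rfl⟩
        exact ⟨x i, rfl⟩
      obtain ⟨y, hy⟩ := this h
      exact hne ⟨y, hy.symm⟩
  let c : Fin (r + 1) → T → K := Fin.cons w x
  let V0 : Matrix P (Fin (r + 1)) K :=
    Matrix.of fun i j => (Fin.cons (ψ *ᵥ w) (fun i => φ *ᵥ x i) : Fin (r + 1) → P → K) j i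
  let V1 : Matrix P (Fin (r + 1)) K :=
    Matrix.of fun i j => (Fin.cons 0 (fun i => ψ *ᵥ x i) : Fin (r + 1) → P → K) j i
  have hV0 : Function.Injective (toLin' V0) := by
    have := Matrix.mulVec_injective_iff.2 (show LinearIndependent K V0.col from hli)
    exact this
  obtain ⟨N, hN⟩ := LinearMap.exists_leftInverse_of_injective (toLin' V0)
    (LinearMap.ker_eq_bot.2 hV0)
  let N' := LinearMap.toMatrix' N
  have hN' : N' * V0 = 1 := by
    have := congrArg LinearMap.toMatrix' hN
    rwa [LinearMap.toMatrix'_comp, LinearMap.toMatrix'_toLin', LinearMap.toMatrix'_id] at this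
  let p : Polynomial K := Polynomial.X * Matrix.det
    ((1 : Matrix (Fin (r + 1)) (Fin (r + 1)) K).map Polynomial.C +
      (Polynomial.X : Polynomial K) • (N' * V1).map Polynomial.C)
  have hp : ∀ t, p.eval t = t * Matrix.det (1 + t • (N' * V1)) := by
    intro t
    rw [Polynomial.eval_mul, Polynomial.eval_X, ← Polynomial.coe_evalRingHom, RingHom.map_det]
    congr 2
    ext i j
    by_cases hij : i = j
    · subst hij; simp [-Matrix.map_mul]; ring
    · simp [-Matrix.map_mul, hij]; ring
  have hp0 : p ≠ 0 := by
    refine mul_ne_zero Polynomial.X_ne_zero fun h => ?_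
    have h2 := congrArg (Polynomial.eval 0) h
    rw [← Polynomial.coe_evalRingHom, RingHom.map_det] at h2
    have h3 : (Polynomial.evalRingHom (0 : K)).mapMatrix
      ((1 : Matrix (Fin (r + 1)) (Fin (r + 1)) K).map Polynomial.C +
        (Polynomial.X : Polynomial K) • (N' * V1).map Polynomial.C) = 1 := by
      ext i j
      by_cases hij : i = j
      · subst hij; simp
      · simp [hij]
    rw [h3] at h2
    simp at h2
  obtain ⟨t, ht⟩ : ∃ t, p.eval t ≠ 0 := by
    by_contra h
    push Not at h
    exact hp0 (Polynomial.funext fun t => by simp [h t])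
  rw [hp] at ht
  have ht0 : t ≠ 0 := left_ne_zero_of_mul ht
  have hdet := right_ne_zero_of_mul ht
  have hVt : N' * (V0 + t • V1) = 1 + t • (N' * V1) := by
    rw [Matrix.mul_add, hN', Matrix.mul_smul]
  have hinj : Function.Injective (toLin' (V0 + t • V1)) := by
    refine mulVec_injective_of_left_inv (N := (1 + t • (N' * V1))⁻¹ * N') ?_
    rw [Matrix.mul_assoc, hVt, Matrix.nonsing_inv_mul _ (isUnit_iff_ne_zero.2 hdet)]
  have hli' : LinearIndependent K (V0 + t • V1).col := Matrix.mulVec_injective_iff.1 hinj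
  have hsub : Submodule.span K (Set.range (V0 + t • V1).col) ≤
      LinearMap.range (toLin' (φ + t • ψ)) := by
    rw [Submodule.span_le]
    rintro _ ⟨j, rfl⟩
    refine Fin.cases ?_ (fun j => ?_) j
    · refine ⟨t⁻¹ • w, ?_⟩
      ext i
      simp [V0, V1, Matrix.col, add_mulVec, mulVec_smul, smul_mulVec, hw, ht0]
    · refine ⟨x j, ?_⟩
      ext i
      simp [V0, V1, Matrix.col, add_mulVec, smul_mulVec]
  have h1 := finrank_span_eq_card hli'
  have h2 := Submodule.finrank_mono hsub
  rw [h1, Fintype.card_fin] at h2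
  have h3 := hmax t
  have h4 : φ.rank = r := rfl
  have h5 : (φ + t • ψ).rank = finrank K (LinearMap.range (toLin' (φ + t • ψ))) := rfl
  omega

end LinAlg

section Count

variable {K : Type*} [Field K] {P T : Type*} [Fintype P] [DecidableEq P] [PartialOrder P]
  [Fintype T] [DecidableEq T] [PartialOrder T]

/-- Surjectivity of `(u, φ) ↦ z u - φ y`. -/
def Trans (y z : Matrix P T K) (Dσ B : Finset P) (Dτ A : Finset T) : Prop :=
  ∀ h ∈ SM K (Dσ ×ˢ A), ∃ u ∈ SM K (tri Dτ A), ∃ φ ∈ SM K (tri Dσ B), z * u - φ * y = h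

theorem card_le_of_forall_exists {V : Type*} [AddCommGroup V] [Module K V] [FiniteDimensional K V]
    (E : Submodule K V)
    {V1 V2 : Type*} [AddCommGroup V1] [Module K V1] [FiniteDimensional K V1]
    [AddCommGroup V2] [Module K V2] [FiniteDimensional K V2] (S1 : Submodule K V1)
    (S2 : Submodule K V2) (f : V1 × V2 →ₗ[K] V)
    (h : ∀ x ∈ E, ∃ a ∈ S1, ∃ b ∈ S2, f (a, b) = x) :
    finrank K E ≤ finrank K S1 + finrank K S2 := by
  have h1 : E ≤ (S1.prod S2).map f := by
    intro x hx
    obtain ⟨a, ha, b, hb, hab⟩ := h x hx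
    exact ⟨(a, b), ⟨ha, hb⟩, hab⟩
  calc _ ≤ _ := Submodule.finrank_mono h1
    _ ≤ finrank K (S1.prod S2) := Submodule.finrank_map_le f _
    _ = _ := finrank_submodule_prod _ _

/-- The linear map `(u, φ) ↦ z u - φ y`. -/
def transMap (y z : Matrix P T K) : Matrix T T K × Matrix P P K →ₗ[K] Matrix P T K where
  toFun x := z * x.1 - x.2 * y
  map_add' a b := by simp only [Prod.fst_add, Prod.snd_add, Matrix.mul_add, Matrix.add_mul]; abel
  map_smul' c a := by
    simp only [Prod.smul_fst, Prod.smul_snd, Matrix.mul_smul, Matrix.smul_mul, smul_sub,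
      RingHom.id_apply]

theorem transMap_apply (y z : Matrix P T K) (x) : transMap y z x = z * x.1 - x.2 * y := rfl

theorem tri_mul_mem {D B D' B' D'' B'' : Finset P} {φ ψ : Matrix P P K} (hφ : φ ∈ SM K (tri D B))
    (hψ : ψ ∈ SM K (tri D' B')) (h : D ⊆ D'') (h' : B' ⊆ B'') : φ * ψ ∈ SM K (tri D'' B'') :=
  SM_mul hφ hψ fun _ _ _ h1 h2 => mem_tri.2
    ⟨h (mem_tri.1 h1).1, h' (mem_tri.1 h2).2.1, (mem_tri.1 h1).2.2.trans (mem_tri.1 h2).2.2⟩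

theorem mask_mem (X : Finset P) : mask K X ∈ SM K (tri X X) := mem_SM_of fun i j h => by
  have hij : i = j := by
    by_contra h'; exact h (Matrix.diagonal_apply_ne _ h')
  subst hij
  rw [mem_tri]
  have : i ∈ X := by
    by_contra h'; simp [mask, h'] at h
  exact ⟨this, this, le_rfl⟩

theorem mul_mask_of_mem {Q : Type*} {S : Finset (Q × P)} {X : Finset P} {M : Matrix Q P K}
    (hM : M ∈ SM K S) (h : ∀ i j, (i, j) ∈ S → j ∈ X) : M * mask K X = M := by
  ext i j
  rw [mul_mask_apply]
  split_ifs with hj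
  · rfl
  · exact (hM i j fun h' => hj (h i j h')).symm

theorem mask_mul_of_mem {Q : Type*} {S : Finset (P × Q)} {X : Finset P} {M : Matrix P Q K}
    (hM : M ∈ SM K S) (h : ∀ i j, (i, j) ∈ S → i ∈ X) : mask K X * M = M := by
  ext i j
  rw [mask_mul_apply]
  split_ifs with hj
  · rfl
  · exact (hM i j fun h' => hj (h i j h')).symm

theorem SM_mask_left {Q : Type*} {S S' : Finset (P × Q)} {X : Finset P} {M : Matrix P Q K}
    (hM : M ∈ SM K S) (h : ∀ i j, (i, j) ∈ S → i ∈ X → (i, j) ∈ S') : mask K X * M ∈ SM K S' :=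
  mem_SM_of fun i j hij => by
    rw [mask_mul_apply] at hij
    split_ifs at hij with hi
    · exact h i j (SM_ne hM hij) hi
    · exact (hij rfl).elim

theorem SM_mask_right {Q : Type*} {S S' : Finset (Q × P)} {X : Finset P} {M : Matrix Q P K}
    (hM : M ∈ SM K S) (h : ∀ i j, (i, j) ∈ S → j ∈ X → (i, j) ∈ S') : M * mask K X ∈ SM K S' :=
  mem_SM_of fun i j hij => by
    rw [mul_mask_apply] at hij
    split_ifs at hij with hi
    · exact h i j (SM_ne hM hij) hi
    · exact (hij rfl).elim

/-- Restricting `Trans` to subspaces. -/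
theorem Trans.restrict {y z : Matrix P T K} {Dσ B B' : Finset P} {Dτ A A' : Finset T}
    (h : Trans y z Dσ B Dτ A) (hA : A' ⊆ A) {s : Matrix P P K} {s' : Matrix T T K} {M : Matrix P T K}
    (hs : s ∈ SM K (tri B'ᶜ B')) (hs' : s' ∈ SM K (tri A'ᶜ A'))
    (hM : y * ((1 + s') * mask K A') = (1 + s) * (mask K B' * M)) :
    Dσ.card * A'.card ≤ (tri Dτ A').card + (tri Dσ B').card := by
  have key : ∀ x ∈ SM K (Dσ ×ˢ A'), ∃ u ∈ SM K (tri Dτ A'), ∃ φ ∈ SM K (tri Dσ B'),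
      transMap (mask K B' * M) z (u, φ) = x := by
    intro x hx
    obtain ⟨u, hu, φ, hφ, huφ⟩ := h x (SM_mono (Finset.product_subset_product_right hA) hx)
    have e1 : x * ((1 + s') * mask K A') = x := by
      rw [← Matrix.mul_assoc, Matrix.mul_add, Matrix.mul_one,
        SM_mul_eq_zero hx hs' (fun i j k h1 h2 => ?_), add_zero]
      · exact mul_mask_of_mem hx fun i j h => (Finset.mem_product.1 h).2
      · have := (mem_tri.1 h2).1
        rw [Finset.mem_compl] at this
        exact this (Finset.mem_product.1 h1).2
    refine ⟨u * ((1 + s') * mask K A'), ?_, φ * ((1 + s) * mask K B'), ?_, ?_⟩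
    · rw [← Matrix.mul_assoc]
      refine SM_mask_right (S := tri Dτ Finset.univ) ?_ fun i j h1 h2 => ?_
      · rw [Matrix.mul_add, Matrix.mul_one]
        exact add_mem (SM_mono (tri_mono le_rfl (Finset.subset_univ _)) hu)
          (tri_mul_mem hu hs' le_rfl (Finset.subset_univ _))
      · exact mem_tri.2 ⟨(mem_tri.1 h1).1, h2, (mem_tri.1 h1).2.2⟩
    · rw [← Matrix.mul_assoc]
      refine SM_mask_right (S := tri Dσ Finset.univ) ?_ fun i j h1 h2 => ?_
      · rw [Matrix.mul_add, Matrix.mul_one]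
        exact add_mem (SM_mono (tri_mono le_rfl (Finset.subset_univ _)) hφ)
          (tri_mul_mem hφ hs le_rfl (Finset.subset_univ _))
      · exact mem_tri.2 ⟨(mem_tri.1 h1).1, h2, (mem_tri.1 h1).2.2⟩
    · rw [transMap_apply]
      have e2 : mask K B' * (mask K B' * M) = mask K B' * M := by
        ext i j; simp only [mask_mul_apply]; split_ifs <;> rfl
      have e3 : φ * ((1 + s) * mask K B') * (mask K B' * M) = φ * (y * ((1 + s') * mask K A')) := by
        rw [hM, Matrix.mul_assoc, Matrix.mul_assoc (1 + s), e2]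
      rw [e3, ← Matrix.mul_assoc, ← Matrix.mul_assoc φ, ← Matrix.sub_mul, huφ, e1]
  have := card_le_of_forall_exists _ _ _ _ key
  simpa [finrank_SM] using this

/-- Projecting `Trans` to quotients. -/
theorem Trans.project {y z : Matrix P T K} {Dσ B D1 : Finset P} {Dτ A D1τ : Finset T}
    (h : Trans y z Dσ B Dτ A) {r : Matrix P P K} {ρ : Matrix T T K}
    (hD1 : D1 ⊆ Dσ) (hD1τ : D1τ ⊆ Dτ)
    (hr : r ∈ SM K (tri (Dσ \ D1) D1)) (hρ : ρ ∈ SM K (tri (Dτ \ D1τ) D1τ))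
    (hz : ∀ v ∈ coord K D1τ, ∃ w ∈ coord K D1, z *ᵥ (v + ρ *ᵥ v) = w + r *ᵥ w) :
    (Dσ \ D1).card * A.card ≤ (tri (Dτ \ D1τ) A).card + (tri (Dσ \ D1) B).card := by
  have hr0 : r * r = 0 := tri_mul_self Finset.sdiff_disjoint hr hr
  have hρ0 : ρ * ρ = 0 := tri_mul_self Finset.sdiff_disjoint hρ hρ
  let π := mask K (Dσ \ D1) * (1 - r)
  have hzz : π * z * ((1 + ρ) * mask K D1τ) = 0 := by
    refine ext_of_mulVec_single fun k => ?_
    rw [← mulVec_mulVec, ← mulVec_mulVec, ← mulVec_mulVec _ (1 + ρ)]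
    obtain ⟨w, hw, e⟩ := hz _ (mask_mulVec_mem D1τ (Pi.single k 1))
    have e' : (1 + ρ) *ᵥ (mask K D1τ *ᵥ Pi.single k 1) = mask K D1τ *ᵥ Pi.single k 1 +
        ρ *ᵥ (mask K D1τ *ᵥ Pi.single k 1) := by
      rw [add_mulVec, one_mulVec]
    rw [e', e, zero_mulVec]
    have e2 : (1 - r) *ᵥ (w + r *ᵥ w) = w := by
      have : w + r *ᵥ w = (1 + r) *ᵥ w := by rw [add_mulVec, one_mulVec]
      rw [this, mulVec_mulVec, one_sub_mul_one_add hr0, one_mulVec]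
    rw [show π *ᵥ (w + r *ᵥ w) = mask K (Dσ \ D1) *ᵥ ((1 - r) *ᵥ (w + r *ᵥ w)) by
      rw [mulVec_mulVec], e2]
    ext i
    rw [mask_mulVec_apply]
    split_ifs with hi
    · exact hw i (Finset.mem_sdiff.1 hi).2
    · rfl
  have key : ∀ x ∈ SM K ((Dσ \ D1) ×ˢ A), ∃ u ∈ SM K (tri (Dτ \ D1τ) A),
      ∃ φ ∈ SM K (tri (Dσ \ D1) B), transMap y (π * z * (1 + ρ)) (u, φ) = x := by
    intro x hx
    obtain ⟨u, hu, φ, hφ, huφ⟩ := h x (SM_mono (Finset.product_subset_product_left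
      Finset.sdiff_subset) hx)
    have hρu : (1 - ρ) * u ∈ SM K (tri Dτ A) := by
      rw [Matrix.sub_mul, Matrix.one_mul]
      exact sub_mem hu (tri_mul_mem hρ hu Finset.sdiff_subset le_rfl)
    have hrφ : (1 - r) * φ ∈ SM K (tri Dσ B) := by
      rw [Matrix.sub_mul, Matrix.one_mul]
      exact sub_mem hφ (tri_mul_mem hr hφ Finset.sdiff_subset le_rfl)
    refine ⟨mask K (Dτ \ D1τ) * ((1 - ρ) * u), ?_, π * φ, ?_, ?_⟩
    · exact SM_mask_left hρu fun i j h1 h2 => mem_tri.2 ⟨h2, (mem_tri.1 h1).2⟩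
    · rw [Matrix.mul_assoc]
      exact SM_mask_left hrφ fun i j h1 h2 => mem_tri.2 ⟨h2, (mem_tri.1 h1).2⟩
    · rw [transMap_apply]
      have e1 : mask K Dτ * ((1 - ρ) * u) = (1 - ρ) * u :=
        mask_mul_of_mem hρu fun i j h => (mem_tri.1 h).1
      have e2 : mask K Dτ = mask K D1τ + mask K (Dτ \ D1τ) := by
        ext i j
        by_cases hij : i = j
        · subst hij
          by_cases h1 : i ∈ D1τ
          · simp [mask, h1, hD1τ h1]
          · simp [mask, h1]
        · simp [mask, hij]
      have e3 : π * z * (1 + ρ) * (mask K (Dτ \ D1τ) * ((1 - ρ) * u)) = π * z * u := by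
        have : π * z * (1 + ρ) * (mask K Dτ * ((1 - ρ) * u)) = π * z * u := by
          rw [e1, Matrix.mul_assoc, ← Matrix.mul_assoc (1 + ρ), one_add_mul_one_sub hρ0,
            Matrix.one_mul]
        have h0 : π * z * (1 + ρ) * mask K D1τ = 0 := by rw [Matrix.mul_assoc, hzz]
        rw [← this, e2, Matrix.add_mul, Matrix.mul_add (π * z * (1 + ρ)),
          ← Matrix.mul_assoc (π * z * (1 + ρ)) (mask K D1τ), h0, Matrix.zero_mul, zero_add]
      rw [e3, Matrix.mul_assoc, Matrix.mul_assoc π, ← Matrix.mul_sub, huφ]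
      rw [Matrix.mul_assoc, Matrix.sub_mul, Matrix.one_mul,
        SM_mul_eq_zero hr hx fun i j k h1 h2 =>
          (Finset.mem_sdiff.1 (Finset.mem_product.1 h2).1).2 (mem_tri.1 h1).2.1, sub_zero]
      exact mask_mul_of_mem hx fun i j h => (Finset.mem_product.1 h).1
  have := card_le_of_forall_exists _ _ _ _ key
  simpa [finrank_SM] using this

end Count

section KernelReduction

variable {K : Type*} [Field K] {P T : Type*} [Fintype P] [DecidableEq P] [PartialOrder P]
  [Fintype T] [DecidableEq T] [PartialOrder T]

/-- Matrices in `SM K (tri D B)` mapping the kernel of `φ` to its range. -/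
def kerToRange (φ : Matrix P P K) (D B : Finset P) : Submodule K (Matrix P P K) where
  carrier := {f | f ∈ SM K (tri D B) ∧ ∀ w, φ *ᵥ w = 0 → ∃ x, f *ᵥ w = φ *ᵥ x}
  add_mem' := by
    rintro a b ⟨ha, ha'⟩ ⟨hb, hb'⟩
    refine ⟨add_mem ha hb, fun w hw => ?_⟩
    obtain ⟨x, hx⟩ := ha' w hw
    obtain ⟨y, hy⟩ := hb' w hw
    exact ⟨x + y, by rw [add_mulVec, mulVec_add, hx, hy]⟩
  zero_mem' := ⟨zero_mem _, fun w _ => ⟨0, by simp⟩⟩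
  smul_mem' := by
    rintro c a ⟨ha, ha'⟩
    refine ⟨Submodule.smul_mem _ c ha, fun w hw => ?_⟩
    obtain ⟨x, hx⟩ := ha' w hw
    exact ⟨c • x, by rw [smul_mulVec, mulVec_smul, hx]⟩

/-- Echelon data for the kernel and the range of `φ ∈ SM K (tri D B)`. -/
structure KerRange (φ : Matrix P P K) (D B D1 B' : Finset P) (r s : Matrix P P K) : Prop where
  mem : φ ∈ SM K (tri D B)
  subB : B' ⊆ B
  hs : s ∈ SM K (tri (B \ B') B')
  ker : LinearMap.ker (toLin' φ) ⊓ coord K B = ech B' s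
  subD : D1 ⊆ D
  hr : r ∈ SM K (tri (D \ D1) D1)
  range : LinearMap.range (toLin' φ) = ech D1 r

theorem sdiff_sub_compl (X Y : Finset P) : X \ Y ⊆ Yᶜ := fun _ h =>
  Finset.mem_compl.2 (Finset.mem_sdiff.1 h).2

theorem exists_kerRange [ChainPoset P] {φ : Matrix P P K} {D B : Finset P}
    (h : φ ∈ SM K (tri D B)) : ∃ D1 B' r s, KerRange φ D B D1 B' r s := by
  have hg : GradedMat φ := gradedMat_of_tri h
  have g1 : Graded (LinearMap.ker (toLin' φ) ⊓ coord K B) := by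
    refine Graded.inf ?_ (graded_coord B)
    have : Graded (coord K (∅ : Finset P)) := graded_coord _
    convert this.comap hg using 1
    ext v
    simp only [LinearMap.mem_ker, Submodule.mem_comap, mem_coord]
    exact ⟨fun h i _ => by rw [h]; rfl, fun h => funext fun i => h i (by simp)⟩
  have g2 : Graded (LinearMap.range (toLin' φ)) := by
    have : Graded (coord K (Finset.univ : Finset P)) := graded_coord _
    convert this.map hg using 1
    rw [coord_univ, LinearMap.range_eq_map]
  obtain ⟨B', s, hs, e1, h1⟩ := exists_ech _ g1
  obtain ⟨D1, r, hr, e2, h2⟩ := exists_ech _ g2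
  obtain ⟨h3, h4⟩ := h1 B inf_le_right
  obtain ⟨h5, h6⟩ := h2 D (by
    rintro _ ⟨x, rfl⟩
    rw [toLin'_apply]
    exact SM_mulVec h (X := Finset.univ) (by simp [coord_univ]) fun i j h _ => (mem_tri.1 h).1)
  exact ⟨D1, B', r, s, h, h3, h4, e1, h5, h6, e2⟩

variable {φ r s : Matrix P P K} {D B D1 B' : Finset P}

theorem KerRange.mulVec_eq_zero (h : KerRange φ D B D1 B' r s) {v : P → K} (hv : v ∈ coord K B') :
    φ *ᵥ (v + s *ᵥ v) = 0 := by
  have : v + s *ᵥ v ∈ LinearMap.ker (toLin' φ) ⊓ coord K B := by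
    rw [h.ker, mem_ech']; exact ⟨v, hv, rfl⟩
  simpa using this.1

theorem KerRange.exists_of_range (h : KerRange φ D B D1 B' r s) (x : P → K) :
    ∃ w ∈ coord K D1, φ *ᵥ x = w + r *ᵥ w := by
  have : φ *ᵥ x ∈ LinearMap.range (toLin' φ) := ⟨x, toLin'_apply _ _⟩
  rw [h.range, mem_ech'] at this
  exact this

theorem KerRange.exists_preimage (h : KerRange φ D B D1 B' r s) {w : P → K} (hw : w ∈ coord K D1) :
    ∃ x, w + r *ᵥ w = φ *ᵥ x := by
  have : w + r *ᵥ w ∈ LinearMap.range (toLin' φ) := by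
    rw [h.range, mem_ech']; exact ⟨w, hw, rfl⟩
  obtain ⟨x, hx⟩ := this
  exact ⟨x, by rw [← hx, toLin'_apply]⟩

theorem KerRange.card_range (h : KerRange φ D B D1 B' r s) :
    D1.card = finrank K (LinearMap.range (toLin' φ)) := by
  rw [h.range, finrank_ech (SM_mono (tri_mono (sdiff_sub_compl _ _) le_rfl) h.hr)]

theorem KerRange.card_ker (h : KerRange φ D B D1 B' r s) :
    B'.card = finrank K (LinearMap.ker (toLin' φ) ⊓ coord K B : Submodule K (P → K)) := by
  rw [h.ker, finrank_ech (SM_mono (tri_mono (sdiff_sub_compl _ _) le_rfl) h.hs)]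

theorem KerRange.finrank_kerToRange (h : KerRange φ D B D1 B' r s) :
    finrank K (kerToRange φ D B) + (tri (D \ D1) B').card ≤ (tri D B).card := by
  have hdis : kerToRange φ D B ⊓ SM K (tri (D \ D1) B') = ⊥ := by
    rw [eq_bot_iff]
    rintro f ⟨⟨-, hf⟩, hf'⟩
    rw [Submodule.mem_bot]
    refine ext_of_mulVec_single fun j => ?_
    have hfm : f = f * mask K B' := (mul_mask_of_mem hf' fun i j h => (mem_tri.1 h).2.1).symm
    have hfs : f * s = 0 := SM_mul_eq_zero hf' h.hs fun i j k h1 h2 =>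
      (Finset.mem_sdiff.1 (mem_tri.1 h2).1).2 (mem_tri.1 h1).2.1
    set v := mask K B' *ᵥ Pi.single j (1 : K) with hv
    have hvB : v ∈ coord K B' := mask_mulVec_mem _ _
    obtain ⟨x, hx⟩ := hf _ (h.mulVec_eq_zero hvB)
    rw [mulVec_add, mulVec_mulVec _ f s, hfs, zero_mulVec, add_zero] at hx
    have e1 : f *ᵥ Pi.single j 1 = f *ᵥ v := by rw [hv, mulVec_mulVec, ← hfm]
    obtain ⟨w, hw, hw'⟩ := h.exists_of_range x
    rw [e1, hx, hw', zero_mulVec]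
    have hfv : f *ᵥ v ∈ coord K (D \ D1) :=
      SM_mulVec hf' hvB fun i j h _ => (mem_tri.1 h).1
    have hrw : r *ᵥ w ∈ coord K (D \ D1) := SM_mulVec h.hr hw fun i j h _ => (mem_tri.1 h).1
    have hw0 : w = 0 := by
      ext i
      by_cases hi : i ∈ D1
      · have hi' : i ∉ D \ D1 := fun h => (Finset.mem_sdiff.1 h).2 hi
        have := congrFun (hx.trans hw') i
        rw [hfv i hi', Pi.add_apply, hrw i hi', add_zero] at this
        exact this.symm
      · exact hw i hi
    rw [hw0, mulVec_zero, add_zero]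
  have h1 := Submodule.finrank_sup_add_finrank_inf_eq (kerToRange φ D B) (SM K (tri (D \ D1) B'))
  have h2 : kerToRange φ D B ⊔ SM K (tri (D \ D1) B') ≤ SM K (tri D B) :=
    sup_le (fun f hf => hf.1) (SM_mono (tri_mono Finset.sdiff_subset h.subB))
  have h3 := Submodule.finrank_mono h2
  rw [hdis, finrank_bot, finrank_SM] at h1
  rw [finrank_SM] at h3
  omega

variable {Y Z : Matrix P T K} {Yi Zi : Matrix T P K} {A : Finset T} {Dσ : Finset P} {Dτ : Finset T}

/-- `Yi` is inverse to `Y` on the coordinate subspaces of `A` and `B`. -/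
structure PartialInv (Y : Matrix P T K) (Yi : Matrix T P K) (B : Finset P) (A : Finset T) : Prop where
  mem : Y ∈ SM K (B ×ˢ A)
  mem' : Yi ∈ SM K (A ×ˢ B)
  left : Yi * Y = mask K A
  right : Y * Yi = mask K B

theorem exists_right_factor {m n l : Type*} [Fintype m] [Fintype n] [DecidableEq n] [Fintype l]
    [DecidableEq l] (f : Matrix m n K) (g : Matrix m l K) (h : ∀ v, ∃ x, g *ᵥ v = f *ᵥ x) :
    ∃ X : Matrix n l K, f * X = g := by
  choose x hx using fun k : l => h (Pi.single k 1)
  refine ⟨Matrix.of fun i k => x k i, ext_of_mulVec_single fun k => ?_⟩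
  rw [← mulVec_mulVec, hx]
  congr 1
  ext i
  simp

variable {u ρ s' : Matrix T T K} {D1τ A' : Finset T}

theorem KerRange.card_eq_range (hφ : KerRange φ Dσ B D1 B' r s) (hu : KerRange u Dτ A D1τ A' ρ s')
    (hY : PartialInv Y Yi B A) (hZ : PartialInv Z Zi Dσ Dτ) (huφ : Z * u = φ * Y) :
    D1.card = D1τ.card := by
  have hφB : φ * mask K B = φ := mul_mask_of_mem hφ.mem fun i j h => (mem_tri.1 h).2.1
  have huD : mask K Dτ * u = u := mask_mul_of_mem hu.mem fun i j h => (mem_tri.1 h).1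
  have e1 : u = Zi * φ * Y := by rw [Matrix.mul_assoc, ← huφ, ← Matrix.mul_assoc, hZ.left, huD]
  have e2 : φ = Z * u * Yi := by rw [huφ, Matrix.mul_assoc, hY.right, hφB]
  rw [hφ.card_range, hu.card_range]
  change φ.rank = u.rank
  apply le_antisymm
  · calc φ.rank = (Z * u * Yi).rank := congrArg _ e2
      _ ≤ (Z * u).rank := Matrix.rank_mul_le_left _ _
      _ ≤ u.rank := Matrix.rank_mul_le_right _ _
  · calc u.rank = (Zi * φ * Y).rank := congrArg _ e1
      _ ≤ (Zi * φ).rank := Matrix.rank_mul_le_left _ _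
      _ ≤ φ.rank := Matrix.rank_mul_le_right _ _

theorem finrank_le_of_mulVec {m n : Type*} [Fintype m] [Fintype n] [DecidableEq m] [DecidableEq n]
    {M : Matrix m n K} {N : Matrix n m K} {V : Submodule K (n → K)} {W : Submodule K (m → K)}
    (h : ∀ v ∈ V, M *ᵥ v ∈ W) (h' : ∀ v ∈ V, N *ᵥ (M *ᵥ v) = v) :
    finrank K V ≤ finrank K W := by
  refine LinearMap.finrank_le_finrank_of_injective
    (f := ((toLin' M).restrict (p := V) (q := W) h)) ?_
  intro v w hvw
  have := congrArg (fun x : W => N *ᵥ (x : m → K)) hvw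
  change N *ᵥ (M *ᵥ (v : n → K)) = N *ᵥ (M *ᵥ (w : n → K)) at this
  rw [h' _ v.2, h' _ w.2] at this
  exact Subtype.ext this

theorem PartialInv.mem_ker (hY : PartialInv Y Yi B A) (huφ : Z * u = φ * Y) {a : T → K}
    (ha : u *ᵥ a = 0) : φ *ᵥ (Y *ᵥ a) = 0 := by
  rw [mulVec_mulVec, ← huφ, ← mulVec_mulVec, ha, mulVec_zero]

theorem PartialInv.mulVec_mem (hY : PartialInv Y Yi B A) (a : T → K) : Y *ᵥ a ∈ coord K B :=
  SM_mulVec hY.mem (X := Finset.univ) (by simp [coord_univ]) fun _ _ h _ => (Finset.mem_product.1 h).1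

theorem KerRange.card_eq_ker (hφ : KerRange φ Dσ B D1 B' r s) (hu : KerRange u Dτ A D1τ A' ρ s')
    (hY : PartialInv Y Yi B A) (hZ : PartialInv Z Zi Dσ Dτ) (huφ : Z * u = φ * Y) :
    B'.card = A'.card := by
  have huD : mask K Dτ * u = u := mask_mul_of_mem hu.mem fun i j h => (mem_tri.1 h).1
  have e1 : u = Zi * φ * Y := by rw [Matrix.mul_assoc, ← huφ, ← Matrix.mul_assoc, hZ.left, huD]
  rw [hφ.card_ker, hu.card_ker]
  apply le_antisymm
  · refine finrank_le_of_mulVec (M := Yi) (N := Y) ?_ ?_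
    · rintro v ⟨h1, h2⟩
      rw [SetLike.mem_coe, LinearMap.mem_ker, toLin'_apply] at h1
      refine ⟨?_, SM_mulVec hY.mem' h2 fun i j h _ => (Finset.mem_product.1 h).1⟩
      rw [SetLike.mem_coe, LinearMap.mem_ker, toLin'_apply, e1, mulVec_mulVec,
        Matrix.mul_assoc, hY.right, ← mulVec_mulVec, mask_mulVec_of_mem h2,
        ← mulVec_mulVec, h1, mulVec_zero]
    · rintro v ⟨-, h2⟩
      rw [mulVec_mulVec, hY.right, mask_mulVec_of_mem h2]
  · refine finrank_le_of_mulVec (M := Y) (N := Yi) ?_ ?_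
    · rintro v ⟨h1, h2⟩
      rw [SetLike.mem_coe, LinearMap.mem_ker, toLin'_apply] at h1
      refine ⟨?_, hY.mulVec_mem v⟩
      rw [SetLike.mem_coe, LinearMap.mem_ker, toLin'_apply]
      exact hY.mem_ker huφ h1
    · rintro v ⟨-, h2⟩
      rw [mulVec_mulVec, hY.left, mask_mulVec_of_mem h2]

/-- If `(u, φ)` is a kernel element whose deformations behave as for a generic point, and
`Trans` fails, then the numerical obstruction occurs on `ker φ` and `range φ`. -/
theorem KerRange.card_lt (hφ : KerRange φ Dσ B D1 B' r s) (hu : KerRange u Dτ A D1τ A' ρ s')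
    (hY : PartialInv Y Yi B A) (hZ : PartialInv Z Zi Dσ Dτ) (huφ : Z * u = φ * Y)
    (hT : ¬ Trans Y Z Dσ B Dτ A)
    (H1 : ∀ u' ∈ SM K (tri Dτ A), ∀ φ' ∈ SM K (tri Dσ B), Z * u' = φ' * Y →
      ∀ w, φ *ᵥ w = 0 → ∃ x, φ' *ᵥ w = φ *ᵥ x)
    (H2 : ∀ X ∈ SM K (Dσ ×ˢ Dτ),
      X * u ∈ ((kerToRange u Dτ A).prod (kerToRange φ Dσ B)).map (transMap Y Z))
    (H3 : ∀ X ∈ SM K (B ×ˢ A),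
      φ * X ∈ ((kerToRange u Dτ A).prod (kerToRange φ Dσ B)).map (transMap Y Z)) :
    (tri (Dτ \ D1τ) A').card + (tri (Dσ \ D1) B').card < (Dσ \ D1).card * A'.card := by
  by_contra hcon
  push Not at hcon
  apply hT
  set S := (SM K (tri Dτ A)).prod (SM K (tri Dσ B)) with hS
  set E := (kerToRange u Dτ A).prod (kerToRange φ Dσ B) with hE
  set Δ := transMap Y Z with hΔ
  have huD : mask K Dτ * u = u := mask_mul_of_mem hu.mem fun i j h => (mem_tri.1 h).1
  have huA : u * mask K A = u := mul_mask_of_mem hu.mem fun i j h => (mem_tri.1 h).2.1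
  have hφB : φ * mask K B = φ := mul_mask_of_mem hφ.mem fun i j h => (mem_tri.1 h).2.1
  have hφD : mask K Dσ * φ = φ := mask_mul_of_mem hφ.mem fun i j h => (mem_tri.1 h).1
  have hker : S ⊓ LinearMap.ker Δ = E ⊓ LinearMap.ker Δ := by
    apply le_antisymm
    · rintro ⟨u', φ'⟩ ⟨⟨h1, h2⟩, h3⟩
      rw [SetLike.mem_coe, LinearMap.mem_ker, hΔ, transMap_apply, sub_eq_zero] at h3
      refine ⟨⟨⟨h1, fun a ha => ?_⟩, h2, H1 u' h1 φ' h2 h3⟩, ?_⟩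
      · obtain ⟨x, hx⟩ := H1 u' h1 φ' h2 h3 _ (hY.mem_ker huφ ha)
        refine ⟨Yi *ᵥ x, ?_⟩
        have hu'D : mask K Dτ * u' = u' := mask_mul_of_mem h1 fun i j h => (mem_tri.1 h).1
        dsimp only at h3
        calc u' *ᵥ a = (Zi * (Z * u')) *ᵥ a := by rw [← Matrix.mul_assoc, hZ.left, hu'D]
          _ = Zi *ᵥ (φ *ᵥ x) := by
            rw [h3, ← hx, ← mulVec_mulVec, ← mulVec_mulVec]
          _ = (Zi * (φ * mask K B)) *ᵥ x := by rw [hφB, mulVec_mulVec]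
          _ = (Zi * Z * u * Yi) *ᵥ x := by
            rw [← hY.right, ← Matrix.mul_assoc φ, ← huφ]; simp only [Matrix.mul_assoc]
          _ = u *ᵥ (Yi *ᵥ x) := by rw [hZ.left, huD, mulVec_mulVec]
      · rw [SetLike.mem_coe, LinearMap.mem_ker, hΔ, transMap_apply, sub_eq_zero]; exact h3
    · exact inf_le_inf_right _ (Submodule.prod_mono (fun f hf => hf.1) (fun f hf => hf.1))
  have hspan : SM K (Dσ ×ˢ A) ≤ E.map Δ ⊔ SM K ((Dσ \ D1) ×ˢ A') := by
    intro h hh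
    have hhA : h * mask K A = h := mul_mask_of_mem hh fun i j h => (Finset.mem_product.1 h).2
    have hhD : mask K Dσ * h = h := mask_mul_of_mem hh fun i j h => (Finset.mem_product.1 h).1
    set π := (1 + r) * mask K D1 with hπ
    have hπh : ∀ v, ∃ x, (π * h) *ᵥ v = φ *ᵥ x := by
      intro v
      obtain ⟨x, hx⟩ := hφ.exists_preimage (mask_mulVec_mem D1 (h *ᵥ v))
      refine ⟨x, ?_⟩
      rw [← hx, hπ, ← mulVec_mulVec, ← mulVec_mulVec, add_mulVec,
        one_mulVec]
    obtain ⟨Y0, hY0⟩ := exists_right_factor φ (π * h) hπh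
    have hY1 : φ * (mask K B * Y0 * mask K A) = π * h := by
      rw [← Matrix.mul_assoc, ← Matrix.mul_assoc, hφB, hY0, Matrix.mul_assoc, hhA]
    have hm1 : mask K B * Y0 * mask K A ∈ SM K (B ×ˢ A) := by
      intro i j hij
      rw [mul_mask_apply, mask_mul_apply]
      rw [Finset.mem_product] at hij
      by_cases hi : i ∈ B
      · by_cases hj : j ∈ A
        · exact (hij ⟨hi, hj⟩).elim
        · simp [hj]
      · simp [hi]
    have hin1 := H3 _ hm1
    rw [hY1] at hin1
    set h' := h - π * h with hh'
    have hh'm : h' ∈ SM K ((Dσ \ D1) ×ˢ A) := by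
      intro i j hij
      by_cases hi : i ∈ D1
      · have hri : (r * mask K D1 * h) i j = 0 := by
          have : r * (mask K D1 * h) ∈ SM K ((Dσ \ D1) ×ˢ (Finset.univ : Finset T)) :=
            SM_mul (S' := Finset.univ) hφ.hr (by intro _ _ h; simp at h) fun i j k h1 h2 => by
              simpa using Finset.mem_sdiff.1 (mem_tri.1 h1).1
          rw [Matrix.mul_assoc]
          exact this i j (by simp [hi])
        rw [hh', hπ, Matrix.add_mul, Matrix.add_mul, Matrix.one_mul, Matrix.sub_apply,
          Matrix.add_apply, hri, mask_mul_apply, if_pos hi, add_zero, sub_self]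
      · by_cases hj : j ∈ A
        · have hi' : i ∉ Dσ := fun h => hij (by simp [h, hi, hj])
          have h1 : h i j = 0 := hh i j (by simp [hi'])
          have hri : (r * mask K D1 * h) i j = 0 := by
            have : r * (mask K D1 * h) ∈ SM K ((Dσ \ D1) ×ˢ (Finset.univ : Finset T)) :=
              SM_mul (S' := Finset.univ) hφ.hr (by intro _ _ h; simp at h) fun i j k h1 h2 => by
                simpa using Finset.mem_sdiff.1 (mem_tri.1 h1).1
            rw [Matrix.mul_assoc]
            exact this i j (by simp [hi'])
          rw [hh', hπ, Matrix.add_mul, Matrix.add_mul, Matrix.one_mul, Matrix.sub_apply,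
            Matrix.add_apply, hri, mask_mul_apply, if_neg hi, h1]
          simp
        · rw [hh', ← hhA, ← Matrix.mul_assoc, Matrix.sub_apply, mul_mask_apply, mul_mask_apply,
            if_neg hj, if_neg hj, sub_self]
    have hh'A : h' * mask K A = h' := mul_mask_of_mem hh'm fun i j h => (Finset.mem_product.1 h).2
    have hh'D : mask K Dσ * h' = h' := mask_mul_of_mem hh'm fun i j h =>
      (Finset.mem_sdiff.1 (Finset.mem_product.1 h).1).1
    set h'' := h' * ((1 + s') * mask K A') with hh''
    have hm2 : h'' ∈ SM K ((Dσ \ D1) ×ˢ A') := by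
      rw [hh'', ← Matrix.mul_assoc]
      refine SM_mask_right (S := (Dσ \ D1) ×ˢ Finset.univ) ?_ fun i j h1 h2 => ?_
      · exact SM_mul (S' := Finset.univ) hh'm (by intro _ _ h; simp at h) fun i j k h1 _ => by
          simpa using Finset.mem_sdiff.1 (Finset.mem_product.1 h1).1
      · exact Finset.mem_product.2 ⟨(Finset.mem_product.1 h1).1, h2⟩
    have hkill : ∀ v, u *ᵥ v = 0 → (h' - h'') *ᵥ v = 0 := by
      intro v hv
      have h1 : mask K A *ᵥ v ∈ ech A' s' := by
        rw [← hu.ker]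
        refine ⟨?_, mask_mulVec_mem _ _⟩
        rw [SetLike.mem_coe, LinearMap.mem_ker, toLin'_apply, mulVec_mulVec, huA, hv]
      obtain ⟨w, hw, hw'⟩ := mem_ech'.1 h1
      have e1 : mask K A' *ᵥ v = w := by
        have : mask K A' *ᵥ (mask K A *ᵥ v) = mask K A' *ᵥ v := by
          ext i
          simp only [mask_mulVec_apply]
          by_cases hi : i ∈ A'
          · simp [hi, hu.subB hi]
          · simp [hi]
        rw [← this, hw', mulVec_add, mask_mulVec_of_mem hw]
        have : mask K A' *ᵥ (s' *ᵥ w) = 0 := by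
          have hsw : s' *ᵥ w ∈ coord K (A \ A') := SM_mulVec hu.hs hw fun i j h _ => (mem_tri.1 h).1
          ext i
          rw [mask_mulVec_apply]
          split_ifs with hi
          · exact hsw i fun h => (Finset.mem_sdiff.1 h).2 hi
          · rfl
        rw [this, add_zero]
      have e2 : h' *ᵥ v = h' *ᵥ (w + s' *ᵥ w) := by rw [← hw', mulVec_mulVec, hh'A]
      rw [sub_mulVec, e2, hh'', ← mulVec_mulVec, ← mulVec_mulVec, e1,
        add_mulVec, one_mulVec, sub_self]
    obtain ⟨X0, hX0⟩ := exists_left_factor u (h' - h'') hkill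
    have hm2D : mask K Dσ * h'' = h'' := mask_mul_of_mem hm2 fun i j h =>
      (Finset.mem_sdiff.1 (Finset.mem_product.1 h).1).1
    have hX1 : (mask K Dσ * X0 * mask K Dτ) * u = h' - h'' := by
      rw [Matrix.mul_assoc, huD, Matrix.mul_assoc, hX0, Matrix.mul_sub, hh'D, hm2D]
    have hm3 : mask K Dσ * X0 * mask K Dτ ∈ SM K (Dσ ×ˢ Dτ) := by
      intro i j hij
      rw [mul_mask_apply, mask_mul_apply]
      rw [Finset.mem_product] at hij
      by_cases hi : i ∈ Dσ
      · by_cases hj : j ∈ Dτ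
        · exact (hij ⟨hi, hj⟩).elim
        · simp [hj]
      · simp [hi]
    have hin2 := H2 _ hm3
    rw [hX1] at hin2
    rw [Submodule.mem_sup]
    exact ⟨_, add_mem hin1 hin2, h'', hm2, by rw [hh']; abel⟩
  have hle : S.map Δ ≤ SM K (Dσ ×ˢ A) := by
    rintro _ ⟨⟨u', φ'⟩, ⟨h1, h2⟩, rfl⟩
    rw [hΔ, transMap_apply]
    refine sub_mem (SM_mul hZ.mem h1 fun i j k h1 h2 => ?_) (SM_mul h2 hY.mem fun i j k h1 h2 => ?_)
    · exact Finset.mem_product.2 ⟨(Finset.mem_product.1 h1).1, (mem_tri.1 h2).2.1⟩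
    · exact Finset.mem_product.2 ⟨(mem_tri.1 h1).1, (Finset.mem_product.1 h2).2⟩
  have c1 := finrank_map_add_inf_ker Δ S
  have c2 := finrank_map_add_inf_ker Δ E
  have c1' : finrank K S = (tri Dτ A).card + (tri Dσ B).card := by
    rw [hS, finrank_submodule_prod, finrank_SM, finrank_SM]
  have c2' : finrank K E = _ := finrank_submodule_prod _ _
  rw [hker] at c1
  have c3 := hφ.finrank_kerToRange
  have c4 := hu.finrank_kerToRange
  have c5 := (Submodule.finrank_mono hspan).trans (Submodule.finrank_add_le_finrank_add_finrank _ _)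
  rw [finrank_SM, finrank_SM, Finset.card_product (Dσ \ D1)] at c5
  have heq : S.map Δ = SM K (Dσ ×ˢ A) := by
    refine Submodule.eq_of_le_of_finrank_le hle ?_
    rw [finrank_SM]
    omega
  intro h hh
  rw [← heq] at hh
  obtain ⟨⟨u', φ'⟩, ⟨h1, h2⟩, h3⟩ := hh
  exact ⟨u', h1, φ', h2, h3⟩

end KernelReduction

section Generic

variable {P T : Type*} [Fintype P] [DecidableEq P] [PartialOrder P]
  [Fintype T] [DecidableEq T] [PartialOrder T]

/-- The coordinate ring of pairs of `P × T` matrices. -/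
abbrev Poly (P T : Type*) := MvPolynomial ((P × T) ⊕ (P × T)) ℂ

/-- Its field of rational functions. -/
abbrev Rat' (P T : Type*) := FractionRing (Poly P T)

/-- First generic matrix. -/
noncomputable def genY (B : Finset P) (A : Finset T) : Matrix P T (Poly P T) :=
  Matrix.of fun i j => if (i, j) ∈ B ×ˢ A then MvPolynomial.X (Sum.inl (i, j)) else 0

/-- Second generic matrix. -/
noncomputable def genZ (B : Finset P) (A : Finset T) : Matrix P T (Poly P T) :=
  Matrix.of fun i j => if (i, j) ∈ B ×ˢ A then MvPolynomial.X (Sum.inr (i, j)) else 0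

/-- Embedding of polynomial matrices into matrices over the fraction field. -/
noncomputable def emb {m n : Type*} (M : Matrix m n (Poly P T)) : Matrix m n (Rat' P T) :=
  M.map (algebraMap _ _)

/-- Evaluation of polynomial matrices. -/
noncomputable def evm {m n : Type*} (x : (P × T) ⊕ (P × T) → ℂ) (M : Matrix m n (Poly P T)) :
    Matrix m n ℂ := M.map (MvPolynomial.eval x)

theorem emb_injective {m n : Type*} : Function.Injective (emb (P := P) (T := T) (m := m) (n := n)) :=
  Matrix.map_injective (IsFractionRing.injective _ _)

theorem emb_mul {m n l : Type*} [Fintype n] (M : Matrix m n (Poly P T)) (N : Matrix n l (Poly P T)) :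
    emb (M * N) = emb M * emb N := Matrix.map_mul

theorem evm_mul {m n l : Type*} [Fintype n] (x : (P × T) ⊕ (P × T) → ℂ) (M : Matrix m n (Poly P T))
    (N : Matrix n l (Poly P T)) : evm x (M * N) = evm x M * evm x N := Matrix.map_mul

theorem emb_sub {m n : Type*} (M N : Matrix m n (Poly P T)) : emb (M - N) = emb M - emb N :=
  Matrix.map_sub _ (map_sub _) _ _

theorem evm_sub {m n : Type*} (x : (P × T) ⊕ (P × T) → ℂ) (M N : Matrix m n (Poly P T)) :
    evm x (M - N) = evm x M - evm x N := Matrix.map_sub _ (map_sub _) _ _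

theorem emb_smul {m n : Type*} (q : Poly P T) (M : Matrix m n (Poly P T)) :
    emb (q • M) = algebraMap _ (Rat' P T) q • emb M := by
  ext i j; simp [emb]

theorem evm_smul {m n : Type*} (x : (P × T) ⊕ (P × T) → ℂ) (q : Poly P T) (M : Matrix m n (Poly P T)) :
    evm x (q • M) = MvPolynomial.eval x q • evm x M := by
  ext i j; simp [evm]

theorem emb_genY_mem (B : Finset P) (A : Finset T) : emb (genY B A) ∈ SM (Rat' P T) (B ×ˢ A) := by
  intro i j h; simp only [emb, genY, Matrix.map_apply, Matrix.of_apply, if_neg h, map_zero]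

theorem emb_genZ_mem (B : Finset P) (A : Finset T) : emb (genZ B A) ∈ SM (Rat' P T) (B ×ˢ A) := by
  intro i j h; simp only [emb, genZ, Matrix.map_apply, Matrix.of_apply, if_neg h, map_zero]

theorem evm_mem {m n : Type*} (x : (P × T) ⊕ (P × T) → ℂ) {S : Finset (m × n)}
    {M : Matrix m n (Poly P T)} (h : emb M ∈ SM (Rat' P T) S) : evm x M ∈ SM ℂ S := by
  intro i j hij
  have h1 : M i j = 0 := IsFractionRing.injective _ (Rat' P T) (by
    rw [map_zero]; exact h i j hij)
  simp [evm, h1]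

theorem evm_surj_genY (B : Finset P) (A : Finset T) {y : Matrix P T ℂ} (hy : y ∈ SM ℂ (B ×ˢ A)) :
    ∃ x, evm x (genY B A) = y := by
  refine ⟨Sum.elim (fun p => y p.1 p.2) 0, ?_⟩
  ext i j
  simp only [evm, genY, Matrix.map_apply, Matrix.of_apply]
  split_ifs with h
  · simp
  · simp [hy i j h]

/-- Constant matrices. -/
noncomputable def constM (P T : Type*) {m n : Type*} (M : Matrix m n ℂ) : Matrix m n (Poly P T) :=
  Matrix.of fun i j => MvPolynomial.C (M i j)

theorem evm_constM {m n : Type*} (x : (P × T) ⊕ (P × T) → ℂ) (M : Matrix m n ℂ) :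
    evm x (constM P T M) = M := by
  ext i j; simp [evm, constM]

theorem emb_constM_mem {m n : Type*} {S : Finset (m × n)} {M : Matrix m n ℂ} (h : M ∈ SM ℂ S) :
    emb (constM P T M) ∈ SM (Rat' P T) S := by
  intro i j hij
  simp [emb, constM, h i j hij]

/-- Common denominators for families of matrices. -/
theorem exists_clear_mat {ι : Type*} [Finite ι] (u : ι → Matrix T T (Rat' P T))
    (φ : ι → Matrix P P (Rat' P T)) : ∃ q : Poly P T, q ≠ 0 ∧ ∃ (u' : ι → Matrix T T (Poly P T))
      (φ' : ι → Matrix P P (Poly P T)), (∀ i, emb (u' i) = algebraMap _ (Rat' P T) q • u i) ∧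
      ∀ i, emb (φ' i) = algebraMap _ (Rat' P T) q • φ i := by
  obtain ⟨q, hq, g, hg⟩ := exists_clear (A := Poly P T) (L := Rat' P T)
    (ι := ι × ((T × T) ⊕ (P × P)))
    (fun k => Sum.elim (fun p => u k.1 p.1 p.2) (fun p => φ k.1 p.1 p.2) k.2)
  refine ⟨q, hq, fun i => Matrix.of fun a b => g (i, Sum.inl (a, b)),
    fun i => Matrix.of fun a b => g (i, Sum.inr (a, b)), fun i => ?_, fun i => ?_⟩
  · ext a b
    simpa [emb] using hg (i, Sum.inl (a, b))
  · ext a b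
    simpa [emb] using hg (i, Sum.inr (a, b))

theorem SM_le_of_single {K : Type*} [Field K] {S : Finset (P × T)} {V : Submodule K (Matrix P T K)}
    (h : ∀ p ∈ S, Matrix.single p.1 p.2 (1 : K) ∈ V) : SM K S ≤ V := by
  intro M hM
  rw [Matrix.matrix_eq_sum_single M]
  refine Submodule.sum_mem _ fun i _ => Submodule.sum_mem _ fun j _ => ?_
  by_cases hij : (i, j) ∈ S
  · have := V.smul_mem (M i j) (h _ hij)
    simpa [Matrix.smul_single] using this
  · rw [hM i j hij]; simp

theorem trans_iff {K : Type*} [Field K] {y z : Matrix P T K} {Dσ B : Finset P} {Dτ A : Finset T} :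
    Trans y z Dσ B Dτ A ↔ ∀ p : P × T, ∃ u ∈ SM K (tri Dτ A), ∃ φ ∈ SM K (tri Dσ B),
      p ∈ Dσ ×ˢ A → z * u - φ * y = Matrix.single p.1 p.2 1 := by
  constructor
  · intro h p
    by_cases hp : p ∈ Dσ ×ˢ A
    · obtain ⟨u, hu, φ, hφ, e⟩ := h (Matrix.single p.1 p.2 1) fun i j hij => by
        rw [Matrix.single_apply]
        split_ifs with h
        · obtain ⟨rfl, rfl⟩ := h
          exact (hij hp).elim
        · rfl
      exact ⟨u, hu, φ, hφ, fun _ => e⟩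
    · exact ⟨0, zero_mem _, 0, zero_mem _, fun h => (hp h).elim⟩
  · intro h x hx
    have hle : SM K (Dσ ×ˢ A) ≤ ((SM K (tri Dτ A)).prod (SM K (tri Dσ B))).map (transMap y z) := by
      refine SM_le_of_single fun p hp => ?_
      obtain ⟨u, hu, φ, hφ, e⟩ := h p
      exact ⟨(u, φ), ⟨hu, hφ⟩, e hp⟩
    obtain ⟨⟨u, φ⟩, ⟨hu, hφ⟩, e⟩ := hle hx
    exact ⟨u, hu, φ, hφ, e⟩

theorem exists_eval_of_trans {Dσ B : Finset P} {Dτ A : Finset T}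
    (h : Trans (emb (genY B A)) (emb (genZ Dσ Dτ)) Dσ B Dτ A) :
    ∃ x, Trans (evm x (genY B A)) (evm x (genZ Dσ Dτ)) Dσ B Dτ A := by
  rw [trans_iff] at h
  choose u hu φ hφ e using h
  obtain ⟨q, hq, u', φ', hu', hφ'⟩ := exists_clear_mat u φ
  obtain ⟨x, hx⟩ := exists_eval_ne_zero hq
  refine ⟨x, trans_iff.2 fun p => ?_⟩
  refine ⟨(MvPolynomial.eval x q)⁻¹ • evm x (u' p), Submodule.smul_mem _ _ (evm_mem x ?_),
    (MvPolynomial.eval x q)⁻¹ • evm x (φ' p), Submodule.smul_mem _ _ (evm_mem x ?_), fun hp => ?_⟩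
  · rw [hu']; exact Submodule.smul_mem _ _ (hu p)
  · rw [hφ']; exact Submodule.smul_mem _ _ (hφ p)
  · have h1 : genZ Dσ Dτ * u' p - φ' p * genY B A = q • Matrix.single p.1 p.2 1 := by
      apply emb_injective
      rw [emb_sub, emb_mul, emb_mul, hu', hφ', Matrix.mul_smul, Matrix.smul_mul, ← smul_sub, e p hp,
        emb_smul]
      congr 1
      ext i j
      by_cases h : p.1 = i ∧ p.2 = j <;> simp [emb, Matrix.single_apply, h]
    have h2 := congrArg (evm x) h1
    rw [evm_sub, evm_mul, evm_mul, evm_smul] at h2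
    rw [Matrix.mul_smul, Matrix.smul_mul, ← smul_sub, h2, smul_smul, inv_mul_cancel₀ hx, one_smul]
    ext i j
    by_cases h : p.1 = i ∧ p.2 = j <;> simp [evm, Matrix.single_apply, h]

/-- A partial permutation matrix matching `B` and `A`. -/
theorem exists_matching {R : Type*} [Field R] {B : Finset P} {A : Finset T}
    (h : B.card = A.card) : ∃ S : Matrix P T R, S ∈ SM R (B ×ˢ A) ∧ S * Sᵀ = mask R B ∧
      Sᵀ * S = mask R A := by
  classical
  let e := Finset.equivOfCardEq h
  refine ⟨Matrix.of fun i j => if ∃ hi : i ∈ B, (e ⟨i, hi⟩ : T) = j then 1 else 0, ?_, ?_, ?_⟩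
  · intro i j hij
    rw [Matrix.of_apply, if_neg]
    rintro ⟨hi, rfl⟩
    exact hij (Finset.mem_product.2 ⟨hi, (e _).2⟩)
  · ext i k
    simp only [Matrix.mul_apply, Matrix.of_apply, Matrix.transpose_apply, mask,
      Matrix.diagonal_apply,
      ite_mul, one_mul, zero_mul]
    by_cases hi : i ∈ B
    · rw [Finset.sum_eq_single (e ⟨i, hi⟩ : T)]
      · rw [if_pos ⟨hi, rfl⟩]
        by_cases hik : i = k
        · subst hik; simp [hi]
        · rw [if_neg hik, if_neg]
          rintro ⟨hk, h2⟩
          exact hik (by simpa using (e.injective (Subtype.ext h2)).symm)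
      · intro j _ hj
        rw [if_neg]
        rintro ⟨_, h2⟩; exact hj h2.symm
      · simp
    · simp [hi]
  · ext j l
    simp only [Matrix.mul_apply, Matrix.of_apply, Matrix.transpose_apply, mask,
      Matrix.diagonal_apply,
      ite_mul, one_mul, zero_mul]
    by_cases hj : j ∈ A
    · rw [Finset.sum_eq_single (e.symm ⟨j, hj⟩ : P)]
      · rw [if_pos ⟨(e.symm ⟨j, hj⟩).2, by simp⟩]
        by_cases hjl : j = l
        · subst hjl
          simp [hj]
        · rw [if_neg hjl, if_neg]
          rintro ⟨_, h2⟩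
          exact hjl (by simpa using h2)
      · intro i _ hi
        rw [if_neg]
        rintro ⟨h1, h2⟩
        apply hi
        have : (⟨j, hj⟩ : A) = e ⟨i, h1⟩ := Subtype.ext h2.symm
        rw [this]; simp
      · simp
    · rw [Finset.sum_eq_zero]
      · simp [hj]
      · intro i _
        rw [if_neg]
        rintro ⟨h1, h2⟩
        exact hj (h2 ▸ (e _).2)

theorem mask_add_mask_compl {R : Type*} [CommRing R] (X : Finset P) :
    mask R X + mask R Xᶜ = 1 := by
  ext i j
  by_cases h : i = j
  · subst h; by_cases hi : i ∈ X <;> simp [mask, hi]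
  · simp [mask, h]

theorem mask_compl_mul_self {R : Type*} [CommRing R] (X : Finset P) :
    mask R Xᶜ * mask R X = 0 := by
  simp only [mask, Matrix.diagonal_mul_diagonal]
  ext i j
  by_cases h : i = j
  · subst h; by_cases hi : i ∈ X <;> simp [hi]
  · simp [h]

theorem mask_compl_mul_eq_zero {K Q : Type*} [Field K] {S : Finset (P × Q)} {X : Finset P}
    {M : Matrix P Q K} (hM : M ∈ SM K S) (h : ∀ i j, (i, j) ∈ S → i ∈ X) : mask K Xᶜ * M = 0 := by
  ext i j
  rw [mask_mul_apply]
  split_ifs with hj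
  · exact hM i j fun h' => (Finset.mem_compl.1 hj) (h i j h')
  · rfl

theorem emb_mask {Q : Type*} [DecidableEq Q] (X : Finset Q) :
    emb (mask (Poly P T) X) = mask (Rat' P T) X := by
  ext i j
  by_cases h : i = j
  · subst h; by_cases hi : i ∈ X <;> simp [emb, mask, hi]
  · simp [emb, mask, h]

theorem evm_mask {Q : Type*} [DecidableEq Q] (x : (P × T) ⊕ (P × T) → ℂ) (X : Finset Q) :
    evm x (mask (Poly P T) X) = mask ℂ X := by
  ext i j
  by_cases h : i = j
  · subst h; by_cases hi : i ∈ X <;> simp [evm, mask, hi]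
  · simp [evm, mask, h]

theorem evm_add {m n : Type*} (x : (P × T) ⊕ (P × T) → ℂ) (M N : Matrix m n (Poly P T)) :
    evm x (M + N) = evm x M + evm x N := Matrix.map_add _ (map_add _) _ _

theorem emb_add {m n : Type*} (M N : Matrix m n (Poly P T)) : emb (M + N) = emb M + emb N :=
  Matrix.map_add _ (map_add _) _ _

theorem det_emb_ne_zero {Q : Type*} [Fintype Q] [DecidableEq Q] {M : Matrix Q Q (Poly P T)}
    {x : (P × T) ⊕ (P × T) → ℂ} (h : (evm x M).det ≠ 0) : (emb M).det ≠ 0 := by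
  rw [show (emb M).det = algebraMap _ _ M.det from (RingHom.map_det _ _).symm]
  intro h0
  have h1 : M.det = 0 := IsFractionRing.injective _ (Rat' P T) (by rw [h0, map_zero])
  apply h
  rw [show (evm x M).det = MvPolynomial.eval x M.det from (RingHom.map_det _ _).symm, h1, map_zero]

theorem constM_mul {l m n : Type*} [Fintype m] (M : Matrix l m ℂ) (N : Matrix m n ℂ) :
    constM P T (M * N) = constM P T M * constM P T N :=
  Matrix.map_mul (f := (MvPolynomial.C : ℂ →+* Poly P T))

/-- A matrix with generic entries on a square block is invertible. -/
theorem exists_partialInv {B : Finset P} {A : Finset T} (hc : B.card = A.card)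
    {G : Matrix P T (Poly P T)} (hG : emb G ∈ SM (Rat' P T) (B ×ˢ A))
    (hx : ∀ y ∈ SM ℂ (B ×ˢ A), ∃ x, evm x G = y) : ∃ Gi, PartialInv (emb G) Gi B A := by
  obtain ⟨Sc, hSm, hS1, hS2⟩ := exists_matching (R := ℂ) hc
  obtain ⟨x, hx⟩ := hx Sc hSm
  let M : Matrix P P (Poly P T) := G * constM P T Scᵀ + mask (Poly P T) Bᶜ
  have hMx : evm x M = 1 := by
    rw [evm_add, evm_mul, evm_constM, evm_mask, hx, hS1, mask_add_mask_compl]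
  have hdet : (emb M).det ≠ 0 := det_emb_ne_zero (x := x) (by rw [hMx, Matrix.det_one]; exact one_ne_zero)
  have hu := isUnit_iff_ne_zero.2 hdet
  let S : Matrix P T (Rat' P T) := emb (constM P T Sc)
  let G0 : Matrix T P (Rat' P T) := emb (constM P T Scᵀ)
  have hS : S ∈ SM _ (B ×ˢ A) := emb_constM_mem hSm
  have hG0 : G0 ∈ SM _ (A ×ˢ B) := emb_constM_mem fun i j h => hSm j i fun h' =>
    h (Finset.mem_product.2 (Finset.mem_product.1 h').symm)
  have hG0S : G0 * S = mask _ A := by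
    rw [← emb_mul, ← constM_mul, hS2, ← emb_mask]
    congr 1
    ext i j
    by_cases h : i = j
    · subst h; by_cases hi : i ∈ A <;> simp [constM, mask, hi]
    · simp [constM, mask, h]
  have hM : emb M = emb G * G0 + mask (Rat' P T) Bᶜ := by rw [emb_add, emb_mul, emb_mask]
  let N := (emb M)⁻¹
  have h1 : mask (Rat' P T) Bᶜ * emb M = mask (Rat' P T) Bᶜ := by
    rw [hM, Matrix.mul_add, ← Matrix.mul_assoc,
      mask_compl_mul_eq_zero hG fun i j h => (Finset.mem_product.1 h).1, Matrix.zero_mul, zero_add]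
    exact mul_mask_of_mem (mask_mem Bᶜ) fun i j h => (mem_tri.1 h).2.1
  have h2 : mask (Rat' P T) Bᶜ * N = mask (Rat' P T) Bᶜ := by
    conv_lhs => rw [← h1]
    rw [Matrix.mul_assoc, Matrix.mul_nonsing_inv _ hu, Matrix.mul_one]
  have h3 : emb M * S = emb G := by
    rw [hM, Matrix.add_mul, Matrix.mul_assoc, hG0S,
      mask_compl_mul_eq_zero hS fun i j h => (Finset.mem_product.1 h).1, add_zero]
    exact mul_mask_of_mem hG fun i j h => (Finset.mem_product.1 h).2
  refine ⟨G0 * N * mask (Rat' P T) B, hG, ?_, ?_, ?_⟩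
  · refine SM_mask_right (S := A ×ˢ Finset.univ) (SM_mul (S' := Finset.univ) hG0
      (fun i j h => (h (Finset.mem_univ _)).elim) fun i j k h _ => ?_) fun i j h hj => ?_
    · exact Finset.mem_product.2 ⟨(Finset.mem_product.1 h).1, Finset.mem_univ _⟩
    · exact Finset.mem_product.2 ⟨(Finset.mem_product.1 h).1, hj⟩
  · rw [Matrix.mul_assoc, mask_mul_of_mem hG fun i j h => (Finset.mem_product.1 h).1, ← h3,
      Matrix.mul_assoc, ← Matrix.mul_assoc N, Matrix.nonsing_inv_mul _ hu, Matrix.one_mul, hG0S]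
  · rw [← Matrix.mul_assoc, ← Matrix.mul_assoc, show emb G * G0 = emb M - mask (Rat' P T) Bᶜ by
      rw [hM, add_sub_cancel_right], Matrix.sub_mul, Matrix.mul_nonsing_inv _ hu, h2, Matrix.sub_mul,
      Matrix.one_mul, mask_compl_mul_self, sub_zero]

/-- Entrywise partial derivative. -/
noncomputable def dm {m n : Type*} (k : (P × T) ⊕ (P × T)) (M : Matrix m n (Poly P T)) :
    Matrix m n (Poly P T) := M.map (MvPolynomial.pderiv k)

theorem dm_mul {l m n : Type*} [Fintype m] (k : (P × T) ⊕ (P × T)) (M : Matrix l m (Poly P T))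
    (N : Matrix m n (Poly P T)) : dm k (M * N) = dm k M * N + M * dm k N := by
  refine Matrix.ext fun i j => ?_
  simp only [dm, Matrix.map_apply, Matrix.mul_apply, Matrix.add_apply, map_sum, Derivation.leibniz,
    smul_eq_mul, ← Finset.sum_add_distrib]
  exact Finset.sum_congr rfl fun _ _ => by ring

theorem eq_zero_of_emb_mem {m n : Type*} {S : Finset (m × n)} {M : Matrix m n (Poly P T)}
    (h : emb M ∈ SM (Rat' P T) S) {i j} (hij : (i, j) ∉ S) : M i j = 0 :=
  IsFractionRing.injective _ (Rat' P T) (by rw [map_zero]; exact h i j hij)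

theorem emb_dm_mem {m n : Type*} {S : Finset (m × n)} {M : Matrix m n (Poly P T)}
    (k : (P × T) ⊕ (P × T)) (h : emb M ∈ SM (Rat' P T) S) : emb (dm k M) ∈ SM (Rat' P T) S := by
  intro i j hij
  simp [emb, dm, eq_zero_of_emb_mem h hij]

/-- Derivatives of a matrix map its kernel to its range. -/
theorem emb_dm_mem_kerToRange {Q : Type*} [Fintype Q] [DecidableEq Q] [PartialOrder Q]
    {M : Matrix Q Q (Poly P T)} {D B : Finset Q} (k : (P × T) ⊕ (P × T))
    (h : emb M ∈ SM (Rat' P T) (tri D B)) : emb (dm k M) ∈ kerToRange (emb M) D B := by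
  refine ⟨emb_dm_mem k h, fun w hw => ?_⟩
  obtain ⟨q, hq, g, hg⟩ := exists_clear (A := Poly P T) (L := Rat' P T) w
  have hq' : algebraMap (Poly P T) (Rat' P T) q ≠ 0 := fun h0 =>
    hq (IsFractionRing.injective _ (Rat' P T) (by rw [h0, map_zero]))
  let W : Matrix Q Unit (Poly P T) := Matrix.of fun i _ => g i
  let w' : Matrix Q Unit (Rat' P T) := Matrix.of fun i _ => w i
  have hW : emb W = algebraMap (Poly P T) (Rat' P T) q • w' := by
    ext i j
    simp [emb, W, w', hg]
  have hw' : emb M * w' = 0 := by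
    ext i j
    exact congrFun hw i
  have h1 : M * W = 0 := by
    apply emb_injective
    rw [emb_mul, hW, Matrix.mul_smul, hw', smul_zero]
    ext i j; simp [emb]
  have h2 := congrArg (fun X => emb (dm k X)) h1
  simp only [dm_mul, emb_add, emb_mul, hW, Matrix.mul_smul] at h2
  refine ⟨fun i => -(algebraMap (Poly P T) (Rat' P T) q)⁻¹ * emb (dm k W) i (), ?_⟩
  have h3 : emb (dm k M) * w' = emb M * (-(algebraMap (Poly P T) (Rat' P T) q)⁻¹ • emb (dm k W)) := by
    rw [Matrix.mul_smul, neg_smul, ← smul_neg]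
    rw [show -(emb M * emb (dm k W)) = algebraMap (Poly P T) (Rat' P T) q • (emb (dm k M) * w') by
      rw [neg_eq_iff_add_eq_zero, add_comm, h2]
      ext i j; simp [emb, dm]]
    rw [smul_smul, inv_mul_cancel₀ hq', one_smul]
  ext i
  exact congrFun (congrFun h3 i) ()

theorem dm_genY_inl {B : Finset P} {A : Finset T} {p : P × T} (hp : p ∈ B ×ˢ A) :
    dm (Sum.inl p) (genY B A) = Matrix.single p.1 p.2 (1 : Poly P T) := by
  refine Matrix.ext fun i j => ?_
  simp only [dm, genY, Matrix.map_apply, Matrix.of_apply, Matrix.single_apply]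
  by_cases h : p.1 = i ∧ p.2 = j
  · obtain ⟨rfl, rfl⟩ := h
    simp [hp]
  · rw [if_neg h]
    split_ifs
    · rw [MvPolynomial.pderiv_X_of_ne]
      intro h'
      simp only [Sum.inl.injEq] at h'
      exact h (by rw [← h']; simp)
    · simp

theorem dm_genZ_inr {B : Finset P} {A : Finset T} {p : P × T} (hp : p ∈ B ×ˢ A) :
    dm (Sum.inr p) (genZ B A) = Matrix.single p.1 p.2 (1 : Poly P T) := by
  refine Matrix.ext fun i j => ?_
  simp only [dm, genZ, Matrix.map_apply, Matrix.of_apply, Matrix.single_apply]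
  by_cases h : p.1 = i ∧ p.2 = j
  · obtain ⟨rfl, rfl⟩ := h
    simp [hp]
  · rw [if_neg h]
    split_ifs
    · rw [MvPolynomial.pderiv_X_of_ne]
      intro h'
      simp only [Sum.inr.injEq] at h'
      exact h (by rw [← h']; simp)
    · simp

theorem dm_genY_inr {B : Finset P} {A : Finset T} {p : P × T} :
    dm (Sum.inr p) (genY B A) = 0 := by
  refine Matrix.ext fun i j => ?_
  simp only [dm, genY, Matrix.map_apply, Matrix.of_apply, Matrix.zero_apply]
  split_ifs
  · exact MvPolynomial.pderiv_X_of_ne (by simp)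
  · simp

theorem dm_genZ_inl {B : Finset P} {A : Finset T} {p : P × T} :
    dm (Sum.inl p) (genZ B A) = 0 := by
  refine Matrix.ext fun i j => ?_
  simp only [dm, genZ, Matrix.map_apply, Matrix.of_apply, Matrix.zero_apply]
  split_ifs
  · exact MvPolynomial.pderiv_X_of_ne (by simp)
  · simp

theorem emb_single (p : P × T) :
    emb (Matrix.single p.1 p.2 (1 : Poly P T)) = Matrix.single p.1 p.2 (1 : Rat' P T) := by
  ext i j
  by_cases h : p.1 = i ∧ p.2 = j <;> simp [emb, Matrix.single_apply, h]

section Deform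

variable {Dσ B : Finset P} {Dτ A : Finset T} {u : Matrix T T (Poly P T)} {φ : Matrix P P (Poly P T)}

theorem mul_mem_of_deform_left
    (hu : emb u ∈ SM (Rat' P T) (tri Dτ A)) (hφ : emb φ ∈ SM (Rat' P T) (tri Dσ B))
    (huφ : genZ Dσ Dτ * u = φ * genY B A)
    (X : Matrix P T (Rat' P T)) (hX : X ∈ SM (Rat' P T) (Dσ ×ˢ Dτ)) :
    X * emb u ∈ ((kerToRange (emb u) Dτ A).prod (kerToRange (emb φ) Dσ B)).map
      (transMap (emb (genY B A)) (emb (genZ Dσ Dτ))) := by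
  have : SM (Rat' P T) (Dσ ×ˢ Dτ) ≤ (((kerToRange (emb u) Dτ A).prod
      (kerToRange (emb φ) Dσ B)).map (transMap (emb (genY B A)) (emb (genZ Dσ Dτ)))).comap
      (mulRightLinearMap P (Rat' P T) (emb u)) := by
    refine SM_le_of_single fun p hp => ?_
    refine ⟨(-emb (dm (Sum.inr p) u), -emb (dm (Sum.inr p) φ)),
      ⟨neg_mem (emb_dm_mem_kerToRange _ hu), neg_mem (emb_dm_mem_kerToRange _ hφ)⟩, ?_⟩
    have h := congrArg (fun X => emb (dm (Sum.inr p) X)) huφ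
    simp only [dm_mul, emb_add, emb_mul, dm_genZ_inr hp, dm_genY_inr, emb_single, Matrix.mul_zero,
      add_zero] at h
    rw [transMap_apply, mulRightLinearMap_apply]
    simp only [Matrix.mul_neg, Matrix.neg_mul, sub_neg_eq_add]
    rw [← h]; abel
  exact this hX

theorem mul_mem_of_deform_right
    (hu : emb u ∈ SM (Rat' P T) (tri Dτ A)) (hφ : emb φ ∈ SM (Rat' P T) (tri Dσ B))
    (huφ : genZ Dσ Dτ * u = φ * genY B A)
    (X : Matrix P T (Rat' P T)) (hX : X ∈ SM (Rat' P T) (B ×ˢ A)) :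
    emb φ * X ∈ ((kerToRange (emb u) Dτ A).prod (kerToRange (emb φ) Dσ B)).map
      (transMap (emb (genY B A)) (emb (genZ Dσ Dτ))) := by
  have : SM (Rat' P T) (B ×ˢ A) ≤ (((kerToRange (emb u) Dτ A).prod
      (kerToRange (emb φ) Dσ B)).map (transMap (emb (genY B A)) (emb (genZ Dσ Dτ)))).comap
      (mulLeftLinearMap T (Rat' P T) (emb φ)) := by
    refine SM_le_of_single fun p hp => ?_
    refine ⟨(emb (dm (Sum.inl p) u), emb (dm (Sum.inl p) φ)),
      ⟨emb_dm_mem_kerToRange _ hu, emb_dm_mem_kerToRange _ hφ⟩, ?_⟩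
    have h := congrArg (fun X => emb (dm (Sum.inl p) X)) huφ
    simp only [dm_mul, emb_add, emb_mul, dm_genZ_inl, dm_genY_inl hp, emb_single] at h
    rw [transMap_apply, mulLeftLinearMap_apply]
    rw [show emb (0 : Matrix P T (Poly P T)) = 0 by ext i j; simp [emb], Matrix.zero_mul, zero_add] at h
    rw [h]; abel
  exact this hX

end Deform

end Generic

section Destab

variable {P T : Type*} [Fintype P] [DecidableEq P] [PartialOrder P]
  [Fintype T] [DecidableEq T] [PartialOrder T]

theorem exists_max_rank {K : Type*} [Field K] {ι : Type*} (S : Set ι) (hS : S.Nonempty)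
    (f : ι → Matrix P P K) : ∃ a ∈ S, ∀ b ∈ S, (f b).rank ≤ (f a).rank := by
  obtain ⟨a, ha, h⟩ := Nat.sSup_mem (s := (fun a => (f a).rank) '' S) (hS.image _)
    ⟨Fintype.card P, by rintro _ ⟨a, -, rfl⟩; exact Matrix.rank_le_card_height _⟩
  refine ⟨a, ha, fun b hb => ?_⟩
  change (f a).rank = _ at h
  rw [h]
  exact le_csSup ⟨Fintype.card P, by rintro _ ⟨a, -, rfl⟩; exact Matrix.rank_le_card_height _⟩
    ⟨b, hb, rfl⟩

theorem KerRange.ssubset {K : Type*} [Field K] {φ r s : Matrix P P K} {D B D1 B' : Finset P}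
    (h : KerRange φ D B D1 B' r s) (h0 : φ ≠ 0) : B' ⊂ B := by
  refine h.subB.ssubset_of_ne fun hB => h0 ?_
  have h1 := h.card_ker
  rw [hB, ← finrank_coord (K := K) B] at h1
  have h2 := Submodule.eq_of_le_of_finrank_eq (inf_le_right :
    LinearMap.ker (toLin' φ) ⊓ coord K B ≤ coord K B) h1.symm
  refine ext_of_mulVec_single fun j => ?_
  rw [zero_mulVec]
  by_cases hj : j ∈ B
  · have : (Pi.single j 1 : P → K) ∈ coord K B := fun i hi => by
      rw [Pi.single_apply, if_neg]; rintro rfl; exact hi hj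
    rw [← h2] at this
    simpa using this.1
  · ext i
    rw [mulVec_single_one]
    exact h.mem i j fun h' => hj (mem_tri.1 h').2.1

/-- The destabilising data produced by a failure of generic surjectivity. -/
structure Destab (Dσ B : Finset P) (Dτ A : Finset T) (D1 B' : Finset P) (D1τ A' : Finset T) :
    Prop where
  subB : B' ⊂ B
  subA : A' ⊆ A
  subD : D1 ⊆ Dσ
  subDτ : D1τ ⊆ Dτ
  cardD : D1.card = D1τ.card
  cardB : B'.card = A'.card
  lt : (tri (Dτ \ D1τ) A').card + (tri (Dσ \ D1) B').card < (Dσ \ D1).card * A'.card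
  sub : ∃ s ∈ SM (Rat' P T) (tri (B \ B') B'), ∃ s' ∈ SM (Rat' P T) (tri (A \ A') A'),
    emb (genY B A) * ((1 + s') * mask (Rat' P T) A') =
      (1 + s) * (mask (Rat' P T) B' * (emb (genY B A) * ((1 + s') * mask (Rat' P T) A')))
  quot : ∃ r ∈ SM (Rat' P T) (tri (Dσ \ D1) D1), ∃ ρ ∈ SM (Rat' P T) (tri (Dτ \ D1τ) D1τ),
    ∀ v ∈ coord (Rat' P T) D1τ, ∃ w ∈ coord (Rat' P T) D1,
      emb (genZ Dσ Dτ) *ᵥ (v + ρ *ᵥ v) = w + r *ᵥ w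

theorem exists_destab [ChainPoset P] [ChainPoset T] {Dσ B : Finset P} {Dτ A : Finset T}
    (hBA : B.card = A.card) (hD : Dσ.card = Dτ.card)
    (hT : ¬ Trans (emb (genY B A)) (emb (genZ Dσ Dτ)) Dσ B Dτ A)
    {u0 : Matrix T T (Rat' P T)} (hu0 : u0 ∈ SM (Rat' P T) (tri Dτ A))
    {φ0 : Matrix P P (Rat' P T)} (hφ0 : φ0 ∈ SM (Rat' P T) (tri Dσ B))
    (huφ0 : emb (genZ Dσ Dτ) * u0 = φ0 * emb (genY B A)) (hne : φ0 ≠ 0) :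
    ∃ D1 B' D1τ A', Destab Dσ B Dτ A D1 B' D1τ A' := by
  obtain ⟨Yi, hY⟩ := exists_partialInv hBA (emb_genY_mem B A) fun y hy => evm_surj_genY B A hy
  obtain ⟨Zi, hZ⟩ := exists_partialInv hD (emb_genZ_mem Dσ Dτ) fun y hy => by
    refine ⟨Sum.elim 0 (fun p => y p.1 p.2), ?_⟩
    ext i j
    simp only [evm, genZ, Matrix.map_apply, Matrix.of_apply]
    split_ifs with h
    · simp
    · simp [hy i j h]
  obtain ⟨⟨u1, φ1⟩, ⟨hu1, hφ1, huφ1⟩, hmax⟩ := exists_max_rank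
    {x : Matrix T T (Rat' P T) × Matrix P P (Rat' P T) | x.1 ∈ SM (Rat' P T) (tri Dτ A) ∧
      x.2 ∈ SM (Rat' P T) (tri Dσ B) ∧ emb (genZ Dσ Dτ) * x.1 = x.2 * emb (genY B A)}
    ⟨(u0, φ0), hu0, hφ0, huφ0⟩ Prod.snd
  simp only at hu1 hφ1 huφ1 hmax
  have hφ1ne : φ1 ≠ 0 := by
    rintro rfl
    have := hmax (u0, φ0) ⟨hu0, hφ0, huφ0⟩
    rw [Matrix.rank_zero, Nat.le_zero] at this
    have h0 : φ0.mulVecLin = 0 := by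
      simpa [Matrix.rank, Submodule.finrank_eq_zero, LinearMap.range_eq_bot] using this
    refine hne (ext_of_mulVec_single fun j => ?_)
    rw [zero_mulVec, ← mulVecLin_apply, h0, LinearMap.zero_apply]
  obtain ⟨q, hq, u', φ', hu', hφ'⟩ := exists_clear_mat (fun _ : Unit => u1) (fun _ : Unit => φ1)
  set c := algebraMap (Poly P T) (Rat' P T) q with hc
  have hc0 : c ≠ 0 := fun h0 => hq (IsFractionRing.injective _ (Rat' P T) (by rw [← hc, h0, map_zero]))
  have hu : emb (u' ()) ∈ SM (Rat' P T) (tri Dτ A) := by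
    rw [hu']; exact Submodule.smul_mem _ _ hu1
  have hφ : emb (φ' ()) ∈ SM (Rat' P T) (tri Dσ B) := by
    rw [hφ']; exact Submodule.smul_mem _ _ hφ1
  have huφ : genZ Dσ Dτ * u' () = φ' () * genY B A := by
    apply emb_injective
    rw [emb_mul, emb_mul, hu', hφ', Matrix.mul_smul, Matrix.smul_mul, huφ1]
  have huφL : emb (genZ Dσ Dτ) * emb (u' ()) = emb (φ' ()) * emb (genY B A) := by
    rw [← emb_mul, ← emb_mul, huφ]
  have hφne : emb (φ' ()) ≠ 0 := by
    rw [hφ']; exact smul_ne_zero hc0 hφ1ne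
  haveI : Infinite (Rat' P T) := Infinite.of_injective (algebraMap (Poly P T) (Rat' P T))
    (IsFractionRing.injective _ _)
  have H1 : ∀ u'' ∈ SM (Rat' P T) (tri Dτ A), ∀ φ'' ∈ SM (Rat' P T) (tri Dσ B),
      emb (genZ Dσ Dτ) * u'' = φ'' * emb (genY B A) →
      ∀ w, emb (φ' ()) *ᵥ w = 0 → ∃ x, φ'' *ᵥ w = emb (φ' ()) *ᵥ x := by
    intro u'' hu'' φ'' hφ'' h w hw
    rw [hφ', smul_mulVec, smul_eq_zero_iff_right hc0] at hw
    obtain ⟨x, hx⟩ := mulVec_mem_range_of_max_rank (φ := φ1) (ψ := φ'') (fun t =>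
      hmax (u1 + t • u'', φ1 + t • φ'') ⟨add_mem hu1 (Submodule.smul_mem _ _ hu''),
        add_mem hφ1 (Submodule.smul_mem _ _ hφ''), by
          rw [Matrix.mul_add, Matrix.add_mul, huφ1, Matrix.mul_smul, Matrix.smul_mul, h]⟩) hw
    refine ⟨c⁻¹ • x, ?_⟩
    rw [hx, hφ', smul_mulVec, mulVec_smul, smul_smul, mul_inv_cancel₀ hc0, one_smul]
  obtain ⟨D1, B', r, s, kφ⟩ := exists_kerRange hφ
  obtain ⟨D1τ, A', ρ, s', ku⟩ := exists_kerRange hu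
  refine ⟨D1, B', D1τ, A', kφ.ssubset hφne, ku.subB, kφ.subD, ku.subD,
    kφ.card_eq_range ku hY hZ huφL, kφ.card_eq_ker ku hY hZ huφL,
    kφ.card_lt ku hY hZ huφL hT H1 (mul_mem_of_deform_left hu hφ huφ)
      (mul_mem_of_deform_right hu hφ huφ), ⟨s, kφ.hs, s', ku.hs, ?_⟩, ⟨r, kφ.hr, ρ, ku.hr, ?_⟩⟩
  · refine ext_of_mulVec_single fun j => ?_
    set v := mask (Rat' P T) A' *ᵥ (Pi.single j 1) with hv
    have hvA : v ∈ coord (Rat' P T) A' := mask_mulVec_mem _ _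
    have h1 : emb (φ' ()) *ᵥ (emb (genY B A) *ᵥ (v + s' *ᵥ v)) = 0 :=
      hY.mem_ker huφL (ku.mulVec_eq_zero hvA)
    have h2 : emb (genY B A) *ᵥ (v + s' *ᵥ v) ∈ ech B' s := by
      rw [← kφ.ker]
      exact ⟨by simpa using h1, hY.mulVec_mem _⟩
    obtain ⟨w, hw, hw'⟩ := mem_ech'.1 h2
    have h3 : mask (Rat' P T) B' *ᵥ (emb (genY B A) *ᵥ (v + s' *ᵥ v)) = w := by
      rw [hw', mulVec_add, mask_mulVec_of_mem hw]
      conv_rhs => rw [← add_zero w]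
      congr 1
      ext i
      rw [mask_mulVec_apply]
      split_ifs with hi
      · exact SM_mulVec kφ.hs hw (Y := B \ B') (fun i j h _ => (mem_tri.1 h).1) i fun h =>
          (Finset.mem_sdiff.1 h).2 hi
      · rfl
    have e1 : (emb (genY B A) * ((1 + s') * mask (Rat' P T) A')) *ᵥ Pi.single j 1
        = emb (genY B A) *ᵥ (v + s' *ᵥ v) := by
      rw [← mulVec_mulVec, ← mulVec_mulVec, ← hv, add_mulVec, one_mulVec]
    rw [← mulVec_mulVec (v := Pi.single j 1) (M := 1 + s),
      ← mulVec_mulVec (v := Pi.single j 1) (M := mask _ B'), e1, h3, hw', add_mulVec,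
      one_mulVec]
  · intro v hv
    obtain ⟨x, hx⟩ := ku.exists_preimage hv
    obtain ⟨w, hw, hw'⟩ := kφ.exists_of_range (emb (genY B A) *ᵥ x)
    refine ⟨w, hw, ?_⟩
    rw [hx, mulVec_mulVec, huφL, ← mulVec_mulVec, hw']

end Destab

section SchubertPosition

variable {P T : Type*} [Fintype P] [DecidableEq P] [PartialOrder P]
  [Fintype T] [DecidableEq T] [PartialOrder T]

/-- `W` is a subspace of `coord B` in Schubert position `B'` whose preimage under `y` in `coord A`
is in Schubert position at least `A'`. -/
structure Inc (y : Matrix P T ℂ) (B : Finset P) (A : Finset T) (B' : Finset P) (A' : Finset T)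
    (W : Submodule ℂ (P → ℂ)) : Prop where
  graded : Graded W
  le : W ≤ coord ℂ B
  rank : finrank ℂ W = B'.card
  left : ∀ X : Finset P, IsLowerSet (X : Set P) →
    (B' ∩ X).card ≤ finrank ℂ (W ⊓ coord ℂ X : Submodule ℂ (P → ℂ))
  right : ∀ X : Finset T, IsLowerSet (X : Set T) →
    (A' ∩ X).card ≤
      finrank ℂ (coord ℂ (A ∩ X) ⊓ W.comap (toLin' y) : Submodule ℂ (T → ℂ))

theorem isClosed_inc [ChainPoset P] (B : Finset P) (A : Finset T) (B' : Finset P) (A' : Finset T) :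
    IsClosed {y : Matrix P T ℂ | ∃ W, Inc y B A B' A' W} := by
  have h := isClosed_incidence (P := P) (T := T) B'.card
    (ι := Option {X : Finset P // IsLowerSet (X : Set P)}) (κ := {X : Finset T // IsLowerSet (X : Set T)})
    (fun o => o.elim (coord ℂ B) fun X => coord ℂ X.1) (fun o => o.elim B'.card fun X => (B' ∩ X.1).card)
    (fun X => coord ℂ (A ∩ X.1)) (fun X => (A' ∩ X.1).card)
  convert h using 1
  ext y
  constructor
  · rintro ⟨W, hW⟩
    refine ⟨W, hW.graded, hW.rank, ?_, fun X => hW.right X.1 X.2⟩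
    rintro (_ | X)
    · show _ ≤ finrank ℂ (W ⊓ coord ℂ B : Submodule ℂ (P → ℂ))
      rw [inf_eq_left.2 hW.le]
      exact hW.rank.ge
    · exact hW.left X.1 X.2
  · rintro ⟨W, h1, h2, h3, h4⟩
    refine ⟨W, h1, ?_, h2, fun X hX => h3 (some ⟨X, hX⟩), fun X hX => h4 ⟨X, hX⟩⟩
    have h5 : B'.card ≤ finrank ℂ (W ⊓ coord ℂ B : Submodule ℂ (P → ℂ)) := h3 none
    exact inf_eq_left.1 (Submodule.eq_of_le_of_finrank_le inf_le_left (h2.trans_le h5))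

theorem inc_ech [ChainPoset P] {y : Matrix P T ℂ} {B B' : Finset P} {A A' : Finset T}
    (hB : B' ⊆ B) (hA : A' ⊆ A) {s : Matrix P P ℂ} {s' : Matrix T T ℂ} {M : Matrix P T ℂ}
    (hs : s ∈ SM ℂ (tri (B \ B') B')) (hs' : s' ∈ SM ℂ (tri (A \ A') A'))
    (h : y * ((1 + s') * mask ℂ A') = (1 + s) * (mask ℂ B' * M)) : Inc y B A B' A' (ech B' s) := by
  have hs1 : s ∈ SM ℂ (tri B'ᶜ B') := SM_mono (tri_mono (sdiff_sub_compl _ _) subset_rfl) hs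
  have hs1' : s' ∈ SM ℂ (tri A'ᶜ A') := SM_mono (tri_mono (sdiff_sub_compl _ _) subset_rfl) hs'
  refine ⟨graded_ech hs1, ?_, finrank_ech hs1, fun X hX => (finrank_ech_inf hX hs1).ge, fun X hX => ?_⟩
  · intro v hv
    obtain ⟨w, hw, rfl⟩ := mem_ech'.1 hv
    exact add_mem (coord_mono hB hw) (coord_mono Finset.sdiff_subset
      (SM_mulVec hs hw (Y := B \ B') fun i j h _ => (mem_tri.1 h).1))
  · rw [← finrank_ech_inf hX hs1']
    refine Submodule.finrank_mono fun v hv => ?_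
    obtain ⟨w, hw, hvw⟩ := mem_ech'.1 hv.1
    refine ⟨?_, ?_⟩
    · rw [← coord_inf]
      refine ⟨?_, hv.2⟩
      rw [hvw]
      exact add_mem (coord_mono hA hw) (coord_mono Finset.sdiff_subset
        (SM_mulVec hs' hw (Y := A \ A') fun i j h _ => (mem_tri.1 h).1))
    · show toLin' y v ∈ ech B' s
      have h1 := congrArg (fun N => N *ᵥ w) h
      simp only [← mulVec_mulVec] at h1
      rw [mask_mulVec_of_mem hw, add_mulVec, one_mulVec, ← hvw] at h1
      rw [toLin'_apply, h1]
      exact mem_ech'.2 ⟨mask ℂ B' *ᵥ (M *ᵥ w), mask_mulVec_mem _ _, by rw [add_mulVec, one_mulVec]⟩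

theorem mask_univ {K R : Type*} [CommRing K] [DecidableEq R] [Fintype R] :
    mask K (Finset.univ : Finset R) = 1 := by
  simp [mask]

theorem smul_one_add {K R : Type*} [Field K] [DecidableEq R] {c : K} (hc : c ≠ 0)
    (N : Matrix R R K) : c • (1 : Matrix R R K) + N = c • (1 + c⁻¹ • N) := by
  rw [smul_add, smul_smul, mul_inv_cancel₀ hc, one_smul]

theorem continuous_evm {m n : Type*} (M : Matrix m n (Poly P T)) :
    Continuous fun x => evm x M := by
  refine continuous_matrix fun i j => ?_
  exact MvPolynomial.continuous_eval _

theorem Destab.exists_inc [ChainPoset P] {Dσ B : Finset P} {Dτ A : Finset T} {D1 B' : Finset P}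
    {D1τ A' : Finset T} (h : Destab Dσ B Dτ A D1 B' D1τ A') {y : Matrix P T ℂ}
    (hy : y ∈ SM ℂ (B ×ˢ A)) : ∃ W, Inc y B A B' A' W := by
  obtain ⟨s, hs, s', hs', e⟩ := h.sub
  obtain ⟨q, hq, s'c, sc, hs'c, hsc⟩ := exists_clear_mat (fun _ : Unit => s') (fun _ : Unit => s)
  have hcl := (isClosed_inc B A B' A').preimage (continuous_evm (genY B A))
  have key : ∀ x, MvPolynomial.eval x q ≠ 0 → ∃ W, Inc (evm x (genY B A)) B A B' A' W := by
    intro x hx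
    have hs1 : emb (sc ()) ∈ SM (Rat' P T) (tri (B \ B') B') := by
      rw [hsc]; exact Submodule.smul_mem _ _ hs
    have hs1' : emb (s'c ()) ∈ SM (Rat' P T) (tri (A \ A') A') := by
      rw [hs'c]; exact Submodule.smul_mem _ _ hs'
    have hE : genY B A * (q • ((q • mask (Poly P T) (Finset.univ : Finset T) + s'c ()) * mask (Poly P T) A')) =
        (q • mask (Poly P T) (Finset.univ : Finset P) + sc ()) * (mask (Poly P T) B' * (genY B A *
          ((q • mask (Poly P T) (Finset.univ : Finset T) + s'c ()) * mask (Poly P T) A'))) := by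
      apply emb_injective
      simp only [emb_mul, emb_smul, emb_add, emb_mask, hs'c, hsc]
      rw [mask_univ, mask_univ, ← smul_add, ← smul_add]
      simp only [Matrix.smul_mul, Matrix.mul_smul]
      exact congrArg (fun z => algebraMap (Poly P T) (Rat' P T) q • algebraMap (Poly P T) (Rat' P T) q • z) e
    have hE' := congrArg (evm x) hE
    simp only [evm_mul, evm_smul, evm_add, evm_mask] at hE'
    rw [mask_univ, mask_univ] at hE'
    set c := MvPolynomial.eval x q with hc
    refine ⟨_, inc_ech h.subB.1 h.subA (s := c⁻¹ • evm x (sc ())) (s' := c⁻¹ • evm x (s'c ()))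
      (M := evm x (genY B A) * ((1 + c⁻¹ • evm x (s'c ())) * mask ℂ A'))
      (Submodule.smul_mem _ _ (evm_mem x hs1)) (Submodule.smul_mem _ _ (evm_mem x hs1')) ?_⟩
    rw [smul_one_add hx, smul_one_add hx] at hE'
    simp only [Matrix.smul_mul, Matrix.mul_smul, smul_smul] at hE'
    exact smul_right_injective _ (mul_ne_zero hx hx) hE'
  obtain ⟨x, rfl⟩ := evm_surj_genY B A hy
  have h3 : closure {x | MvPolynomial.eval x q ≠ 0} ⊆ _ := hcl.closure_subset_iff.2 key
  rw [(dense_eval_ne_zero hq).closure_eq] at h3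
  exact h3 (Set.mem_univ x)

end SchubertPosition

section Dominance

variable {P T : Type*} [Fintype P] [DecidableEq P] [PartialOrder P]

open Classical in
/-- The lower set of elements that are not above `d`. -/
noncomputable def lowSet (d : P) : Finset P := Finset.univ.filter fun x => ¬ d ≤ x

theorem mem_lowSet {d x : P} : x ∈ lowSet d ↔ ¬ d ≤ x := by simp [lowSet]

theorem isLowerSet_lowSet (d : P) : IsLowerSet (lowSet d : Set P) := by
  intro a b hba ha
  simp only [Finset.mem_coe, mem_lowSet] at *
  exact fun h => ha (h.trans hba)

theorem card_tri_add (D B : Finset P) :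
    (tri D B).card + ∑ d ∈ D, (B ∩ lowSet d).card = D.card * B.card := by
  classical
  have h1 : (tri D B).card = ∑ d ∈ D, (B.filter fun x => d ≤ x).card := by
    have : tri D B = (D.sigma (fun d => B.filter fun x => d ≤ x)).map
        (Equiv.sigmaEquivProd P P).toEmbedding := by
      ext ⟨i, j⟩
      simp [mem_tri]
    rw [this, Finset.card_map, Finset.card_sigma]
  rw [h1, ← Finset.sum_add_distrib, ← smul_eq_mul, ← Finset.sum_const]
  refine Finset.sum_congr rfl fun d _ => ?_
  rw [← Finset.card_filter_add_card_filter_not (s := B) (fun x => d ≤ x)]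
  congr 2
  ext x
  simp [mem_lowSet]

theorem card_tri_le {D B B' : Finset P} (h : B.card = B'.card)
    (h' : ∀ X : Finset P, IsLowerSet (X : Set P) → (B' ∩ X).card ≤ (B ∩ X).card) :
    (tri D B).card ≤ (tri D B').card := by
  have h1 := card_tri_add D B
  have h2 := card_tri_add D B'
  have h3 : ∑ d ∈ D, (B' ∩ lowSet d).card ≤ ∑ d ∈ D, (B ∩ lowSet d).card :=
    Finset.sum_le_sum fun d _ => h' _ (isLowerSet_lowSet d)
  rw [h] at h1
  omega

variable [Fintype T] [DecidableEq T]

theorem transMap_mem_SM {K : Type*} [Field K] [PartialOrder T] {y z : Matrix P T K} {Dσ B : Finset P}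
    {Dτ A : Finset T} (hy : y ∈ SM K (B ×ˢ A)) (hz : z ∈ SM K (Dσ ×ˢ Dτ)) {u : Matrix T T K}
    {φ : Matrix P P K} (hu : u ∈ SM K (tri Dτ A)) (hφ : φ ∈ SM K (tri Dσ B)) :
    z * u - φ * y ∈ SM K (Dσ ×ˢ A) := by
  refine sub_mem (SM_mul hz hu fun i j k h1 h2 => ?_) (SM_mul hφ hy fun i j k h1 h2 => ?_)
  · exact Finset.mem_product.2 ⟨(Finset.mem_product.1 h1).1, (mem_tri.1 h2).2.1⟩
  · exact Finset.mem_product.2 ⟨(mem_tri.1 h1).1, (Finset.mem_product.1 h2).2⟩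

/-- If the transversality map is injective but not surjective, then a dimension count. -/
theorem card_lt_of_not_trans {K : Type*} [Field K] [PartialOrder T] {y z : Matrix P T K}
    {Dσ B : Finset P} {Dτ A : Finset T} (hy : y ∈ SM K (B ×ˢ A)) (hz : z ∈ SM K (Dσ ×ˢ Dτ))
    (hinj : ∀ u ∈ SM K (tri Dτ A), ∀ φ ∈ SM K (tri Dσ B), z * u = φ * y → u = 0 ∧ φ = 0)
    (hT : ¬ Trans y z Dσ B Dτ A) :
    (tri Dτ A).card + (tri Dσ B).card < Dσ.card * A.card := by
  set S := (SM K (tri Dτ A)).prod (SM K (tri Dσ B)) with hS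
  have h1 : finrank K (S.map (transMap y z)) = (tri Dτ A).card + (tri Dσ B).card := by
    have h := finrank_map_add_inf_ker (transMap y z) S
    have h0 : LinearMap.ker (transMap y z) ⊓ S = ⊥ := by
      rw [eq_bot_iff]
      rintro ⟨u, φ⟩ ⟨h1, h2⟩
      rw [SetLike.mem_coe, LinearMap.mem_ker, transMap_apply, sub_eq_zero] at h1
      obtain ⟨rfl, rfl⟩ := hinj u h2.1 φ h2.2 h1
      rfl
    have h0' : S ⊓ LinearMap.ker (transMap y z) = ⊥ := by rw [inf_comm, h0]
    rw [hS, finrank_submodule_prod, finrank_SM, finrank_SM, ← hS] at h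
    rwa [h0', finrank_bot, add_zero] at h
  have hle : S.map (transMap y z) ≤ SM K (Dσ ×ˢ A) := by
    rintro _ ⟨⟨u, φ⟩, ⟨h1, h2⟩, rfl⟩
    rw [transMap_apply]
    exact transMap_mem_SM hy hz h1 h2
  have hlt : S.map (transMap y z) < SM K (Dσ ×ˢ A) := by
    refine lt_of_le_of_ne hle fun he => hT fun h hh => ?_
    rw [← he] at hh
    obtain ⟨⟨u, φ⟩, ⟨h1, h2⟩, h3⟩ := hh
    exact ⟨u, h1, φ, h2, h3⟩
  have := Submodule.finrank_lt_finrank_of_lt hlt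
  rwa [h1, finrank_SM, Finset.card_product] at this

/-- `W` violates the numerical semistability condition attached to `(Dσ, Dτ)`. -/
def Violates [PartialOrder T] (y : Matrix P T ℂ) (Dσ : Finset P) (Dτ A : Finset T)
    (W : Submodule ℂ (P → ℂ)) : Prop :=
  Dσ.card * finrank ℂ W <
    ∑ d ∈ Dτ, finrank ℂ (coord ℂ (A ∩ lowSet d) ⊓ W.comap (toLin' y) :
      Submodule ℂ (T → ℂ)) +
    ∑ d ∈ Dσ, finrank ℂ (W ⊓ coord ℂ (lowSet d) : Submodule ℂ (P → ℂ))

theorem violates_coord [PartialOrder T] {y : Matrix P T ℂ} {Dσ B : Finset P} {Dτ A : Finset T}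
    (hy : y ∈ SM ℂ (B ×ˢ A)) (hBA : B.card = A.card) (hD : Dσ.card = Dτ.card)
    (h : (tri Dτ A).card + (tri Dσ B).card < Dσ.card * A.card) :
    Violates y Dσ Dτ A (coord ℂ B) := by
  have h1 := card_tri_add Dτ A
  have h2 := card_tri_add Dσ B
  have h3 : ∀ d : T, finrank ℂ (coord ℂ (A ∩ lowSet d) ⊓ (coord ℂ B).comap (toLin' y) :
      Submodule ℂ (T → ℂ)) = (A ∩ lowSet d).card := fun d => by
    rw [inf_eq_left.2, finrank_coord]
    intro v _
    rw [Submodule.mem_comap, toLin'_apply]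
    exact SM_mulVec hy (X := Finset.univ) (by simp [coord_univ])
      fun i j h _ => (Finset.mem_product.1 h).1
  have h4 : ∀ d : P, finrank ℂ (coord ℂ B ⊓ coord ℂ (lowSet d) : Submodule ℂ (P → ℂ)) =
      (B ∩ lowSet d).card := fun d => by rw [coord_inf, finrank_coord]
  simp only [Violates, h3, h4, finrank_coord]
  rw [hBA] at h2 ⊢
  rw [← hD] at h1
  omega

theorem inter_le_finrank_ech {W : Submodule ℂ (P → ℂ)} {B'' : Finset P} {φ : Matrix P P ℂ}
    (hφ : φ ∈ SM ℂ (tri B''ᶜ B'')) {X : Finset P} (hX : IsLowerSet (X : Set P))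
    (hW : W = ech B'' φ) {k : ℕ} (h : k ≤ finrank ℂ (W ⊓ coord ℂ X : Submodule ℂ (P → ℂ))) :
    k ≤ (B'' ∩ X).card := by
  rwa [hW, finrank_ech_inf hX hφ] at h

theorem violates_transport [PartialOrder T] [ChainPoset P] {y y' : Matrix P T ℂ} {Dσ B B' : Finset P}
    {Dτ A A' : Finset T} (hB : B' ⊆ B) (hA : A' ⊆ A) {φ : Matrix P P ℂ} {u : Matrix T T ℂ}
    (hφ : φ ∈ SM ℂ (tri (B \ B') B')) (hu : u ∈ SM ℂ (tri (A \ A') A'))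
    (hy : ∀ v ∈ coord ℂ A', y *ᵥ ((1 + u) *ᵥ v) = (1 + φ) *ᵥ (y' *ᵥ v))
    {W : Submodule ℂ (P → ℂ)} (hW : W ≤ coord ℂ B') (hV : Violates y' Dσ Dτ A' W) :
    W.map (toLin' (1 + φ)) ≤ coord ℂ B ∧
      Violates y Dσ Dτ A (W.map (toLin' (1 + φ))) := by
  have hφ1 : φ ∈ SM ℂ (tri B'ᶜ B') := SM_mono (tri_mono (sdiff_sub_compl _ _) subset_rfl) hφ
  have hu1 : u ∈ SM ℂ (tri A'ᶜ A') := SM_mono (tri_mono (sdiff_sub_compl _ _) subset_rfl) hu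
  have hi := one_add_injective disjoint_compl_left hφ1
  have hiu := one_add_injective disjoint_compl_left hu1
  refine ⟨?_, ?_⟩
  · rintro _ ⟨w, hw, rfl⟩
    rw [toLin'_apply, add_mulVec, one_mulVec]
    exact add_mem (coord_mono hB (hW hw)) (coord_mono Finset.sdiff_subset
      (SM_mulVec hφ (hW hw) (Y := B \ B') fun i j h _ => (mem_tri.1 h).1))
  · rw [Violates, finrank_map_of_injective _ hi]
    refine lt_of_lt_of_le hV (add_le_add (Finset.sum_le_sum fun d _ => ?_)
      (Finset.sum_le_sum fun d _ => ?_))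
    · rw [← finrank_map_of_injective _ hiu]
      refine Submodule.finrank_mono ?_
      rintro _ ⟨v, ⟨hv1, hv2⟩, rfl⟩
      rw [← coord_inf] at hv1
      refine ⟨?_, ?_⟩
      · rw [← coord_inf, toLin'_apply, add_mulVec, one_mulVec]
        refine add_mem ⟨coord_mono hA hv1.1, hv1.2⟩ ⟨coord_mono Finset.sdiff_subset
          (SM_mulVec hu hv1.1 (Y := A \ A') fun i j h _ => (mem_tri.1 h).1), ?_⟩
        exact tri_mulVec_mem (isLowerSet_lowSet d) hu hv1.2
      · refine ⟨y' *ᵥ v, hv2, ?_⟩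
        rw [toLin'_apply, toLin'_apply, toLin'_apply, hy v hv1.1]
    · rw [← finrank_map_of_injective _ hi]
      refine Submodule.finrank_mono ?_
      rintro _ ⟨v, ⟨hv1, hv2⟩, rfl⟩
      refine ⟨⟨v, hv1, rfl⟩, ?_⟩
      rw [toLin'_apply, add_mulVec, one_mulVec]
      exact add_mem hv2 (tri_mulVec_mem (isLowerSet_lowSet d) hφ hv2)

theorem Destab.violates {T : Type*} [Fintype T] [LinearOrder T] [ChainPoset P] {Dσ B : Finset P}
    {Dτ A : Finset T} {D1 B' : Finset P} {D1τ A' : Finset T} (h : Destab Dσ B Dτ A D1 B' D1τ A')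
    (ih : ∀ (B'' : Finset P) (A'' : Finset T), B''.card < B.card → B''.card = A''.card →
      ¬ Trans (emb (genY B'' A'')) (emb (genZ Dσ Dτ)) Dσ B'' Dτ A'' →
      ∀ y ∈ SM ℂ (B'' ×ˢ A''), (∀ v ∈ coord ℂ A'', y *ᵥ v = 0 → v = 0) →
        ∃ W, Graded W ∧ W ≤ coord ℂ B'' ∧ Violates y Dσ Dτ A'' W)
    {y : Matrix P T ℂ} (hy : y ∈ SM ℂ (B ×ˢ A)) (hinj : ∀ v ∈ coord ℂ A, y *ᵥ v = 0 → v = 0) :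
    ∃ W, Graded W ∧ W ≤ coord ℂ B ∧ Violates y Dσ Dτ A W := by
  obtain ⟨W0, hW0⟩ := h.exists_inc hy
  obtain ⟨B'', φ, hφ1, hWφ, hφB⟩ := exists_ech W0 hW0.graded
  obtain ⟨hB'', hφ⟩ := hφB B hW0.le
  have hcB : B''.card = B'.card := by rw [← finrank_ech hφ1, ← hWφ, hW0.rank]
  set V0 := coord ℂ A ⊓ W0.comap (toLin' y) with hV0
  obtain ⟨A'', u, hu1, hVu, huA⟩ := exists_ech V0 (graded_of_linear V0)
  obtain ⟨hA'', hu⟩ := huA A inf_le_left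
  have hcA : A''.card = A'.card := by
    apply le_antisymm
    · rw [← finrank_ech hu1, ← hVu, ← h.cardB, ← hW0.rank]
      let f : V0 →ₗ[ℂ] W0 := ((toLin' y).restrict fun v hv => hv.2)
      refine LinearMap.finrank_le_finrank_of_injective (f := f) ?_
      rw [← LinearMap.ker_eq_bot, eq_bot_iff]
      intro v hv
      have h1 : y *ᵥ (v : T → ℂ) = 0 := congrArg Subtype.val (LinearMap.mem_ker.1 hv)
      exact (Submodule.mk_eq_zero _ _).2 (hinj _ v.2.1 h1)
    · have h1 := hW0.right Finset.univ (by simp [isLowerSet_univ])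
      rw [Finset.inter_univ, Finset.inter_univ, ← hV0, hVu, finrank_ech hu1] at h1
      exact h1
  have hleft : ∀ X : Finset P, IsLowerSet (X : Set P) → (B' ∩ X).card ≤ (B'' ∩ X).card :=
    fun X hX => inter_le_finrank_ech hφ1 hX hWφ (hW0.left X hX)
  have hright : ∀ X : Finset T, IsLowerSet (X : Set T) → (A' ∩ X).card ≤ (A'' ∩ X).card := by
    intro X hX
    refine inter_le_finrank_ech hu1 hX hVu ((hW0.right X hX).trans_eq ?_)
    rw [← coord_inf, hV0, inf_right_comm]
  have hφ2 : φ * φ = 0 := tri_mul_self disjoint_compl_left hφ1 hφ1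
  let y' := (1 - φ) * (y * ((1 + u) * mask ℂ A''))
  have hmem : ∀ w, ∃ v ∈ coord ℂ B'', y *ᵥ ((1 + u) *ᵥ (mask ℂ A'' *ᵥ w)) = v + φ *ᵥ v := by
    intro w
    have h1 : (1 + u) *ᵥ (mask ℂ A'' *ᵥ w) ∈ V0 := by
      rw [hVu]
      exact mem_ech'.2 ⟨_, mask_mulVec_mem A'' w, by rw [add_mulVec, one_mulVec]⟩
    have h2 : y *ᵥ ((1 + u) *ᵥ (mask ℂ A'' *ᵥ w)) ∈ W0 := h1.2
    rw [hWφ] at h2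
    exact mem_ech'.1 h2
  have hy'v : ∀ w, ∃ v ∈ coord ℂ B'', y *ᵥ ((1 + u) *ᵥ (mask ℂ A'' *ᵥ w)) = (1 + φ) *ᵥ v ∧
      y' *ᵥ w = v := by
    intro w
    obtain ⟨v, hv, e⟩ := hmem w
    have e' : y *ᵥ ((1 + u) *ᵥ (mask ℂ A'' *ᵥ w)) = (1 + φ) *ᵥ v := by
      rw [e, add_mulVec, one_mulVec]
    refine ⟨v, hv, e', ?_⟩
    simp only [y', ← mulVec_mulVec]
    rw [e', mulVec_mulVec, one_sub_mul_one_add hφ2, one_mulVec]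
  have hy' : y' ∈ SM ℂ (B'' ×ˢ A'') := by
    intro i j hij
    by_cases hj : j ∈ A''
    · have hi : i ∉ B'' := fun hi => hij (Finset.mem_product.2 ⟨hi, hj⟩)
      obtain ⟨v, hv, -, e⟩ := hy'v (Pi.single j 1)
      rw [mulVec_single_one] at e
      have := hv i hi
      rw [← e] at this
      exact this
    · simp only [y']
      rw [← Matrix.mul_assoc, ← Matrix.mul_assoc, mul_mask_apply, if_neg hj]
  have hyy : ∀ v ∈ coord ℂ A'', y *ᵥ ((1 + u) *ᵥ v) = (1 + φ) *ᵥ (y' *ᵥ v) := by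
    intro v hv
    obtain ⟨v', -, e1, e2⟩ := hy'v v
    rw [mask_mulVec_of_mem hv] at e1
    rw [e1, e2]
  have hinj' : ∀ v ∈ coord ℂ A'', y' *ᵥ v = 0 → v = 0 := by
    intro v hv h0
    have h1 := hyy v hv
    rw [h0, mulVec_zero] at h1
    have h2 : (1 + u) *ᵥ v ∈ V0 := by
      rw [hVu]
      exact mem_ech'.2 ⟨v, hv, by rw [add_mulVec, one_mulVec]⟩
    have h3 := hinj _ h2.1 h1
    refine one_add_injective disjoint_compl_left hu1 ?_
    rw [map_zero, toLin'_apply, h3]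
  have hnT : ¬ Trans (emb (genY B'' A'')) (emb (genZ Dσ Dτ)) Dσ B'' Dτ A'' := by
    intro hT
    obtain ⟨r, hr, ρ, hρ, hz⟩ := h.quot
    have h1 := hT.project h.subD h.subDτ hr hρ hz
    have h2 := card_tri_le (D := Dσ \ D1) hcB hleft
    have h3 := card_tri_le (D := Dτ \ D1τ) hcA hright
    have h4 := h.lt
    rw [hcA] at h1
    omega
  obtain ⟨W1, hg, hle, hv⟩ := ih B'' A'' (hcB.trans_lt (Finset.card_lt_card h.subB))
    (by rw [hcB, hcA, h.cardB]) hnT y' hy' hinj'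
  obtain ⟨h1, h2⟩ := violates_transport hB'' hA'' hφ hu hyy hle hv
  exact ⟨_, hg.map (gradedMat_one.add (gradedMat_of_tri hφ)), h1, h2⟩

theorem exists_violates_of_not_trans {T : Type*} [Fintype T] [LinearOrder T] [ChainPoset P]
    {Dσ : Finset P} {Dτ : Finset T} (hD : Dσ.card = Dτ.card) (n : ℕ) :
    ∀ (B : Finset P) (A : Finset T), B.card = n → B.card = A.card →
      ¬ Trans (emb (genY B A)) (emb (genZ Dσ Dτ)) Dσ B Dτ A →
      ∀ y ∈ SM ℂ (B ×ˢ A), (∀ v ∈ coord ℂ A, y *ᵥ v = 0 → v = 0) →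
        ∃ W, Graded W ∧ W ≤ coord ℂ B ∧ Violates y Dσ Dτ A W := by
  induction n using Nat.strong_induction_on with
  | _ n ih =>
    intro B A hB hBA hT y hy hinj
    by_cases hk : ∀ u ∈ SM (Rat' P T) (tri Dτ A), ∀ φ ∈ SM (Rat' P T) (tri Dσ B),
      emb (genZ Dσ Dτ) * u = φ * emb (genY B A) → φ = 0
    · refine ⟨coord ℂ B, graded_coord B, le_rfl, violates_coord hy hBA hD
        (card_lt_of_not_trans (emb_genY_mem B A) (emb_genZ_mem Dσ Dτ) ?_ hT)⟩
      intro u hu φ hφ e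
      have h0 := hk u hu φ hφ e
      refine ⟨?_, h0⟩
      obtain ⟨Zi, hZ⟩ := exists_partialInv hD (emb_genZ_mem Dσ Dτ) fun y hy => by
        refine ⟨Sum.elim 0 (fun p => y p.1 p.2), ?_⟩
        ext i j
        simp only [evm, genZ, Matrix.map_apply, Matrix.of_apply]
        split_ifs with h
        · simp
        · simp [hy i j h]
      have h1 : Zi * (emb (genZ Dσ Dτ) * u) = 0 := by rw [e, h0, Matrix.zero_mul, Matrix.mul_zero]
      rw [← Matrix.mul_assoc, hZ.left] at h1
      rw [← h1, eq_comm]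
      exact mask_mul_of_mem hu fun i j h => (mem_tri.1 h).1
    · push Not at hk
      obtain ⟨u0, hu0, φ0, hφ0, e, hne⟩ := hk
      obtain ⟨D1, B', D1τ, A', hd⟩ := exists_destab hBA hD hT hu0 hφ0 e hne
      exact hd.violates (fun B'' A'' h1 h2 h3 => ih _ (hB ▸ h1) B'' A'' rfl h2 h3) hy hinj

end Dominance

section Dominant

open PrimeSpectrum in
/-- A constructible set containing the generic point of a domain contains a nonempty basic open. -/
theorem exists_basicOpen_subset {A : Type*} [CommRing A] [IsDomain A] {s : Set (PrimeSpectrum A)}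
    (hs : Topology.IsConstructible s) (h0 : (⊥ : PrimeSpectrum A) ∈ s) :
    ∃ f : A, f ≠ 0 ∧ ∀ x : PrimeSpectrum A, f ∉ x.asIdeal → x ∈ s := by
  obtain ⟨S, rfl⟩ := exists_constructibleSetData_iff.2 hs
  simp only [ConstructibleSetData.toSet, Set.mem_iUnion, BasicConstructibleSetData.toSet] at h0 ⊢
  obtain ⟨C, hC, h1, h2⟩ := h0
  refine ⟨C.f, fun hf => h2 (by simp [hf]), fun x hx => ⟨C, hC, ?_, by simpa using hx⟩⟩
  have hg : Set.range C.g ⊆ {0} := by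
    intro a ha
    have := h1 ha
    simpa using this
  intro a ha
  rw [hg ha]
  exact zero_mem _

theorem dense_range_of_open {σ τ : Type*} [Fintype σ] [Fintype τ] (F : τ → MvPolynomial σ ℂ)
    {U : Set (τ → ℂ)} (hU : IsOpen U) (hne : U.Nonempty)
    (h : ∀ y ∈ U, ∃ x, ∀ t, MvPolynomial.eval x (F t) = y t) :
    Dense (Set.range fun (x : σ → ℂ) t => MvPolynomial.eval x (F t)) := by
  let f : MvPolynomial τ ℂ →+* MvPolynomial σ ℂ := (MvPolynomial.aeval F).toRingHom
  have hfe : ∀ (x : σ → ℂ) q, MvPolynomial.eval x (f q) =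
      MvPolynomial.eval (fun t => MvPolynomial.eval x (F t)) q := by
    intro x q
    induction q using MvPolynomial.induction_on with
    | C a => simp [f]
    | add p q hp hq => rw [map_add, map_add, hp, hq, map_add]
    | mul_X p i hp => rw [map_mul, map_mul, hp, map_mul]; simp [f]
  have hinj : Function.Injective f := by
    rw [injective_iff_map_eq_zero]
    intro q hq
    refine eq_zero_of_eval_eq_zero_on_open hU hne fun y hy => ?_
    obtain ⟨x, hx⟩ := h y hy
    rw [← funext hx, ← hfe, hq, map_zero]
  have hfp : f.FinitePresentation := by
    refine RingHom.FinitePresentation.of_comp_finiteType (algebraMap ℂ (MvPolynomial τ ℂ))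
      (g := f) ?_ ?_
    · have : f.comp (algebraMap ℂ (MvPolynomial τ ℂ)) = algebraMap ℂ (MvPolynomial σ ℂ) := by
        ext x; simp [f]
      rw [this, RingHom.finitePresentation_algebraMap]
      infer_instance
    · rw [RingHom.finiteType_algebraMap]
      infer_instance
  have hcon := PrimeSpectrum.isConstructible_range_comap hfp
  have h0 : (⊥ : PrimeSpectrum (MvPolynomial τ ℂ)) ∈ Set.range (PrimeSpectrum.comap f) := by
    refine ⟨⊥, ?_⟩
    ext q
    simp [PrimeSpectrum.comap_asIdeal, map_eq_zero_iff f hinj]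
  obtain ⟨p, hp, hpS⟩ := exists_basicOpen_subset hcon h0
  refine (dense_eval_ne_zero hp).mono fun y hy => ?_
  let m := MvPolynomial.vanishingIdeal ℂ ({y} : Set (τ → ℂ))
  have hm : m.IsMaximal := MvPolynomial.isMaximal_iff_eq_vanishingIdeal_singleton.2 ⟨y, rfl⟩
  have hmem : ∀ q, q ∈ m ↔ MvPolynomial.eval y q = 0 := by
    intro q
    simp [m, MvPolynomial.mem_vanishingIdeal_singleton_iff, MvPolynomial.aeval_eq_eval]
  obtain ⟨Q, hQ⟩ := hpS ⟨m, hm.isPrime⟩ fun hpm => hy ((hmem p).1 hpm)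
  obtain ⟨N, hN, hQN⟩ := Ideal.exists_le_maximal Q.asIdeal Q.isPrime.ne_top
  obtain ⟨x, rfl⟩ := MvPolynomial.isMaximal_iff_eq_vanishingIdeal_singleton.1 hN
  refine ⟨x, funext fun t => ?_⟩
  have h1 : MvPolynomial.X t - MvPolynomial.C (y t) ∈ m := (hmem _).2 (by simp)
  have h2 : MvPolynomial.X t - MvPolynomial.C (y t) ∈ (PrimeSpectrum.comap f Q).asIdeal := by
    rw [hQ]; exact h1
  have h3 := hQN h2
  rw [MvPolynomial.mem_vanishingIdeal_singleton_iff] at h3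
  have h4 : MvPolynomial.eval x (f (MvPolynomial.X t - MvPolynomial.C (y t))) = 0 := by
    simpa [MvPolynomial.aeval_eq_eval] using h3
  rw [hfe] at h4
  simpa [sub_eq_zero] using h4

end Dominant

section Jacobian

variable {P T : Type*} [Fintype P] [DecidableEq P] [PartialOrder P]
  [Fintype T] [DecidableEq T] [PartialOrder T]

/-- The variables of the parametrization of rectangular matrices in a given Schubert position. -/
abbrev ParIdx (P T : Type*) := (P × P) ⊕ (T × T) ⊕ (P × T)

/-- Substitution of the variables selected by `S` for the entries of a matrix. -/
noncomputable def genMat {σ m n : Type*} (S : Finset (m × n)) (ι : m × n → σ) :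
    Matrix m n (MvPolynomial σ ℂ) :=
  open Classical in Matrix.of fun i j => if (i, j) ∈ S then MvPolynomial.X (ι (i, j)) else 0

/-- The values of `genMat`. -/
noncomputable def parMat {σ m n : Type*} (S : Finset (m × n)) (ι : m × n → σ) (x : σ → ℂ) :
    Matrix m n ℂ :=
  open Classical in Matrix.of fun i j => if (i, j) ∈ S then x (ι (i, j)) else 0

theorem parMat_mem {σ m n : Type*} (S : Finset (m × n)) (ι : m × n → σ) (x : σ → ℂ) :
    parMat S ι x ∈ SM ℂ S := by
  intro i j h
  simp [parMat, h]

theorem genMat_map {σ m n : Type*} (S : Finset (m × n)) (ι : m × n → σ) (x : σ → ℂ) :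
    (genMat S ι).map (MvPolynomial.eval x) = parMat S ι x := by
  refine Matrix.ext fun i j => ?_
  simp only [genMat, parMat, Matrix.map_apply, Matrix.of_apply]
  split_ifs <;> simp

/-- The polynomial matrix `(1 + φ) g (1 - u)`. -/
noncomputable def parPoly (B : Finset P) (A : Finset T) : Matrix P T (MvPolynomial (ParIdx P T) ℂ) :=
  (1 + genMat (σ := ParIdx P T) (tri Bᶜ B) Sum.inl) * genMat (σ := ParIdx P T) (Bᶜ ×ˢ A)ᶜ (Sum.inr ∘ Sum.inr) *
    (1 - genMat (σ := ParIdx P T) (tri Aᶜ A) (Sum.inr ∘ Sum.inl))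

theorem parPoly_eval (B : Finset P) (A : Finset T) (x : ParIdx P T → ℂ) (i : P) (j : T) :
    MvPolynomial.eval x (parPoly B A i j) =
      ((1 + parMat (σ := ParIdx P T) (tri Bᶜ B) Sum.inl x) * parMat (σ := ParIdx P T) (Bᶜ ×ˢ A)ᶜ (Sum.inr ∘ Sum.inr) x *
        (1 - parMat (σ := ParIdx P T) (tri Aᶜ A) (Sum.inr ∘ Sum.inl) x) : Matrix P T ℂ) i j := by
  have : (parPoly B A).map (MvPolynomial.eval x) =
      ((1 + parMat (σ := ParIdx P T) (tri Bᶜ B) Sum.inl x) * parMat (σ := ParIdx P T) (Bᶜ ×ˢ A)ᶜ (Sum.inr ∘ Sum.inr) x *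
        (1 - parMat (σ := ParIdx P T) (tri Aᶜ A) (Sum.inr ∘ Sum.inl) x)) := by
    rw [parPoly, Matrix.map_mul, Matrix.map_mul, Matrix.map_add _ (map_add _),
      Matrix.map_sub _ (map_sub _), genMat_map, genMat_map, genMat_map,
      Matrix.map_one _ (map_zero _) (map_one _), Matrix.map_one _ (map_zero _) (map_one _)]
  rw [← this, Matrix.map_apply]

/-- A matrix in the image of the parametrization is incident to an echelon subspace. -/
theorem inc_of_par [ChainPoset P] {B : Finset P} {A : Finset T} {φ : Matrix P P ℂ} {u : Matrix T T ℂ}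
    {g : Matrix P T ℂ} (hφ : φ ∈ SM ℂ (tri Bᶜ B)) (hu : u ∈ SM ℂ (tri Aᶜ A))
    (hg : g ∈ SM ℂ (Bᶜ ×ˢ A)ᶜ) :
    Inc ((1 + φ) * g * (1 - u)) Finset.univ Finset.univ B A (ech B φ) := by
  refine inc_ech (M := g * mask ℂ A) (s' := u) (Finset.subset_univ _) (Finset.subset_univ _) ?_ ?_ ?_
  · rwa [← Finset.compl_eq_univ_sdiff]
  · rwa [← Finset.compl_eq_univ_sdiff]
  · have h1 : (1 - u) * (1 + u) = 1 := one_sub_mul_one_add (tri_mul_self (disjoint_compl_left' A) hu hu)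
    have h2 : mask ℂ B * (g * mask ℂ A) = g * mask ℂ A := by
      refine mask_mul_of_mem (S := B ×ˢ A) ?_ fun i j h => (Finset.mem_product.1 h).1
      refine mem_SM_of fun i j h => ?_
      rw [mul_mask_apply] at h
      by_cases hj : j ∈ A
      · rw [if_pos hj] at h
        have := SM_ne hg h
        simp only [Finset.mem_compl, Finset.mem_product, not_and] at this
        by_contra hc
        simp only [Finset.mem_product, not_and] at hc
        exact this (fun hi => hc hi hj) hj
      · rw [if_neg hj] at h
        exact absurd rfl h
    rw [h2, ← Matrix.mul_assoc, Matrix.mul_assoc _ (1 - u), h1, Matrix.mul_one, Matrix.mul_assoc]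

theorem parPoly_surj {B : Finset P} {A : Finset T} {y z : Matrix P T ℂ} (hy : y ∈ SM ℂ (B ×ˢ A))
    (hz : z ∈ SM ℂ (Bᶜ ×ˢ Aᶜ)) (h : Trans y z Bᶜ B Aᶜ A) (H : Matrix P T ℂ) :
    ∃ φ ∈ SM ℂ (tri Bᶜ B), ∃ u ∈ SM ℂ (tri Aᶜ A), ∃ k ∈ SM ℂ (Bᶜ ×ˢ A)ᶜ,
      φ * (y + z) + k - (y + z) * u = H := by
  obtain ⟨u, hu, φ, hφ, huφ⟩ := h (-(mask ℂ Bᶜ * H * mask ℂ A)) (mem_SM_of fun i j hij => by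
    rw [Matrix.neg_apply, mul_mask_apply, mask_mul_apply] at hij
    by_contra hc
    refine hij ?_
    rw [Finset.mem_product, not_and_or] at hc
    rcases hc with hc | hc <;> simp [hc])
  have h1 : φ * z = 0 := SM_mul_eq_zero hφ hz fun i j k h h' => by
    have := (mem_tri.1 h).2.1
    have := (Finset.mem_product.1 h').1
    simp_all
  have h2 : y * u = 0 := SM_mul_eq_zero hy hu fun i j k h h' => by
    have := (mem_tri.1 h').1
    have := (Finset.mem_product.1 h).2
    simp_all
  refine ⟨φ, hφ, u, hu, H - φ * (y + z) + (y + z) * u, ?_, by abel⟩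
  have h3 : H - φ * (y + z) + (y + z) * u = H - mask ℂ Bᶜ * H * mask ℂ A := by
    rw [Matrix.mul_add, Matrix.add_mul, h1, h2, sub_eq_add_neg H (_ * _ * _), ← huφ]
    abel
  rw [h3]
  intro i j hij
  simp only [Finset.mem_compl, not_not, Finset.mem_product] at hij
  rw [Matrix.sub_apply, mul_mask_apply, mask_mul_apply]
  simp [hij.1, hij.2]

theorem hasDerivAt_cubic (a b c d : ℂ) :
    HasDerivAt (fun t : ℂ => a + t * b + t ^ 2 * c + t ^ 3 * d) b 0 := by
  have h1 := ((hasDerivAt_id (0 : ℂ)).mul_const b).const_add a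
  have h2 := ((hasDerivAt_id (0 : ℂ)).pow 2).mul_const c
  have h3 := ((hasDerivAt_id (0 : ℂ)).pow 3).mul_const d
  have := (h1.add h2).add h3
  simp only [id, one_mul, Nat.cast_ofNat, ne_eq, OfNat.ofNat_ne_zero, not_false_eq_true,
    Nat.add_one_sub_one, zero_pow, mul_zero, zero_mul, add_zero, mul_one, pow_one] at this
  exact this

theorem parMat_line {σ m n : Type*} (S : Finset (m × n)) (ι : m × n → σ) (x v : σ → ℂ) (t : ℂ) :
    parMat S ι (x + t • v) = parMat S ι x + t • parMat S ι v := by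
  refine Matrix.ext fun i j => ?_
  simp only [parMat, Matrix.add_apply, Matrix.smul_apply, Matrix.of_apply]
  split_ifs <;> simp

theorem parMat_eq {σ m n : Type*} {S : Finset (m × n)} {ι : m × n → σ} {x : σ → ℂ} {M : Matrix m n ℂ}
    (hM : M ∈ SM ℂ S) (h : ∀ p, x (ι p) = M p.1 p.2) : parMat S ι x = M := by
  refine Matrix.ext fun i j => ?_
  simp only [parMat, Matrix.of_apply]
  split_ifs with hij
  · exact h _
  · exact (hM i j hij).symm

theorem exists_inc_of_trans [ChainPoset P] {B : Finset P} {A : Finset T} {y z : Matrix P T ℂ}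
    (hy : y ∈ SM ℂ (B ×ˢ A)) (hz : z ∈ SM ℂ (Bᶜ ×ˢ Aᶜ)) (h : Trans y z Bᶜ B Aᶜ A)
    (g : Matrix P T ℂ) : ∃ W, Inc g Finset.univ Finset.univ B A W := by
  let F : P × T → MvPolynomial (ParIdx P T) ℂ := fun p => parPoly B A p.1 p.2
  let Ψ : (ParIdx P T → ℂ) → (P × T → ℂ) := fun x p => MvPolynomial.eval x (F p)
  let x0 : ParIdx P T → ℂ := Sum.elim 0 (Sum.elim 0 fun p => (y + z) p.1 p.2)
  have hw : y + z ∈ SM ℂ (Bᶜ ×ˢ A)ᶜ := by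
    refine add_mem (SM_mono ?_ hy) (SM_mono ?_ hz) <;> intro p hp <;>
      simp only [Finset.mem_compl, Finset.mem_product] at hp ⊢ <;> tauto
  have hdiff : ContDiff ℂ 1 Ψ := by
    rw [contDiff_pi]
    intro p
    exact (AnalyticOnNhd.aeval_mvPolynomial (𝕜 := ℂ) (A := ℂ) (s := Set.univ)
      (f := fun (x : ParIdx P T → ℂ) => x) (by
        intro i; exact (ContinuousLinearMap.proj (R := ℂ) (φ := fun _ : ParIdx P T => ℂ) i).analyticOnNhd _) (F p)).contDiff
  have hst := hdiff.hasStrictFDerivAt (x := x0) one_ne_zero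
  have hsurj : Function.Surjective (fderiv ℂ Ψ x0) := by
    intro H
    obtain ⟨φ, hφ, u, hu, k, hk, hH⟩ := parPoly_surj hy hz h (Matrix.of fun i j => H (i, j))
    let v : ParIdx P T → ℂ := Sum.elim (fun p => φ p.1 p.2)
      (Sum.elim (fun p => u p.1 p.2) fun p => k p.1 p.2)
    refine ⟨v, ?_⟩
    have hline : HasDerivAt (fun t : ℂ => Ψ (x0 + t • v)) (fderiv ℂ Ψ x0 v) 0 := by
      have h1 : HasDerivAt (fun t : ℂ => x0 + t • v) v 0 := by
        simpa using ((hasDerivAt_id (0 : ℂ)).smul_const v).const_add x0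
      have h2 : HasFDerivAt Ψ (fderiv ℂ Ψ x0) (x0 + (0 : ℂ) • v) := by
        simpa using hst.hasFDerivAt
      exact h2.comp_hasDerivAt 0 h1
    rw [hasDerivAt_pi] at hline
    funext p
    refine (hline p).unique ?_
    have h3 : ∀ t : ℂ, Ψ (x0 + t • v) p = ((1 + t • φ) * (y + z + t • k) * (1 - t • u) : Matrix P T ℂ) p.1 p.2 := by
      intro t
      simp only [Ψ, F]
      rw [parPoly_eval, parMat_line, parMat_line, parMat_line,
        parMat_eq (ι := Sum.inl) (M := 0) (x := x0) (zero_mem _) (fun _ => rfl),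
        parMat_eq (M := φ) (x := v) hφ (fun _ => rfl),
        parMat_eq (ι := Sum.inr ∘ Sum.inl) (M := 0) (x := x0) (zero_mem _) (fun _ => rfl),
        parMat_eq (M := u) (x := v) hu (fun _ => rfl),
        parMat_eq (M := y + z) (x := x0) hw (fun _ => rfl),
        parMat_eq (M := k) (x := v) hk (fun _ => rfl), zero_add, zero_add]
    have h4 : ∀ t : ℂ, (1 + t • φ) * (y + z + t • k) * (1 - t • u) = (y + z) +
        t • (φ * (y + z) + k - (y + z) * u) + t ^ 2 • (φ * k - φ * (y + z) * u - k * u) +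
        t ^ 3 • (-(φ * k * u)) := by
      intro t
      generalize y + z = w
      simp only [Matrix.add_mul, Matrix.mul_add, Matrix.mul_sub, Matrix.one_mul, Matrix.mul_one,
        Matrix.smul_mul, Matrix.mul_smul, smul_add, smul_sub, smul_neg, smul_smul]
      module
    have h5 : (fun t : ℂ => Ψ (x0 + t • v) p) = fun t => (y + z) p.1 p.2 + t * H p +
        t ^ 2 * (φ * k - φ * (y + z) * u - k * u) p.1 p.2 + t ^ 3 * (-(φ * k * u)) p.1 p.2 := by
      funext t
      rw [h3, h4, hH]
      simp [Matrix.add_apply]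
    rw [h5]
    exact hasDerivAt_cubic _ _ _ _
  have hmap := hst.map_nhds_eq_of_surj (LinearMap.range_eq_top.2 hsurj)
  have hnh : Set.range Ψ ∈ nhds (Ψ x0) := by
    rw [← hmap]
    exact Filter.mem_map.2 (Filter.univ_mem' fun x => ⟨x, rfl⟩)
  have hdense : Dense (Set.range Ψ) := dense_range_of_open F isOpen_interior
    ⟨_, mem_interior_iff_mem_nhds.2 hnh⟩ (fun y hy => by
      obtain ⟨x, hx⟩ := interior_subset hy
      exact ⟨x, fun t => congrFun hx t⟩)
  let toM : (P × T → ℂ) → Matrix P T ℂ := fun y => Matrix.of fun i j => y (i, j)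
  have hcont : Continuous toM := continuous_pi fun i => continuous_pi fun j => continuous_apply _
  have hcl : IsClosed {y | ∃ W, Inc (toM y) Finset.univ Finset.univ B A W} :=
    (isClosed_inc Finset.univ Finset.univ B A).preimage hcont
  have hsub : Set.range Ψ ⊆ {y | ∃ W, Inc (toM y) Finset.univ Finset.univ B A W} := by
    rintro _ ⟨x, rfl⟩
    have h6 := inc_of_par (parMat_mem (tri Bᶜ B) Sum.inl x)
      (parMat_mem (tri Aᶜ A) (Sum.inr ∘ Sum.inl) x) (parMat_mem (Bᶜ ×ˢ A)ᶜ (Sum.inr ∘ Sum.inr) x)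
    rw [← show toM (Ψ x) = _ from Matrix.ext fun i j => parPoly_eval B A x i j] at h6
    exact ⟨_, h6⟩
  have huniv := hcl.closure_subset_iff.2 hsub
  rw [hdense.closure_eq] at huniv
  exact huniv (Set.mem_univ fun p => g p.1 p.2)

end Jacobian

section Projections

open scoped ComplexOrder

variable {P T : Type*} [Fintype P] [DecidableEq P] [Fintype T] [DecidableEq T]

/-- `Q` is the orthogonal projection onto `W`. -/
structure IsProj (Q : Matrix P P ℂ) (W : Submodule ℂ (P → ℂ)) : Prop where
  herm : Qᴴ = Q
  mem : ∀ x, Q *ᵥ x ∈ W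
  fix : ∀ x ∈ W, Q *ᵥ x = x

theorem IsProj.idem {Q : Matrix P P ℂ} {W : Submodule ℂ (P → ℂ)} (h : IsProj Q W) : Q * Q = Q := by
  refine ext_of_mulVec_single fun k => ?_
  rw [← mulVec_mulVec]
  exact h.fix _ (h.mem _)

theorem exists_proj (W : Submodule ℂ (P → ℂ)) :
    ∃ Q : Matrix P P ℂ, IsProj Q W ∧ trace Q = finrank ℂ W := by
  obtain ⟨v, hv, hvW⟩ := exists_frame W _ le_rfl
  have hr : LinearMap.range (toLin' v) = W := by
    refine Submodule.eq_of_le_of_finrank_le ?_ ?_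
    · rintro _ ⟨x, rfl⟩; exact hvW x
    · rw [LinearMap.finrank_range_of_inj (mulVec_injective_of_left_inv hv)]; simp
  refine ⟨v * vᴴ, ⟨by simp, fun x => ?_, fun x hx => ?_⟩, ?_⟩
  · rw [← mulVec_mulVec]; exact hvW _
  · rw [← hr] at hx
    obtain ⟨y, rfl⟩ := hx
    rw [toLin'_apply, mulVec_mulVec, Matrix.mul_assoc, hv, Matrix.mul_one]
  · rw [trace_mul_comm, hv]; simp

theorem mul_eq_of_fix {b : ℕ} {Q : Matrix P P ℂ} {w : Matrix P (Fin b) ℂ} {U : Submodule ℂ (P → ℂ)}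
    (hw : ∀ x, w *ᵥ x ∈ U) (hQ : ∀ x ∈ U, Q *ᵥ x = x) : Q * w = w := by
  refine ext_of_mulVec_single fun k => ?_
  rw [← mulVec_mulVec]
  exact hQ _ (hw _)

theorem finrank_le_trace_mul {Q R : Matrix P P ℂ} (hQ : Qᴴ = Q) (hQ2 : Q * Q = Q) (hR : Rᴴ = R)
    (hR2 : R * R = R) {U : Submodule ℂ (P → ℂ)} (h1 : ∀ x ∈ U, Q *ᵥ x = x)
    (h2 : ∀ x ∈ U, R *ᵥ x = x) : (finrank ℂ U : ℝ) ≤ (trace (Q * R)).re := by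
  obtain ⟨w, hw, hwU⟩ := exists_frame U _ le_rfl
  have hQw : Q * w = w := mul_eq_of_fix hwU h1
  have hRw : R * w = w := mul_eq_of_fix hwU h2
  have hwQ : wᴴ * Q = wᴴ := by
    have := congrArg conjTranspose hQw
    rwa [conjTranspose_mul, hQ] at this
  have hwR : wᴴ * R = wᴴ := by
    have := congrArg conjTranspose hRw
    rwa [conjTranspose_mul, hR] at this
  have hN : ((Q - w * wᴴ) * R) * ((Q - w * wᴴ) * R)ᴴ = Q * R * Q - w * wᴴ := by
    rw [conjTranspose_mul, conjTranspose_sub, hQ, hR, conjTranspose_mul,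
      conjTranspose_conjTranspose, Matrix.sub_mul, Matrix.mul_assoc w, hwR, Matrix.sub_mul,
      Matrix.mul_sub, Matrix.mul_sub (w * wᴴ), Matrix.mul_sub (Q * R)]
    have e1 : Q * R * (R * Q) = Q * R * Q := by rw [← Matrix.mul_assoc, Matrix.mul_assoc Q, hR2]
    have e2 : Q * R * (R * (w * wᴴ)) = w * wᴴ := by
      rw [← Matrix.mul_assoc R, hRw, Matrix.mul_assoc Q, ← Matrix.mul_assoc R, hRw,
        ← Matrix.mul_assoc, hQw]
    have e3 : w * wᴴ * (R * Q) = w * wᴴ := by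
      rw [Matrix.mul_assoc, ← Matrix.mul_assoc wᴴ, hwR, hwQ]
    have e4 : w * wᴴ * (R * (w * wᴴ)) = w * wᴴ := by
      rw [← Matrix.mul_assoc R, hRw, Matrix.mul_assoc w, ← Matrix.mul_assoc wᴴ, hw, Matrix.one_mul]
    rw [e1, e2, e3, e4]
    abel
  have hpos := (Matrix.posSemidef_self_mul_conjTranspose ((Q - w * wᴴ) * R)).trace_nonneg
  rw [hN, Matrix.trace_sub, trace_mul_comm (Q * R), ← Matrix.mul_assoc, hQ2,
    trace_mul_comm w, hw, Matrix.trace_one, Fintype.card_fin] at hpos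
  have := (Complex.le_def.1 hpos).1
  simpa using this

/-- The weight function of a family of subsets. -/
noncomputable def wt {ι : Type*} [Fintype ι] (c : ι → ℝ) (X : ι → Finset T) (t : T) : ℝ :=
  ∑ i, if t ∈ X i then c i else 0

/-- A real diagonal matrix. -/
noncomputable def rdiag (f : T → ℝ) : Matrix T T ℂ := Matrix.diagonal fun t => (f t : ℂ)

theorem rdiag_wt {ι : Type*} [Fintype ι] (c : ι → ℝ) (X : ι → Finset T) :
    rdiag (wt c X) = ∑ i, (c i : ℂ) • mask ℂ (X i) := by
  refine Matrix.ext fun a b => ?_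
  simp only [rdiag, wt, Matrix.sum_apply, Matrix.smul_apply, mask, Matrix.diagonal_apply]
  split_ifs with h
  · push_cast
    refine Finset.sum_congr rfl fun i _ => ?_
    split_ifs <;> simp
  · simp

theorem rdiag_conjTranspose (f : T → ℝ) : (rdiag f)ᴴ = rdiag f := by
  rw [rdiag, Matrix.diagonal_conjTranspose]
  congr 1
  funext t
  simp

theorem mask_conjTranspose (X : Finset T) : (mask ℂ X)ᴴ = mask ℂ X := by
  rw [mask, Matrix.diagonal_conjTranspose]
  congr 1
  funext t
  simp only [Pi.star_apply]
  split_ifs <;> simp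

theorem mask_mul_mask (X : Finset T) : mask ℂ X * mask ℂ X = mask ℂ X := by
  rw [mask, Matrix.diagonal_mul_diagonal]
  congr 1
  funext t
  split_ifs <;> simp

theorem finrank_le_trace_conj {Q : Matrix P P ℂ} {W : Submodule ℂ (P → ℂ)} (hQ : IsProj Q W)
    {g : Matrix P T ℂ} (hg : gᴴ * g = 1) (X : Finset T) :
    (finrank ℂ (coord ℂ X ⊓ W.comap (toLin' g) : Submodule ℂ (T → ℂ)) : ℝ) ≤
      (trace (Q * (g * mask ℂ X * gᴴ))).re := by
  rw [← finrank_map_of_injective (toLin' g) (mulVec_injective_of_left_inv hg)]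
  refine finrank_le_trace_mul hQ.herm hQ.idem ?_ ?_ ?_ ?_
  · simp [conjTranspose_mul, mask_conjTranspose, Matrix.mul_assoc]
  · rw [← Matrix.mul_assoc, ← Matrix.mul_assoc, Matrix.mul_assoc _ gᴴ, hg, Matrix.mul_one,
      Matrix.mul_assoc g, mask_mul_mask]
  · rintro _ ⟨x, hx, rfl⟩
    exact hQ.fix _ hx.2
  · rintro _ ⟨x, hx, rfl⟩
    rw [toLin'_apply, mulVec_mulVec, Matrix.mul_assoc, hg, Matrix.mul_one,
      ← mulVec_mulVec, mask_mulVec_of_mem hx.1]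

theorem sum_finrank_le_trace {ι : Type*} [Fintype ι] {c : ι → ℝ} (hc : ∀ i, 0 ≤ c i)
    (X : ι → Finset T) {Q : Matrix P P ℂ} {W : Submodule ℂ (P → ℂ)} (hQ : IsProj Q W)
    {g : Matrix P T ℂ} (hg : gᴴ * g = 1) :
    ∑ i, c i * (finrank ℂ (coord ℂ (X i) ⊓ W.comap (toLin' g) :
      Submodule ℂ (T → ℂ)) : ℝ) ≤ (trace (Q * (g * rdiag (wt c X) * gᴴ))).re := by
  have : trace (Q * (g * rdiag (wt c X) * gᴴ)) =
      ∑ i, (c i : ℂ) * trace (Q * (g * mask ℂ (X i) * gᴴ)) := by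
    rw [rdiag_wt, Matrix.mul_sum, Matrix.sum_mul, Matrix.mul_sum, Matrix.trace_sum]
    refine Finset.sum_congr rfl fun i _ => ?_
    rw [Matrix.mul_smul, Matrix.smul_mul, Matrix.mul_smul, Matrix.trace_smul, smul_eq_mul]
  rw [this, Complex.re_sum]
  refine Finset.sum_le_sum fun i _ => ?_
  rw [Complex.re_ofReal_mul]
  exact mul_le_mul_of_nonneg_left (finrank_le_trace_conj hQ hg _) (hc i)

theorem sum_finrank_le_trace' {ι : Type*} [Fintype ι] {c : ι → ℝ} (hc : ∀ i, 0 ≤ c i)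
    (X : ι → Finset P) {Q : Matrix P P ℂ} {W : Submodule ℂ (P → ℂ)} (hQ : IsProj Q W) :
    ∑ i, c i * (finrank ℂ (W ⊓ coord ℂ (X i) : Submodule ℂ (P → ℂ)) : ℝ) ≤
      (trace (Q * rdiag (wt c X))).re := by
  have := sum_finrank_le_trace hc X hQ (g := (1 : Matrix P P ℂ)) (by simp)
  have h1 : W.comap (toLin' (1 : Matrix P P ℂ)) = W := by
    rw [toLin'_one, Submodule.comap_id]
  rw [Matrix.one_mul, conjTranspose_one, Matrix.mul_one, h1] at this
  refine le_trans (Finset.sum_congr rfl fun i _ => ?_).le this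
  rw [inf_comm]

theorem exists_layerCake [PartialOrder T] (n : ℕ) : ∀ f : T → ℝ, Antitone f → (∀ t, 0 ≤ f t) →
    (Finset.univ.filter fun t => f t ≠ 0).card = n →
    ∃ c : Finset T → ℝ, (∀ X, 0 ≤ c X) ∧ (∀ X, c X ≠ 0 → IsLowerSet (X : Set T)) ∧
      wt c id = f := by
  induction n using Nat.strong_induction_on with
  | _ n ih =>
    intro f hf h0 hn
    set S := Finset.univ.filter fun t => f t ≠ 0 with hS
    rcases S.eq_empty_or_nonempty with he | hne
    · refine ⟨0, fun _ => le_rfl, fun X h => absurd rfl h, ?_⟩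
      funext t
      have : t ∉ S := by simp [he]
      simp only [hS, Finset.mem_filter, Finset.mem_univ, true_and, not_not] at this
      simp [wt, this]
    · obtain ⟨t0, ht0, hmin⟩ := S.exists_min_image f hne
      have hSl : IsLowerSet (S : Set T) := by
        intro a b hba ha
        simp only [hS, Finset.coe_filter, Finset.mem_univ, true_and, Set.mem_setOf_eq] at ha ⊢
        exact ((lt_of_le_of_ne (h0 a) ha.symm).trans_le (hf hba)).ne'
      have hmemS : ∀ t, t ∈ S ↔ f t ≠ 0 := fun t => by simp [hS]
      let f1 : T → ℝ := fun t => f t - if t ∈ S then f t0 else 0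
      have h10 : ∀ t, 0 ≤ f1 t := by
        intro t
        simp only [f1]
        split_ifs with h
        · linarith [hmin t h]
        · linarith [h0 t]
      have h1a : Antitone f1 := by
        intro a b hab
        simp only [f1]
        by_cases hb : b ∈ S
        · rw [if_pos hb, if_pos (show a ∈ S from hSl hab hb)]
          linarith [hf hab]
        · have : f b = 0 := not_not.1 (mt (hmemS b).2 hb)
          rw [if_neg hb, this, sub_zero]
          exact h10 a
      have hlt : (Finset.univ.filter fun t => f1 t ≠ 0).card < n := by
        rw [← hn]
        refine Finset.card_lt_card ⟨?_, ?_⟩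
        · intro t ht
          rw [Finset.mem_filter] at ht
          by_contra hc
          have : f t = 0 := not_not.1 (mt (hmemS t).2 hc)
          exact ht.2 (by simp [f1, hc, this])
        · intro hc
          have := hc ht0
          simp [f1, ht0] at this
      obtain ⟨c, hc0, hcl, hcf⟩ := ih _ hlt f1 h1a h10 rfl
      refine ⟨fun X => c X + if X = S then f t0 else 0, fun X => ?_, fun X hX => ?_, ?_⟩
      · have := hc0 X
        dsimp only
        split_ifs
        · linarith [h0 t0]
        · linarith
      · by_cases h : X = S
        · rwa [h]
        · refine hcl X ?_
          simpa [h] using hX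
      · funext t
        have h3 := congrFun hcf t
        simp only [wt, id, f1] at h3 ⊢
        have h4 : ∀ X : Finset T, (if t ∈ X then c X + (if X = S then f t0 else 0) else 0) =
            (if t ∈ X then c X else 0) + if X = S then (if t ∈ S then f t0 else 0) else 0 := by
          intro X
          by_cases h : X = S
          · subst h; split_ifs <;> simp
          · simp [h]
        rw [Finset.sum_congr rfl fun X _ => h4 X, Finset.sum_add_distrib, h3,
          Finset.sum_ite_eq' Finset.univ S]
        simp

theorem sum_wt {ι : Type*} [Fintype ι] (c : ι → ℝ) (X : ι → Finset T) (A : Finset T) :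
    ∑ t ∈ A, wt c X t = ∑ i, c i * ((A ∩ X i).card : ℝ) := by
  simp only [wt]
  rw [Finset.sum_comm]
  refine Finset.sum_congr rfl fun i _ => ?_
  rw [← Finset.sum_filter, Finset.sum_const, nsmul_eq_mul, mul_comm, Finset.filter_mem_eq_inter]

/-- The Hersch–Zwahlen inequality. -/
theorem sum_le_trace [PartialOrder T] {f : T → ℝ} (hf : Antitone f) {Q : Matrix P P ℂ}
    {W : Submodule ℂ (P → ℂ)} (hQ : IsProj Q W) (htr : trace Q = finrank ℂ W)
    {g : Matrix P T ℂ} (hg : gᴴ * g = 1) (hg' : g * gᴴ = 1) {A : Finset T}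
    (hA : finrank ℂ W = A.card)
    (h : ∀ X : Finset T, IsLowerSet (X : Set T) → (A ∩ X).card ≤
      finrank ℂ (coord ℂ X ⊓ W.comap (toLin' g) : Submodule ℂ (T → ℂ))) :
    ∑ t ∈ A, f t ≤ (trace (Q * (g * rdiag f * gᴴ))).re := by
  obtain ⟨k, hk⟩ : ∃ k : ℝ, ∀ t, 0 ≤ f t + k := by
    refine ⟨∑ t, |f t|, fun t => ?_⟩
    have := Finset.single_le_sum (f := fun t => |f t|) (fun i _ => abs_nonneg _) (Finset.mem_univ t)
    have := neg_abs_le (f t)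
    linarith
  obtain ⟨c, hc0, hcl, hcf⟩ := exists_layerCake _ (fun t => f t + k)
    (fun a b hab => by have := hf hab; simp only; linarith) hk rfl
  have h1 := sum_finrank_le_trace hc0 id hQ hg
  have h2 : rdiag (wt c id) = rdiag f + (k : ℂ) • (1 : Matrix T T ℂ) := by
    rw [hcf]
    refine Matrix.ext fun a b => ?_
    simp only [rdiag, Matrix.diagonal_apply, Matrix.add_apply, Matrix.smul_apply, Matrix.one_apply]
    split_ifs <;> simp
  rw [h2, Matrix.mul_add, Matrix.add_mul, Matrix.mul_add, Matrix.trace_add, Matrix.mul_smul,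
    Matrix.mul_one, Matrix.smul_mul, hg', Matrix.mul_smul, Matrix.mul_one, Matrix.trace_smul, htr,
    Complex.add_re, smul_eq_mul, Complex.re_ofReal_mul, Complex.natCast_re, hA] at h1
  have h3 := sum_wt c id A
  rw [hcf, Finset.sum_add_distrib, Finset.sum_const, nsmul_eq_mul] at h3
  have h4 : ∑ X, c X * ((A ∩ id X).card : ℝ) ≤ ∑ X, c X * (finrank ℂ
      (coord ℂ (id X) ⊓ W.comap (toLin' g) : Submodule ℂ (T → ℂ)) : ℝ) := by
    refine Finset.sum_le_sum fun X _ => ?_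
    by_cases hX : c X = 0
    · simp [hX]
    · exact mul_le_mul_of_nonneg_left (by exact_mod_cast h X (hcl X hX)) (hc0 X)
  linarith [mul_comm (A.card : ℝ) k]

theorem trace_mul_eq_of_graded [PartialOrder P] {Q M N : Matrix P P ℂ} (hQ : GradedMat Q)
    (h : ∀ i j, Comp i j → M i j = N i j) : trace (Q * M) = trace (Q * N) := by
  simp only [Matrix.trace, Matrix.diag_apply, Matrix.mul_apply]
  refine Finset.sum_congr rfl fun i _ => Finset.sum_congr rfl fun j _ => ?_
  by_cases hij : Q i j = 0
  · simp [hij]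
  · rw [h j i (hQ i j hij).symm]

/-- A nonnegative weight on a family of subsets, supported on lower sets. -/
structure LowerWeight [PartialOrder P] {ι : Type*} (c : ι → ℝ) (X : ι → Finset P) : Prop where
  nonneg : ∀ i, 0 ≤ c i
  lower : ∀ i, c i ≠ 0 → IsLowerSet (X i : Set P)

/-- The numerical semistability condition for a pair of filtrations compared through `g`. -/
def Semi [PartialOrder P] {ι ι' : Type*} [Fintype ι] [Fintype ι'] (c : ι → ℝ) (X : ι → Finset T)
    (c' : ι' → ℝ) (X' : ι' → Finset P) (κ : ℝ) (g : Matrix P T ℂ) : Prop :=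
  ∀ W : Submodule ℂ (P → ℂ), Graded W →
    ∑ i, c i * (finrank ℂ (coord ℂ (X i) ⊓ W.comap (toLin' g) :
        Submodule ℂ (T → ℂ)) : ℝ) +
      ∑ i, c' i * (finrank ℂ (W ⊓ coord ℂ (X' i) : Submodule ℂ (P → ℂ)) : ℝ) ≤
    κ * finrank ℂ W

theorem semi_of_unitary [PartialOrder P] {ι ι' : Type*} [Fintype ι] [Fintype ι'] {c : ι → ℝ}
    (hc : ∀ i, 0 ≤ c i) (X : ι → Finset T) {c' : ι' → ℝ} (hc' : ∀ i, 0 ≤ c' i) (X' : ι' → Finset P)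
    {κ : ℝ} {g : Matrix P T ℂ} (hg : gᴴ * g = 1)
    (h : ∀ i j, Comp i j → (g * rdiag (wt c X) * gᴴ + rdiag (wt c' X')) i j =
      ((κ : ℂ) • (1 : Matrix P P ℂ)) i j) : Semi c X c' X' κ g := by
  intro W hW
  obtain ⟨Q, hQ, htr⟩ := exists_proj W
  have h1 := sum_finrank_le_trace hc X hQ hg
  have h2 := sum_finrank_le_trace' hc' X' hQ
  have h3 := trace_mul_eq_of_graded (gradedMat_proj hW hQ.herm hQ.mem hQ.fix) h
  rw [Matrix.mul_add, Matrix.trace_add, Matrix.mul_smul, Matrix.mul_one, Matrix.trace_smul, htr] at h3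
  have h4 := congrArg Complex.re h3
  rw [Complex.add_re, smul_eq_mul, Complex.re_ofReal_mul, Complex.natCast_re] at h4
  linarith

end Projections

section Eigen

/-- A rectangular matrix with orthonormal rows and columns. -/
structure IsU {P T : Type*} [Fintype P] [DecidableEq P] [Fintype T] [DecidableEq T]
    (g : Matrix P T ℂ) : Prop where
  left : gᴴ * g = 1
  right : g * gᴴ = 1

theorem IsU.mul {P T R : Type*} [Fintype P] [DecidableEq P] [Fintype T] [DecidableEq T] [Fintype R]
    [DecidableEq R] {g : Matrix P T ℂ} {h : Matrix T R ℂ} (hg : IsU g) (hh : IsU h) : IsU (g * h) where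
  left := by
    rw [conjTranspose_mul, Matrix.mul_assoc, ← Matrix.mul_assoc gᴴ, hg.left, Matrix.one_mul,
      hh.left]
  right := by
    rw [conjTranspose_mul, Matrix.mul_assoc, ← Matrix.mul_assoc h, hh.right, Matrix.one_mul,
      hg.right]

theorem IsU.conjTranspose {P T : Type*} [Fintype P] [DecidableEq P] [Fintype T] [DecidableEq T]
    {g : Matrix P T ℂ} (hg : IsU g) : IsU gᴴ where
  left := by rw [conjTranspose_conjTranspose, hg.right]
  right := by rw [conjTranspose_conjTranspose, hg.left]

theorem IsU.submatrix {P T P' T' : Type*} [Fintype P] [DecidableEq P] [Fintype T] [DecidableEq T]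
    [Fintype P'] [DecidableEq P'] [Fintype T'] [DecidableEq T']
    {g : Matrix P T ℂ} (hg : IsU g) (e : P' ≃ P) (f : T' ≃ T) : IsU (g.submatrix e f) where
  left := by
    rw [conjTranspose_submatrix, submatrix_mul_equiv, hg.left, submatrix_one_equiv]
  right := by
    rw [conjTranspose_submatrix, submatrix_mul_equiv, hg.right, submatrix_one_equiv]

theorem IsU.fromBlocks {P T P' T' : Type*} [Fintype P] [DecidableEq P] [Fintype T] [DecidableEq T]
    [Fintype P'] [DecidableEq P'] [Fintype T'] [DecidableEq T']
    {g : Matrix P T ℂ} (hg : IsU g) {h : Matrix P' T' ℂ} (hh : IsU h) :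
    IsU (fromBlocks g 0 0 h) where
  left := by
    rw [fromBlocks_conjTranspose, fromBlocks_multiply]
    simp [hg.left, hh.left]
  right := by
    rw [fromBlocks_conjTranspose, fromBlocks_multiply]
    simp [hg.right, hh.right]

variable {k : ℕ}

theorem eigVec_antitone (X : Matrix (Fin k) (Fin k) ℂ) (hX : X.IsHermitian) :
    Antitone (eigVec X hX) := fun _ _ h =>
  Tuple.monotone_sort hX.eigenvalues (Fin.rev_le_rev.2 h)

theorem exists_isU_eigVec (X : Matrix (Fin k) (Fin k) ℂ) (hX : X.IsHermitian) :
    ∃ U : Matrix (Fin k) (Fin k) ℂ, IsU U ∧ X = U * rdiag (eigVec X hX) * Uᴴ := by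
  let V : Matrix (Fin k) (Fin k) ℂ := hX.eigenvectorUnitary
  have hV : IsU V := ⟨Unitary.coe_star_mul_self hX.eigenvectorUnitary,
    Unitary.coe_mul_star_self hX.eigenvectorUnitary⟩
  let e : Fin k ≃ Fin k := Fin.revPerm.trans (Tuple.sort hX.eigenvalues)
  refine ⟨V.submatrix (Equiv.refl _) e, hV.submatrix _ _, ?_⟩
  have h1 : rdiag (eigVec X hX) = (rdiag hX.eigenvalues).submatrix e e := by
    rw [rdiag, rdiag, submatrix_diagonal_equiv]
    rfl
  rw [h1, conjTranspose_submatrix, submatrix_mul_equiv, submatrix_mul_equiv]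
  have := hX.spectral_theorem
  rw [Unitary.conjStarAlgAut_apply] at this
  exact this

theorem charpoly_conj_rdiag {P T : Type*} [Fintype P] [DecidableEq P] [Fintype T] [DecidableEq T]
    (e : P ≃ T) {U : Matrix P T ℂ} (hU : IsU U) (v : T → ℝ) :
    (U * rdiag v * Uᴴ).charpoly = ∏ i, (Polynomial.X - Polynomial.C (v i : ℂ)) := by
  have h1 : U * rdiag v * Uᴴ = (U.submatrix id e * (rdiag v).submatrix e e) * (Uᴴ).submatrix e id := by
    rw [submatrix_mul_equiv, submatrix_mul_equiv, submatrix_id_id]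
  rw [h1, Matrix.charpoly_mul_comm, ← Matrix.mul_assoc]
  have h2 : (Uᴴ).submatrix e id * U.submatrix id e = 1 := by
    have := submatrix_mul_equiv Uᴴ U e (Equiv.refl _) e
    rw [hU.left, submatrix_one_equiv] at this
    exact this
  rw [h2, Matrix.one_mul, rdiag, submatrix_diagonal_equiv, Matrix.charpoly_diagonal]
  exact Fintype.prod_equiv e _ _ fun i => rfl

theorem antitone_eq_of_prod_eq {v w : Fin k → ℝ} (hv : Antitone v) (hw : Antitone w)
    (h : ∏ i, (Polynomial.X - Polynomial.C (v i : ℂ)) = ∏ i, (Polynomial.X - Polynomial.C (w i : ℂ))) :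
    v = w := by
  have h1 : ∀ u : Fin k → ℝ, (∏ i, (Polynomial.X - Polynomial.C (u i : ℂ))).roots.map Complex.re =
      (List.ofFn u : Multiset ℝ) := by
    intro u
    rw [Polynomial.roots_prod _ _ (Finset.prod_ne_zero_iff.2 fun i _ => Polynomial.X_sub_C_ne_zero _)]
    simp only [Polynomial.roots_X_sub_C, Multiset.bind_singleton, Multiset.map_map]
    rw [← Fin.univ_val_map]
    exact Multiset.map_congr rfl fun i _ => by simp
  have h2 : (List.ofFn v : Multiset ℝ) = List.ofFn w := by rw [← h1, ← h1, h]
  exact List.ofFn_injective ((Multiset.coe_eq_coe.1 h2).eq_of_sortedGE hv.sortedGE_ofFn hw.sortedGE_ofFn)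

theorem eigVec_charpoly (X : Matrix (Fin k) (Fin k) ℂ) (hX : X.IsHermitian) :
    X.charpoly = ∏ i, (Polynomial.X - Polynomial.C (eigVec X hX i : ℂ)) := by
  obtain ⟨U, hU, h⟩ := exists_isU_eigVec X hX
  conv_lhs => rw [h]
  exact charpoly_conj_rdiag (Equiv.refl _) hU _

theorem eigVec_eq_of_charpoly {X : Matrix (Fin k) (Fin k) ℂ} (hX : X.IsHermitian) {v : Fin k → ℝ}
    (hv : Antitone v) (h : X.charpoly = ∏ i, (Polynomial.X - Polynomial.C (v i : ℂ))) :
    eigVec X hX = v :=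
  antitone_eq_of_prod_eq (eigVec_antitone X hX) hv (by rw [← eigVec_charpoly X hX, h])

/-- Equality of matrices on comparable pairs of indices. -/
def CompEq {P : Type*} [PartialOrder P] (M N : Matrix P P ℂ) : Prop := ∀ i j, Comp i j → M i j = N i j

theorem exists_diagonal_blocks {m n : ℕ} (M : Matrix (Fin (m + n)) (Fin (m + n)) ℂ)
    (hM : M.IsHermitian) : ∃ g : Matrix (Fin m ⊕ Fin n) (Fin (m + n)) ℂ, IsU g ∧
      CompEq (g * rdiag (eigVec M hM) * gᴴ)
        (rdiag (Sum.elim (eigVec (M.submatrix (Fin.castAdd n) (Fin.castAdd n)) (hM.submatrix _))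
          (eigVec (M.submatrix (Fin.natAdd m) (Fin.natAdd m)) (hM.submatrix _)))) := by
  obtain ⟨U, hU, h⟩ := exists_isU_eigVec M hM
  obtain ⟨V1, hV1, h1⟩ := exists_isU_eigVec _ (hM.submatrix (Fin.castAdd n))
  obtain ⟨V2, hV2, h2⟩ := exists_isU_eigVec _ (hM.submatrix (Fin.natAdd m))
  refine ⟨fromBlocks V1ᴴ 0 0 V2ᴴ * U.submatrix finSumFinEquiv (Equiv.refl _),
    (hV1.conjTranspose.fromBlocks hV2.conjTranspose).mul (hU.submatrix _ _), ?_⟩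
  set Λ := rdiag (eigVec M hM)
  have h3 : U.submatrix finSumFinEquiv (Equiv.refl _) * Λ * (U.submatrix finSumFinEquiv (Equiv.refl _))ᴴ
      = M.submatrix (finSumFinEquiv (m := m) (n := n)) finSumFinEquiv := by
    conv_rhs => rw [h]
    rw [conjTranspose_submatrix]
    rfl
  have h4 : M.submatrix (finSumFinEquiv (m := m) (n := n)) finSumFinEquiv = fromBlocks
      (M.submatrix (Fin.castAdd n) (Fin.castAdd n)) (M.submatrix (Fin.castAdd n) (Fin.natAdd m))
      (M.submatrix (Fin.natAdd m) (Fin.castAdd n)) (M.submatrix (Fin.natAdd m) (Fin.natAdd m)) := by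
    refine Matrix.ext fun i j => ?_
    rcases i with i | i <;> rcases j with j | j <;> simp
  have h5 : ∀ (N : SqMat (Fin m ⊕ Fin n)) (g : Matrix (Fin m ⊕ Fin n) (Fin (m + n)) ℂ),
      N * g * Λ * (N * g)ᴴ = N * (g * Λ * gᴴ) * Nᴴ := by
    intro N g
    simp only [conjTranspose_mul, Matrix.mul_assoc]
  rw [h5, h3, h4, fromBlocks_conjTranspose, fromBlocks_multiply,
    fromBlocks_multiply]
  have h6 : V1ᴴ * M.submatrix (Fin.castAdd n) (Fin.castAdd n) * V1 = rdiag (eigVec _ (hM.submatrix (Fin.castAdd n))) := by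
    conv_lhs => rw [h1]
    simp only [← Matrix.mul_assoc, hV1.left, Matrix.one_mul]
    rw [Matrix.mul_assoc, hV1.left, Matrix.mul_one]
  have h7 : V2ᴴ * M.submatrix (Fin.natAdd m) (Fin.natAdd m) * V2 = rdiag (eigVec _ (hM.submatrix (Fin.natAdd m))) := by
    conv_lhs => rw [h2]
    simp only [← Matrix.mul_assoc, hV2.left, Matrix.one_mul]
    rw [Matrix.mul_assoc, hV2.left, Matrix.mul_one]
  rintro (i | i) (j | j) hij
  · simp [h6, rdiag, Matrix.diagonal_apply]
  · rcases hij with h | h <;> simp at h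
  · rcases hij with h | h <;> simp at h
  · simp [h7, rdiag, Matrix.diagonal_apply]

theorem eigVec_of_isU {P : Type*} [Fintype P] [DecidableEq P] {M : Matrix P P ℂ} (e : Fin k ≃ P)
    {U : Matrix P (Fin k) ℂ} (hU : IsU U) {v : Fin k → ℝ} (hv : Antitone v)
    (h : M = U * rdiag v * Uᴴ) (hM : (M.submatrix e e).IsHermitian) : eigVec (M.submatrix e e) hM = v := by
  refine eigVec_eq_of_charpoly hM hv ?_
  rw [← charpoly_conj_rdiag e.symm hU v, ← h]
  exact Matrix.charpoly_reindex e.symm M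

theorem mem_LRcone_of_isU {m n : ℕ} {l : Fin (m + n) → ℝ} {μ : Fin m → ℝ} {ν : Fin n → ℝ}
    (hl : Antitone l) (hμ : Antitone μ) (hν : Antitone ν)
    {g : Matrix (Fin m ⊕ Fin n) (Fin (m + n)) ℂ} (hg : IsU g)
    (h : CompEq (g * rdiag l * gᴴ) (rdiag (Sum.elim μ ν))) : (l, μ, ν) ∈ LRcone m n := by
  have hH : (g * rdiag l * gᴴ).IsHermitian := by
    rw [Matrix.IsHermitian, conjTranspose_mul, conjTranspose_mul, rdiag_conjTranspose,
      conjTranspose_conjTranspose, Matrix.mul_assoc]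
  refine ⟨(g * rdiag l * gᴴ).submatrix finSumFinEquiv.symm finSumFinEquiv.symm, hH.submatrix _, ?_, ?_, ?_⟩
  · exact (eigVec_of_isU finSumFinEquiv.symm hg hl rfl _).symm
  · refine (eigVec_eq_of_charpoly _ hμ ?_).symm
    have h1 : ((g * rdiag l * gᴴ).submatrix finSumFinEquiv.symm finSumFinEquiv.symm).submatrix
        (Fin.castAdd n) (Fin.castAdd n) = rdiag μ := by
      refine Matrix.ext fun i j => ?_
      have := h (Sum.inl i) (Sum.inl j) (by rcases le_total i j with h | h <;> simp [Comp, h])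
      simp only [submatrix_apply, finSumFinEquiv_symm_apply_castAdd]
      rw [this]
      simp [rdiag, Matrix.diagonal_apply]
    rw [h1, rdiag, Matrix.charpoly_diagonal]
  · refine (eigVec_eq_of_charpoly _ hν ?_).symm
    have h1 : ((g * rdiag l * gᴴ).submatrix finSumFinEquiv.symm finSumFinEquiv.symm).submatrix
        (Fin.natAdd m) (Fin.natAdd m) = rdiag ν := by
      refine Matrix.ext fun i j => ?_
      have := h (Sum.inr i) (Sum.inr j) (by rcases le_total i j with h | h <;> simp [Comp, h])
      simp only [submatrix_apply, finSumFinEquiv_symm_apply_natAdd]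
      rw [this]
      simp [rdiag, Matrix.diagonal_apply]
    rw [h1, rdiag, Matrix.charpoly_diagonal]

end Eigen

section Transport

variable {P T P1 T1 : Type*}

/-- Extension by zero along an injection. -/
noncomputable def extZ {P1 P : Type*} (e : P1 → P) : (P1 → ℂ) →ₗ[ℂ] (P → ℂ) :=
  Function.ExtendByZero.linearMap ℂ e

theorem extZ_apply {e : P1 → P} (he : Function.Injective e) (v : P1 → ℂ) (k : P1) :
    extZ e v (e k) = v k := by
  exact he.extend_apply v (0 : P → ℂ) k

theorem extZ_apply' {e : P1 → P} (v : P1 → ℂ) {i : P} (hi : ∀ k, e k ≠ i) : extZ e v i = 0 := by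
  have : ¬ ∃ a, e a = i := fun ⟨a, h⟩ => hi a h
  exact Function.extend_apply' v (0 : P → ℂ) i this

theorem extZ_injective {e : P1 → P} (he : Function.Injective e) : Function.Injective (extZ e) := by
  intro v w h
  ext k
  rw [← extZ_apply he v k, h, extZ_apply he]

theorem extZ_restrict {e : P1 → P} (he : Function.Injective e) {v : P → ℂ}
    (hv : ∀ i, (∀ k, e k ≠ i) → v i = 0) : extZ e (v ∘ e) = v := by
  ext i
  by_cases hi : ∃ k, e k = i
  · obtain ⟨k, rfl⟩ := hi
    rw [extZ_apply he]; rfl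
  · push Not at hi
    rw [extZ_apply' _ hi, hv i hi]

variable [Fintype P] [DecidableEq P] [Fintype T] [DecidableEq T]
  [Fintype P1] [DecidableEq P1] [Fintype T1] [DecidableEq T1]

theorem map_extZ_inf_coord {e : P1 → P} (he : Function.Injective e) (W : Submodule ℂ (P1 → ℂ))
    (X : Finset P) : W.map (extZ e) ⊓ coord ℂ X =
      (W ⊓ coord ℂ (Finset.univ.filter fun k => e k ∈ X)).map (extZ e) := by
  ext v
  constructor
  · rintro ⟨⟨w, hw, rfl⟩, hX⟩
    refine ⟨w, ⟨hw, fun k hk => ?_⟩, rfl⟩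
    rw [← extZ_apply he w k]
    exact hX _ (by simpa using hk)
  · rintro ⟨w, ⟨hw, hX⟩, rfl⟩
    refine ⟨⟨w, hw, rfl⟩, fun i hi => ?_⟩
    by_cases h : ∃ k, e k = i
    · obtain ⟨k, rfl⟩ := h
      rw [extZ_apply he]
      exact hX _ (by simpa using hi)
    · push Not at h
      exact extZ_apply' _ h

theorem mulVec_extZ {e : P1 → P} (he : Function.Injective e) {ea : T1 → T} (ha : Function.Injective ea)
    {B : Finset P} {A : Finset T} (hB : ∀ i, i ∈ B ↔ ∃ k, e k = i) {y : Matrix P T ℂ}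
    (hy : y ∈ SM ℂ (B ×ˢ A)) (v : T1 → ℂ) :
    y *ᵥ extZ ea v = extZ e (y.submatrix e ea *ᵥ v) := by
  ext i
  by_cases h : ∃ k, e k = i
  · obtain ⟨k, rfl⟩ := h
    rw [extZ_apply he, mulVec, dotProduct, mulVec, dotProduct,
      ← Finset.sum_subset (Finset.subset_univ (Finset.univ.image ea)), Finset.sum_image fun a _ b _ h => ha h]
    · exact Finset.sum_congr rfl fun j _ => by rw [extZ_apply ha, submatrix_apply]
    · intro j _ hj
      rw [extZ_apply' _ (fun k hk => hj (by simp [← hk])), mul_zero]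
  · have h' : ∀ k, e k ≠ i := by push Not at h; exact h
    rw [extZ_apply' _ h', mulVec, dotProduct]
    refine Finset.sum_eq_zero fun j _ => ?_
    by_cases h0 : y i j = 0
    · simp [h0]
    · exact absurd ((hB i).1 (Finset.mem_product.1 (SM_ne hy h0)).1) h

theorem coord_inf_comap_extZ {e : P1 → P} (he : Function.Injective e) {ea : T1 → T}
    (ha : Function.Injective ea) {B : Finset P} {A : Finset T} (hB : ∀ i, i ∈ B ↔ ∃ k, e k = i)
    (hA : ∀ i, i ∈ A ↔ ∃ k, ea k = i) {y : Matrix P T ℂ} (hy : y ∈ SM ℂ (B ×ˢ A))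
    (W : Submodule ℂ (P1 → ℂ)) (X : Finset T) :
    coord ℂ (A ∩ X) ⊓ (W.map (extZ e)).comap (toLin' y) =
      (coord ℂ (Finset.univ.filter fun k => ea k ∈ X) ⊓
        W.comap (toLin' (y.submatrix e ea))).map (extZ ea) := by
  ext v
  constructor
  · rintro ⟨hX, h⟩
    have hv : extZ ea (v ∘ ea) = v := extZ_restrict ha fun i hi =>
      hX i fun h => by
        obtain ⟨k, hk⟩ := (hA i).1 (Finset.mem_inter.1 h).1
        exact hi k hk
    refine ⟨v ∘ ea, ⟨fun k hk => hX _ fun h => hk (by simpa using (Finset.mem_inter.1 h).2), ?_⟩, hv⟩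
    change toLin' y v ∈ W.map (extZ e) at h
    obtain ⟨w, hw, e1⟩ := h
    show toLin' (y.submatrix e ea) (v ∘ ea) ∈ W
    rw [toLin'_apply, ← hv, mulVec_extZ he ha hB hy] at e1
    rw [toLin'_apply, ← extZ_injective he e1]
    exact hw
  · rintro ⟨w, ⟨hX, h⟩, rfl⟩
    refine ⟨fun i hi => ?_, ?_⟩
    · by_cases hk : ∃ k, ea k = i
      · obtain ⟨k, rfl⟩ := hk
        rw [extZ_apply ha]
        exact hX _ fun h => hi (Finset.mem_inter.2 ⟨(hA _).2 ⟨k, rfl⟩, by simpa using h⟩)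
      · push Not at hk
        exact extZ_apply' _ hk
    · show toLin' y (extZ ea w) ∈ W.map (extZ e)
      rw [toLin'_apply, mulVec_extZ he ha hB hy]
      exact ⟨_, h, rfl⟩

variable [PartialOrder P] [PartialOrder P1]

theorem Graded.map_extZ {e : P1 → P} (he : Function.Injective e)
    (hc : ∀ i j, Comp (e i) (e j) → Comp i j) (hc' : ∀ i j, Comp i j → Comp (e i) (e j)) [ChainPoset P]
    {W : Submodule ℂ (P1 → ℂ)} (hW : Graded W) : Graded (W.map (extZ e)) := by
  classical
  rintro _ ⟨v, hv, rfl⟩ i w h h'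
  have hw : extZ e (w ∘ e) = w := by
    refine extZ_restrict he fun j hj => ?_
    by_cases hij : Comp i j
    · rw [h j hij, extZ_apply' _ hj]
    · exact h' j hij
  refine ⟨w ∘ e, ?_, hw⟩
  by_cases hi : ∃ k, Comp i (e k)
  · obtain ⟨k, hk⟩ := hi
    refine hW v hv k _ (fun j hj => ?_) fun j hj => ?_
    · rw [Function.comp, h _ (hk.trans (hc' _ _ hj)), extZ_apply he]
    · exact h' _ fun hij => hj (hc _ _ (hk.symm.trans hij))
  · push Not at hi
    have : w ∘ e = 0 := funext fun j => h' _ (hi j)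
    rw [this]
    exact W.zero_mem

theorem Graded.comap_extZ {e : P1 → P} (he : Function.Injective e)
    (hc : ∀ i j, Comp (e i) (e j) → Comp i j) (hc' : ∀ i j, Comp i j → Comp (e i) (e j))
    {W : Submodule ℂ (P → ℂ)} (hW : Graded W) : Graded (W.comap (extZ e)) := by
  intro v hv i w h h'
  refine hW _ hv (e i) _ (fun j hj => ?_) fun j hj => ?_
  · by_cases hk : ∃ k, e k = j
    · obtain ⟨k, rfl⟩ := hk
      rw [extZ_apply he, extZ_apply he, h _ (hc _ _ hj)]
    · push Not at hk
      rw [extZ_apply' _ hk, extZ_apply' _ hk]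
  · by_cases hk : ∃ k, e k = j
    · obtain ⟨k, rfl⟩ := hk
      rw [extZ_apply he, h' _ fun h => hj (hc' _ _ h)]
    · push Not at hk
      rw [extZ_apply' _ hk]

/-- Indicator weights. -/
noncomputable def indW {ι : Type*} [DecidableEq ι] (D : Finset ι) (i : ι) : ℝ := if i ∈ D then 1 else 0

theorem indW_nonneg {ι : Type*} [DecidableEq ι] (D : Finset ι) (i : ι) : 0 ≤ indW D i := by
  unfold indW; split_ifs <;> norm_num

theorem sum_indW {ι : Type*} [Fintype ι] [DecidableEq ι] (D : Finset ι) (f : ι → ℝ) :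
    ∑ i, indW D i * f i = ∑ i ∈ D, f i := by
  simp [indW, ite_mul, Finset.sum_ite_mem]

variable [PartialOrder T]

/-- The semistability condition for a partial matrix is that of its core block. -/
theorem semi_iff_not_violates [ChainPoset P] {e : P1 → P} (he : Function.Injective e)
    (hc : ∀ i j, Comp (e i) (e j) → Comp i j) (hc' : ∀ i j, Comp i j → Comp (e i) (e j)) {ea : T1 → T}
    (ha : Function.Injective ea) {B : Finset P} {A : Finset T} (hB : ∀ i, i ∈ B ↔ ∃ k, e k = i)
    (hA : ∀ i, i ∈ A ↔ ∃ k, ea k = i) {y : Matrix P T ℂ} (hy : y ∈ SM ℂ (B ×ˢ A))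
    {Dσ : Finset P} {Dτ : Finset T} :
    Semi (indW Dτ) (fun d => Finset.univ.filter fun k => ea k ∈ lowSet d) (indW Dσ)
      (fun d => Finset.univ.filter fun k => e k ∈ lowSet d) Dσ.card (y.submatrix e ea) ↔
    ∀ W, Graded W → W ≤ coord ℂ B → ¬ Violates y Dσ Dτ A W := by
  have key : ∀ W1 : Submodule ℂ (P1 → ℂ), ¬ Violates y Dσ Dτ A (W1.map (extZ e)) ↔
      ∑ i, indW Dτ i * (finrank ℂ (coord ℂ (Finset.univ.filter fun k => ea k ∈ lowSet i) ⊓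
        W1.comap (toLin' (y.submatrix e ea)) : Submodule ℂ (T1 → ℂ)) : ℝ) +
      ∑ i, indW Dσ i * (finrank ℂ (W1 ⊓ coord ℂ (Finset.univ.filter fun k => e k ∈ lowSet i) :
        Submodule ℂ (P1 → ℂ)) : ℝ) ≤ (Dσ.card : ℝ) * finrank ℂ W1 := by
    intro W1
    have h1 : ∀ d : T, finrank ℂ (coord ℂ (A ∩ lowSet d) ⊓ (W1.map (extZ e)).comap
        (toLin' y) : Submodule ℂ (T → ℂ)) = finrank ℂ
        (coord ℂ (Finset.univ.filter fun k => ea k ∈ lowSet d) ⊓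
        W1.comap (toLin' (y.submatrix e ea)) : Submodule ℂ (T1 → ℂ)) := fun d => by
      rw [coord_inf_comap_extZ he ha hB hA hy, finrank_map_of_injective _ (extZ_injective ha)]
    have h2 : ∀ d : P, finrank ℂ (W1.map (extZ e) ⊓ coord ℂ (lowSet d) : Submodule ℂ (P → ℂ)) =
        finrank ℂ (W1 ⊓ coord ℂ (Finset.univ.filter fun k => e k ∈ lowSet d) :
          Submodule ℂ (P1 → ℂ)) := fun d => by
      rw [map_extZ_inf_coord he, finrank_map_of_injective _ (extZ_injective he)]
    rw [sum_indW, sum_indW, Violates, not_lt, finrank_map_of_injective _ (extZ_injective he)]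
    simp only [h1, h2]
    exact_mod_cast Iff.rfl
  constructor
  · intro hS W hW hle
    have h1 : (W.comap (extZ e)).map (extZ e) = W := by
      rw [Submodule.map_comap_eq, inf_eq_right]
      intro v hv
      refine ⟨v ∘ e, extZ_restrict he fun i hi => hle hv i fun h => ?_⟩
      obtain ⟨k, hk⟩ := (hB i).1 h
      exact hi k hk
    rw [← h1, key]
    exact hS _ (hW.comap_extZ he hc hc')
  · intro h W1 hW1
    rw [← key]
    refine h _ (hW1.map_extZ he hc hc') ?_
    rintro _ ⟨v, -, rfl⟩ i hi
    exact extZ_apply' _ fun k hk => hi ((hB i).2 ⟨k, hk⟩)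

end Transport

section Weights

theorem muVec_apply {n r : ℕ} (A : Finset (Fin n)) (h : A.card = r) (k : Fin r) :
    muVec A h k = ((A.orderEmbOfFin h k.rev : Fin n) : ℕ) - ((k.rev : ℕ) : ℝ) := rfl

theorem card_filter_lt_orderEmb {n r : ℕ} (S : Finset (Fin n)) (h : S.card = r) (j : Fin r) :
    (S.filter fun d => d < S.orderEmbOfFin h j).card = (j : ℕ) := by
  have : (S.filter fun d => d < S.orderEmbOfFin h j) = (Finset.Iio j).map (S.orderEmbOfFin h).toEmbedding := by
    ext d
    simp only [Finset.mem_filter, Finset.mem_map, Finset.mem_Iio]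
    constructor
    · rintro ⟨hd, hlt⟩
      have : d ∈ Set.range (S.orderEmbOfFin h) := by rw [Finset.range_orderEmbOfFin]; exact hd
      obtain ⟨i, rfl⟩ := this
      exact ⟨i, (S.orderEmbOfFin h).lt_iff_lt.1 hlt, rfl⟩
    · rintro ⟨i, hi, rfl⟩
      exact ⟨Finset.orderEmbOfFin_mem S h i, (S.orderEmbOfFin h).lt_iff_lt.2 hi⟩
  rw [this, Finset.card_map, Fin.card_Iio]

theorem card_compl_gt {n r : ℕ} (S : Finset (Fin n)) (h : S.card = r) (j : Fin r) :
    ((Sᶜ.filter fun d => ¬ d ≤ S.orderEmbOfFin h j).card : ℝ) =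
      (Sᶜ.card : ℝ) - (((S.orderEmbOfFin h j : Fin n) : ℕ) - ((j : ℕ) : ℝ)) := by
  set x := S.orderEmbOfFin h j
  have hx : x ∈ S := Finset.orderEmbOfFin_mem S h j
  have h1 := Finset.card_filter_add_card_filter_not (s := Sᶜ) (fun d => d ≤ x)
  have h2 : (Sᶜ.filter fun d => d ≤ x).card + (S.filter fun d => d < x).card = (x : ℕ) := by
    rw [← Finset.card_union_of_disjoint, ← Fin.card_Iio x]
    · congr 1
      ext d
      simp only [Finset.mem_union, Finset.mem_filter, Finset.mem_compl, Finset.mem_Iio]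
      constructor
      · rintro (⟨h1, h2⟩ | ⟨_, h⟩)
        · exact lt_of_le_of_ne h2 fun e => h1 (e ▸ hx)
        · exact h
      · intro hd
        by_cases hS : d ∈ S
        · exact Or.inr ⟨hS, hd⟩
        · exact Or.inl ⟨hS, hd.le⟩
    · rw [Finset.disjoint_left]
      intro d hd hd'
      exact (Finset.mem_compl.1 (Finset.mem_filter.1 hd).1) (Finset.mem_filter.1 hd').1
  rw [card_filter_lt_orderEmb] at h2
  rw [← h1, ← h2]
  push_cast
  ring

theorem mem_opp {n : ℕ} {A : Finset (Fin n)} {i : Fin n} : i ∈ opp A ↔ i.rev ∈ A := by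
  simp only [opp, Finset.mem_image]
  constructor
  · rintro ⟨a, ha, rfl⟩; simpa
  · intro h; exact ⟨_, h, by simp⟩

theorem opp_opp {n : ℕ} (A : Finset (Fin n)) : opp (opp A) = A := by ext i; simp [mem_opp]

theorem card_opp {n : ℕ} (A : Finset (Fin n)) : (opp A).card = A.card :=
  Finset.card_image_of_injective _ Fin.rev_injective

theorem orderEmb_opp {n r : ℕ} (A : Finset (Fin n)) (h : A.card = r) (h' : (opp A).card = r)
    (k : Fin r) : (opp A).orderEmbOfFin h' k = (A.orderEmbOfFin h k.rev).rev := by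
  have := Finset.orderEmbOfFin_unique h' (f := fun k => (A.orderEmbOfFin h k.rev).rev)
    (fun k => by simp [mem_opp]) (fun a b hab => by
      simp only [Fin.rev_lt_rev, OrderEmbedding.lt_iff_lt]; exact hab)
  exact (congrFun this k).symm

theorem sum_indW_boole {ι : Type*} [Fintype ι] [DecidableEq ι] (D : Finset ι) (p : ι → Prop)
    [DecidablePred p] : ∑ i, (if p i then indW D i else 0) = ((D.filter p).card : ℝ) := by
  rw [Finset.card_filter, Nat.cast_sum, ← sum_indW D]
  exact Finset.sum_congr rfl fun i _ => by split_ifs <;> simp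

theorem wt_lowSet {P P1 : Type*} [Fintype P] [DecidableEq P] [PartialOrder P] [Fintype P1]
    [DecidableEq P1] [DecidableLE P] (D : Finset P) (e : P1 → P) (k : P1) :
    wt (indW D) (fun d => Finset.univ.filter fun k => e k ∈ lowSet d) k =
      ∑ i, (if ¬ i ≤ e k then indW D i else 0) := by
  unfold wt
  refine Finset.sum_congr rfl fun i _ => ?_
  simp [mem_lowSet]

/-- The embedding of the core index poset. -/
def coreEmb {m n : ℕ} (B : Finset (Fin m)) (C : Finset (Fin n)) :
    Fin B.card ⊕ Fin C.card → Fin m ⊕ Fin n :=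
  Sum.map (B.orderEmbOfFin rfl) (C.orderEmbOfFin rfl)

variable {m n : ℕ} (B : Finset (Fin m)) (C : Finset (Fin n))

theorem coreEmb_injective : Function.Injective (coreEmb B C) :=
  Sum.map_injective.2 ⟨(B.orderEmbOfFin rfl).injective, (C.orderEmbOfFin rfl).injective⟩

theorem coreEmb_comp (i j) : Comp (coreEmb B C i) (coreEmb B C j) ↔ Comp i j := by
  rcases i with i | i <;> rcases j with j | j <;> simp [coreEmb, Comp]

theorem mem_disjSum_iff (i) : i ∈ B.disjSum C ↔ ∃ k, coreEmb B C k = i := by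
  have h1 : ∀ i, i ∈ B ↔ ∃ k, B.orderEmbOfFin rfl k = i := fun i => by
    rw [← Finset.mem_coe, ← Finset.range_orderEmbOfFin B rfl]; rfl
  have h2 : ∀ i, i ∈ C ↔ ∃ k, C.orderEmbOfFin rfl k = i := fun i => by
    rw [← Finset.mem_coe, ← Finset.range_orderEmbOfFin C rfl]; rfl
  rcases i with i | i <;> simp [coreEmb, h1, h2]

theorem mem_iff_orderEmb {n r : ℕ} (A : Finset (Fin n)) (h : A.card = r) (i) :
    i ∈ A ↔ ∃ k, A.orderEmbOfFin h k = i := by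
  rw [← Finset.mem_coe, ← Finset.range_orderEmbOfFin A h]; rfl

theorem wt_opp {N r : ℕ} (A : Finset (Fin N)) (h : A.card = r) (h' : (opp A).card = r) :
    wt (indW (opp A)ᶜ) (fun d => Finset.univ.filter fun k => (opp A).orderEmbOfFin h' k ∈ lowSet d) =
      muVec A h := by
  funext k
  rw [wt_lowSet, sum_indW_boole, card_compl_gt, muVec_apply, orderEmb_opp A h, Finset.card_compl, card_opp,
    Fintype.card_fin, Fin.val_rev, Fin.val_rev, h]
  have h1 := (A.orderEmbOfFin h k.rev).2
  have h2 := k.2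
  have h3 : r ≤ N := by have := A.card_le_univ; simp at this; omega
  rw [Nat.cast_sub h3, Nat.cast_sub (by omega), Nat.cast_sub (by omega)]
  push_cast
  ring

theorem wt_disjSum :
    wt (indW (B.disjSum C)ᶜ) (fun d => Finset.univ.filter fun k => coreEmb B C k ∈ lowSet d) =
      fun k => ((B.disjSum C)ᶜ.card : ℝ) -
        Sum.elim (muVec B rfl ∘ Fin.rev) (muVec C rfl ∘ Fin.rev) k := by
  have hc : (B.disjSum C)ᶜ = Bᶜ.disjSum Cᶜ := by ext (i | i) <;> simp
  have hf : ∀ p : Fin m ⊕ Fin n → Prop, ∀ [DecidablePred p], ((Bᶜ.disjSum Cᶜ).filter p).card =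
      (Bᶜ.filter fun i => p (Sum.inl i)).card + (Cᶜ.filter fun i => p (Sum.inr i)).card := by
    intro p _
    rw [← Finset.card_disjSum]
    congr 1
    ext (i | i) <;> simp
  classical
  funext k
  rw [wt_lowSet, sum_indW_boole, hc, hf]
  rcases k with k | k
  · have e1 : (Bᶜ.filter fun i => ¬ (Sum.inl i : Fin m ⊕ Fin n) ≤ coreEmb B C (Sum.inl k)) =
        Bᶜ.filter fun d => ¬ d ≤ B.orderEmbOfFin rfl k := by ext; simp [coreEmb]
    have e2 : (Cᶜ.filter fun i => ¬ (Sum.inr i : Fin m ⊕ Fin n) ≤ coreEmb B C (Sum.inl k)) = Cᶜ := by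
      ext; simp [coreEmb]
    rw [e1, e2, Nat.cast_add, card_compl_gt B rfl k, Finset.card_disjSum, Nat.cast_add, Sum.elim_inl,
      Function.comp, muVec_apply, Fin.rev_rev]
    ring
  · have e1 : (Cᶜ.filter fun i => ¬ (Sum.inr i : Fin m ⊕ Fin n) ≤ coreEmb B C (Sum.inr k)) =
        Cᶜ.filter fun d => ¬ d ≤ C.orderEmbOfFin rfl k := by ext; simp [coreEmb]
    have e2 : (Bᶜ.filter fun i => ¬ (Sum.inl i : Fin m ⊕ Fin n) ≤ coreEmb B C (Sum.inr k)) = Bᶜ := by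
      ext; simp [coreEmb]
    rw [e1, e2, Nat.cast_add, card_compl_gt C rfl k, Finset.card_disjSum, Nat.cast_add, Sum.elim_inr,
      Function.comp, muVec_apply, Fin.rev_rev]
    ring

end Weights

section Necessity

variable {m n : ℕ}

theorem comp_map_rev {i j : Fin m ⊕ Fin n} (h : Comp i j) :
    Comp (Sum.map Fin.rev Fin.rev i) (Sum.map Fin.rev Fin.rev j) := by
  rcases i with i | i <;> rcases j with j | j <;> simp_all [Comp, or_comm]

theorem semi_of_mem_LRcone (B : Finset (Fin m)) (C : Finset (Fin n)) {N : ℕ} (A : Finset (Fin N))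
    (hA : A.card = B.card + C.card) (hA' : (opp A).card = B.card + C.card)
    (h : (muVec A hA, muVec B rfl, muVec C rfl) ∈ LRcone B.card C.card) :
    ∃ g : Matrix (Fin B.card ⊕ Fin C.card) (Fin (B.card + C.card)) ℂ, IsU g ∧
      Semi (indW (opp A)ᶜ) (fun d => Finset.univ.filter fun k => (opp A).orderEmbOfFin hA' k ∈ lowSet d)
        (indW (B.disjSum C)ᶜ) (fun d => Finset.univ.filter fun k => coreEmb B C k ∈ lowSet d)
        (B.disjSum C)ᶜ.card g := by
  obtain ⟨M, hM, e1, e2, e3⟩ := h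
  simp only at e1 e2 e3
  obtain ⟨g, hg, hd⟩ := exists_diagonal_blocks M hM
  rw [← e1, ← e2, ← e3] at hd
  let σ : Fin B.card ⊕ Fin C.card ≃ Fin B.card ⊕ Fin C.card := Equiv.sumCongr Fin.revPerm Fin.revPerm
  have hσ : ∀ i, σ i = Sum.map Fin.rev Fin.rev i := fun i => rfl
  have hgσ := hg.submatrix σ (Equiv.refl _)
  refine ⟨_, hgσ, semi_of_unitary (indW_nonneg _) _ (indW_nonneg _) _ hgσ.left ?_⟩
  rw [wt_opp A hA, wt_disjSum]
  intro i j hij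
  have h1 := hd _ _ (comp_map_rev hij)
  rw [conjTranspose_submatrix]
  have h2 : (g.submatrix σ (Equiv.refl _) * rdiag (muVec A hA) *
      gᴴ.submatrix (Equiv.refl _) σ : Matrix _ _ ℂ) = (g * rdiag (muVec A hA) * gᴴ).submatrix σ σ := rfl
  rw [h2, Matrix.add_apply, submatrix_apply, hσ, hσ, h1]
  by_cases e : i = j
  · subst e
    rcases i with i | i <;> simp [rdiag]
  · have e' : Sum.map Fin.rev Fin.rev i ≠ Sum.map Fin.rev Fin.rev j := by
      rw [← hσ, ← hσ]; exact fun h => e (σ.injective h)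
    simp [rdiag, Matrix.diagonal_apply_ne _ e, Matrix.diagonal_apply_ne _ e', Matrix.one_apply_ne e]

/-- Extension of a matrix by zero. -/
noncomputable def extM {P T P1 T1 : Type*} (e : P1 → P) (ea : T1 → T) (g : Matrix P1 T1 ℂ) : Matrix P T ℂ :=
  fun i j => extZ e (fun k => extZ ea (fun l => g k l) j) i

theorem extM_submatrix {P T P1 T1 : Type*} {e : P1 → P} (he : Function.Injective e) {ea : T1 → T}
    (ha : Function.Injective ea) (g : Matrix P1 T1 ℂ) : (extM e ea g).submatrix e ea = g := by
  refine Matrix.ext fun i j => ?_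
  rw [submatrix_apply, extM, extZ_apply he, extZ_apply ha]

theorem extM_mem {P T P1 T1 : Type*} {e : P1 → P} (he : Function.Injective e) {ea : T1 → T}
    {B : Finset P} {A : Finset T} (hB : ∀ i, i ∈ B ↔ ∃ k, e k = i)
    (hA : ∀ i, i ∈ A ↔ ∃ k, ea k = i) (g : Matrix P1 T1 ℂ) : extM e ea g ∈ SM ℂ (B ×ˢ A) := by
  intro i j h
  rw [Finset.mem_product, not_and_or, hB, hA] at h
  push Not at h
  rw [extM]
  rcases h with h | h
  · exact extZ_apply' _ h
  · have : (fun k => extZ ea (fun l => g k l) j) = 0 := funext fun k => extZ_apply' _ h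
    rw [this, map_zero]; rfl

theorem necessity (M : Matrix (Fin (m + n)) (Fin (m + n)) ℂ) (hM : M.IsHermitian)
    (A : Finset (Fin (m + n))) (B : Finset (Fin m)) (C : Finset (Fin n))
    (hA : A.card = B.card + C.card)
    (h : (muVec A hA, muVec B rfl, muVec C rfl) ∈ LRcone B.card C.card) :
    ∑ i ∈ B, eigVec (M.submatrix (Fin.castAdd n) (Fin.castAdd n)) (hM.submatrix _) i +
      ∑ i ∈ C, eigVec (M.submatrix (Fin.natAdd m) (Fin.natAdd m)) (hM.submatrix _) i ≤
    ∑ i ∈ A, eigVec M hM i := by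
  have hA' : (opp A).card = B.card + C.card := by rw [card_opp, hA]
  obtain ⟨g', hg', hS⟩ := semi_of_mem_LRcone B C A hA hA' h
  have he := coreEmb_injective B C
  have ha := ((opp A).orderEmbOfFin hA').injective
  have hB := mem_disjSum_iff B C
  have hA2 := mem_iff_orderEmb (opp A) hA'
  set y := extM (coreEmb B C) ((opp A).orderEmbOfFin hA') g' with hy
  have hym : y ∈ SM ℂ (B.disjSum C ×ˢ opp A) := extM_mem he hB hA2 g'
  have hyg : y.submatrix (coreEmb B C) ((opp A).orderEmbOfFin hA') = g' := extM_submatrix he ha g'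
  rw [← hyg, semi_iff_not_violates he (fun i j => (coreEmb_comp B C i j).1)
    (fun i j => (coreEmb_comp B C i j).2) ha hB hA2 hym] at hS
  have hcard : (B.disjSum C).card = (opp A).card := by rw [Finset.card_disjSum, hA']
  have hD : (B.disjSum C)ᶜ.card = (opp A)ᶜ.card := by
    rw [Finset.card_compl, Finset.card_compl, hcard]; simp
  have hinj : ∀ v ∈ coord ℂ (opp A), y *ᵥ v = 0 → v = 0 := by
    intro v hv h0
    have e1 : extZ ((opp A).orderEmbOfFin hA') (v ∘ (opp A).orderEmbOfFin hA') = v :=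
      extZ_restrict ha fun i hi => hv i fun h => by
        obtain ⟨k, hk⟩ := (hA2 i).1 h
        exact hi k hk
    rw [← e1, mulVec_extZ he ha hB hym, hyg, ← map_zero (extZ (coreEmb B C))] at h0
    have h1 := congrArg (g'ᴴ *ᵥ ·) (extZ_injective he h0)
    simp only [mulVec_mulVec, hg'.left, one_mulVec, mulVec_zero] at h1
    rw [← e1, h1, map_zero]
  have hT : Trans (emb (genY (B.disjSum C) (opp A))) (emb (genZ (B.disjSum C)ᶜ (opp A)ᶜ))
      (B.disjSum C)ᶜ (B.disjSum C) (opp A)ᶜ (opp A) := by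
    by_contra hT
    obtain ⟨W, hW, hle, hv⟩ := exists_violates_of_not_trans hD _ _ _ rfl hcard hT y hym hinj
    exact hS W hW hle hv
  obtain ⟨x, hx⟩ := exists_eval_of_trans hT
  obtain ⟨g0, hg0, hd⟩ := exists_diagonal_blocks M hM
  set l := eigVec M hM
  set ρ : Fin m ⊕ Fin n → ℝ := Sum.elim
    (eigVec (M.submatrix (Fin.castAdd n) (Fin.castAdd n)) (hM.submatrix _))
    (eigVec (M.submatrix (Fin.natAdd m) (Fin.natAdd m)) (hM.submatrix _)) with hρ
  have hgr := hg0.submatrix (Equiv.refl _) (Fin.revPerm : Fin (m + n) ≃ Fin (m + n))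
  set g : Matrix (Fin m ⊕ Fin n) (Fin (m + n)) ℂ := g0.submatrix (Equiv.refl _) Fin.revPerm with hg
  obtain ⟨W, hW⟩ := exists_inc_of_trans (evm_mem x (emb_genY_mem _ _)) (evm_mem x (emb_genZ_mem _ _)) hx g
  obtain ⟨Q, hQ, htr⟩ := exists_proj W
  have hρa : Antitone ρ := by
    rintro (i | i) (j | j) hij
    · exact eigVec_antitone _ _ (Sum.inl_le_inl_iff.1 hij)
    · exact absurd hij Sum.not_inl_le_inr
    · exact absurd hij Sum.not_inr_le_inl
    · exact eigVec_antitone _ _ (Sum.inr_le_inr_iff.1 hij)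
  have h1 := sum_le_trace hρa hQ htr (g := 1) (by simp) (by simp) hW.rank (fun X hX => by
    have := hW.left X hX
    rwa [inf_comm, show W.comap (toLin' (1 : SqMat (Fin m ⊕ Fin n))) = W by
      rw [toLin'_one]; rfl])
  have hla : Antitone (fun t : Fin (m + n) => - l t.rev) := fun a b hab =>
    neg_le_neg (eigVec_antitone _ _ (Fin.rev_le_rev.2 hab))
  have h2 := sum_le_trace hla hQ htr hgr.left hgr.right (A := opp A) (by rw [hW.rank, hcard])
    (fun X hX => by
      have := hW.right X hX
      rwa [Finset.univ_inter] at this)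
  have h3 : (g * rdiag (fun t : Fin (m + n) => - l t.rev) * gᴴ : Matrix _ _ ℂ) =
      - (g0 * rdiag l * g0ᴴ) := by
    have e1 : rdiag (fun t : Fin (m + n) => - l t.rev) = - (rdiag l).submatrix Fin.revPerm Fin.revPerm := by
      refine Matrix.ext fun i j => ?_
      by_cases hij : i = j
      · subst hij; simp [rdiag]
      · simp [rdiag, Matrix.diagonal_apply_ne _ hij]
    have e2 : ((g0.submatrix (Equiv.refl _) Fin.revPerm : Matrix (Fin m ⊕ Fin n) (Fin (m + n)) ℂ) *
        (rdiag l).submatrix Fin.revPerm Fin.revPerm *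
        g0ᴴ.submatrix Fin.revPerm (Equiv.refl _) : Matrix _ _ ℂ) = g0 * rdiag l * g0ᴴ := by
      rw [submatrix_mul_equiv, submatrix_mul_equiv]; rfl
    rw [e1, hg, conjTranspose_submatrix, ← e2, Matrix.mul_neg, Matrix.neg_mul]
  have h4 := trace_mul_eq_of_graded (gradedMat_proj hW.graded hQ.herm hQ.mem hQ.fix) hd
  rw [h3, Matrix.mul_neg, Matrix.trace_neg, h4, Complex.neg_re, Finset.sum_neg_distrib] at h2
  rw [Matrix.one_mul, conjTranspose_one, Matrix.mul_one, Finset.sum_disjSum] at h1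
  have h5 : ∑ t ∈ opp A, l t.rev = ∑ t ∈ A, l t := by
    rw [opp, Finset.sum_image fun a _ b _ h => Fin.rev_injective h]
    simp
  rw [h5] at h2
  simp only [hρ, Sum.elim_inl, Sum.elim_inr] at h1
  linarith

end Necessity

section Determinants

open scoped ComplexOrder

theorem exists_isU_diag {S : Type*} [Fintype S] [DecidableEq S] {M : Matrix S S ℂ}
    (hM : M.IsHermitian) : ∃ (U : Matrix S S ℂ) (y : S → ℝ), IsU U ∧ M = U * rdiag y * Uᴴ := by
  refine ⟨hM.eigenvectorUnitary, hM.eigenvalues, ⟨Unitary.coe_star_mul_self hM.eigenvectorUnitary,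
    Unitary.coe_mul_star_self hM.eigenvectorUnitary⟩, ?_⟩
  have := hM.spectral_theorem
  rw [Unitary.conjStarAlgAut_apply] at this
  exact this

theorem det_conj_isU {S : Type*} [Fintype S] [DecidableEq S] {U : Matrix S S ℂ} (hU : IsU U)
    (M : Matrix S S ℂ) : (U * M * Uᴴ).det = M.det := by
  rw [Matrix.det_mul_comm, ← Matrix.mul_assoc, hU.left, Matrix.one_mul]

theorem diag_conj_nonneg {P T : Type*} [Fintype P] [DecidableEq P] [Fintype T] {M : Matrix P P ℂ}
    (hM : M.PosSemidef) (U : Matrix P T ℂ) (t : T) : 0 ≤ ((Uᴴ * M * U) t t).re :=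
  (Complex.le_def.1 ((hM.conjTranspose_mul_mul_same U).diag_nonneg (i := t))).1

theorem eq_of_eq_conj {S : Type*} [Fintype S] [DecidableEq S] {U M : Matrix S S ℂ} (hU : IsU U)
    {y : S → ℝ} (h : M = U * rdiag y * Uᴴ) : Uᴴ * M * U = rdiag y := by
  rw [h, Matrix.mul_assoc U, ← Matrix.mul_assoc, ← Matrix.mul_assoc, hU.left, Matrix.one_mul,
    Matrix.mul_assoc, hU.left, Matrix.mul_one]

theorem det_rdiag {S : Type*} [Fintype S] [DecidableEq S] (y : S → ℝ) :
    (rdiag y).det = ((∏ i, y i : ℝ) : ℂ) := by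
  rw [rdiag, Matrix.det_diagonal]
  push_cast
  rfl

theorem one_le_norm_det_one_add {S : Type*} [Fintype S] [DecidableEq S] {M : Matrix S S ℂ}
    (hM : M.PosSemidef) : 1 ≤ ‖(1 + M).det‖ := by
  obtain ⟨U, y, hU, h⟩ := exists_isU_diag hM.isHermitian
  have hy : ∀ i, 0 ≤ y i := by
    intro i
    have := diag_conj_nonneg hM U i
    rw [eq_of_eq_conj hU h] at this
    simpa [rdiag] using this
  have h1 : 1 + M = U * rdiag (fun i => 1 + y i) * Uᴴ := by
    have : rdiag (fun i => 1 + y i) = 1 + rdiag y := by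
      refine Matrix.ext fun i j => ?_
      by_cases hij : i = j <;> simp [rdiag, hij, Matrix.one_apply]
    rw [this, Matrix.mul_add, Matrix.add_mul, Matrix.mul_one, hU.right, ← h]
  rw [h1, det_conj_isU hU, det_rdiag, Complex.norm_real, Real.norm_eq_abs]
  refine le_trans ?_ (le_abs_self _)
  calc (1 : ℝ) = ∏ _i : S, (1 : ℝ) := by simp
    _ ≤ _ := Finset.prod_le_prod (fun _ _ => zero_le_one) fun i _ => by linarith [hy i]

theorem log_norm_det_le {S : Type*} [Fintype S] [DecidableEq S] {M : Matrix S S ℂ}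
    (hM : M.PosDef) : Real.log ‖M.det‖ ≤ (trace M).re - Fintype.card S := by
  obtain ⟨U, y, hU, h⟩ := exists_isU_diag hM.isHermitian
  have hy0 : ∀ i, 0 ≤ y i := by
    intro i
    have := diag_conj_nonneg hM.posSemidef U i
    rw [eq_of_eq_conj hU h] at this
    simpa [rdiag] using this
  have hd : M.det = ((∏ i, y i : ℝ) : ℂ) := by rw [h, det_conj_isU hU, det_rdiag]
  have hne : ∏ i, y i ≠ 0 := by
    have := hM.det_pos.ne'
    rw [hd] at this
    exact_mod_cast this
  have hy : ∀ i, 0 < y i := fun i =>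
    lt_of_le_of_ne (hy0 i) fun h => hne (Finset.prod_eq_zero (Finset.mem_univ i) h.symm)
  have ht : trace M = ((∑ i, y i : ℝ) : ℂ) := by
    rw [h, trace_mul_comm, ← Matrix.mul_assoc, hU.left, Matrix.one_mul, rdiag,
      Matrix.trace_diagonal]
    push_cast
    rfl
  rw [hd, ht, Complex.norm_real, Real.norm_eq_abs, Real.log_abs, Real.log_prod (fun i _ => (hy i).ne'),
    Complex.ofReal_re]
  calc ∑ i, Real.log (y i) ≤ ∑ i, (y i - 1) :=
        Finset.sum_le_sum fun i _ => Real.log_le_sub_one_of_pos (hy i)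
    _ = _ := by simp

theorem rdiag_mul {S : Type*} [Fintype S] [DecidableEq S] (a b : S → ℝ) :
    rdiag a * rdiag b = rdiag fun i => a i * b i := by
  rw [rdiag, rdiag, Matrix.diagonal_mul_diagonal, rdiag]
  congr 1
  funext i
  push_cast
  rfl

theorem rdiag_one {S : Type*} [Fintype S] [DecidableEq S] : rdiag (fun _ : S => (1 : ℝ)) = 1 := by
  simp [rdiag]

theorem minor_le_norm_det {K S : Type*} [Fintype K] [DecidableEq K] [Fintype S] [DecidableEq S]
    (F : Matrix K S ℂ) (B : Finset K) (e : S ≃ B) {d : K → ℝ} (hd : ∀ i, 0 < d i) :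
    ‖(F.submatrix (fun s => (e s : K)) id).det‖ ^ 2 * ∏ b ∈ B, d b ≤ ‖(Fᴴ * rdiag d * F).det‖ := by
  classical
  set F0 := F.submatrix (fun s => (e s : K)) id with hF0
  by_cases h0 : F0.det = 0
  · simp [h0]
  let σ : S → K := fun s => e s
  let G : Matrix S S ℂ := rdiag (fun s => Real.sqrt (d (σ s))) * F0
  have hdet : ‖G.det‖ ^ 2 = ‖F0.det‖ ^ 2 * ∏ b ∈ B, d b := by
    rw [Matrix.det_mul, det_rdiag, norm_mul, mul_pow, Complex.norm_real, Real.norm_eq_abs, sq_abs,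
      ← Finset.prod_pow, mul_comm]
    congr 1
    rw [← Finset.prod_coe_sort B d]
    exact Fintype.prod_equiv e _ _ fun s => Real.sq_sqrt (hd _).le
  have hprod : 0 < ∏ b ∈ B, d b := Finset.prod_pos fun b _ => hd b
  have hG : IsUnit G.det := by
    rw [isUnit_iff_ne_zero]
    intro h
    rw [h] at hdet
    have : 0 < ‖F0.det‖ := norm_pos_iff.2 h0
    simp at hdet
    rcases hdet with h | h
    · exact h0 h
    · exact hprod.ne' h
  let H : Matrix K S ℂ := rdiag (fun i => if i ∈ B then 0 else Real.sqrt (d i)) * F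
  have hsum : Fᴴ * rdiag d * F = Gᴴ * G + Hᴴ * H := by
    have h1 : Gᴴ * G = F0ᴴ * rdiag (fun s => d (σ s)) * F0 := by
      rw [conjTranspose_mul, rdiag_conjTranspose, Matrix.mul_assoc, ← Matrix.mul_assoc (rdiag _),
        rdiag_mul, ← Matrix.mul_assoc]
      congr 3
      funext s
      exact Real.mul_self_sqrt (hd _).le
    have h2 : Hᴴ * H = Fᴴ * rdiag (fun i => if i ∈ B then 0 else d i) * F := by
      rw [conjTranspose_mul, rdiag_conjTranspose, Matrix.mul_assoc, ← Matrix.mul_assoc (rdiag _),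
        rdiag_mul, ← Matrix.mul_assoc]
      congr 3
      funext s
      split_ifs
      · simp
      · exact Real.mul_self_sqrt (hd _).le
    have h3 : ∀ {K' : Type _} [Fintype K'] [DecidableEq K'] (F : Matrix K' S ℂ) (d : K' → ℝ) (a b : S),
        (Fᴴ * rdiag d * F) a b = ∑ i, star (F i a) * d i * F i b := by
      intro K' _ _ F d a b
      rw [Matrix.mul_apply]
      refine Finset.sum_congr rfl fun i _ => ?_
      rw [rdiag, Matrix.mul_diagonal, conjTranspose_apply]
    rw [h1, h2]
    refine Matrix.ext fun a b => ?_
    rw [Matrix.add_apply, h3, h3]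
    have h4 : (F0ᴴ * rdiag (fun s => d (σ s)) * F0) a b = ∑ i ∈ B, star (F i a) * d i * F i b := by
      rw [Matrix.mul_apply, ← Finset.sum_coe_sort B]
      refine Fintype.sum_equiv e _ _ fun i => ?_
      rw [rdiag, Matrix.mul_diagonal, conjTranspose_apply]
      rfl
    rw [h4, ← Finset.sum_filter_add_sum_filter_not Finset.univ (fun i => i ∈ B)]
    congr 1
    · exact Finset.sum_congr (by simp) fun i _ => rfl
    · rw [Finset.sum_filter]
      refine Finset.sum_congr rfl fun i _ => ?_
      by_cases hi : i ∈ B <;> simp [hi]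
  clear_value G H
  have hfac : Fᴴ * rdiag d * F = Gᴴ * (1 + (H * G⁻¹)ᴴ * (H * G⁻¹)) * G := by
    rw [hsum, Matrix.mul_add, Matrix.add_mul, Matrix.mul_one, ← Matrix.mul_assoc Gᴴ, ← conjTranspose_mul,
      Matrix.nonsing_inv_mul_cancel_right _ _ hG, Matrix.mul_assoc Hᴴ,
      Matrix.nonsing_inv_mul_cancel_right _ _ hG]
  rw [← hdet, hfac, Matrix.det_mul, Matrix.det_mul, norm_mul, norm_mul, Matrix.det_conjTranspose,
    norm_star]
  have h5 := one_le_norm_det_one_add (Matrix.posSemidef_conjTranspose_mul_self (H * G⁻¹))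
  nlinarith [sq_nonneg ‖G.det‖]

end Determinants

section LowerBound

open Filter Topology

theorem sum_mul_monotone_nonneg {K : Type*} [Fintype K] [DecidableEq K] [LinearOrder K] {w a : K → ℝ}
    (ha : Monotone a)
    (h1 : ∀ Z : Finset K, IsLowerSet (Z : Set K) → ∑ b ∈ Z, w b ≤ 0) (h2 : ∑ b, w b = 0) :
    0 ≤ ∑ b, w b * a b := by
  classical
  obtain ⟨C, hC⟩ : ∃ C, ∀ b, a b ≤ C := by
    refine ⟨∑ b, |a b|, fun b => (le_abs_self _).trans ?_⟩
    exact Finset.single_le_sum (f := fun b => |a b|) (fun _ _ => abs_nonneg _) (Finset.mem_univ b)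
  obtain ⟨γ, hγ0, hγ1, hγ⟩ := exists_layerCake _ (fun b => C - a b)
    (fun x y hxy => by have := ha hxy; show C - a y ≤ C - a x; linarith) (fun b => by have := hC b; show 0 ≤ C - a b; linarith) rfl
  have h3 : ∑ b, w b * (C - a b) = ∑ Z, γ Z * ∑ b ∈ Z, w b := by
    have : ∀ b, C - a b = ∑ Z : Finset K, if b ∈ Z then γ Z else 0 := fun b => (congrFun hγ b).symm
    simp_rw [this, Finset.mul_sum]
    rw [Finset.sum_comm]
    refine Finset.sum_congr rfl fun Z _ => ?_
    rw [← Finset.sum_filter_add_sum_filter_not Finset.univ (fun b => b ∈ Z)]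
    rw [Finset.sum_eq_zero (s := Finset.univ.filter fun b => b ∉ Z), add_zero]
    · refine Finset.sum_congr (by simp) fun b hb => ?_
      rw [if_pos hb, mul_comm]
    · intro b hb
      rw [if_neg (by simpa using hb), mul_zero]
  have h4 : ∑ Z, γ Z * ∑ b ∈ Z, w b ≤ 0 := Finset.sum_nonpos fun Z _ => by
    by_cases hZ : γ Z = 0
    · simp [hZ]
    · exact mul_nonpos_of_nonneg_of_nonpos (hγ0 Z) (h1 Z (hγ1 Z hZ))
  simp_rw [mul_sub] at h3
  rw [Finset.sum_sub_distrib, ← Finset.sum_mul, h2] at h3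
  linarith

/-- The submatrix of columns with index in `X`. -/
def cols {P T : Type*} (M : Matrix P T ℂ) (X : Finset T) : Matrix P X ℂ := M.submatrix id Subtype.val

theorem cols_mulVec {P T : Type*} [Fintype T] (M : Matrix P T ℂ) {X : Finset T} {w : T → ℂ} (hw : w ∈ coord ℂ X) :
    cols M X *ᵥ (fun t => w t) = M *ᵥ w := by
  funext i
  simp only [mulVec, dotProduct, cols, submatrix_apply, id]
  rw [Finset.sum_coe_sort X fun t => M i t * w t]
  refine Finset.sum_subset (Finset.subset_univ _) fun t _ ht => ?_
  rw [hw t ht, mul_zero]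

variable {P T : Type*} [Fintype P] [DecidableEq P] [Fintype T] [DecidableEq T]

/-- The logarithm of the Gram determinant of the columns in `X`, for the form `h`. -/
noncomputable def lgram (h : Matrix P P ℂ) (M : Matrix P T ℂ) (X : Finset T) : ℝ :=
  Real.log ‖((cols M X)ᴴ * h * cols M X).det‖

theorem exists_local_bound {K : Type*} [Fintype K] [DecidableEq K] [LinearOrder K] {g : Matrix P T ℂ}
    (hg : Function.Injective (toLin' g)) (X : Finset T) {U₀ : Matrix P K ℂ} (hU₀ : IsU U₀) :
    ∃ B : Finset K, B.card = X.card ∧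
      (∀ Z : Finset K, IsLowerSet (Z : Set K) → (B ∩ Z).card =
        finrank ℂ (coord ℂ X ⊓ ((coord ℂ Z).map (toLin' U₀)).comap (toLin' g) :
          Submodule ℂ (T → ℂ))) ∧
      ∃ C : ℝ, ∀ᶠ U in 𝓝 U₀, ∀ d : K → ℝ, (∀ i, 0 < d i) →
        C + ∑ b ∈ B, Real.log (d b) ≤ lgram (U * rdiag d * Uᴴ) g X := by
  classical
  have hUinj : Function.Injective (toLin' U₀ᴴ) :=
    mulVec_injective_of_left_inv (N := U₀) hU₀.right
  have hinj : Function.Injective (toLin' (U₀ᴴ * g)) := by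
    rw [toLin'_mul]
    exact hUinj.comp hg
  obtain ⟨B, φ, hφ, hY, -⟩ := exists_ech ((coord ℂ X).map (toLin' (U₀ᴴ * g))) (graded_of_linear _)
  have hcard : B.card = X.card := by
    rw [← finrank_ech hφ, ← hY, finrank_map_of_injective _ hinj, finrank_coord]
  refine ⟨B, hcard, fun Z hZ => ?_, ?_⟩
  · rw [← finrank_ech_inf hZ hφ, ← hY, ← finrank_map_of_injective _ hinj]
    have hsub : (coord ℂ X).map (toLin' (U₀ᴴ * g)) ⊓ coord ℂ Z =
        (coord ℂ X ⊓ ((coord ℂ Z).map (toLin' U₀)).comap (toLin' g)).map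
          (toLin' (U₀ᴴ * g)) := ?_
    · rw [hsub]
    ext v
    constructor
    · rintro ⟨⟨w, hw, rfl⟩, hZ⟩
      refine ⟨w, ⟨hw, ⟨_, hZ, ?_⟩⟩, rfl⟩
      rw [toLin'_apply, toLin'_apply, toLin'_apply, mulVec_mulVec,
        ← Matrix.mul_assoc, hU₀.right, Matrix.one_mul]
    · rintro ⟨w, ⟨hw, ⟨z, hz, hzw⟩⟩, rfl⟩
      refine ⟨⟨w, hw, rfl⟩, ?_⟩
      rw [toLin'_apply, toLin'_apply] at hzw
      rw [toLin'_apply, ← mulVec_mulVec, ← hzw, mulVec_mulVec, hU₀.left,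
        one_mulVec]
      exact hz
  · let e : X ≃ B := Fintype.equivOfCardEq (by simp [hcard])
    let δ : Matrix P K ℂ → ℂ := fun U => ((Uᴴ * cols g X).submatrix (fun s => (e s : K)) id).det
    have hδ0 : δ U₀ ≠ 0 := by
      intro h0
      obtain ⟨v, hv, h⟩ := Matrix.exists_mulVec_eq_zero_iff.2 h0
      refine hv ?_
      let w : T → ℂ := fun t => if ht : t ∈ X then v ⟨t, ht⟩ else 0
      have hw : w ∈ coord ℂ X := fun t ht => dif_neg ht
      have hwv : v = fun t : X => w t := by
        funext t
        simp [w]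
      have h1 : ∀ b ∈ B, ((U₀ᴴ * g) *ᵥ w) b = 0 := by
        intro b hb
        have h2 := congrFun h (e.symm ⟨b, hb⟩)
        rw [hwv] at h2
        have h3 : ((U₀ᴴ * cols g X) *ᵥ fun t : X => w t) b = 0 := by
          simpa [mulVec, dotProduct] using h2
        rwa [← mulVec_mulVec, cols_mulVec g hw, mulVec_mulVec] at h3
      have h2 : (U₀ᴴ * g) *ᵥ w ∈ ech B φ := by
        rw [← hY]
        exact ⟨w, hw, rfl⟩
      obtain ⟨z, hz, hz2⟩ := mem_ech'.1 h2
      have hz0 : z = 0 := by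
        funext b
        by_cases hb : b ∈ B
        · have h3 := h1 b hb
          rw [hz2, Pi.add_apply] at h3
          have h4 : (φ *ᵥ z) b = 0 :=
            SM_mulVec hφ hz (Y := Bᶜ) (fun i j h _ => (mem_tri.1 h).1) b (by simpa using hb)
          simpa [h4] using h3
        · exact hz b hb
      rw [hz0, mulVec_zero, add_zero] at hz2
      have hw0 : w = 0 := hinj (by rw [toLin'_apply, hz2, map_zero])
      rw [hwv, hw0]
      rfl
    have hδc : Continuous δ := by
      refine Continuous.matrix_det (Continuous.matrix_submatrix ?_ _ _)
      fun_prop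
    have hpos : 0 < ‖δ U₀‖ := norm_pos_iff.2 hδ0
    refine ⟨Real.log ((‖δ U₀‖ / 2) ^ 2), ?_⟩
    have hev : ∀ᶠ U in 𝓝 U₀, ‖δ U₀‖ / 2 < ‖δ U‖ :=
      (hδc.norm.tendsto U₀).eventually (lt_mem_nhds (by linarith))
    filter_upwards [hev] with U hU d hd
    have h1 := minor_le_norm_det (Uᴴ * cols g X) B e hd
    have h2 : (Uᴴ * cols g X)ᴴ * rdiag d * (Uᴴ * cols g X) =
        (cols g X)ᴴ * (U * rdiag d * Uᴴ) * cols g X := by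
      simp only [conjTranspose_mul, conjTranspose_conjTranspose, Matrix.mul_assoc]
    rw [h2] at h1
    have hprod : 0 < ∏ b ∈ B, d b := Finset.prod_pos fun b _ => hd b
    have h3 : (‖δ U₀‖ / 2) ^ 2 * ∏ b ∈ B, d b ≤
        ‖((cols g X)ᴴ * (U * rdiag d * Uᴴ) * cols g X).det‖ := by
      refine le_trans ?_ h1
      refine mul_le_mul_of_nonneg_right ?_ hprod.le
      exact pow_le_pow_left₀ (by positivity) hU.le 2
    rw [← Real.log_prod (fun b _ => (hd b).ne'), ← Real.log_mul (by positivity) hprod.ne']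
    exact Real.log_le_log (by positivity) h3

variable [PartialOrder P] [ChainPoset P] {ι ι' : Type*} [Fintype ι] [Fintype ι']

/-- Each column of the matrix is supported on pairwise comparable rows. -/
def ColGraded {K : Type*} (U : Matrix P K ℂ) : Prop := ∀ t i j, ¬ Comp i j → U i t * U j t = 0

theorem graded_map_coord {K : Type*} [Fintype K] [DecidableEq K] {U : Matrix P K ℂ}
    (hU : ColGraded U) (Z : Finset K) : Graded ((coord ℂ Z).map (toLin' U)) := by
  classical
  rintro _ ⟨z, hz, rfl⟩ i w hw1 hw2
  refine ⟨fun t => if ∃ j, Comp i j ∧ U j t ≠ 0 then z t else 0, fun t ht => ?_, ?_⟩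
  · simp [hz t ht]
  · funext k
    rw [toLin'_apply]
    by_cases hk : Comp i k
    · rw [hw1 k hk, toLin'_apply]
      simp only [mulVec, dotProduct]
      refine Finset.sum_congr rfl fun t _ => ?_
      by_cases h0 : U k t = 0
      · simp [h0]
      · rw [if_pos ⟨k, hk, h0⟩]
    · rw [hw2 k hk]
      simp only [mulVec, dotProduct]
      refine Finset.sum_eq_zero fun t _ => ?_
      split_ifs with h
      · obtain ⟨j, hj, hjt⟩ := h
        have : ¬ Comp j k := fun h => hk (hj.trans h)
        have h1 := hU t j k this
        rcases mul_eq_zero.1 h1 with h | h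
        · exact absurd h hjt
        · rw [h, zero_mul]
      · rw [mul_zero]

theorem sum_wt_left (c : ι → ℝ) (X : ι → Finset T) (a : T → ℝ) :
    ∑ t, wt c X t * a t = ∑ i, c i * ∑ t ∈ X i, a t := by
  simp only [wt, Finset.sum_mul]
  rw [Finset.sum_comm]
  refine Finset.sum_congr rfl fun i _ => ?_
  rw [Finset.mul_sum, ← Finset.sum_filter_add_sum_filter_not Finset.univ (fun b => b ∈ X i)]
  rw [Finset.sum_eq_zero (s := Finset.univ.filter fun b => b ∉ X i), add_zero]
  · refine Finset.sum_congr (by simp) fun b hb => ?_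
    rw [if_pos hb]
  · intro b hb
    rw [if_neg (by simpa using hb), zero_mul]

theorem Semi.exists_lower_bound {k : ℕ} {c : ι → ℝ} (hc : ∀ i, 0 ≤ c i) {X : ι → Finset T} {c' : ι' → ℝ}
    (hc' : ∀ i, 0 ≤ c' i) {X' : ι' → Finset P} {κ : ℝ} {g : Matrix P T ℂ}
    (hg : Function.Injective (toLin' g)) (h : Semi c X c' X' κ g)
    (heq : ∑ i, c i * ((X i).card : ℝ) + ∑ i, c' i * ((X' i).card : ℝ) = κ * k) :
    ∃ C : ℝ, ∀ U : Matrix P (Fin k) ℂ, IsU U → ColGraded U → ∀ d : Fin k → ℝ, (∀ i, 0 < d i) →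
      Monotone d → C ≤ ∑ i, c i * lgram (U * rdiag d * Uᴴ) g (X i) +
        ∑ i, c' i * lgram (U * rdiag d * Uᴴ) 1 (X' i) - κ * ∑ i, Real.log (d i) := by
  classical
  let 𝒰 : Set (Matrix P (Fin k) ℂ) := {U | Uᴴ * U = 1} ∩ ({U | U * Uᴴ = 1} ∩ {U | ColGraded U})
  have hcomp : IsCompact 𝒰 := by
    refine (isCompact_frames k).inter_right (IsClosed.inter ?_ ?_)
    · exact isClosed_eq (by fun_prop) continuous_const
    · have : {U : Matrix P (Fin k) ℂ | ColGraded U} =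
          ⋂ t, ⋂ i, ⋂ j, ⋂ (_ : ¬ Comp i j), {U | U i t * U j t = 0} := by
        ext U
        simp [ColGraded]
      rw [this]
      refine isClosed_iInter fun t => isClosed_iInter fun i => isClosed_iInter fun j =>
        isClosed_iInter fun _ => isClosed_eq (by fun_prop) continuous_const
  let Φ : Matrix P (Fin k) ℂ → (Fin k → ℝ) → ℝ := fun U d =>
    ∑ i, c i * lgram (U * rdiag d * Uᴴ) g (X i) +
        ∑ i, c' i * lgram (U * rdiag d * Uᴴ) 1 (X' i) - κ * ∑ i, Real.log (d i)
  have key : ∃ C : ℝ, ∀ U ∈ 𝒰, ∀ d : Fin k → ℝ, (∀ i, 0 < d i) → Monotone d → C ≤ Φ U d := by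
    refine hcomp.induction_on (p := fun s => ∃ C : ℝ, ∀ U ∈ s, ∀ d : Fin k → ℝ, (∀ i, 0 < d i) →
      Monotone d → C ≤ Φ U d) ⟨0, fun U hU => absurd hU (Set.notMem_empty _)⟩
      (fun s t hst ⟨C, hC⟩ => ⟨C, fun U hU => hC U (hst hU)⟩)
      (fun s t ⟨C, hC⟩ ⟨C', hC'⟩ => ⟨min C C', fun U hU d hd hd' => ?_⟩) fun U₀ hU₀ => ?_
    · rcases hU with hU | hU
      · exact (min_le_left _ _).trans (hC U hU d hd hd')
      · exact (min_le_right _ _).trans (hC' U hU d hd hd')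
    · have hU₀' : IsU U₀ := ⟨hU₀.1, hU₀.2.1⟩
      choose B hB1 hB2 C hC using fun i => exists_local_bound hg (X i) hU₀'
      have h1 : Function.Injective (toLin' (1 : Matrix P P ℂ)) := by
        rw [toLin'_one]
        exact Function.injective_id
      choose B' hB1' hB2' C' hC' using fun i => exists_local_bound h1 (X' i) hU₀'
      refine ⟨_, mem_nhdsWithin_of_mem_nhds
        ((Filter.eventually_all.2 hC).and (Filter.eventually_all.2 hC')),
        ∑ i, c i * C i + ∑ i, c' i * C' i, fun U hU d hd hmono => ?_⟩
      have h2 : 0 ≤ ∑ b, (wt c B b + wt c' B' b - κ) * Real.log (d b) := by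
        refine sum_mul_monotone_nonneg (fun x y hxy => Real.log_le_log (hd x) (hmono hxy)) ?_ ?_
        · intro Z hZ
          have h3 := h _ (graded_map_coord hU₀.2.2 Z)
          have hUinj : Function.Injective (toLin' U₀) := mulVec_injective_of_left_inv hU₀.1
          rw [finrank_map_of_injective _ hUinj, finrank_coord] at h3
          rw [Finset.sum_sub_distrib, Finset.sum_add_distrib, sum_wt, sum_wt, Finset.sum_const,
            nsmul_eq_mul]
          have h4 : ∀ i, ((Z ∩ B i).card : ℝ) = _ := fun i => by
            rw [Finset.inter_comm, hB2 i Z hZ]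
          have h5 : ∀ i, ((Z ∩ B' i).card : ℝ) = _ := fun i => by
            rw [Finset.inter_comm, hB2' i Z hZ, toLin'_one, Submodule.comap_id, inf_comm]
          simp_rw [h4, h5]
          linarith
        · rw [Finset.sum_sub_distrib, Finset.sum_add_distrib, sum_wt, sum_wt]
          simp only [Finset.univ_inter, hB1, hB1']
          rw [heq]
          simp [mul_comm]
      simp_rw [sub_mul, add_mul] at h2
      rw [Finset.sum_sub_distrib, Finset.sum_add_distrib, sum_wt_left, sum_wt_left, ← Finset.mul_sum] at h2
      have h6 : ∑ i, c i * C i + ∑ i, c i * ∑ b ∈ B i, Real.log (d b) ≤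
          ∑ i, c i * lgram (U * rdiag d * Uᴴ) g (X i) := by
        rw [← Finset.sum_add_distrib]
        refine Finset.sum_le_sum fun i _ => ?_
        rw [← mul_add]
        exact mul_le_mul_of_nonneg_left (hU.1 i d hd) (hc i)
      have h7 : ∑ i, c' i * C' i + ∑ i, c' i * ∑ b ∈ B' i, Real.log (d b) ≤
          ∑ i, c' i * lgram (U * rdiag d * Uᴴ) 1 (X' i) := by
        rw [← Finset.sum_add_distrib]
        refine Finset.sum_le_sum fun i _ => ?_
        rw [← mul_add]
        exact mul_le_mul_of_nonneg_left (hU.2 i d hd) (hc' i)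
      simp only [Φ]
      linarith
  obtain ⟨C, hC⟩ := key
  exact ⟨C, fun U hU hU' d hd hm => hC U ⟨hU.left, hU.right, hU'⟩ d hd hm⟩

end LowerBound

section Cholesky

open scoped ComplexOrder

/-- Upper triangular matrices with respect to a partial order. -/
def Upper {T : Type*} [LE T] (R : Matrix T T ℂ) : Prop := ∀ i j, R i j ≠ 0 → i ≤ j

theorem exists_cholesky {k : ℕ} {S : Matrix (Fin k) (Fin k) ℂ} (hS : S.PosDef) :
    ∃ R : Matrix (Fin k) (Fin k) ℂ, Upper R ∧ Rᴴ * S * R = 1 := by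
  let L := LDL.lowerInv hS
  have hD : LDL.diag hS = L * S * Lᴴ := LDL.diag_eq_lowerInv_conj hS
  have hLinv : IsUnit L := isUnit_of_invertible L
  have hpd : (LDL.diag hS).PosDef := by
    rw [hD]
    have := hS.conjTranspose_mul_mul_same (B := Lᴴ) ?_
    · rwa [conjTranspose_conjTranspose] at this
    · have h2 : IsUnit Lᴴ := by
        have := hLinv.star
        rwa [Matrix.star_eq_conjTranspose] at this
      exact Matrix.mulVec_injective_iff_isUnit.2 h2
  let d : Fin k → ℝ := fun i => (LDL.diag hS i i).re
  have hd : ∀ i, 0 < d i := fun i => (Complex.lt_def.1 (hpd.diag_pos (i := i))).1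
  have hdd : LDL.diag hS = rdiag d := by
    refine Matrix.ext fun i j => ?_
    by_cases hij : i = j
    · subst hij
      have := (Complex.lt_def.1 (hpd.diag_pos (i := i))).2
      rw [rdiag, Matrix.diagonal_apply_eq]
      exact Complex.ext rfl this.symm
    · rw [rdiag, Matrix.diagonal_apply_ne _ hij, LDL.diag, Matrix.diagonal_apply_ne _ hij]
  refine ⟨Lᴴ * rdiag fun i => (Real.sqrt (d i))⁻¹, fun i j hij => ?_, ?_⟩
  · by_contra h
    push Not at h
    apply hij
    rw [rdiag, Matrix.mul_diagonal, conjTranspose_apply]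
    have : L j i = 0 := LDL.lowerInv_triangular hS h
    rw [this]
    simp
  · rw [conjTranspose_mul, conjTranspose_conjTranspose, rdiag_conjTranspose]
    have : (rdiag fun i => (Real.sqrt (d i))⁻¹) * L * S * (Lᴴ * rdiag fun i => (Real.sqrt (d i))⁻¹) =
        (rdiag fun i => (Real.sqrt (d i))⁻¹) * (L * S * Lᴴ) * rdiag fun i => (Real.sqrt (d i))⁻¹ := by
      simp only [Matrix.mul_assoc]
    rw [this, ← hD, hdd, rdiag_mul, rdiag_mul, ← rdiag_one]
    congr 1
    funext i
    have h1 := Real.mul_self_sqrt (hd i).le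
    have h2 : Real.sqrt (d i) ≠ 0 := (Real.sqrt_pos.2 (hd i)).ne'
    field_simp
    nlinarith

theorem isU_of_left {P T : Type*} [Fintype P] [DecidableEq P] [Fintype T] [DecidableEq T]
    (h : Fintype.card P = Fintype.card T) {g : Matrix P T ℂ} (hg : gᴴ * g = 1) : IsU g :=
  ⟨hg, (Matrix.mul_eq_one_comm_of_card_eq T P ℂ h.symm).1 hg⟩

theorem exists_upper_isU {P : Type*} [Fintype P] [DecidableEq P] {k : ℕ} (hk : Fintype.card P = k)
    {y : Matrix P (Fin k) ℂ} (hy : Function.Injective (toLin' y)) :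
    ∃ R : Matrix (Fin k) (Fin k) ℂ, Upper R ∧ IsU (y * R) := by
  obtain ⟨R, hR, h⟩ := exists_cholesky (Matrix.PosDef.conjTranspose_mul_self y hy)
  refine ⟨R, hR, isU_of_left (by simp [hk]) ?_⟩
  rw [conjTranspose_mul, ← h]
  simp only [Matrix.mul_assoc]

variable {m n : ℕ}

theorem GradedMat.eq_fromBlocks {M : SqMat (Fin m ⊕ Fin n)} (hM : GradedMat M) :
    M = fromBlocks M.toBlocks₁₁ 0 0 M.toBlocks₂₂ := by
  conv_lhs => rw [← fromBlocks_toBlocks M]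
  congr 1
  · refine Matrix.ext fun i j => ?_
    by_contra h
    rcases hM (Sum.inl i) (Sum.inr j) h with h | h <;> simp at h
  · refine Matrix.ext fun i j => ?_
    by_contra h
    rcases hM (Sum.inr i) (Sum.inl j) h with h | h <;> simp at h

theorem gradedMat_fromBlocks (A : Matrix (Fin m) (Fin m) ℂ) (D : Matrix (Fin n) (Fin n) ℂ) :
    GradedMat (fromBlocks A 0 0 D) := by
  rintro (i | i) (j | j) h
  · rcases le_total i j with h | h <;> simp [Comp, h]
  · simp at h
  · simp at h
  · rcases le_total i j with h | h <;> simp [Comp, h]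

theorem exists_graded_diag {M : SqMat (Fin m ⊕ Fin n)} (hM : GradedMat M)
    (hH : M.IsHermitian) : ∃ (V : SqMat (Fin m ⊕ Fin n)) (y : Fin m ⊕ Fin n → ℝ),
      IsU V ∧ GradedMat V ∧ M = V * rdiag y * Vᴴ := by
  have h1 : M.toBlocks₁₁.IsHermitian := by
    refine Matrix.ext fun i j => ?_
    exact congrFun (congrFun hH (Sum.inl i)) (Sum.inl j)
  have h2 : M.toBlocks₂₂.IsHermitian := by
    refine Matrix.ext fun i j => ?_
    exact congrFun (congrFun hH (Sum.inr i)) (Sum.inr j)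
  obtain ⟨V1, y1, hV1, e1⟩ := exists_isU_diag h1
  obtain ⟨V2, y2, hV2, e2⟩ := exists_isU_diag h2
  refine ⟨fromBlocks V1 0 0 V2, Sum.elim y1 y2, hV1.fromBlocks hV2, gradedMat_fromBlocks _ _, ?_⟩
  have h3 : rdiag (Sum.elim y1 y2) = fromBlocks (rdiag y1) 0 0 (rdiag y2) := by
    rw [rdiag, rdiag, rdiag, fromBlocks_diagonal]
    congr 1
    funext i
    rcases i with i | i <;> rfl
  rw [h3, fromBlocks_conjTranspose, fromBlocks_multiply, fromBlocks_multiply]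
  simp only [conjTranspose_zero, Matrix.mul_zero, Matrix.zero_mul, add_zero, zero_add]
  rw [← e1, ← e2]
  exact hM.eq_fromBlocks

theorem exists_graded_upper_isU {x : SqMat (Fin m ⊕ Fin n)} (hx : GradedMat x)
    (hinj : Function.Injective (toLin' x)) :
    ∃ R : SqMat (Fin m ⊕ Fin n), Upper R ∧ GradedMat R ∧ IsU (x * R) := by
  have hpd := Matrix.PosDef.conjTranspose_mul_self x hinj
  have h1 : (xᴴ * x).toBlocks₁₁.PosDef := hpd.submatrix Sum.inl_injective
  have h2 : (xᴴ * x).toBlocks₂₂.PosDef := hpd.submatrix Sum.inr_injective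
  obtain ⟨R1, hR1, e1⟩ := exists_cholesky h1
  obtain ⟨R2, hR2, e2⟩ := exists_cholesky h2
  refine ⟨fromBlocks R1 0 0 R2, ?_, gradedMat_fromBlocks _ _, isU_of_left rfl ?_⟩
  · rintro (i | i) (j | j) h
    · exact Sum.inl_le_inl_iff.2 (hR1 i j h)
    · simp at h
    · simp at h
    · exact Sum.inr_le_inr_iff.2 (hR2 i j h)
  · have hH : GradedMat xᴴ := fun i j h => (hx j i (by
      intro h0
      apply h
      rw [conjTranspose_apply, h0, star_zero])).symm
    have h3 := (hH.mul hx).eq_fromBlocks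
    rw [conjTranspose_mul, Matrix.mul_assoc, ← Matrix.mul_assoc xᴴ, h3,
      fromBlocks_conjTranspose, fromBlocks_multiply, fromBlocks_multiply]
    simp only [conjTranspose_zero, Matrix.mul_zero, Matrix.zero_mul, add_zero, zero_add]
    rw [← Matrix.mul_assoc, e1, ← Matrix.mul_assoc, e2, fromBlocks_one]

theorem exists_monotone_diag {k : ℕ} (hk : m + n = k) {M : SqMat (Fin m ⊕ Fin n)}
    (hM : GradedMat M) (hpd : M.PosDef) :
    ∃ (U : Matrix (Fin m ⊕ Fin n) (Fin k) ℂ) (d : Fin k → ℝ), IsU U ∧ ColGraded U ∧ (∀ i, 0 < d i) ∧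
      Monotone d ∧ M = U * rdiag d * Uᴴ := by
  obtain ⟨V, y, hV, hVg, h⟩ := exists_graded_diag hM hpd.isHermitian
  have hy : ∀ i, 0 < y i := by
    intro i
    have h1 : (Vᴴ * M * V).PosDef := hpd.conjTranspose_mul_mul_same
      (mulVec_injective_of_left_inv (N := Vᴴ) hV.left)
    rw [eq_of_eq_conj hV h] at h1
    have := (Complex.lt_def.1 (h1.diag_pos (i := i))).1
    simpa [rdiag] using this
  let e0 : Fin k ≃ Fin m ⊕ Fin n := (finCongr hk.symm).trans finSumFinEquiv.symm
  let e : Fin k ≃ Fin m ⊕ Fin n := (Tuple.sort (y ∘ e0)).trans e0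
  refine ⟨V.submatrix (Equiv.refl _) e, y ∘ e, hV.submatrix _ _, ?_, fun i => hy _,
    Tuple.monotone_sort (y ∘ e0), ?_⟩
  · intro t i j hij
    by_contra h
    have h1 : V i (e t) ≠ 0 := fun h0 => h (by simp [h0])
    have h2 : V j (e t) ≠ 0 := fun h0 => h (by simp [h0])
    exact hij ((hVg _ _ h1).trans (hVg _ _ h2).symm)
  · have h1 : rdiag (y ∘ e) = (rdiag y).submatrix e e := by
      rw [rdiag, rdiag, submatrix_diagonal_equiv]
      rfl
    rw [h1, conjTranspose_submatrix, submatrix_mul_equiv, submatrix_mul_equiv, ← h]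
    rfl

end Cholesky

section Potential

open scoped ComplexOrder

variable {P T : Type*} [Fintype P] [DecidableEq P] [Fintype T] [DecidableEq T]

theorem cols_mul {Q : Type*} [Fintype Q] (x : Matrix P Q ℂ) (y : Matrix Q T ℂ) (X : Finset T) :
    cols (x * y) X = x * cols y X := rfl

theorem cols_mul_upper [PartialOrder T] (y : Matrix P T ℂ) {R : Matrix T T ℂ} (hR : Upper R)
    {X : Finset T} (hX : IsLowerSet (X : Set T)) :
    cols (y * R) X = cols y X * R.submatrix (Subtype.val : X → T) Subtype.val := by
  refine Matrix.ext fun i t => ?_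
  simp only [cols, submatrix_apply, Matrix.mul_apply, id]
  rw [Finset.sum_coe_sort X fun s => y i s * R s t]
  refine (Finset.sum_subset (Finset.subset_univ _) fun s _ hs => ?_).symm
  by_cases h : R s t = 0
  · rw [h, mul_zero]
  · exact absurd (hX (hR s t h) t.2) hs

theorem cols_mul_cols (u : Matrix P T ℂ) (X : Finset T) : cols u X * (cols u X)ᴴ = u * mask ℂ X * uᴴ := by
  refine Matrix.ext fun i j => ?_
  rw [Matrix.mul_apply, Matrix.mul_apply]
  simp only [cols, submatrix_apply, conjTranspose_apply, id, mul_mask_apply]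
  rw [Finset.sum_coe_sort X fun s => u i s * star (u j s)]
  symm
  rw [← Finset.sum_subset (Finset.subset_univ X)]
  · exact Finset.sum_congr rfl fun s hs => by rw [if_pos hs]
  · intro s _ hs
    rw [if_neg hs, zero_mul]

theorem lgram_le [PartialOrder T] {x e : Matrix P P ℂ} {g : Matrix P T ℂ} {R : Matrix T T ℂ}
    (hR : Upper R) (hu : IsU (x * g * R)) (he : (eᴴ * e).PosDef) {X : Finset T}
    (hX : IsLowerSet (X : Set T)) :
    lgram ((e * x)ᴴ * (e * x)) g X ≤ lgram (xᴴ * x) g X +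
      ((trace (eᴴ * e * (x * g * R * mask ℂ X * (x * g * R)ᴴ))).re - X.card) := by
  set u := x * g * R with hudef
  set RX := R.submatrix (Subtype.val : X → T) Subtype.val
  have hcol : cols u X = x * cols g X * RX := by
    rw [hudef, cols_mul_upper _ hR hX, cols_mul]
  have h1 : (cols u X)ᴴ * cols u X = 1 := by
    have : (cols u X)ᴴ * cols u X = (uᴴ * u).submatrix Subtype.val Subtype.val := rfl
    rw [this, hu.left, submatrix_one _ Subtype.val_injective]
  have h2 : ∀ E : Matrix P P ℂ, (cols u X)ᴴ * E * cols u X =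
      RXᴴ * ((cols g X)ᴴ * (xᴴ * E * x) * cols g X) * RX := by
    intro E
    rw [hcol]
    simp only [conjTranspose_mul, Matrix.mul_assoc]
  have h3 : ∀ E : Matrix P P ℂ, ‖((cols u X)ᴴ * E * cols u X).det‖ =
      ‖RX.det‖ ^ 2 * ‖((cols g X)ᴴ * (xᴴ * E * x) * cols g X).det‖ := by
    intro E
    rw [h2, Matrix.det_mul, Matrix.det_mul, norm_mul, norm_mul, Matrix.det_conjTranspose, norm_star]
    ring
  have h4 := h3 1
  rw [Matrix.mul_one, h1, Matrix.det_one, norm_one, Matrix.mul_one] at h4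
  have h5 : ((cols u X)ᴴ * (eᴴ * e) * cols u X).PosDef :=
    he.conjTranspose_mul_mul_same (mulVec_injective_of_left_inv (N := (cols u X)ᴴ) h1)
  have h6 := log_norm_det_le h5
  have h7 := h3 (eᴴ * e)
  have h8 : xᴴ * (eᴴ * e) * x = (e * x)ᴴ * (e * x) := by
    simp only [conjTranspose_mul, Matrix.mul_assoc]
  have h9 : ((cols u X)ᴴ * (eᴴ * e) * cols u X).det ≠ 0 := h5.det_pos.ne'
  rw [h8] at h7
  have hR0 : ‖RX.det‖ ^ 2 ≠ 0 := fun h => by rw [h, zero_mul] at h4; exact one_ne_zero h4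
  have hg0 : ‖((cols g X)ᴴ * (xᴴ * x) * cols g X).det‖ ≠ 0 := fun h => by
    rw [h, mul_zero] at h4; exact one_ne_zero h4
  have he0 : ‖((cols g X)ᴴ * ((e * x)ᴴ * (e * x)) * cols g X).det‖ ≠ 0 := fun h => by
    rw [h, mul_zero] at h7; exact h9 (norm_eq_zero.1 h7)
  have l4 := congrArg Real.log h4
  have l7 := congrArg Real.log h7
  rw [Real.log_one, Real.log_mul hR0 hg0] at l4
  rw [Real.log_mul hR0 he0] at l7
  have h10 : trace ((cols u X)ᴴ * (eᴴ * e) * cols u X) = trace (eᴴ * e * (u * mask ℂ X * uᴴ)) := by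
    rw [← cols_mul_cols, Matrix.mul_assoc, trace_mul_comm, Matrix.mul_assoc]
  rw [h10, Fintype.card_coe] at h6
  simp only [lgram]
  linarith

/-- The logarithmic potential of a pair of weighted filtrations. -/
noncomputable def potential {ι ι' : Type*} [Fintype ι] [Fintype ι'] (c : ι → ℝ) (X : ι → Finset T)
    (c' : ι' → ℝ) (X' : ι' → Finset P) (κ : ℝ) (g : Matrix P T ℂ) (x : Matrix P P ℂ) : ℝ :=
  ∑ i, c i * lgram (xᴴ * x) g (X i) + ∑ i, c' i * lgram (xᴴ * x) 1 (X' i) -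
    κ * Real.log ‖(xᴴ * x).det‖

theorem sum_lgram_le [PartialOrder T] {ι : Type*} [Fintype ι] {c : ι → ℝ} {X : ι → Finset T}
    (hX : LowerWeight c X) {x e : Matrix P P ℂ}
    {g : Matrix P T ℂ} {R : Matrix T T ℂ} (hR : Upper R) (hu : IsU (x * g * R)) (he : (eᴴ * e).PosDef) :
    ∑ i, c i * lgram ((e * x)ᴴ * (e * x)) g (X i) ≤ ∑ i, c i * lgram (xᴴ * x) g (X i) +
      ((trace (eᴴ * e * (x * g * R * rdiag (wt c X) * (x * g * R)ᴴ))).re - ∑ i, c i * (X i).card) := by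
  have h1 : (trace (eᴴ * e * (x * g * R * rdiag (wt c X) * (x * g * R)ᴴ))).re =
      ∑ i, c i * (trace (eᴴ * e * (x * g * R * mask ℂ (X i) * (x * g * R)ᴴ))).re := by
    rw [rdiag_wt, Matrix.mul_sum, Matrix.sum_mul, Matrix.mul_sum, Matrix.trace_sum, Complex.re_sum]
    refine Finset.sum_congr rfl fun i _ => ?_
    rw [Matrix.mul_smul, Matrix.smul_mul, Matrix.mul_smul, Matrix.trace_smul, smul_eq_mul,
      Complex.re_ofReal_mul]
  rw [h1, ← Finset.sum_sub_distrib, ← Finset.sum_add_distrib]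
  refine Finset.sum_le_sum fun i _ => ?_
  by_cases hi : c i = 0
  · simp [hi]
  · have := mul_le_mul_of_nonneg_left (lgram_le hR hu he (hX.lower i hi)) (hX.nonneg i)
    linarith

theorem trace_mul_conj_rdiag {V A : Matrix P P ℂ} (y : P → ℝ) :
    (trace (V * rdiag y * Vᴴ * A)).re = ∑ a, y a * ((Vᴴ * A * V) a a).re := by
  have : trace (V * rdiag y * Vᴴ * A) = trace (rdiag y * (Vᴴ * A * V)) := by
    rw [trace_mul_comm, ← Matrix.mul_assoc, trace_mul_comm, ← Matrix.mul_assoc,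
      ← Matrix.mul_assoc, trace_mul_comm, ← Matrix.mul_assoc]
  rw [this, Matrix.trace, Complex.re_sum]
  refine Finset.sum_congr rfl fun a _ => ?_
  rw [Matrix.diag_apply, rdiag, Matrix.diagonal_mul, Complex.re_ofReal_mul]

theorem trace_conj_rdiag {w : Matrix P T ℂ} (hw : IsU w) (f : T → ℝ) :
    (trace (w * rdiag f * wᴴ)).re = ∑ s, f s := by
  rw [trace_mul_comm, ← Matrix.mul_assoc, hw.left, Matrix.one_mul, rdiag, Matrix.trace_diagonal]
  simp

theorem conj_rdiag_isHermitian (u : Matrix P T ℂ) (f : T → ℝ) : (u * rdiag f * uᴴ).IsHermitian := by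
  rw [Matrix.IsHermitian]
  simp only [conjTranspose_mul, conjTranspose_conjTranspose, rdiag_conjTranspose,
    Matrix.mul_assoc]

theorem isUnit_det_conj_exp {V : Matrix P P ℂ} (hV : IsU V) (y : P → ℝ) :
    IsUnit (V * rdiag (fun a => Real.exp (y a)) * Vᴴ).det := by
  rw [isUnit_iff_ne_zero, det_conj_isU hV, det_rdiag]
  exact_mod_cast (Finset.prod_pos fun a _ => Real.exp_pos _).ne'

theorem posSemidef_conj_rdiag {f : T → ℝ} (hf : ∀ t, 0 ≤ f t) (u : Matrix P T ℂ) :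
    (u * rdiag f * uᴴ).PosSemidef := by
  have h1 : (rdiag f).PosSemidef := by
    rw [rdiag, Matrix.posSemidef_diagonal_iff]
    intro t
    exact_mod_cast hf t
  exact h1.mul_mul_conjTranspose_same u

theorem wt_nonneg {ι : Type*} [Fintype ι] {c : ι → ℝ} (hc : ∀ i, 0 ≤ c i) (X : ι → Finset T) (t : T) :
    0 ≤ wt c X t := Finset.sum_nonneg fun i _ => by
  split_ifs
  · exact hc i
  · exact le_rfl

theorem potential_le [PartialOrder P] [PartialOrder T] {ι ι' : Type*} [Fintype ι] [Fintype ι']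
    {c : ι → ℝ} {X : ι → Finset T} (hX : LowerWeight c X) {c' : ι' → ℝ} {X' : ι' → Finset P}
    (hX' : LowerWeight c' X') {κ : ℝ} {g : Matrix P T ℂ}
    (heq : ∑ i, c i * ((X i).card : ℝ) + ∑ i, c' i * ((X' i).card : ℝ) = κ * Fintype.card P)
    {x : Matrix P P ℂ} (hx : IsUnit x.det) {R : Matrix T T ℂ} {R' : Matrix P P ℂ} (hR : Upper R)
    (hR' : Upper R') {u : Matrix P T ℂ} {v : Matrix P P ℂ} (hu' : u = x * g * R) (hv' : v = x * R')
    (hu : IsU u) (hv : IsU v) {V : Matrix P P ℂ} (hV : IsU V) {y : P → ℝ} {Y τ : ℝ}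
    (hY : ∀ a, |y a| ≤ Y) (hτ : 0 < τ) (hτY : 2 * τ * Y ≤ 1) :
    potential c X c' X' κ g ((V * rdiag (fun a => Real.exp (τ * y a)) * Vᴴ) * x) ≤
      potential c X c' X' κ g x + 2 * τ * ((trace (V * rdiag y * Vᴴ *
          (u * rdiag (wt c X) * uᴴ + v * rdiag (wt c' X') * vᴴ - (κ : ℂ) • (1 : Matrix P P ℂ)))).re) +
        4 * τ ^ 2 * Y ^ 2 * (κ * Fintype.card P) := by
  set A := u * rdiag (wt c X) * uᴴ + v * rdiag (wt c' X') * vᴴ with hA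
  have hAp : A.PosSemidef := (posSemidef_conj_rdiag (wt_nonneg hX.nonneg X) u).add
    (posSemidef_conj_rdiag (wt_nonneg hX'.nonneg X') v)
  set e := V * rdiag (fun a => Real.exp (τ * y a)) * Vᴴ with he
  have heE : eᴴ * e = V * rdiag (fun a => Real.exp (2 * τ * y a)) * Vᴴ := by
    rw [(conj_rdiag_isHermitian V _).eq, Matrix.mul_assoc, ← Matrix.mul_assoc Vᴴ, ← Matrix.mul_assoc Vᴴ, hV.left, Matrix.one_mul,
      ← Matrix.mul_assoc, Matrix.mul_assoc V, rdiag_mul]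
    congr 3
    funext a
    rw [← Real.exp_add]
    congr 1
    ring
  have hdetE : ‖(eᴴ * e).det‖ = Real.exp (2 * τ * ∑ a, y a) := by
    rw [heE, det_conj_isU hV, det_rdiag, Complex.norm_real, Real.norm_eq_abs, ← Real.exp_sum, Real.abs_exp,
      Finset.mul_sum]
  have hpd : (eᴴ * e).PosDef := by
    exact Matrix.PosDef.conjTranspose_mul_self e (Matrix.mulVec_injective_iff_isUnit.2
      ((Matrix.isUnit_iff_isUnit_det _).2 (isUnit_det_conj_exp hV _)))
  have h1 := sum_lgram_le hX hR (hu' ▸ hu) hpd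
  have h2 := sum_lgram_le (g := (1 : Matrix P P ℂ)) hX' hR'
    (by rw [Matrix.mul_one]; exact hv' ▸ hv) hpd
  rw [Matrix.mul_one, ← hv'] at h2
  rw [← hu'] at h1
  have h3 : Real.log ‖((e * x)ᴴ * (e * x)).det‖ = 2 * τ * ∑ a, y a + Real.log ‖(xᴴ * x).det‖ := by
    have h4 : ‖((e * x)ᴴ * (e * x)).det‖ = ‖(eᴴ * e).det‖ * ‖(xᴴ * x).det‖ := by
      simp only [conjTranspose_mul, Matrix.det_mul, norm_mul]
      ring
    have h5 : ‖(xᴴ * x).det‖ ≠ 0 := by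
      rw [Matrix.det_mul, Matrix.det_conjTranspose]
      simpa using hx.ne_zero
    rw [h4, hdetE, Real.log_mul (Real.exp_pos _).ne' h5, Real.log_exp]
  have h4 : (trace (eᴴ * e * (u * rdiag (wt c X) * uᴴ))).re + (trace (eᴴ * e * (v * rdiag (wt c' X') * vᴴ))).re =
      ∑ a, Real.exp (2 * τ * y a) * ((Vᴴ * A * V) a a).re := by
    rw [← Complex.add_re, ← Matrix.trace_add, ← Matrix.mul_add, ← hA, heE, trace_mul_conj_rdiag]
  have h5 : (trace (V * rdiag y * Vᴴ * (A - (κ : ℂ) • (1 : Matrix P P ℂ)))).re =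
      ∑ a, y a * ((Vᴴ * A * V) a a).re - κ * ∑ a, y a := by
    rw [Matrix.mul_sub, Matrix.trace_sub, Complex.sub_re, trace_mul_conj_rdiag, Matrix.mul_smul,
      Matrix.mul_one, Matrix.trace_smul, smul_eq_mul, Complex.re_ofReal_mul, trace_conj_rdiag hV]
  have h6 : ∑ a, ((Vᴴ * A * V) a a).re = κ * Fintype.card P := by
    have h7 := trace_mul_conj_rdiag (V := V) (A := A) (fun _ => 1)
    rw [rdiag_one, Matrix.mul_one, hV.right, Matrix.one_mul] at h7
    simp only [one_mul] at h7
    rw [← h7, ← heq, hA, Matrix.trace_add, Complex.add_re, trace_conj_rdiag hu, trace_conj_rdiag hv,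
      sum_wt, sum_wt]
    simp only [Finset.univ_inter]
  have h7 : ∑ a, Real.exp (2 * τ * y a) * ((Vᴴ * A * V) a a).re ≤
      ∑ a, (1 + 2 * τ * y a + 4 * τ ^ 2 * Y ^ 2) * ((Vᴴ * A * V) a a).re := by
    refine Finset.sum_le_sum fun a _ => mul_le_mul_of_nonneg_right ?_ (diag_conj_nonneg hAp V a)
    have hy1 : |2 * τ * y a| ≤ 2 * τ * Y := by
      rw [abs_mul, abs_of_pos (by positivity : (0 : ℝ) < 2 * τ)]
      exact mul_le_mul_of_nonneg_left (hY a) (by positivity)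
    have hy2 := abs_le.1 (Real.abs_exp_sub_one_sub_id_le (hy1.trans hτY))
    have hy3 : (2 * τ * y a) ^ 2 ≤ (2 * τ * Y) ^ 2 := sq_le_sq' (abs_le.1 hy1).1 (abs_le.1 hy1).2
    nlinarith [hy2.2]
  have h8 : ∑ a, (1 + 2 * τ * y a + 4 * τ ^ 2 * Y ^ 2) * ((Vᴴ * A * V) a a).re =
      (1 + 4 * τ ^ 2 * Y ^ 2) * (κ * Fintype.card P) + 2 * τ * ∑ a, y a * ((Vᴴ * A * V) a a).re := by
    rw [← h6, Finset.mul_sum, Finset.mul_sum, ← Finset.sum_add_distrib]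
    exact Finset.sum_congr rfl fun a _ => by ring
  rw [h5]
  simp only [potential]
  rw [h3]
  linarith

end Potential

section KempfNess

open scoped ComplexOrder

theorem GradedMat.conjTranspose {P : Type*} [PartialOrder P] {M : Matrix P P ℂ} (hM : GradedMat M) :
    GradedMat Mᴴ := fun i j h => (hM j i (by
  rw [conjTranspose_apply] at h
  exact star_ne_zero.1 h)).symm

theorem isCompact_isU (P T : Type*) [Fintype P] [DecidableEq P] [Fintype T] [DecidableEq T] :
    IsCompact {u : Matrix P T ℂ | IsU u} := by
  have h1 : IsCompact ((fun v : Matrix P (Fin (Fintype.card T)) ℂ =>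
      v.submatrix id (Fintype.equivFin T)) '' {v | vᴴ * v = 1}) :=
    (isCompact_frames (P := P) (Fintype.card T)).image (by fun_prop)
  have h2 : IsClosed {u : Matrix P T ℂ | IsU u} := by
    have : {u : Matrix P T ℂ | IsU u} = {u | uᴴ * u = 1} ∩ {u | u * uᴴ = 1} := by
      ext u
      exact ⟨fun h => ⟨h.left, h.right⟩, fun h => ⟨h.1, h.2⟩⟩
    rw [this]
    exact (isClosed_eq (by fun_prop) continuous_const).inter (isClosed_eq (by fun_prop) continuous_const)
  refine h1.of_isClosed_subset h2 fun u hu => ⟨u.submatrix id (Fintype.equivFin T).symm, ?_, ?_⟩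
  · have h3 : (uᴴ * u).submatrix (Fintype.equivFin T).symm (Fintype.equivFin T).symm = 1 := by
      rw [hu.left, submatrix_one_equiv]
    exact h3
  · simp

variable {m n k : ℕ} {ι ι' : Type*} [Fintype ι] [Fintype ι'] {c : ι → ℝ} {X : ι → Finset (Fin k)} {c' : ι' → ℝ}
  {X' : ι' → Finset (Fin m ⊕ Fin n)} {κ : ℝ} {g : Matrix (Fin m ⊕ Fin n) (Fin k) ℂ}

theorem potential_bddBelow (hk : m + n = k) (hc : ∀ i, 0 ≤ c i) (hc' : ∀ i, 0 ≤ c' i)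
    (hg : Function.Injective (toLin' g)) (h : Semi c X c' X' κ g)
    (heq : ∑ i, c i * ((X i).card : ℝ) + ∑ i, c' i * ((X' i).card : ℝ) = κ * k) :
    ∃ C : ℝ, ∀ x : SqMat (Fin m ⊕ Fin n), GradedMat x → IsUnit x.det →
      C ≤ potential c X c' X' κ g x := by
  obtain ⟨C, hC⟩ := h.exists_lower_bound hc hc' hg heq
  refine ⟨C, fun x hx hxd => ?_⟩
  have hpd : (xᴴ * x).PosDef := Matrix.PosDef.conjTranspose_mul_self x
    (Matrix.mulVec_injective_iff_isUnit.2 ((Matrix.isUnit_iff_isUnit_det _).2 hxd))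
  obtain ⟨U, d, hU, hUg, hd, hm, e⟩ := exists_monotone_diag hk (hx.conjTranspose.mul hx) hpd
  have h1 := hC U hU hUg d hd hm
  rw [← e] at h1
  have h2 : Real.log ‖(xᴴ * x).det‖ = ∑ i, Real.log (d i) := by
    rw [e, Matrix.det_conj_of_mul_eq_one hU.right hU.left, det_rdiag, Complex.norm_real, Real.norm_eq_abs,
      abs_of_pos (Finset.prod_pos fun i _ => hd i), Real.log_prod fun i _ => (hd i).ne']
  rw [potential, h2]
  exact h1

theorem exists_almost_critical (hk : m + n = k) (hX : LowerWeight c X) (hX' : LowerWeight c' X')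
    (hg : Function.Injective (toLin' g)) (h : Semi c X c' X' κ g)
    (heq : ∑ i, c i * ((X i).card : ℝ) + ∑ i, c' i * ((X' i).card : ℝ) = κ * k)
    {𝓖 : Set (SqMat (Fin m ⊕ Fin n))}
    (h𝓖 : ∀ x ∈ 𝓖, GradedMat x ∧ IsUnit x.det) (h1 : 1 ∈ 𝓖) {τ : ℝ} (hτ : 0 < τ) :
    ∃ x ∈ 𝓖, ∃ (R : Matrix (Fin k) (Fin k) ℂ) (R' : SqMat (Fin m ⊕ Fin n)), Upper R ∧ Upper R' ∧ IsU (x * g * R) ∧ IsU (x * R') ∧ GradedMat (x * R') ∧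
      ∀ V, IsU V → ∀ (y : Fin m ⊕ Fin n → ℝ) (Y : ℝ), (∀ a, |y a| ≤ Y) → 2 * τ * Y ≤ 1 →
        V * rdiag (fun a => Real.exp (τ * y a)) * Vᴴ * x ∈ 𝓖 →
        0 ≤ 2 * (trace (V * rdiag y * Vᴴ * ((x * g * R) * rdiag (wt c X) * (x * g * R)ᴴ +
          (x * R') * rdiag (wt c' X') * (x * R')ᴴ -
            (κ : ℂ) • (1 : SqMat (Fin m ⊕ Fin n))))).re +
          τ * (1 + 4 * Y ^ 2 * (κ * k)) := by
  obtain ⟨C, hC⟩ := potential_bddBelow hk hX.nonneg hX'.nonneg hg h heq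
  have hb : BddBelow (potential c X c' X' κ g '' 𝓖) := by
    refine ⟨C, ?_⟩
    rintro _ ⟨x, hx, rfl⟩
    exact hC x (h𝓖 x hx).1 (h𝓖 x hx).2
  obtain ⟨_, ⟨x, hx, rfl⟩, hlt⟩ := exists_lt_of_csInf_lt (Set.Nonempty.image _ ⟨1, h1⟩)
    (lt_add_of_pos_right (sInf (potential c X c' X' κ g '' 𝓖)) (by positivity : 0 < τ ^ 2))
  have hxi : Function.Injective (toLin' x) :=
    Matrix.mulVec_injective_iff_isUnit.2 ((Matrix.isUnit_iff_isUnit_det _).2 (h𝓖 x hx).2)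
  have hcard : Fintype.card (Fin m ⊕ Fin n) = k := by simp [hk]
  obtain ⟨R, hR, hRU⟩ := exists_upper_isU hcard (y := x * g) (by
    rw [toLin'_mul]
    exact hxi.comp hg)
  obtain ⟨R', hR', hRg, hRU'⟩ := exists_graded_upper_isU (h𝓖 x hx).1 hxi
  refine ⟨x, hx, R, R', hR, hR', hRU, hRU', (h𝓖 x hx).1.mul hRg, fun V hV y Y hY hτY hmem => ?_⟩
  have h2 := potential_le hX hX' (by rw [heq, hcard]) (h𝓖 x hx).2 hR hR' rfl rfl hRU hRU' hV hY hτ hτY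
  have h3 := csInf_le hb ⟨_, hmem, rfl⟩
  rw [hcard] at h2
  refine nonneg_of_mul_nonneg_right (a := τ) ?_ hτ
  linarith

theorem exists_critical (hk : m + n = k) (hX : LowerWeight c X) (hX' : LowerWeight c' X')
    (hg : Function.Injective (toLin' g)) (h : Semi c X c' X' κ g)
    (heq : ∑ i, c i * ((X i).card : ℝ) + ∑ i, c' i * ((X' i).card : ℝ) = κ * k)
    {𝓖 : Set (SqMat (Fin m ⊕ Fin n))}
    (h𝓖 : ∀ x ∈ 𝓖, GradedMat x ∧ IsUnit x.det) (h1 : 1 ∈ 𝓖)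
    {𝒞 : Set (Matrix (Fin m ⊕ Fin n) (Fin k) ℂ × SqMat (Fin m ⊕ Fin n))}
    (h𝒞 : IsClosed 𝒞) (hmem : ∀ x ∈ 𝓖, ∀ R R', Upper R → Upper R' → GradedMat (x * R') →
      (x * g * R, x * R') ∈ 𝒞) :
    ∃ u v, (u, v) ∈ 𝒞 ∧ IsU u ∧ IsU v ∧ GradedMat v ∧
      ∀ V, IsU V → ∀ y : Fin m ⊕ Fin n → ℝ,
        (∀ τ : ℝ, 0 < τ → ∀ x ∈ 𝓖, V * rdiag (fun a => Real.exp (τ * y a)) * Vᴴ * x ∈ 𝓖) →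
        0 ≤ (trace (V * rdiag y * Vᴴ * (u * rdiag (wt c X) * uᴴ + v * rdiag (wt c' X') * vᴴ -
            (κ : ℂ) • (1 : SqMat (Fin m ⊕ Fin n))))).re := by
  have hgr : IsClosed {v : SqMat (Fin m ⊕ Fin n) | GradedMat v} := by
    simp only [GradedMat, not_imp_comm, Set.setOf_forall]
    exact isClosed_iInter fun i => isClosed_iInter fun j => isClosed_iInter fun _ =>
      isClosed_eq (by fun_prop) continuous_const
  have hK := ((isCompact_isU (Fin m ⊕ Fin n) (Fin k)).prod
    ((isCompact_isU (Fin m ⊕ Fin n) (Fin m ⊕ Fin n)).inter_right hgr)).inter_right h𝒞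
  have hτ : ∀ N : ℕ, (0 : ℝ) < 1 / ((N : ℝ) + 1) := fun N => Nat.one_div_pos_of_nat
  choose x hx R R' hR hR' hU hU' hG hV using fun N : ℕ =>
    exists_almost_critical hk hX hX' hg h heq h𝓖 h1 (hτ N)
  haveI : FirstCountableTopology (Matrix (Fin m ⊕ Fin n) (Fin k) ℂ) :=
    inferInstanceAs (FirstCountableTopology (Fin m ⊕ Fin n → Fin k → ℂ))
  haveI : FirstCountableTopology (SqMat (Fin m ⊕ Fin n)) :=
    inferInstanceAs (FirstCountableTopology (Fin m ⊕ Fin n → Fin m ⊕ Fin n → ℂ))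
  obtain ⟨⟨u, v⟩, ⟨⟨hu, hv, hvg⟩, huv⟩, φ, hφ, hlim⟩ := hK.tendsto_subseq
    (x := fun N => (x N * g * R N, x N * R' N))
    (fun N => ⟨⟨hU N, hU' N, hG N⟩, hmem _ (hx N) _ _ (hR N) (hR' N) (hG N)⟩)
  refine ⟨u, v, huv, hu, hv, hvg, fun V hVU y hy => ?_⟩
  obtain ⟨Y, hY⟩ : ∃ Y : ℝ, ∀ a, |y a| ≤ Y := by
    obtain ⟨Y, hY⟩ := (Set.finite_range fun a => |y a|).bddAbove
    exact ⟨Y, fun a => hY ⟨a, rfl⟩⟩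
  have hτ0 : Filter.Tendsto (fun N => 1 / ((φ N : ℝ) + 1)) Filter.atTop (nhds 0) :=
    (tendsto_one_div_add_atTop_nhds_zero_nat (𝕜 := ℝ)).comp hφ.tendsto_atTop
  let F : Matrix (Fin m ⊕ Fin n) (Fin k) ℂ × SqMat (Fin m ⊕ Fin n) → ℝ := fun w =>
    (trace (V * rdiag y * Vᴴ * (w.1 * rdiag (wt c X) * w.1ᴴ + w.2 * rdiag (wt c' X') * w.2ᴴ -
            (κ : ℂ) • (1 : SqMat (Fin m ⊕ Fin n))))).re
  have hF : Continuous F := by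
    refine Complex.continuous_re.comp (Continuous.matrix_trace ?_)
    fun_prop
  have h2 : Filter.Tendsto (fun N => 2 * F (x (φ N) * g * R (φ N), x (φ N) * R' (φ N)) +
      1 / ((φ N : ℝ) + 1) * (1 + 4 * Y ^ 2 * (κ * k))) Filter.atTop
      (nhds (2 * F (u, v) + 0 * (1 + 4 * Y ^ 2 * (κ * k)))) :=
    (((hF.tendsto _).comp hlim).const_mul 2).add (hτ0.mul_const _)
  have h3 : ∀ᶠ N in Filter.atTop, 2 * (1 / ((φ N : ℝ) + 1)) * Y ≤ 1 := by
    have h4 : Filter.Tendsto (fun N => 2 * (1 / ((φ N : ℝ) + 1)) * Y) Filter.atTop (nhds (2 * 0 * Y)) :=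
      (hτ0.const_mul 2).mul_const Y
    rw [mul_zero, zero_mul] at h4
    exact (h4.eventually_lt_const one_pos).mono fun _ h => h.le
  have h5 : 0 ≤ 2 * F (u, v) + 0 * (1 + 4 * Y ^ 2 * (κ * k)) :=
    ge_of_tendsto h2 (h3.mono fun N hN => hV (φ N) V hVU y Y hY hN (hy _ (hτ _) _ (hx _)))
  have h6 : 0 ≤ 2 * F (u, v) := by linarith
  exact nonneg_of_mul_nonneg_right h6 two_pos

/-- The block-diagonal part of a matrix. -/
def gradedPart (D : SqMat (Fin m ⊕ Fin n)) : SqMat (Fin m ⊕ Fin n) :=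
  fromBlocks D.toBlocks₁₁ 0 0 D.toBlocks₂₂

theorem gradedPart_mul (D : SqMat (Fin m ⊕ Fin n))
    {J : SqMat (Fin m ⊕ Fin n)} (hJ : GradedMat J) :
    gradedPart (D * J) = gradedPart D * J := by
  rw [hJ.eq_fromBlocks]
  conv_lhs => rw [← fromBlocks_toBlocks D]
  simp [gradedPart, fromBlocks_multiply]

theorem mul_gradedPart (D : SqMat (Fin m ⊕ Fin n))
    {J : SqMat (Fin m ⊕ Fin n)} (hJ : GradedMat J) :
    gradedPart (J * D) = J * gradedPart D := by
  rw [hJ.eq_fromBlocks]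
  conv_lhs => rw [← fromBlocks_toBlocks D]
  simp [gradedPart, fromBlocks_multiply]

theorem gradedPart_neg (D : SqMat (Fin m ⊕ Fin n)) :
    gradedPart (-D) = -gradedPart D := by
  refine Matrix.ext ?_
  rintro (i | i) (j | j) <;> simp [gradedPart, Matrix.toBlocks₁₁, Matrix.toBlocks₂₂]

theorem gradedPart_isHermitian {D : SqMat (Fin m ⊕ Fin n)} (hD : D.IsHermitian) :
    (gradedPart D).IsHermitian := by
  refine Matrix.ext ?_
  rintro (i | i) (j | j)
  · exact congrFun (congrFun hD (Sum.inl i)) (Sum.inl j)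
  · simp [gradedPart]
  · simp [gradedPart]
  · exact congrFun (congrFun hD (Sum.inr i)) (Sum.inr j)

theorem trace_gradedPart_mul {D : SqMat (Fin m ⊕ Fin n)} (hD : D.IsHermitian) :
    (trace (gradedPart D * D)).re = ∑ i, ∑ j, ‖gradedPart D i j‖ ^ 2 := by
  rw [Matrix.trace, Complex.re_sum]
  refine Finset.sum_congr rfl fun i _ => ?_
  rw [Matrix.diag_apply, Matrix.mul_apply, Complex.re_sum]
  refine Finset.sum_congr rfl fun j _ => ?_
  have h1 : gradedPart D i j * D j i = gradedPart D i j * star (gradedPart D i j) := by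
    rw [← hD.apply j i]
    rcases i with i | i <;> rcases j with j | j <;> simp [gradedPart, Matrix.toBlocks₁₁, Matrix.toBlocks₂₂]
  rw [h1, Complex.star_def, Complex.mul_conj, Complex.normSq_eq_norm_sq, Complex.ofReal_re]

theorem compEq_zero_of_trace {D : SqMat (Fin m ⊕ Fin n)} (hD : D.IsHermitian)
    (h : (trace (gradedPart D * D)).re ≤ 0) : CompEq D 0 := by
  rw [trace_gradedPart_mul hD] at h
  have h1 : ∀ i j, gradedPart D i j = 0 := by
    intro i j
    have h2 := (Finset.sum_eq_zero_iff_of_nonneg fun i _ => Finset.sum_nonneg fun j _ => sq_nonneg _).1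
      (le_antisymm h (Finset.sum_nonneg fun i _ => Finset.sum_nonneg fun j _ => sq_nonneg
        ‖gradedPart D i j‖)) i (Finset.mem_univ i)
    have h3 := (Finset.sum_eq_zero_iff_of_nonneg fun j _ => sq_nonneg _).1 h2 j (Finset.mem_univ j)
    simpa using h3
  rintro (i | i) (j | j) hij
  · exact h1 (Sum.inl i) (Sum.inl j)
  · rcases hij with h | h <;> simp at h
  · rcases hij with h | h <;> simp at h
  · exact h1 (Sum.inr i) (Sum.inr j)

theorem CompEq.mul_mul {P : Type*} [Fintype P] [PartialOrder P] [ChainPoset P] {D M N : Matrix P P ℂ}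
    (hD : CompEq D 0) (hM : GradedMat M) (hN : GradedMat N) : CompEq (M * D * N) 0 := by
  intro i j hij
  rw [Matrix.mul_apply, Matrix.zero_apply]
  refine Finset.sum_eq_zero fun b _ => ?_
  by_cases hb : N b j = 0
  · rw [hb, mul_zero]
  rw [Matrix.mul_apply, Finset.sum_mul]
  refine Finset.sum_eq_zero fun a _ => ?_
  by_cases ha : M i a = 0
  · rw [ha, zero_mul, zero_mul]
  rw [hD a b (((hM i a ha).symm.trans hij).trans (hN b j hb).symm), Matrix.zero_apply, mul_zero, zero_mul]

theorem rdiag_add_const {T : Type*} [DecidableEq T] (f : T → ℝ) (a : ℝ) :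
    rdiag (fun t => f t + a) = rdiag f + (a : ℂ) • (1 : Matrix T T ℂ) := by
  refine Matrix.ext fun i j => ?_
  by_cases h : i = j
  · subst h; simp [rdiag]
  · simp [rdiag, h]

theorem conj_rdiag_smul_add {P T : Type*} [Fintype P] [DecidableEq P] [Fintype T] [DecidableEq T]
    {u : Matrix P T ℂ} (hu : IsU u) (f : T → ℝ) (a : ℝ) :
    u * rdiag (fun t => f t + a) * uᴴ = u * rdiag f * uᴴ + (a : ℂ) • (1 : Matrix P P ℂ) := by
  rw [rdiag_add_const, Matrix.mul_add, Matrix.add_mul, Matrix.mul_smul, Matrix.smul_mul, Matrix.mul_one, hu.right]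

theorem rdiag_neg {P : Type*} [DecidableEq P] (y : P → ℝ) : rdiag (fun a => - y a) = - rdiag y := by
  simp [rdiag, Matrix.diagonal_neg]

theorem gradedMat_expConj {V : SqMat (Fin m ⊕ Fin n)} (hV : IsU V) (hVg : GradedMat V)
    (y : Fin m ⊕ Fin n → ℝ) : GradedMat (V * rdiag (fun a => Real.exp (y a)) * Vᴴ) ∧
      IsUnit (V * rdiag (fun a => Real.exp (y a)) * Vᴴ).det := by
  refine ⟨(hVg.mul fun i j h => ?_).mul hVg.conjTranspose, isUnit_det_conj_exp hV y⟩
  by_cases hij : i = j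
  · exact hij ▸ Comp.refl i
  · simp [rdiag, hij] at h

theorem Semi.exists_isU (hk : m + n = k) (hX : LowerWeight c X) (hX' : LowerWeight c' X')
    (hg : Function.Injective (toLin' g)) (h : Semi c X c' X' κ g)
    (heq : ∑ i, c i * ((X i).card : ℝ) + ∑ i, c' i * ((X' i).card : ℝ) = κ * k) :
    ∃ w : Matrix (Fin m ⊕ Fin n) (Fin k) ℂ, IsU w ∧
      CompEq (w * rdiag (wt c X) * wᴴ) (rdiag fun i => κ - wt c' X' i) := by
  obtain ⟨u, v, -, hu, hv, hvg, hcrit⟩ := exists_critical hk hX hX' hg h heq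
    (𝓖 := {x | GradedMat x ∧ IsUnit x.det}) (fun x hx => hx) ⟨gradedMat_one, by simp⟩
    isClosed_univ (fun _ _ _ _ _ _ _ => Set.mem_univ _)
  set D := u * rdiag (wt c X) * uᴴ + v * rdiag (wt c' X') * vᴴ -
    (κ : ℂ) • (1 : SqMat (Fin m ⊕ Fin n)) with hD
  have hDH : D.IsHermitian := by
    refine ((conj_rdiag_isHermitian _ _).add (conj_rdiag_isHermitian _ _)).sub ?_
    rw [Matrix.IsHermitian, conjTranspose_smul, conjTranspose_one]
    simp
  have hDg : GradedMat (gradedPart D) := gradedMat_fromBlocks _ _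
  obtain ⟨V, y, hV, hVg, e⟩ := exists_graded_diag hDg (gradedPart_isHermitian hDH)
  have h1 := hcrit V hV (fun a => - y a) fun τ _ x hx => by
    have := gradedMat_expConj hV hVg fun a => τ * - y a
    exact ⟨this.1.mul hx.1, by rw [Matrix.det_mul]; exact this.2.mul hx.2⟩
  rw [rdiag_neg, Matrix.mul_neg, Matrix.neg_mul, ← e, Matrix.neg_mul, Matrix.trace_neg, Complex.neg_re] at h1
  have h3 := (compEq_zero_of_trace hDH (by linarith)).mul_mul hvg.conjTranspose hvg
  refine ⟨vᴴ * u, hv.conjTranspose.mul hu, fun i j hij => ?_⟩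
  have h4 := h3 i j hij
  have h5 : vᴴ * D * v = vᴴ * u * rdiag (wt c X) * (vᴴ * u)ᴴ + rdiag (wt c' X') -
      (κ : ℂ) • (1 : SqMat (Fin m ⊕ Fin n)) := by
    have h6 : vᴴ * (v * rdiag (wt c' X') * vᴴ) * v = rdiag (wt c' X') := by
      rw [← Matrix.mul_assoc, ← Matrix.mul_assoc, hv.left, Matrix.one_mul, Matrix.mul_assoc, hv.left,
        Matrix.mul_one]
    rw [hD, Matrix.mul_sub vᴴ, Matrix.sub_mul, Matrix.mul_add, Matrix.add_mul, h6, Matrix.mul_smul,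
      Matrix.smul_mul, Matrix.mul_one, hv.left, conjTranspose_mul, conjTranspose_conjTranspose]
    simp only [Matrix.mul_assoc]
  rw [h5] at h4
  simp only [Matrix.sub_apply, Matrix.add_apply, Matrix.zero_apply, Matrix.smul_apply, smul_eq_mul] at h4
  simp_rw [sub_eq_neg_add, rdiag_add_const, rdiag_neg, Matrix.add_apply, Matrix.neg_apply,
    Matrix.smul_apply, smul_eq_mul]
  linear_combination h4

theorem add_eq_zero_of_isU {S : Type*} [Fintype S] [DecidableEq S] {D : Matrix S S ℂ} (hD : IsU D)
    {w : S → ℝ} (hw : ∑ i, w i = 0) (h : ∀ i j, D i j ≠ 0 → w i + w j ≤ 0) (i j : S) (hij : D i j ≠ 0) :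
    w i + w j = 0 := by
  have hrow : ∀ E : Matrix S S ℂ, IsU E → ∀ i, ∑ j, ‖E i j‖ ^ 2 = 1 := by
    intro E hE i
    have h1 := congrFun (congrFun hE.right i) i
    rw [Matrix.mul_apply, Matrix.one_apply_eq] at h1
    have h2 : ((∑ j, ‖E i j‖ ^ 2 : ℝ) : ℂ) = 1 := by
      rw [← h1, Complex.ofReal_sum]
      refine Finset.sum_congr rfl fun j _ => ?_
      rw [conjTranspose_apply, Complex.star_def, Complex.mul_conj, Complex.normSq_eq_norm_sq]
    exact_mod_cast h2
  have hcol : ∀ j, ∑ i, ‖D i j‖ ^ 2 = 1 := fun j => by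
    simpa using hrow Dᴴ hD.conjTranspose j
  have h1 : ∑ i, ∑ j, ‖D i j‖ ^ 2 * (-(w i + w j)) = 0 := by
    have e1 : ∑ i, ∑ j, ‖D i j‖ ^ 2 * w i = 0 := by
      simp_rw [← Finset.sum_mul, hrow D hD, one_mul]
      exact hw
    have e2 : ∑ i, ∑ j, ‖D i j‖ ^ 2 * w j = 0 := by
      rw [Finset.sum_comm]
      simp_rw [← Finset.sum_mul, hcol, one_mul]
      exact hw
    simp_rw [mul_neg, mul_add, Finset.sum_neg_distrib, Finset.sum_add_distrib]
    rw [e1, e2]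
    simp
  have h0 : ∀ i j, 0 ≤ ‖D i j‖ ^ 2 * (-(w i + w j)) := by
    intro i j
    by_cases hz : D i j = 0
    · simp [hz]
    · exact mul_nonneg (sq_nonneg _) (by linarith [h i j hz])
  have h2 := (Finset.sum_eq_zero_iff_of_nonneg fun i _ => Finset.sum_nonneg fun j _ => h0 i j).1 h1 i
    (Finset.mem_univ i)
  have h3 := (Finset.sum_eq_zero_iff_of_nonneg fun j _ => h0 i j).1 h2 j (Finset.mem_univ j)
  rcases mul_eq_zero.1 h3 with h4 | h4
  · exact absurd (by simpa using h4) hij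
  · linarith

theorem conj_anticomm {P T : Type*} [Fintype P] [DecidableEq P] [Fintype T] [DecidableEq T]
    {J : Matrix P P ℂ} {u : Matrix P T ℂ} (hu : IsU u) {w : T → ℝ}
    (h : ∀ a b, (uᴴ * J * u) a b ≠ 0 → w a + w b = 0) :
    u * rdiag w * uᴴ * J = -(J * (u * rdiag w * uᴴ)) := by
  have h1 : rdiag w * (uᴴ * J * u) = -((uᴴ * J * u) * rdiag w) := by
    refine Matrix.ext fun a b => ?_
    rw [rdiag, Matrix.diagonal_mul, Matrix.neg_apply, Matrix.mul_diagonal]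
    by_cases hab : (uᴴ * J * u) a b = 0
    · rw [hab]; simp
    · have h2 : (w a : ℂ) + w b = 0 := by exact_mod_cast h a b hab
      linear_combination (uᴴ * J * u) a b * h2
  calc u * rdiag w * uᴴ * J = u * (rdiag w * (uᴴ * J * u)) * uᴴ := by
        simp only [Matrix.mul_assoc, hu.right, Matrix.mul_one]
    _ = -(u * uᴴ * (J * (u * rdiag w * uᴴ))) := by
        rw [h1, Matrix.mul_neg, Matrix.neg_mul]
        simp only [Matrix.mul_assoc]
    _ = _ := by rw [hu.right, Matrix.one_mul]

theorem isU_conj {P T : Type*} [Fintype P] [DecidableEq P] [Fintype T] [DecidableEq T]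
    {J : Matrix P P ℂ} {u : Matrix P T ℂ} (hu : IsU u) (hJ : IsU J) : IsU (uᴴ * J * u) :=
  (hu.conjTranspose.mul hJ).mul hu

theorem Upper.conj_entry {T : Type*} [Fintype T] [PartialOrder T] {R G : Matrix T T ℂ}
    (hR : Upper R) {w : T → ℝ} (hw : Antitone w) (hG : ∀ a b, G a b ≠ 0 → w a + w b ≤ 0) {a b : T}
    (h : (Rᴴ * G * R) a b ≠ 0) : w a + w b ≤ 0 := by
  by_contra hab
  refine h ?_
  rw [Matrix.mul_apply]
  refine Finset.sum_eq_zero fun d _ => ?_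
  by_cases hd : R d b = 0
  · rw [hd, mul_zero]
  rw [Matrix.mul_apply, Finset.sum_mul]
  refine Finset.sum_eq_zero fun c _ => ?_
  by_cases hc : R c a = 0
  · rw [conjTranspose_apply, hc]; simp
  by_cases hg : G c d = 0
  · rw [hg]; simp
  · have := hw (hR _ _ hd)
    have := hw (hR _ _ hc)
    have := hG c d hg
    exact absurd (by linarith) hab

theorem Semi.exists_isU_anticomm {κ₁ κ₂ : ℝ} (hk : m + n = k) (hX : LowerWeight c X) (hX' : LowerWeight c' X')
    (hg : Function.Injective (toLin' g)) (h : Semi c X c' X' (κ₁ + κ₂) g)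
    {w : Fin k → ℝ} {w' : Fin m ⊕ Fin n → ℝ} (hwX : wt c X = fun t => w t + κ₁)
    (hwX' : wt c' X' = fun t => w' t + κ₂) (hw : Antitone w) (hw' : Antitone w')
    (hw0 : ∑ t, w t = 0) (hw0' : ∑ t, w' t = 0)
    {J : SqMat (Fin m ⊕ Fin n)} (hJ : IsU J) (hJg : GradedMat J)
    (hJw : ∀ a b, J a b ≠ 0 → w' a + w' b ≤ 0) (hgw : ∀ a b, (gᴴ * J * g) a b ≠ 0 → w a + w b ≤ 0) :
    ∃ (u : Matrix (Fin m ⊕ Fin n) (Fin k) ℂ) (v : SqMat (Fin m ⊕ Fin n)),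
      IsU u ∧ IsU v ∧ GradedMat v ∧
      u * rdiag w * uᴴ * J = -(J * (u * rdiag w * uᴴ)) ∧
      CompEq (u * rdiag w * uᴴ) (-(v * rdiag w' * vᴴ)) := by
  have heq : ∑ i, c i * ((X i).card : ℝ) + ∑ i, c' i * ((X' i).card : ℝ) = (κ₁ + κ₂) * k := by
    have e1 := sum_wt c X Finset.univ
    have e2 := sum_wt c' X' Finset.univ
    simp only [Finset.univ_inter, hwX, hwX', Finset.sum_add_distrib, hw0, hw0', Finset.sum_const,
      Finset.card_univ, Fintype.card_fin, Fintype.card_sum, nsmul_eq_mul, hk] at e1 e2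
    rw [← e1, ← e2]
    ring
  obtain ⟨u, v, ⟨hu𝒞, hv𝒞⟩, hu, hv, hvg, hcrit⟩ := exists_critical hk hX hX' hg h heq
    (𝓖 := {x | (GradedMat x ∧ IsUnit x.det) ∧ xᴴ * J * x = J}) (fun x hx => hx.1)
    ⟨⟨gradedMat_one, by simp⟩, by simp⟩
    (𝒞 := {z | (∀ a b, 0 < w a + w b → (z.1ᴴ * J * z.1) a b = 0) ∧
      ∀ a b, 0 < w' a + w' b → (z.2ᴴ * J * z.2) a b = 0})
    (by
      simp only [Set.setOf_and, Set.setOf_forall]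
      have hc1 : Continuous fun z : Matrix (Fin m ⊕ Fin n) (Fin k) ℂ ×
          SqMat (Fin m ⊕ Fin n) => z.1ᴴ * J * z.1 := by fun_prop
      have hc2 : Continuous fun z : Matrix (Fin m ⊕ Fin n) (Fin k) ℂ ×
          SqMat (Fin m ⊕ Fin n) => z.2ᴴ * J * z.2 := by fun_prop
      exact (isClosed_iInter fun a => isClosed_iInter fun b => isClosed_iInter fun _ =>
          isClosed_eq (hc1.matrix_elem a b) continuous_const).inter
        (isClosed_iInter fun a => isClosed_iInter fun b => isClosed_iInter fun _ =>
          isClosed_eq (hc2.matrix_elem a b) continuous_const))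
    (by
      intro x hx R R' hR hR' _
      refine ⟨fun a b hab => ?_, fun a b hab => ?_⟩
      · by_contra hne
        refine absurd (hR.conj_entry hw hgw ?_) (not_le.2 hab)
        rw [← hx.2]
        have hne' : ((x * g * R)ᴴ * J * (x * g * R)) a b ≠ 0 := hne
        simpa only [conjTranspose_mul, Matrix.mul_assoc] using hne'
      · by_contra hne
        refine absurd (hR'.conj_entry hw' hJw ?_) (not_le.2 hab)
        rw [← hx.2]
        have hne' : ((x * R')ᴴ * J * (x * R')) a b ≠ 0 := hne
        simpa only [conjTranspose_mul, Matrix.mul_assoc] using hne')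
  have hua : u * rdiag w * uᴴ * J = -(J * (u * rdiag w * uᴴ)) :=
    conj_anticomm hu (add_eq_zero_of_isU (isU_conj hu hJ) hw0 fun i j hij =>
      not_lt.1 fun hlt => hij (hu𝒞 i j hlt))
  have hva : v * rdiag w' * vᴴ * J = -(J * (v * rdiag w' * vᴴ)) :=
    conj_anticomm hv (add_eq_zero_of_isU (isU_conj hv hJ) hw0' fun i j hij =>
      not_lt.1 fun hlt => hij (hv𝒞 i j hlt))
  refine ⟨u, v, hu, hv, hvg, hua, ?_⟩
  rw [hwX, hwX', conj_rdiag_smul_add hu, conj_rdiag_smul_add hv] at hcrit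
  set D := u * rdiag w * uᴴ + v * rdiag w' * vᴴ with hD
  have h0 : u * rdiag w * uᴴ + (κ₁ : ℂ) • (1 : SqMat (Fin m ⊕ Fin n)) +
      (v * rdiag w' * vᴴ + (κ₂ : ℂ) • (1 : SqMat (Fin m ⊕ Fin n))) -
      ((κ₁ + κ₂ : ℝ) : ℂ) • (1 : SqMat (Fin m ⊕ Fin n)) = D := by
    rw [hD, Complex.ofReal_add, add_smul]
    abel
  rw [h0] at hcrit
  have hDH : D.IsHermitian := (conj_rdiag_isHermitian _ _).add (conj_rdiag_isHermitian _ _)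
  have hDJ : D * J = -(J * D) := by
    rw [hD, Matrix.add_mul, Matrix.mul_add, hua, hva, neg_add]
  have hDg : GradedMat (gradedPart D) := gradedMat_fromBlocks _ _
  have hDgJ : gradedPart D * J = -(J * gradedPart D) := by
    rw [← gradedPart_mul D hJg, hDJ, gradedPart_neg, mul_gradedPart D hJg]
  obtain ⟨V, y, hV, hVg, e⟩ := exists_graded_diag hDg (gradedPart_isHermitian hDH)
  have hy : ∀ a b, (Vᴴ * J * V) a b ≠ 0 → y a + y b = 0 := by
    intro a b hab
    have h1 : rdiag y * (Vᴴ * J * V) = -((Vᴴ * J * V) * rdiag y) := by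
      have e' := eq_of_eq_conj hV e
      calc rdiag y * (Vᴴ * J * V) = Vᴴ * (gradedPart D * (V * Vᴴ) * J) * V := by
            rw [← e']
            simp only [Matrix.mul_assoc]
        _ = -(Vᴴ * J * (V * Vᴴ) * gradedPart D * V) := by
            rw [hV.right, Matrix.mul_one, hDgJ, Matrix.mul_neg, Matrix.neg_mul, Matrix.mul_one]
            simp only [Matrix.mul_assoc]
        _ = _ := by
            rw [← e']
            simp only [Matrix.mul_assoc]
    have h2 := congrFun (congrFun h1 a) b
    rw [rdiag, Matrix.diagonal_mul, Matrix.neg_apply, Matrix.mul_diagonal] at h2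
    have h3 : ((y a : ℂ) + y b) * (Vᴴ * J * V) a b = 0 := by linear_combination h2
    exact_mod_cast (mul_eq_zero.1 h3).resolve_right hab
  have h1 := hcrit V hV (fun a => - y a) fun τ _ x hx => by
    have h2 := gradedMat_expConj hV hVg fun a => τ * - y a
    refine ⟨⟨h2.1.mul hx.1.1, by rw [Matrix.det_mul]; exact h2.2.mul hx.1.2⟩, ?_⟩
    set E := rdiag fun a => Real.exp (τ * - y a) with hE
    have h3 : E * (Vᴴ * J * V) * E = Vᴴ * J * V := by
      refine Matrix.ext fun a b => ?_
      rw [hE, rdiag, Matrix.mul_diagonal, Matrix.diagonal_mul]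
      by_cases hab : (Vᴴ * J * V) a b = 0
      · rw [hab]; simp
      · rw [mul_right_comm, ← Complex.ofReal_mul, ← Real.exp_add,
          show τ * -y a + τ * -y b = 0 by linear_combination -τ * hy a b hab]
        simp
    have h4 : (V * E * Vᴴ)ᴴ * J * (V * E * Vᴴ) = J := by
      calc (V * E * Vᴴ)ᴴ * J * (V * E * Vᴴ) = V * (E * (Vᴴ * J * V) * E) * Vᴴ := by
            simp only [conjTranspose_mul, conjTranspose_conjTranspose, hE,
              rdiag_conjTranspose, Matrix.mul_assoc]
        _ = (V * Vᴴ) * J * (V * Vᴴ) := by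
            rw [h3]
            simp only [Matrix.mul_assoc]
        _ = J := by rw [hV.right, Matrix.one_mul, Matrix.mul_one]
    calc (V * E * Vᴴ * x)ᴴ * J * (V * E * Vᴴ * x) = xᴴ * ((V * E * Vᴴ)ᴴ * J * (V * E * Vᴴ)) * x := by
          rw [conjTranspose_mul]
          simp only [Matrix.mul_assoc]
      _ = J := by rw [h4, hx.2]
  rw [rdiag_neg, Matrix.mul_neg, Matrix.neg_mul, ← e, Matrix.neg_mul, Matrix.trace_neg, Complex.neg_re] at h1
  have h3 := compEq_zero_of_trace hDH (by linarith)
  intro i j hij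
  have h4 := h3 i j hij
  rw [hD, Matrix.add_apply, Matrix.zero_apply] at h4
  rw [Matrix.neg_apply]
  linear_combination h4

end KempfNess

section Genericity

open scoped Topology

variable {P T : Type} [Fintype P] [Fintype T] [DecidableEq P] [DecidableEq T]

/-- The generic matrix supported on `S`, whose variables are named by `ι`. -/
noncomputable def genOn {σ m n : Type} [DecidableEq m] [DecidableEq n] (S : Finset (m × n)) (ι : S → σ) :
    Matrix m n (MvPolynomial σ ℂ) :=
  Matrix.of fun i j => if h : (i, j) ∈ S then MvPolynomial.X (ι ⟨(i, j), h⟩) else 0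

theorem genOn_eval {σ m n : Type} [DecidableEq m] [DecidableEq n] {S : Finset (m × n)} {ι : S → σ}
    {x : σ → ℂ} {M : Matrix m n ℂ} (hM : M ∈ SM ℂ S) (hx : ∀ s : S, x (ι s) = M s.1.1 s.1.2) :
    (genOn S ι).map (MvPolynomial.eval x) = M := by
  refine Matrix.ext fun i j => ?_
  rw [Matrix.map_apply, genOn, Matrix.of_apply]
  by_cases h : (i, j) ∈ S
  · rw [dif_pos h, MvPolynomial.eval_X, hx]
  · rw [dif_neg h, map_zero]
    exact (mem_SM.1 hM i j h).symm

theorem exists_poly_vanishing [PartialOrder P] [PartialOrder T] {B : Finset P} {A : Finset T}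
    (h : (tri Bᶜ B).card + (tri Aᶜ A).card < Bᶜ.card * A.card) :
    ∃ p : MvPolynomial (P × T) ℂ, p ≠ 0 ∧ ∀ φ ∈ SM ℂ (tri Bᶜ B), ∀ u ∈ SM ℂ (tri Aᶜ A),
      ∀ g ∈ SM ℂ (Bᶜ ×ˢ A)ᶜ,
        MvPolynomial.eval (fun ij => ((1 + φ) * g * (1 - u) : Matrix P T ℂ) ij.1 ij.2) p = 0 := by
  classical
  let σ : Type := (tri Bᶜ B) ⊕ (tri Aᶜ A) ⊕ ((Bᶜ ×ˢ A)ᶜ : Finset (P × T))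
  let F1 : Matrix P P (MvPolynomial σ ℂ) := genOn (tri Bᶜ B) Sum.inl
  let F2 : Matrix T T (MvPolynomial σ ℂ) := genOn (tri Aᶜ A) fun s => Sum.inr (Sum.inl s)
  let F3 : Matrix P T (MvPolynomial σ ℂ) := genOn (Bᶜ ×ˢ A)ᶜ fun s => Sum.inr (Sum.inr s)
  let F : Matrix P T (MvPolynomial σ ℂ) := (1 + F1) * F3 * (1 - F2)
  have hF : ¬ AlgebraicIndependent ℂ fun ij : P × T => F ij.1 ij.2 := fun hI => by
    have h1 := hI.cardinalMk_le_trdeg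
    rw [MvPolynomial.trdeg_of_isDomain, Cardinal.lift_id, Cardinal.mk_fintype, Cardinal.mk_fintype,
      Nat.cast_le] at h1
    simp only [σ, Fintype.card_sum, Fintype.card_coe, Finset.card_compl, Finset.card_product,
      Fintype.card_prod] at h1 h
    have h2 : (Fintype.card P - B.card) * A.card ≤ Fintype.card P * Fintype.card T :=
      Nat.mul_le_mul (Nat.sub_le _ _) (Finset.card_le_univ A)
    omega
  rw [algebraicIndependent_iff] at hF
  push Not at hF
  obtain ⟨p, hp, hp0⟩ := hF
  refine ⟨p, hp0, fun φ hφ u hu g hg => ?_⟩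
  let x : σ → ℂ := Sum.elim (fun s => φ s.1.1 s.1.2)
    (Sum.elim (fun s => u s.1.1 s.1.2) (fun s => g s.1.1 s.1.2))
  have e1 : F1.map (MvPolynomial.eval x) = φ := genOn_eval hφ fun s => rfl
  have e2 : F2.map (MvPolynomial.eval x) = u := genOn_eval hu fun s => rfl
  have e3 : F3.map (MvPolynomial.eval x) = g := genOn_eval hg fun s => rfl
  have e : F.map (MvPolynomial.eval x) = (1 + φ) * g * (1 - u) := by
    rw [← e1, ← e2, ← e3]
    simp only [F, Matrix.map_mul]
    rw [Matrix.map_add _ (map_add _), Matrix.map_sub _ (map_sub _), Matrix.map_one _ (map_zero _) (map_one _),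
      Matrix.map_one _ (map_zero _) (map_one _)]
  rw [← e]
  have h3 := congrArg (MvPolynomial.eval x) hp
  rw [map_zero, MvPolynomial.aeval_def, MvPolynomial.algebraMap_eq] at h3
  rw [← MvPolynomial.coe_eval₂Hom] at h3
  have h4 : (MvPolynomial.eval x).comp (MvPolynomial.eval₂Hom MvPolynomial.C fun ij : P × T => F ij.1 ij.2)
      = MvPolynomial.eval fun ij : P × T => MvPolynomial.eval x (F ij.1 ij.2) :=
    MvPolynomial.ringHom_ext (fun r => by simp) fun i => by simp
  exact (DFunLike.congr_fun h4 p).symm.trans h3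

section Exp

attribute [local instance] Matrix.linftyOpNormedRing Matrix.linftyOpNormedAlgebra

theorem range_exp_mem_nhds : Set.range (NormedSpace.exp : Matrix P P ℂ → Matrix P P ℂ) ∈ 𝓝 1 := by
  have h := (hasStrictFDerivAt_exp_zero (𝕂 := ℂ) (𝔸 := Matrix P P ℂ)).map_nhds_eq_of_equiv
    (f' := ContinuousLinearEquiv.refl ℂ (Matrix P P ℂ))
  rw [NormedSpace.exp_zero] at h
  exact h ▸ Filter.range_mem_map

theorem differentiable_exp_line (A B : Matrix P P ℂ) (i j : P) :
    Differentiable ℂ fun ζ : ℂ => NormedSpace.exp (A + ζ • B) i j := by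
  have h : Differentiable ℂ fun ζ : ℂ => NormedSpace.exp (A + ζ • B) := by
    intro ζ
    have h1 := (NormedSpace.exp_analytic (𝕂 := ℂ) (A + ζ • B)).differentiableAt
    have h2 : DifferentiableAt ℂ (fun ζ : ℂ => A + ζ • B) ζ := by fun_prop
    exact h1.comp ζ h2
  exact ((Matrix.entryLinearMap ℂ ℂ i j).toContinuousLinearMap.differentiable).comp h

end Exp

theorem conj_exp_eq {J A : Matrix P P ℂ} (hJ : IsU J) (hJ' : Jᴴ = J) (hA : Aᴴ = -A) :
    (NormedSpace.exp (J * A))ᴴ * J * NormedSpace.exp (J * A) = J := by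
  have hJJ : J * J = 1 := by
    have := hJ.left
    rwa [hJ'] at this
  have hi : J⁻¹ = J := Matrix.inv_eq_left_inv hJJ
  have hu : IsUnit J := ⟨⟨J, J, hJJ, hJJ⟩, rfl⟩
  have e1 : J * (A * J) * J⁻¹ = J * A := by
    rw [hi, Matrix.mul_assoc, Matrix.mul_assoc, hJJ, Matrix.mul_one]
  have h1 : NormedSpace.exp (J * A) = J * NormedSpace.exp (A * J) * J := by
    rw [← e1, Matrix.exp_conj J (A * J) hu, hi]
  have e2 : (J * A)ᴴ = -(A * J) := by rw [conjTranspose_mul, hA, hJ', Matrix.neg_mul]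
  have h2 : (NormedSpace.exp (J * A))ᴴ * NormedSpace.exp (A * J) = 1 := by
    rw [← Matrix.exp_conjTranspose, e2, Matrix.exp_neg]
    exact Matrix.nonsing_inv_mul _ ((Matrix.isUnit_iff_isUnit_det _).1 (Matrix.isUnit_exp _))
  generalize NormedSpace.exp (A * J) = Y at h1 h2
  calc (NormedSpace.exp (J * A))ᴴ * J * NormedSpace.exp (J * A)
      = (NormedSpace.exp (J * A))ᴴ * J * (J * Y * J) := by rw [← h1]
    _ = (NormedSpace.exp (J * A))ᴴ * (J * J) * Y * J := by simp only [Matrix.mul_assoc]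
    _ = J := by rw [hJJ, Matrix.mul_one, h2, Matrix.one_mul]

theorem exists_generic {J : Matrix P P ℂ} (hJ : IsU J) (hJ' : Jᴴ = J) {g₀ : Matrix P T ℂ}
    {g₁ : Matrix T P ℂ} (hg : g₁ * g₀ = 1) (hg' : g₀ * g₁ = 1) {q : MvPolynomial (P × T) ℂ} (hq : q ≠ 0) :
    ∃ E : Matrix P P ℂ, Eᴴ * J * E = J ∧ MvPolynomial.eval (fun ij => (E * g₀) ij.1 ij.2) q ≠ 0 := by
  by_contra hcon
  push Not at hcon
  have hJJ : J * J = 1 := by simpa [hJ'] using hJ.left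
  have h1 : ∀ C : Matrix P P ℂ, MvPolynomial.eval (fun ij => (NormedSpace.exp C * g₀) ij.1 ij.2) q = 0 := by
    intro C
    let A : Matrix P P ℂ := (2 : ℂ)⁻¹ • (J * C - (J * C)ᴴ)
    let B : Matrix P P ℂ := (-Complex.I * (2 : ℂ)⁻¹) • (J * C + (J * C)ᴴ)
    have hA : Aᴴ = -A := by
      simp only [A, conjTranspose_smul, conjTranspose_sub, conjTranspose_conjTranspose]
      rw [← smul_neg, neg_sub]
      simp
    have hB : Bᴴ = -B := by
      simp only [B, conjTranspose_smul, conjTranspose_add, conjTranspose_conjTranspose]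
      rw [← neg_smul, add_comm (J * C)ᴴ]
      simp
    have hAB : A + Complex.I • B = J * C := by
      refine Matrix.ext fun i j => ?_
      simp only [A, B, Matrix.add_apply, Matrix.smul_apply, Matrix.sub_apply, smul_eq_mul]
      linear_combination (-(1 / 2 : ℂ) * ((J * C) i j + (J * C)ᴴ i j)) * Complex.I_mul_I
    clear_value A B
    let f : ℂ → ℂ := fun ζ => MvPolynomial.eval
      (fun ij => (NormedSpace.exp (J * A + ζ • (J * B)) * g₀) ij.1 ij.2) q
    have hf : Differentiable ℂ f := by
      have : ∀ ij : P × T, Differentiable ℂ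
          fun ζ : ℂ => (NormedSpace.exp (J * A + ζ • (J * B)) * g₀) ij.1 ij.2 := fun ij => by
        simp only [Matrix.mul_apply]
        exact Differentiable.fun_sum fun k _ => (differentiable_exp_line _ _ _ _).mul_const _
      simp only [f, MvPolynomial.eval_eq]
      refine Differentiable.fun_sum fun k _ => Differentiable.const_mul ?_ _
      refine Differentiable.fun_finset_prod fun i _ => (this i).pow _
    have hf0 : ∀ τ : ℝ, f τ = 0 := fun τ => by
      have h2 : J * A + (τ : ℂ) • (J * B) = J * (A + (τ : ℂ) • B) := by
        rw [Matrix.mul_add, Matrix.mul_smul]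
      simp only [f]
      rw [h2]
      refine hcon _ (conj_exp_eq hJ hJ' ?_)
      rw [conjTranspose_add, conjTranspose_smul, hA, hB]
      simp [add_comm]
    have hfz : f = 0 := by
      have ha : AnalyticOnNhd ℂ f Set.univ := fun z _ => hf.analyticAt z
      refine ha.eq_of_frequently_eq (z₀ := 0) (fun z _ => analyticAt_const) ?_
      have ht : Filter.Tendsto (fun k : ℕ => (((1 : ℝ) / ((k : ℝ) + 1) : ℝ) : ℂ)) Filter.atTop (𝓝[≠] 0) := by
        refine tendsto_nhdsWithin_iff.2 ⟨?_, Filter.Eventually.of_forall fun k => ?_⟩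
        · have := (Complex.continuous_ofReal.tendsto 0).comp tendsto_one_div_add_atTop_nhds_zero_nat
          simpa [Function.comp_def] using this
        · have : (0 : ℝ) < 1 / ((k : ℝ) + 1) := by positivity
          exact fun h => this.ne' (Complex.ofReal_eq_zero.1 h)
      exact ht.frequently (Filter.Frequently.of_forall fun k => hf0 _)
    have h3 := congrFun hfz Complex.I
    simp only [f, Pi.zero_apply] at h3
    rwa [← Matrix.mul_smul, ← Matrix.mul_add, hAB, ← Matrix.mul_assoc, hJJ, Matrix.one_mul] at h3
  obtain ⟨U, hU, hUo, h1U⟩ := mem_nhds_iff.1 (range_exp_mem_nhds (P := P))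
  have hc : Continuous fun x : P × T → ℂ => (Matrix.of fun i j => x (i, j) : Matrix P T ℂ) * g₁ := by
    refine Continuous.matrix_mul (continuous_matrix fun i j => ?_) continuous_const
    exact continuous_apply (i, j)
  refine hq (eq_zero_of_eval_eq_zero_on_open (hUo.preimage hc)
    ⟨fun ij => g₀ ij.1 ij.2, ?_⟩ fun x hx => ?_)
  · show (g₀ * g₁) ∈ U
    rwa [hg']
  · obtain ⟨C, hC⟩ := hU hx
    have h2 := h1 C
    rw [hC, Matrix.mul_assoc, hg, Matrix.mul_one] at h2
    exact h2

theorem exists_generic_card [PartialOrder P] [PartialOrder T] {J : Matrix P P ℂ} (hJ : IsU J)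
    (hJ' : Jᴴ = J) {g₀ : Matrix P T ℂ} {g₁ : Matrix T P ℂ} (hg : g₁ * g₀ = 1) (hg' : g₀ * g₁ = 1) :
    ∃ E : Matrix P P ℂ, Eᴴ * J * E = J ∧ ∀ (B : Finset P) (A : Finset T),
      ∀ φ ∈ SM ℂ (tri Bᶜ B), ∀ u ∈ SM ℂ (tri Aᶜ A), ∀ g ∈ SM ℂ (Bᶜ ×ˢ A)ᶜ,
        E * g₀ = (1 + φ) * g * (1 - u) → Bᶜ.card * A.card ≤ (tri Bᶜ B).card + (tri Aᶜ A).card := by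
  classical
  have h : ∀ BA : Finset P × Finset T, ∃ p : MvPolynomial (P × T) ℂ, p ≠ 0 ∧
      ((tri BA.1ᶜ BA.1).card + (tri BA.2ᶜ BA.2).card < BA.1ᶜ.card * BA.2.card →
      ∀ φ ∈ SM ℂ (tri BA.1ᶜ BA.1), ∀ u ∈ SM ℂ (tri BA.2ᶜ BA.2), ∀ g ∈ SM ℂ (BA.1ᶜ ×ˢ BA.2)ᶜ,
        MvPolynomial.eval (fun ij => ((1 + φ) * g * (1 - u) : Matrix P T ℂ) ij.1 ij.2) p = 0) := by
    intro BA
    by_cases hc : (tri BA.1ᶜ BA.1).card + (tri BA.2ᶜ BA.2).card < BA.1ᶜ.card * BA.2.card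
    · obtain ⟨p, hp, hp'⟩ := exists_poly_vanishing hc
      exact ⟨p, hp, fun _ => hp'⟩
    · exact ⟨1, one_ne_zero, fun h => absurd h hc⟩
  choose p hp hp' using h
  obtain ⟨E, hE, hE'⟩ := exists_generic hJ hJ' hg hg' (q := ∏ BA, p BA)
    (Finset.prod_ne_zero_iff.2 fun BA _ => hp BA)
  refine ⟨E, hE, fun B A φ hφ u hu g hgm e => ?_⟩
  by_contra hc
  push Not at hc
  rw [map_prod] at hE'
  refine Finset.prod_ne_zero_iff.1 hE' (B, A) (Finset.mem_univ _) ?_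
  rw [e]
  exact hp' (B, A) hc φ hφ u hu g hgm

end Genericity

section Optimal

theorem finrank_push_eq {V : Type*} [AddCommGroup V] [Module ℂ V] [FiniteDimensional ℂ V]
    (Φ : V →ₗ[ℂ] V) (W : Submodule ℂ V) :
    finrank ℂ (W ⊔ W.map Φ : Submodule ℂ V) + finrank ℂ (W ⊓ W.comap Φ : Submodule ℂ V) =
      2 * finrank ℂ W := by
  have h1 := finrank_map_add_inf_ker (W.mkQ ∘ₗ Φ) W
  have h2 := finrank_map_add_inf_ker W.mkQ (W ⊔ W.map Φ)
  rw [LinearMap.ker_comp, Submodule.ker_mkQ] at h1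
  rw [Submodule.ker_mkQ, Submodule.map_sup, Submodule.mkQ_map_self, bot_sup_eq, ← Submodule.map_comp,
    inf_eq_right.2 (le_sup_left : W ≤ W ⊔ W.map Φ)] at h2
  omega

theorem finrank_push_le {V : Type*} [AddCommGroup V] [Module ℂ V] [FiniteDimensional ℂ V]
    (Φ : V →ₗ[ℂ] V) (W F : Submodule ℂ V) (h : ∀ w ∈ W, w ∈ F → Φ w ∈ F ⊔ W) :
    2 * finrank ℂ (F ⊓ W : Submodule ℂ V) ≤ finrank ℂ (F ⊓ (W ⊔ W.map Φ) : Submodule ℂ V) +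
      finrank ℂ (F ⊓ (W ⊓ W.comap Φ) : Submodule ℂ V) := by
  have h1 := finrank_map_add_inf_ker (W.mkQ ∘ₗ Φ) (F ⊓ W)
  have h2 := finrank_map_add_inf_ker W.mkQ (F ⊓ (W ⊔ W.map Φ))
  rw [LinearMap.ker_comp, Submodule.ker_mkQ, inf_assoc] at h1
  rw [Submodule.ker_mkQ, inf_assoc, inf_eq_right.2 (le_sup_left : W ≤ W ⊔ W.map Φ)] at h2
  have h3 : (F ⊓ W).map (W.mkQ ∘ₗ Φ) ≤ (F ⊓ (W ⊔ W.map Φ)).map W.mkQ := by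
    rintro _ ⟨w, ⟨hF, hW⟩, rfl⟩
    obtain ⟨f, hf, w', hw', e⟩ := Submodule.mem_sup.1 (h w hW hF)
    refine ⟨f, ⟨hf, ?_⟩, ?_⟩
    · rw [eq_sub_of_add_eq e]
      exact sub_mem (Submodule.mem_sup_right ⟨w, hW, rfl⟩) (Submodule.mem_sup_left hw')
    · have h3 : W.mkQ w' = 0 := (Submodule.Quotient.mk_eq_zero W).2 hw'
      rw [LinearMap.comp_apply, ← e, map_add, h3, add_zero]
  have := Submodule.finrank_mono h3
  omega

variable {P T : Type*} [Fintype P] [Fintype T] [DecidableEq P] [DecidableEq T] [PartialOrder P]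
  {ι ι' : Type*} [Fintype ι] [Fintype ι']

/-- The quantity whose nonpositivity on graded subspaces is semistability. -/
noncomputable def excess (c : ι → ℝ) (X : ι → Finset T) (c' : ι' → ℝ) (X' : ι' → Finset P) (κ : ℝ)
    (g : Matrix P T ℂ) (W : Submodule ℂ (P → ℂ)) : ℝ :=
  ∑ i, c i * (finrank ℂ (coord ℂ (X i) ⊓ W.comap (toLin' g) : Submodule ℂ (T → ℂ)) : ℝ) +
    ∑ i, c' i * (finrank ℂ (W ⊓ coord ℂ (X' i) : Submodule ℂ (P → ℂ)) : ℝ) -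
    κ * finrank ℂ W

theorem exists_optimal {c : ι → ℝ} {X : ι → Finset T} {c' : ι' → ℝ} {X' : ι' → Finset P} {κ : ℝ}
    {g : Matrix P T ℂ} (h : ¬ Semi c X c' X' κ g) :
    ∃ W, Graded W ∧ 0 < excess c X c' X' κ g W ∧ ∀ W', Graded W' →
      excess c X c' X' κ g W' ≤ excess c X c' X' κ g W ∧
      (excess c X c' X' κ g W ≤ excess c X c' X' κ g W' → finrank ℂ W' ≤ finrank ℂ W) := by
  let F : Submodule ℂ (P → ℂ) → (ι → ℕ) × (ι' → ℕ) × ℕ := fun W =>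
    (fun i => finrank ℂ (coord ℂ (X i) ⊓ W.comap (toLin' g) : Submodule ℂ (T → ℂ)),
      fun i => finrank ℂ (W ⊓ coord ℂ (X' i) : Submodule ℂ (P → ℂ)), finrank ℂ W)
  let G : (ι → ℕ) × (ι' → ℕ) × ℕ → ℝ ×ₗ ℕ := fun x =>
    toLex (∑ i, c i * (x.1 i : ℝ) + ∑ i, c' i * (x.2.1 i : ℝ) - κ * x.2.2, x.2.2)
  let S := F '' {W | Graded W}
  have hT : ∀ U : Submodule ℂ (T → ℂ), finrank ℂ U ≤ Fintype.card T := fun U => by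
    simpa using Submodule.finrank_le U
  have hP : ∀ U : Submodule ℂ (P → ℂ), finrank ℂ U ≤ Fintype.card P := fun U => by
    simpa using Submodule.finrank_le U
  have hS : S.Finite := by
    refine ((Set.Finite.pi' fun _ : ι => Set.finite_Iic (Fintype.card T)).prod
      ((Set.Finite.pi' fun _ : ι' => Set.finite_Iic (Fintype.card P)).prod
        (Set.finite_Iic (Fintype.card P)))).subset ?_
    rintro _ ⟨W, -, rfl⟩
    exact ⟨fun i => hT _, fun i => hP _, hP _⟩
  unfold Semi at h
  push Not at h
  obtain ⟨W0, hW0, h0⟩ := h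
  obtain ⟨_, ⟨W, hW, rfl⟩, hmax⟩ := Set.exists_max_image S G hS ⟨_, W0, hW0, rfl⟩
  have key : ∀ W', Graded W' → excess c X c' X' κ g W' ≤ excess c X c' X' κ g W ∧
      (excess c X c' X' κ g W ≤ excess c X c' X' κ g W' → finrank ℂ W' ≤ finrank ℂ W) := by
    intro W' hW'
    have h1 := hmax _ ⟨W', hW', rfl⟩
    rcases Prod.Lex.le_iff.1 h1 with h2 | ⟨h2, h3⟩
    · exact ⟨le_of_lt h2, fun h3 => absurd h2 (not_lt.2 h3)⟩
    · exact ⟨le_of_eq h2, fun _ => h3⟩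
  refine ⟨W, hW, lt_of_lt_of_le ?_ (key W0 hW0).1, key⟩
  unfold excess
  linarith

theorem two_mul_sum_le {c : ι → ℝ} (hc : ∀ i, 0 ≤ c i) {f₀ f₁ f₂ : ι → ℕ}
    (h : ∀ i, c i ≠ 0 → 2 * f₀ i ≤ f₁ i + f₂ i) :
    2 * ∑ i, c i * (f₀ i : ℝ) ≤ ∑ i, c i * (f₁ i : ℝ) + ∑ i, c i * (f₂ i : ℝ) := by
  rw [Finset.mul_sum, ← Finset.sum_add_distrib]
  refine Finset.sum_le_sum fun i _ => ?_
  by_cases hi : c i = 0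
  · simp [hi]
  · have h1 : (2 * f₀ i : ℝ) ≤ f₁ i + f₂ i := by exact_mod_cast h i hi
    linear_combination mul_le_mul_of_nonneg_left h1 (hc i)

theorem optimal_stable {c : ι → ℝ} (hc : ∀ i, 0 ≤ c i) {X : ι → Finset T} {c' : ι' → ℝ}
    (hc' : ∀ i, 0 ≤ c' i) {X' : ι' → Finset P} {κ : ℝ} {g : Matrix P T ℂ}
    (hg : Function.Injective (toLin' g)) [ChainPoset P] {W : Submodule ℂ (P → ℂ)} (hW : Graded W)
    (hmax : ∀ W', Graded W' → excess c X c' X' κ g W' ≤ excess c X c' X' κ g W ∧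
      (excess c X c' X' κ g W ≤ excess c X c' X' κ g W' → finrank ℂ W' ≤ finrank ℂ W))
    {Φ : Matrix P P ℂ} (hΦ : GradedMat Φ)
    (h1 : ∀ i, c i ≠ 0 → ∀ w ∈ coord ℂ (X i), g *ᵥ w ∈ W →
      ∃ v ∈ coord ℂ (X i), Φ *ᵥ (g *ᵥ w) - g *ᵥ v ∈ W)
    (h2 : ∀ i, c' i ≠ 0 → ∀ w ∈ coord ℂ (X' i), Φ *ᵥ w ∈ coord ℂ (X' i)) :
    ∀ w ∈ W, Φ *ᵥ w ∈ W := by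
  have e0 : ∀ (i : ι) (U : Submodule ℂ (P → ℂ)),
      finrank ℂ (coord ℂ (X i) ⊓ U.comap (toLin' g) : Submodule ℂ (T → ℂ)) =
      finrank ℂ ((coord ℂ (X i)).map (toLin' g) ⊓ U : Submodule ℂ (P → ℂ)) := by
    intro i U
    rw [← finrank_map_of_injective _ hg, Submodule.map_inf _ hg, Submodule.map_comap_eq, ← inf_assoc,
      inf_eq_left.2 (show (coord ℂ (X i)).map (toLin' g) ≤ LinearMap.range (toLin' g) from
        LinearMap.map_le_range)]
  let L := toLin' Φ
  have k1 : ∀ i, c i ≠ 0 → 2 * finrank ℂ ((coord ℂ (X i)).map (toLin' g) ⊓ W :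
      Submodule ℂ (P → ℂ)) ≤ finrank ℂ ((coord ℂ (X i)).map (toLin' g) ⊓ (W ⊔ W.map L) :
      Submodule ℂ (P → ℂ)) + finrank ℂ ((coord ℂ (X i)).map (toLin' g) ⊓ (W ⊓ W.comap L) :
      Submodule ℂ (P → ℂ)) := by
    intro i hi
    refine finrank_push_le L W _ ?_
    rintro _ hw ⟨w, hw', rfl⟩
    obtain ⟨v, hv, hv'⟩ := h1 i hi w hw' hw
    refine Submodule.mem_sup.2 ⟨_, ⟨v, hv, rfl⟩, _, hv', ?_⟩
    rw [toLin'_apply, toLin'_apply, toLin'_apply, add_sub_cancel]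
  have k2 : ∀ i, c' i ≠ 0 → 2 * finrank ℂ (W ⊓ coord ℂ (X' i) : Submodule ℂ (P → ℂ)) ≤
      finrank ℂ ((W ⊔ W.map L) ⊓ coord ℂ (X' i) : Submodule ℂ (P → ℂ)) +
      finrank ℂ ((W ⊓ W.comap L) ⊓ coord ℂ (X' i) : Submodule ℂ (P → ℂ)) := by
    intro i hi
    rw [inf_comm, inf_comm (W ⊔ _), inf_comm (W ⊓ _)]
    exact finrank_push_le L W _ fun w _ hw => Submodule.mem_sup_left (h2 i hi w hw)
  have k3 := finrank_push_eq L W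
  have g1 : Graded (W ⊔ W.map L) := hW.sup (hW.map hΦ)
  have g2 : Graded (W ⊓ W.comap L) := hW.inf (hW.comap hΦ)
  have hsum : 2 * excess c X c' X' κ g W ≤
      excess c X c' X' κ g (W ⊔ W.map L) + excess c X c' X' κ g (W ⊓ W.comap L) := by
    unfold excess
    simp only [e0]
    have s1 := two_mul_sum_le hc k1
    have s2 := two_mul_sum_le hc' k2
    have s3 : (finrank ℂ (W ⊔ W.map L : Submodule ℂ (P → ℂ)) : ℝ) +
        finrank ℂ (W ⊓ W.comap L : Submodule ℂ (P → ℂ)) = 2 * finrank ℂ W := by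
      exact_mod_cast k3
    linear_combination s1 + s2 + κ * s3
  have hd := (hmax _ g1).2 (by linarith [(hmax _ g2).1])
  have e : W = W ⊔ W.map L := Submodule.eq_of_le_of_finrank_le le_sup_left hd
  intro w hw
  rw [e]
  exact Submodule.mem_sup_right ⟨w, hw, rfl⟩

end Optimal

section Core

variable {P T : Type*} [Fintype P] [Fintype T] [DecidableEq P] [DecidableEq T]

theorem mem_SM_of_mulVec {S : Finset (P × T)} {M : Matrix P T ℂ}
    (h : ∀ i j, (i, j) ∉ S → (M *ᵥ Pi.single j 1) i = 0) : M ∈ SM ℂ S := by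
  intro i j hij
  have := h i j hij
  rwa [mulVec_single_one] at this

theorem single_mem_coord {A : Finset T} {j : T} (hj : j ∈ A) :
    (Pi.single j 1 : T → ℂ) ∈ coord ℂ A := fun i hi => by
  rw [Pi.single_apply, if_neg]
  rintro rfl
  exact hi hj

theorem eq_zero_of_mem_coord_compl {A : Finset T} {v : T → ℂ} (h : v ∈ coord ℂ A) (h' : v ∈ coord ℂ Aᶜ) :
    v = 0 := by
  ext i
  by_cases hi : i ∈ A
  · exact h' i (by simpa using hi)
  · exact h i hi

theorem mem_ech_iff_mulVec [PartialOrder P] {B : Finset P} {φ : Matrix P P ℂ}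
    (hφ : φ ∈ SM ℂ (tri Bᶜ B)) {v : P → ℂ} : v ∈ ech B φ ↔ (1 - φ) *ᵥ v ∈ coord ℂ B := by
  have e1 := one_add_mul_one_sub (tri_mul_self disjoint_compl_left hφ hφ)
  have e2 := one_sub_mul_one_add (tri_mul_self disjoint_compl_left hφ hφ)
  constructor
  · rintro ⟨w, hw, rfl⟩
    rw [toLin'_apply, mulVec_mulVec, e2, one_mulVec]
    exact hw
  · intro h
    exact ⟨_, h, by rw [toLin'_apply, mulVec_mulVec, e1, one_mulVec]⟩

theorem mask_mul_mul_mask_mem (B : Finset P) (M : Matrix P T ℂ) (A : Finset T) :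
    mask ℂ B * M * mask ℂ A ∈ SM ℂ (B ×ˢ A) := mem_SM_of fun i j h => by
  rw [mul_mask_apply, mask_mul_apply] at h
  by_contra h'
  rw [Finset.mem_product] at h'
  push Not at h'
  split_ifs at h with h1 h2 <;> first | exact h rfl | exact h' h2 h1

variable [PartialOrder P] [ChainPoset P] [LinearOrder T]

/-- At an optimal graded subspace of a generic matrix, the diagonal blocks are transverse. -/
theorem optimal_core {ι ι' : Type*} [Fintype ι] [Fintype ι'] {c : ι → ℝ} {X : ι → Finset T}
    (hX : LowerWeight c X) {c' : ι' → ℝ} {X' : ι' → Finset P} (hX' : LowerWeight c' X')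
    {κ : ℝ} {g : Matrix P T ℂ} {g₁ : Matrix T P ℂ} (hg : g₁ * g = 1) (hg' : g * g₁ = 1)
    (hgen : ∀ (B : Finset P) (A : Finset T), ∀ φ ∈ SM ℂ (tri Bᶜ B), ∀ u ∈ SM ℂ (tri Aᶜ A),
      ∀ g' ∈ SM ℂ (Bᶜ ×ˢ A)ᶜ, g = (1 + φ) * g' * (1 - u) →
      Bᶜ.card * A.card ≤ (tri Bᶜ B).card + (tri Aᶜ A).card)
    {W : Submodule ℂ (P → ℂ)} (hW : Graded W)
    (hmax : ∀ W', Graded W' → excess c X c' X' κ g W' ≤ excess c X c' X' κ g W ∧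
      (excess c X c' X' κ g W ≤ excess c X c' X' κ g W' → finrank ℂ W' ≤ finrank ℂ W)) :
    ∃ (B : Finset P) (A : Finset T) (y z : Matrix P T ℂ), B.card = A.card ∧ y ∈ SM ℂ (B ×ˢ A) ∧
      (∀ v ∈ coord ℂ A, y *ᵥ v = 0 → v = 0) ∧ Trans y z Bᶜ B Aᶜ A ∧
      (tri Bᶜ B).card + (tri Aᶜ A).card = Bᶜ.card * A.card ∧
      excess c X c' X' κ g W = ∑ i, c i * ((A ∩ X i).card : ℝ) + ∑ i, c' i * ((B ∩ X' i).card : ℝ)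
        - κ * B.card := by
  have hginj : Function.Injective (toLin' g) := mulVec_injective_of_left_inv hg
  obtain ⟨B, φ₀, hφ₀, rfl, -⟩ := exists_ech W hW
  obtain ⟨A, u₀, hu₀, hA, -⟩ := exists_ech ((ech B φ₀).comap (toLin' g)) (graded_of_linear _)
  have eφ := one_add_mul_one_sub (tri_mul_self disjoint_compl_left hφ₀ hφ₀)
  have eφ' := one_sub_mul_one_add (tri_mul_self disjoint_compl_left hφ₀ hφ₀)
  have eu := one_add_mul_one_sub (tri_mul_self disjoint_compl_left hu₀ hu₀)
  have eu' := one_sub_mul_one_add (tri_mul_self disjoint_compl_left hu₀ hu₀)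
  have hcard : B.card = A.card := by
    rw [← finrank_ech hφ₀, ← finrank_ech hu₀, ← hA, ← finrank_map_of_injective _ hginj,
      Submodule.map_comap_eq, LinearMap.range_eq_top.2 (fun v => ⟨g₁ *ᵥ v, by
        rw [toLin'_apply, mulVec_mulVec, hg', one_mulVec]⟩), top_inf_eq]
  obtain ⟨g₂, hg₂⟩ : ∃ g₂ : Matrix P T ℂ, g₂ = (1 - φ₀) * g * (1 + u₀) := ⟨_, rfl⟩
  have hiff : ∀ v, g₂ *ᵥ v ∈ coord ℂ B ↔ v ∈ coord ℂ A := by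
    intro v
    have h1 : g₂ *ᵥ v = (1 - φ₀) *ᵥ (g *ᵥ ((1 + u₀) *ᵥ v)) := by
      rw [hg₂]; simp only [mulVec_mulVec, Matrix.mul_assoc]
    have h2 : (1 + u₀) *ᵥ v ∈ (ech B φ₀).comap (toLin' g) ↔ g *ᵥ ((1 + u₀) *ᵥ v) ∈ ech B φ₀ := Iff.rfl
    rw [h1, ← mem_ech_iff_mulVec hφ₀, ← h2, hA, mem_ech_iff_mulVec hu₀, mulVec_mulVec, eu',
      one_mulVec]
  have hinj : ∀ v, g₂ *ᵥ v = 0 → v = 0 := fun v hv => by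
    have h1 : (1 - u₀) * g₁ * (1 + φ₀) * g₂ = 1 := by
      calc (1 - u₀) * g₁ * (1 + φ₀) * g₂ = (1 - u₀) * (g₁ * (((1 + φ₀) * (1 - φ₀)) * g)) * (1 + u₀) := by
            rw [hg₂]; simp only [Matrix.mul_assoc]
        _ = 1 := by rw [eφ, Matrix.one_mul, hg, Matrix.mul_one, eu']
    rw [← one_mulVec v, ← h1, ← mulVec_mulVec, hv, mulVec_zero]
  have hgg : g = (1 + φ₀) * g₂ * (1 - u₀) := by
    calc g = ((1 + φ₀) * (1 - φ₀)) * g * ((1 + u₀) * (1 - u₀)) := by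
          rw [eφ, eu, Matrix.one_mul, Matrix.mul_one]
      _ = _ := by rw [hg₂]; simp only [Matrix.mul_assoc]
  have hmem : g₂ ∈ SM ℂ (Bᶜ ×ˢ A)ᶜ := mem_SM_of_mulVec fun i j hij => by
    simp only [Finset.mem_compl, Finset.mem_product, not_not] at hij
    exact (hiff _).2 (single_mem_coord hij.2) i hij.1
  have hle := hgen B A φ₀ hφ₀ u₀ hu₀ g₂ hmem hgg
  obtain ⟨y, hy⟩ : ∃ y : Matrix P T ℂ, y = mask ℂ B * g₂ * mask ℂ A := ⟨_, rfl⟩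
  obtain ⟨z, hz⟩ : ∃ z : Matrix P T ℂ, z = mask ℂ Bᶜ * g₂ * mask ℂ Aᶜ := ⟨_, rfl⟩
  have hyv : ∀ v ∈ coord ℂ A, y *ᵥ v = g₂ *ᵥ v := fun v hv => by
    rw [hy, ← mulVec_mulVec, mask_mulVec_of_mem hv, ← mulVec_mulVec,
      mask_mulVec_of_mem ((hiff v).2 hv)]
  have hzv : ∀ v ∈ coord ℂ Aᶜ, z *ᵥ v = mask ℂ Bᶜ *ᵥ (g₂ *ᵥ v) := fun v hv => by
    rw [hz, ← mulVec_mulVec, mask_mulVec_of_mem hv, ← mulVec_mulVec]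
  have hyS : y ∈ SM ℂ (B ×ˢ A) := hy ▸ mask_mul_mul_mask_mem B g₂ A
  have hzS : z ∈ SM ℂ (Bᶜ ×ˢ Aᶜ) := hz ▸ mask_mul_mul_mask_mem Bᶜ g₂ Aᶜ
  have hker : ∀ u ∈ SM ℂ (tri Aᶜ A), ∀ φ ∈ SM ℂ (tri Bᶜ B), z * u - φ * y = 0 → u = 0 ∧ φ = 0 := by
    intro u hu φ hφ h0
    have huc : ∀ v, u *ᵥ v ∈ coord ℂ Aᶜ := fun v => SM_mulVec hu (X := Finset.univ)
      (by simp [coord_univ]) fun i j h _ => (mem_tri.1 h).1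
    have hφc : ∀ v, φ *ᵥ v ∈ coord ℂ Bᶜ := fun v => SM_mulVec hφ (X := Finset.univ)
      (by simp [coord_univ]) fun i j h _ => (mem_tri.1 h).1
    have hst := optimal_stable (Φ := (1 + φ₀) * φ * (1 - φ₀)) hX.nonneg hX'.nonneg hginj hW hmax
      (((gradedMat_one.add (gradedMat_of_tri hφ₀)).mul (gradedMat_of_tri hφ)).mul
        (gradedMat_one.sub (gradedMat_of_tri hφ₀))) (fun i hi w hw hgw => ?_) (fun i hi w hw => ?_)
    · have hφ0 : φ = 0 := by
        have h1 : ∀ v ∈ coord ℂ B, φ *ᵥ v = 0 := fun v hv => by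
          refine eq_zero_of_mem_coord_compl (A := B) ?_ (hφc v)
          have h2 := hst ((1 + φ₀) *ᵥ v) ⟨v, hv, rfl⟩
          rw [mem_ech_iff_mulVec hφ₀, mulVec_mulVec, mulVec_mulVec] at h2
          have h3 : (1 - φ₀) * ((1 + φ₀) * φ * (1 - φ₀) * (1 + φ₀)) = φ := by
            calc _ = ((1 - φ₀) * (1 + φ₀)) * φ * ((1 - φ₀) * (1 + φ₀)) := by
                  simp only [Matrix.mul_assoc]
              _ = φ := by rw [eφ', Matrix.one_mul, Matrix.mul_one]
          rwa [Matrix.mul_assoc (1 - φ₀), h3] at h2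
        refine Matrix.ext fun i j => ?_
        by_cases hj : j ∈ B
        · have := congrFun (h1 _ (single_mem_coord hj)) i
          rwa [mulVec_single_one] at this
        · exact hφ i j fun h => hj (mem_tri.1 h).2.1
      refine ⟨?_, hφ0⟩
      rw [hφ0, Matrix.zero_mul, sub_zero] at h0
      refine Matrix.ext fun i j => ?_
      have h1 : u *ᵥ Pi.single j 1 = 0 := by
        have h2 : z *ᵥ (u *ᵥ Pi.single j 1) = 0 := by
          rw [mulVec_mulVec, h0, zero_mulVec]
        rw [hzv _ (huc _)] at h2
        refine eq_zero_of_mem_coord_compl ((hiff _).1 fun i hi => ?_) (huc _)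
        have h3 := congrFun h2 i
        rwa [mask_mulVec_apply, if_pos (by simpa using hi)] at h3
      have := congrFun h1 i
      rwa [mulVec_single_one] at this
    · have hw' : w ∈ ech A u₀ := by rw [← hA]; exact hgw
      have ha := (mem_ech_iff_mulVec hu₀).1 hw'
      have hlow := hX.lower i hi
      have haX : (1 - u₀) *ᵥ w ∈ coord ℂ (X i) := by
        rw [sub_mulVec, one_mulVec]
        exact sub_mem hw (tri_mulVec_mem hlow hu₀ hw)
      have hw2 : w = (1 + u₀) *ᵥ ((1 - u₀) *ᵥ w) := by
        rw [mulVec_mulVec, eu, one_mulVec]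
      generalize (1 - u₀) *ᵥ w = a at ha haX hw2
      subst hw2
      have huX := tri_mulVec_mem hlow hu haX
      refine ⟨(1 + u₀) *ᵥ (u *ᵥ a), ?_, ?_⟩
      · rw [add_mulVec, one_mulVec]
        exact add_mem huX (tri_mulVec_mem hlow hu₀ huX)
      · have hg2a : ∀ v, (1 - φ₀) *ᵥ (g *ᵥ ((1 + u₀) *ᵥ v)) = g₂ *ᵥ v := fun v => by
          rw [hg₂]; simp only [mulVec_mulVec, Matrix.mul_assoc]
        rw [mem_ech_iff_mulVec hφ₀, mulVec_sub, hg2a]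
        have h3 : (1 - φ₀) *ᵥ (((1 + φ₀) * φ * (1 - φ₀)) *ᵥ (g *ᵥ ((1 + u₀) *ᵥ a))) = z *ᵥ (u *ᵥ a) := by
          rw [← mulVec_mulVec, hg2a, ← hyv a ha, ← mulVec_mulVec, mulVec_mulVec _ (1 - φ₀),
            eφ', one_mulVec, mulVec_mulVec, mulVec_mulVec, sub_eq_zero.1 h0]
        rw [h3, hzv _ (huc a)]
        intro i hi
        rw [Pi.sub_apply, mask_mulVec_apply, if_pos (by simpa using hi), sub_self]
    · have hlow := hX'.lower i hi
      have h1 : (1 - φ₀) *ᵥ w ∈ coord ℂ (X' i) := by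
        rw [sub_mulVec, one_mulVec]
        exact sub_mem hw (tri_mulVec_mem hlow hφ₀ hw)
      have h2 := tri_mulVec_mem hlow hφ h1
      rw [← mulVec_mulVec, ← mulVec_mulVec, add_mulVec, one_mulVec]
      exact add_mem h2 (tri_mulVec_mem hlow hφ₀ h2)
  let S := (SM ℂ (tri Aᶜ A)).prod (SM ℂ (tri Bᶜ B))
  have hmapS : S.map (transMap y z) ≤ SM ℂ (Bᶜ ×ˢ A) := by
    rintro _ ⟨x, hx, rfl⟩
    exact transMap_mem_SM hyS hzS hx.1 hx.2
  have hfr : finrank ℂ (S.map (transMap y z)) = (tri Aᶜ A).card + (tri Bᶜ B).card := by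
    have h1 := finrank_map_add_inf_ker (transMap y z) S
    have h2 : S ⊓ LinearMap.ker (transMap y z) = ⊥ := by
      rw [eq_bot_iff]
      rintro x ⟨hx, hx0⟩
      obtain ⟨h3, h4⟩ := hker _ hx.1 _ hx.2 hx0
      exact (Submodule.mem_bot ℂ).2 (Prod.ext h3 h4)
    rw [h2, finrank_bot, add_zero, finrank_submodule_prod, finrank_SM, finrank_SM] at h1
    exact h1
  have hfr2 : finrank ℂ (SM ℂ (Bᶜ ×ˢ A)) = Bᶜ.card * A.card := by
    rw [finrank_SM, Finset.card_product]
  have hle2 := Submodule.finrank_mono hmapS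
  have heq : S.map (transMap y z) = SM ℂ (Bᶜ ×ˢ A) :=
    Submodule.eq_of_le_of_finrank_le hmapS (by omega)
  refine ⟨B, A, y, z, hcard, hyS, fun v hv h => hinj v (by rwa [← hyv v hv]), fun h hh => ?_, by omega, ?_⟩
  · rw [← heq] at hh
    obtain ⟨x, hx, e⟩ := hh
    exact ⟨x.1, hx.1, x.2, hx.2, e⟩
  · unfold excess
    rw [finrank_ech hφ₀, hA]
    congr 2
    · refine Finset.sum_congr rfl fun i _ => ?_
      by_cases hi : c i = 0
      · simp [hi]
      · rw [inf_comm, finrank_ech_inf (hX.lower i hi) hu₀]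
    · refine Finset.sum_congr rfl fun i _ => ?_
      by_cases hi : c' i = 0
      · simp [hi]
      · rw [finrank_ech_inf (hX'.lower i hi) hφ₀]

theorem not_violates_of_trans {y z : Matrix P T ℂ} {B : Finset P} {A : Finset T} {Dσ : Finset P}
    {Dτ : Finset T} (hD : Dτ.card ≤ Dσ.card) (h : Trans y z Dσ B Dτ A) {W : Submodule ℂ (P → ℂ)}
    (hW : Graded W) : ¬ Violates y Dσ Dτ A W := by
  obtain ⟨B', s, hs, rfl, -⟩ := exists_ech W hW
  obtain ⟨A', s', hs', e, hA'⟩ := exists_ech (coord ℂ A ⊓ (ech B' s).comap (toLin' y))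
    (graded_of_linear _)
  have hAA := (hA' A inf_le_left).1
  have e1 := one_add_mul_one_sub (tri_mul_self disjoint_compl_left hs hs)
  have hr := h.restrict hAA hs hs' (M := (1 - s) * (y * ((1 + s') * mask ℂ A'))) (by
    have h1 : mask ℂ B' * ((1 - s) * (y * ((1 + s') * mask ℂ A'))) =
        (1 - s) * (y * ((1 + s') * mask ℂ A')) := by
      refine mask_mul_of_mem (S := B' ×ˢ Finset.univ) (mem_SM_of_mulVec fun i j hij => ?_)
        fun i j h => (Finset.mem_product.1 h).1
      have hi : i ∉ B' := by simpa using hij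
      have h2 : (1 + s') *ᵥ (mask ℂ A' *ᵥ Pi.single j 1) ∈ ech A' s' :=
        ⟨_, mask_mulVec_mem _ _, rfl⟩
      rw [← e] at h2
      have h3 := (mem_ech_iff_mulVec hs).1 h2.2 i hi
      rw [toLin'_apply] at h3
      simpa only [mulVec_mulVec, Matrix.mul_assoc] using h3
    rw [h1, ← Matrix.mul_assoc (1 + s), e1, Matrix.one_mul])
  unfold Violates
  have s1 : ∀ d ∈ Dτ, finrank ℂ (coord ℂ (A ∩ lowSet d) ⊓ (ech B' s).comap (toLin' y) :
      Submodule ℂ (T → ℂ)) = (A' ∩ lowSet d).card := fun d _ => by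
    rw [← coord_inf, inf_right_comm, e, finrank_ech_inf (isLowerSet_lowSet d) hs']
  have s2 : ∀ d ∈ Dσ, finrank ℂ (ech B' s ⊓ coord ℂ (lowSet d) : Submodule ℂ (P → ℂ)) =
      (B' ∩ lowSet d).card := fun d _ => finrank_ech_inf (isLowerSet_lowSet d) hs
  rw [Finset.sum_congr rfl s1, Finset.sum_congr rfl s2, finrank_ech hs]
  have t1 := card_tri_add Dτ A'
  have t2 := card_tri_add Dσ B'
  have t3 := Nat.mul_le_mul_right A'.card hD
  omega

end Core

section CoreLR

theorem wt_antitone {ι T : Type*} [Fintype ι] [DecidableEq T] [PartialOrder T] {c : ι → ℝ}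
    {X : ι → Finset T} (hc : ∀ i, 0 ≤ c i) (hX : ∀ i, c i ≠ 0 → IsLowerSet (X i : Set T)) :
    Antitone (wt c X) := by
  intro a b hab
  refine Finset.sum_le_sum fun i _ => ?_
  by_cases h0 : c i = 0
  · simp [h0]
  · by_cases hb : b ∈ X i
    · rw [if_pos hb, if_pos (show a ∈ X i from hX i h0 hab hb)]
    · rw [if_neg hb]
      split_ifs
      exacts [hc i, le_rfl]

theorem isLowerSet_filter_lowSet {P P1 : Type*} [Fintype P] [DecidableEq P] [PartialOrder P]
    [Fintype P1] [PartialOrder P1]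
    {e : P1 → P} (he : Monotone e) (d : P) :
    IsLowerSet ((Finset.univ.filter fun k => e k ∈ lowSet d : Finset P1) : Set P1) := by
  intro a b hba ha
  simp only [Finset.mem_coe, Finset.mem_filter, Finset.mem_univ, true_and] at *
  exact isLowerSet_lowSet d (he hba) ha

theorem card_filter_emb {P P1 : Type*} [Fintype P1] [DecidableEq P] {e : P1 → P}
    (he : Function.Injective e) {B : Finset P} (hB : ∀ i, i ∈ B ↔ ∃ k, e k = i) (X : Finset P) :
    (Finset.univ.filter fun k => e k ∈ X).card = (B ∩ X).card := by
  rw [← Finset.card_image_of_injective _ he]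
  congr 1
  ext i
  simp only [Finset.mem_image, Finset.mem_filter, Finset.mem_univ, true_and, Finset.mem_inter, hB]
  constructor
  · rintro ⟨k, hk, rfl⟩; exact ⟨⟨k, rfl⟩, hk⟩
  · rintro ⟨⟨k, rfl⟩, hk⟩; exact ⟨k, hk, rfl⟩

theorem muVec_antitone {N r : ℕ} (A : Finset (Fin N)) (h : A.card = r) : Antitone (muVec A h) := by
  rw [← wt_opp A h ((card_opp A).trans h)]
  exact wt_antitone (indW_nonneg _) fun i _ => isLowerSet_filter_lowSet (OrderEmbedding.monotone _) i

/-- A transverse injective partial matrix produces a point of the Littlewood–Richardson cone. -/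
theorem mem_LRcone_of_trans {m n N : ℕ} (hN : m + n = N) {B : Finset (Fin m)} {C : Finset (Fin n)}
    {A : Finset (Fin N)} (hA : A.card = B.card + C.card) {y z : Matrix (Fin m ⊕ Fin n) (Fin N) ℂ}
    (hy : y ∈ SM ℂ (B.disjSum C ×ˢ opp A)) (hinj : ∀ v ∈ coord ℂ (opp A), y *ᵥ v = 0 → v = 0)
    (htr : Trans y z (B.disjSum C)ᶜ (B.disjSum C) (opp A)ᶜ (opp A))
    (hcard : (tri (B.disjSum C)ᶜ (B.disjSum C)).card + (tri (opp A)ᶜ (opp A)).card =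
      (B.disjSum C)ᶜ.card * (opp A).card) :
    (muVec A hA, muVec B rfl, muVec C rfl) ∈ LRcone B.card C.card := by
  have hA' : (opp A).card = B.card + C.card := (card_opp A).trans hA
  have he := coreEmb_injective B C
  have ha := ((opp A).orderEmbOfFin hA').injective
  have hD : (opp A)ᶜ.card = (B.disjSum C)ᶜ.card := by
    rw [Finset.card_compl, Finset.card_compl, hA', Finset.card_disjSum]; simp [hN]
  have hsemi := (semi_iff_not_violates he (fun i j h => (coreEmb_comp B C i j).1 h)
    (fun i j h => (coreEmb_comp B C i j).2 h) ha (mem_disjSum_iff B C) (mem_iff_orderEmb (opp A) hA') hy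
    (Dσ := (B.disjSum C)ᶜ) (Dτ := (opp A)ᶜ)).2
    fun W hW _ => not_violates_of_trans hD.le htr hW
  have hmono : Monotone (coreEmb B C) := by
    rintro (i | i) (j | j) hij <;> simp_all [coreEmb]
  have h1 := card_tri_add (B.disjSum C)ᶜ (B.disjSum C)
  have h2 := card_tri_add (opp A)ᶜ (opp A)
  have hcB : (B.disjSum C).card = B.card + C.card := Finset.card_disjSum _ _
  obtain ⟨w, hw, hwe⟩ := hsemi.exists_isU rfl
    ⟨indW_nonneg _, fun d _ => isLowerSet_filter_lowSet (OrderEmbedding.monotone _) d⟩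
    ⟨indW_nonneg _, fun d _ => isLowerSet_filter_lowSet hmono d⟩ (by
      intro v v' hv
      refine extZ_injective ha (sub_eq_zero.1 (hinj _ (Submodule.sub_mem _ ?_ ?_) ?_))
      · exact fun i hi => extZ_apply' _ fun k hk => hi ((mem_iff_orderEmb _ hA' _).2 ⟨k, hk⟩)
      · exact fun i hi => extZ_apply' _ fun k hk => hi ((mem_iff_orderEmb _ hA' _).2 ⟨k, hk⟩)
      · rw [mulVec_sub, mulVec_extZ he ha (mem_disjSum_iff B C) hy,
          mulVec_extZ he ha (mem_disjSum_iff B C) hy, sub_eq_zero]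
        exact congrArg _ hv) (by
      rw [sum_indW, sum_indW]
      simp only [card_filter_emb ha (mem_iff_orderEmb (opp A) hA'), card_filter_emb he (mem_disjSum_iff B C)]
      rw [hD, hA'] at h2
      rw [hcB] at h1
      rw [hA'] at hcard
      have : ∑ d ∈ (opp A)ᶜ, (opp A ∩ lowSet d).card + ∑ d ∈ (B.disjSum C)ᶜ, (B.disjSum C ∩ lowSet d).card =
          (B.disjSum C)ᶜ.card * (B.card + C.card) := by omega
      exact_mod_cast this)
  rw [wt_opp A hA hA', wt_disjSum B C] at hwe
  refine mem_LRcone_of_isU (muVec_antitone _ _) (muVec_antitone _ _) (muVec_antitone _ _)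
    (hw.submatrix (Equiv.sumCongr Fin.revPerm Fin.revPerm) (Equiv.refl _)) fun i j hij => ?_
  have h3 := hwe _ _ (comp_map_rev hij)
  rw [conjTranspose_submatrix]
  refine Eq.trans (b := (w * rdiag (muVec A hA) * wᴴ) (Sum.map Fin.rev Fin.rev i) (Sum.map Fin.rev Fin.rev j))
    rfl (h3.trans ?_)
  by_cases e : i = j
  · subst e
    rcases i with i | i <;> simp [rdiag]
  · have e' : Sum.map Fin.rev Fin.rev i ≠ Sum.map Fin.rev Fin.rev j := fun h =>
      e ((Equiv.sumCongr Fin.revPerm Fin.revPerm : Fin B.card ⊕ Fin C.card ≃ _).injective h)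
    rw [rdiag, rdiag, Matrix.diagonal_apply_ne _ e', Matrix.diagonal_apply_ne _ e]

/-- A generic matrix which is not semistable violates a Horn inequality. -/
theorem exists_LRcone_of_not_semi {m n N : ℕ} (hN : m + n = N) {ι ι' : Type*} [Fintype ι] [Fintype ι']
    {c : ι → ℝ} {X : ι → Finset (Fin N)} (hX : LowerWeight c X) {c' : ι' → ℝ}
    {X' : ι' → Finset (Fin m ⊕ Fin n)} (hX' : LowerWeight c' X')
    {κ₁ κ₂ : ℝ} {g : Matrix (Fin m ⊕ Fin n) (Fin N) ℂ} {g₁ : Matrix (Fin N) (Fin m ⊕ Fin n) ℂ}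
    (hg : g₁ * g = 1) (hg' : g * g₁ = 1)
    (hgen : ∀ (B : Finset (Fin m ⊕ Fin n)) (A : Finset (Fin N)),
      ∀ φ ∈ SM ℂ (tri Bᶜ B), ∀ u ∈ SM ℂ (tri Aᶜ A),
      ∀ g' ∈ SM ℂ (Bᶜ ×ˢ A)ᶜ, g = (1 + φ) * g' * (1 - u) →
      Bᶜ.card * A.card ≤ (tri Bᶜ B).card + (tri Aᶜ A).card)
    (h : ¬ Semi c X c' X' (κ₁ + κ₂) g) {w : Fin N → ℝ} {w' : Fin m ⊕ Fin n → ℝ}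
    (hwX : wt c X = fun t => w t + κ₁) (hwX' : wt c' X' = fun t => w' t + κ₂) :
    ∃ (B : Finset (Fin m)) (C : Finset (Fin n)) (A : Finset (Fin N)) (hA : A.card = B.card + C.card),
      (muVec A hA, muVec B rfl, muVec C rfl) ∈ LRcone B.card C.card ∧
      0 < ∑ t ∈ opp A, w t + (∑ i ∈ B, w' (Sum.inl i) + ∑ i ∈ C, w' (Sum.inr i)) := by
  obtain ⟨W, hW, hpos, hmax⟩ := exists_optimal h
  obtain ⟨B, A, y, z, hBA, hy, hinj, htr, hcard, hex⟩ := optimal_core hX hX' hg hg' hgen hW hmax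
  obtain ⟨B, C, rfl⟩ : ∃ (B₁ : Finset (Fin m)) (C₁ : Finset (Fin n)), B = B₁.disjSum C₁ := ⟨_, _, Finset.toLeft_disjSum_toRight.symm⟩
  obtain ⟨A, rfl⟩ : ∃ A₁, A = opp A₁ := ⟨opp A, (opp_opp A).symm⟩
  have hA : A.card = B.card + C.card := by rw [← card_opp, ← hBA, Finset.card_disjSum]
  refine ⟨B, C, A, hA, mem_LRcone_of_trans hN hA hy hinj htr hcard, ?_⟩
  rw [hex, ← sum_wt, ← sum_wt, hwX, hwX', Finset.sum_add_distrib, Finset.sum_add_distrib,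
    Finset.sum_disjSum, Finset.sum_const, Finset.sum_const, ← hBA, nsmul_eq_mul, nsmul_eq_mul] at hpos
  linarith

end CoreLR

section Hat

open Polynomial

theorem charpoly_hat {a b : ℕ} (Z : Matrix (Fin a) (Fin b) ℂ) {τ : Fin b → ℝ}
    (h : (Zᴴ * Z).charpoly = ∏ i, (X - C (τ i : ℂ))) :
    X ^ b * (fromBlocks 0 Z Zᴴ 0).charpoly = X ^ a * ∏ i, (X ^ 2 - C (τ i : ℂ)) := by
  have h1 : ((Zᴴ * Z).charmatrix.map (compRingHom (X ^ 2 : ℂ[X]))).det = ∏ i, (X ^ 2 - C (τ i : ℂ)) := by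
    have := congrArg (compRingHom (X ^ 2 : ℂ[X])) h
    rw [Matrix.charpoly, RingHom.map_det, map_prod] at this
    refine this.trans (Finset.prod_congr rfl fun i _ => ?_)
    simp [coe_compRingHom_apply]
  have h2 : (Zᴴ * Z).charmatrix.map (compRingHom (X ^ 2 : ℂ[X])) =
      (X : ℂ[X]) ^ 2 • (1 : Matrix (Fin b) (Fin b) ℂ[X]) - Zᴴ.map C * Z.map C := by
    rw [← Matrix.map_mul]
    refine Matrix.ext fun i j => ?_
    rw [Matrix.map_apply, Matrix.charmatrix_apply, coe_compRingHom_apply, Matrix.sub_apply, Matrix.smul_apply,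
      Matrix.map_apply, Matrix.diagonal_apply, Matrix.one_apply]
    split_ifs <;> simp
  have h3 : (fromBlocks 1 0 (Zᴴ.map C) ((X : ℂ[X]) • (1 : Matrix (Fin b) (Fin b) ℂ[X]))) *
      (fromBlocks 0 Z Zᴴ 0).charmatrix =
      fromBlocks ((X : ℂ[X]) • (1 : Matrix (Fin a) (Fin a) ℂ[X])) (-(Z.map C)) 0
        ((X : ℂ[X]) ^ 2 • (1 : Matrix (Fin b) (Fin b) ℂ[X]) - Zᴴ.map C * Z.map C) := by
    have hc : ∀ k : ℕ, (0 : Matrix (Fin k) (Fin k) ℂ).charmatrix = (X : ℂ[X]) • 1 := fun k => by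
      rw [Matrix.smul_one_eq_diagonal, Matrix.charmatrix]; simp
    rw [Matrix.charmatrix_fromBlocks, hc, hc, fromBlocks_multiply]
    congr 1
    · simp
    · simp
    · simp
    · simp [pow_two, smul_smul, sub_eq_neg_add]
  have h4 := congrArg Matrix.det h3
  rw [Matrix.det_mul, Matrix.det_fromBlocks_zero₁₂, Matrix.det_fromBlocks_zero₂₁, ← h2, h1] at h4
  simpa [Matrix.charpoly, Matrix.det_smul] using h4

theorem hatPQ_rev {p q : ℕ} (hpq : q ≤ p) (s : Fin q → ℝ) (i : Fin (p + q)) :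
    hatPQ p q s i.rev = -hatPQ p q s i := by
  have hi := i.2
  have hr : (i.rev : ℕ) = p + q - (i + 1) := Fin.val_rev i
  unfold hatPQ
  by_cases h1 : (i : ℕ) < q
  · rw [dif_pos h1, dif_neg (by omega), dif_neg (by omega)]
    congr 2; ext; simp only; omega
  · by_cases h2 : (i : ℕ) < p
    · rw [dif_neg h1, dif_pos h2, dif_neg (by omega), dif_pos (by omega), neg_zero]
    · rw [dif_neg h1, dif_neg h2, dif_pos (by omega), neg_neg]
      congr 2; omega

theorem hatPQ_antitone {p q : ℕ} (hpq : q ≤ p) {s : Fin q → ℝ} (hs : Antitone s) (h0 : ∀ i, 0 ≤ s i) :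
    Antitone (hatPQ p q s) := by
  intro i j hij
  have hij' : (i : ℕ) ≤ j := hij
  unfold hatPQ
  split_ifs with h1 h2 h3 h4 h5 h6 h7 h8
  · exact hs hij
  · omega
  · omega
  · exact h0 _
  · exact le_rfl
  · omega
  · linarith [h0 ⟨p + q - 1 - j, by omega⟩, h0 ⟨i, by assumption⟩]
  · linarith [h0 ⟨p + q - 1 - j, by omega⟩]
  · exact neg_le_neg (hs (Fin.mk_le_mk.2 (by omega)))

theorem prod_hatPQ {p q : ℕ} (hpq : q ≤ p) (s : Fin q → ℝ) :
    X ^ q * ∏ i, (X - C (hatPQ p q s i : ℂ)) = X ^ p * ∏ i, (X ^ 2 - C ((s i ^ 2 : ℝ) : ℂ)) := by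
  obtain ⟨d, rfl⟩ := Nat.exists_eq_add_of_le hpq
  rw [Fin.prod_univ_add, Fin.prod_univ_add]
  have h1 : ∀ i : Fin q, hatPQ (q + d) q s (Fin.castAdd q (Fin.castAdd d i)) = s i := fun i => by
    unfold hatPQ; rw [dif_pos (by simp)]; rfl
  have h2 : ∀ i : Fin d, hatPQ (q + d) q s (Fin.castAdd q (Fin.natAdd q i)) = 0 := fun i => by
    unfold hatPQ; rw [dif_neg (by simp), dif_pos (by simp)]
  have h3 : ∀ i : Fin q, hatPQ (q + d) q s (Fin.natAdd (q + d) i) = -s i.rev := fun i => by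
    rw [← neg_neg (hatPQ _ _ _ _), ← hatPQ_rev hpq, ← h1 i.rev]
    congr 3; ext; simp; omega
  simp only [h1, h2, h3]
  have h4 : ∏ i : Fin q, (X - C ((-s i.rev : ℝ) : ℂ)) = ∏ i : Fin q, (X - C ((-s i : ℝ) : ℂ)) :=
    Equiv.prod_comp Fin.revPerm fun i => (X - C ((-s i : ℝ) : ℂ))
  have h5 : ∏ i, (X ^ 2 - C ((s i ^ 2 : ℝ) : ℂ)) =
      (∏ i, (X - C (s i : ℂ))) * ∏ i, (X - C ((-s i : ℝ) : ℂ)) := by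
    rw [← Finset.prod_mul_distrib]
    refine Finset.prod_congr rfl fun i _ => ?_
    push_cast
    simp only [map_neg, map_pow]
    ring
  rw [h4, h5]
  simp only [Complex.ofReal_zero, C_0, sub_zero, Finset.prod_const, Finset.card_univ, Fintype.card_fin]
  ring

/-- The singular values of a tall matrix are the square roots of the eigenvalues of its Gram matrix. -/
theorem sval_eq_sqrt {a b : ℕ} (hab : b ≤ a) (Z : Matrix (Fin a) (Fin b) ℂ) (i : Fin b) :
    sval Z i = sval Zᴴ i := by
  have hZ := Matrix.isHermitian_conjTranspose_mul_self Z
  have hpos : ∀ i, 0 ≤ eigVec (Zᴴ * Z) hZ i := fun i => by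
    open scoped ComplexOrder in
    exact (Matrix.posSemidef_conjTranspose_mul_self Z).eigenvalues_nonneg _
  have hanti := eigVec_antitone _ hZ
  have h1 : eigVec (Z * Zᴴ) (Matrix.isHermitian_mul_conjTranspose_self Z) = fun i : Fin a =>
      if h : (i : ℕ) < b then eigVec (Zᴴ * Z) hZ ⟨i, h⟩ else 0 := by
    refine eigVec_eq_of_charpoly _ (fun i j hij => ?_) ?_
    · have hij' : (i : ℕ) ≤ j := hij
      split_ifs with h1 h2
      exacts [hanti hij, by omega, hpos _, le_rfl]
    · rw [Matrix.charpoly_mul_comm_of_le _ _ (by simpa using hab), eigVec_charpoly _ hZ]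
      obtain ⟨d, rfl⟩ := Nat.exists_eq_add_of_le hab
      rw [Fin.prod_univ_add]
      simp [mul_comm]
  have h2 : eigVec (Zᴴ * Zᴴᴴ) (Matrix.isHermitian_mul_conjTranspose_self Zᴴ) = eigVec (Zᴴ * Z) hZ := by
    have : ∀ W, W = Z → ∀ hW : (Zᴴ * W).IsHermitian, eigVec (Zᴴ * W) hW = eigVec (Zᴴ * Z) hZ := by
      rintro _ rfl _; rfl
    exact this _ (conjTranspose_conjTranspose Z) _
  rw [sval, sval, dif_pos (i.2.trans_le hab), dif_pos i.2, h1, h2]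
  simp

theorem sval_nonneg {a b : ℕ} (Z : Matrix (Fin a) (Fin b) ℂ) (i : ℕ) : 0 ≤ sval Z i := by
  unfold sval; split_ifs; exacts [Real.sqrt_nonneg _, le_rfl]

theorem eigVec_hat {a b : ℕ} (hab : b ≤ a) (Z : Matrix (Fin a) (Fin b) ℂ)
    {M : Matrix (Fin (a + b)) (Fin (a + b)) ℂ} (hM : M.IsHermitian)
    (h : M.charpoly = (fromBlocks 0 Z Zᴴ 0).charpoly) :
    eigVec M hM = hatPQ a b fun i => sval Zᴴ i := by
  have hpos : ∀ i, 0 ≤ eigVec (Zᴴ * Zᴴᴴ) (Matrix.isHermitian_mul_conjTranspose_self Zᴴ) i := fun i => by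
    open scoped ComplexOrder in
    exact (Matrix.posSemidef_self_mul_conjTranspose Zᴴ).eigenvalues_nonneg _
  have h0 : ∀ i : Fin b, sval Zᴴ i =
      Real.sqrt (eigVec (Zᴴ * Zᴴᴴ) (Matrix.isHermitian_mul_conjTranspose_self Zᴴ) i) := fun i => by
    rw [sval, dif_pos i.2]
  refine eigVec_eq_of_charpoly hM (hatPQ_antitone hab (fun i j hij => ?_) fun i => sval_nonneg _ _) ?_
  · simp only [h0]
    exact Real.sqrt_le_sqrt (eigVec_antitone _ _ hij)
  · refine mul_left_cancel₀ (pow_ne_zero b X_ne_zero) ?_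
    rw [h, prod_hatPQ hab]
    refine charpoly_hat Z ?_
    refine Eq.trans (by rw [conjTranspose_conjTranspose])
      ((eigVec_charpoly _ (Matrix.isHermitian_mul_conjTranspose_self Zᴴ)).trans ?_)
    refine Finset.prod_congr rfl fun i _ => ?_
    rw [h0, Real.sq_sqrt (hpos i)]

theorem hatPQ_injective {p q : ℕ} (s t : Fin q → ℝ) (h : hatPQ p q s = hatPQ p q t) : s = t := by
  funext i
  have := congrFun h (Fin.castLE (Nat.le_add_left q p) i)
  simpa [hatPQ] using this

theorem sum_hatPQ {p q : ℕ} (hpq : q ≤ p) (s : Fin q → ℝ) (A : Finset (Fin (p + q))) :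
    ∑ i ∈ A, hatPQ p q s i = sumRestr s A - sumRestr s (opp A) := by
  unfold sumRestr opp
  rw [Finset.sum_image (fun _ _ _ _ h => Fin.rev_injective h), ← Finset.sum_sub_distrib]
  refine Finset.sum_congr rfl fun i _ => ?_
  have hr : (i.rev : ℕ) = p + q - (i + 1) := Fin.val_rev i
  have hi := i.2
  unfold hatPQ
  by_cases h1 : (i : ℕ) < q
  · rw [dif_pos h1, dif_pos h1, dif_neg (by omega), sub_zero]
  · by_cases h2 : (i : ℕ) < p
    · rw [dif_neg h1, dif_pos h2, dif_neg h1, dif_neg (by omega), sub_zero]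
    · rw [dif_neg h1, dif_neg h2, dif_neg h1, dif_pos (by omega), zero_sub]
      congr 2; ext; simp only; omega

theorem sum_opp_hatPQ {p q : ℕ} (hpq : q ≤ p) (s : Fin q → ℝ) (A : Finset (Fin (p + q))) :
    ∑ i ∈ opp A, hatPQ p q s i = -∑ i ∈ A, hatPQ p q s i := by
  rw [sum_hatPQ hpq, sum_hatPQ hpq, opp_opp, neg_sub]

end Hat

section Mix

/-- The involution exchanging the last `q` indices of the two summands. -/
def mix (p q : ℕ) : Equiv.Perm (Fin (p + q) ⊕ Fin (p + q)) :=
  Function.Involutive.toPerm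
    (Sum.elim (fun i => if (i : ℕ) < p then Sum.inl i else Sum.inr i)
      fun i => if (i : ℕ) < p then Sum.inr i else Sum.inl i) (by
    rintro (i | i) <;> by_cases h : (i : ℕ) < p <;> simp [h])

theorem mix_inl {p q : ℕ} (i : Fin (p + q)) :
    mix p q (Sum.inl i) = if (i : ℕ) < p then Sum.inl i else Sum.inr i := rfl

theorem mix_inr {p q : ℕ} (i : Fin (p + q)) :
    mix p q (Sum.inr i) = if (i : ℕ) < p then Sum.inr i else Sum.inl i := rfl

theorem mix_mix {p q : ℕ} (i : Fin (p + q) ⊕ Fin (p + q)) : mix p q (mix p q i) = i :=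
  (mix p q).symm_apply_apply i

/-- The augmented matrix of `X`, reordered so that its diagonal blocks are the augmented matrices of the
off-diagonal blocks of `X`. -/
def mixM (p q : ℕ) (X : Matrix (Fin (p + q)) (Fin (p + q)) ℂ) :
    SqMat (Fin (p + q) ⊕ Fin (p + q)) :=
  (fromBlocks 0 X Xᴴ 0).submatrix (mix p q) (mix p q)

variable {p q : ℕ} (X : Matrix (Fin (p + q)) (Fin (p + q)) ℂ)

theorem mixM_isHermitian : (mixM p q X).IsHermitian := by
  refine Matrix.IsHermitian.submatrix ?_ _
  rw [Matrix.IsHermitian, fromBlocks_conjTranspose]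
  simp

theorem eigVec_mixM (hM : ((mixM p q X).submatrix finSumFinEquiv.symm finSumFinEquiv.symm).IsHermitian) :
    eigVec _ hM = hatPQ (p + q) (p + q) fun i => sval X i := by
  rw [eigVec_hat le_rfl X hM]
  · congr 1; funext i; rw [← sval_eq_sqrt le_rfl]
  · exact (Matrix.charpoly_reindex finSumFinEquiv (mixM p q X)).trans
      (Matrix.charpoly_reindex (mix p q).symm _)

theorem mixM_inl : (mixM p q X).submatrix Sum.inl Sum.inl =
    Matrix.reindex finSumFinEquiv finSumFinEquiv
      (fromBlocks 0 (blockTR p q X) (blockTR p q X)ᴴ 0) := by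
  refine Matrix.ext fun i j => ?_
  induction i using Fin.addCases <;> induction j using Fin.addCases <;>
    simp [mixM, mix_inl, blockTR]

theorem mixM_inr : (mixM p q X).submatrix Sum.inr Sum.inr =
    Matrix.reindex finSumFinEquiv finSumFinEquiv
      (fromBlocks 0 (blockBL p q X)ᴴ (blockBL p q X)ᴴᴴ 0) := by
  refine Matrix.ext fun i j => ?_
  induction i using Fin.addCases <;> induction j using Fin.addCases <;>
    simp [mixM, mix_inr, blockBL]

theorem eigVec_mixM_inl (hpq : q ≤ p) (hM : ((mixM p q X).submatrix Sum.inl Sum.inl).IsHermitian) :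
    eigVec _ hM = hatPQ p q fun i => sval (blockTR p q X) i := by
  rw [eigVec_hat hpq (blockTR p q X) hM]
  · congr 1; funext i; rw [sval_eq_sqrt hpq]
  · rw [mixM_inl]; exact Matrix.charpoly_reindex _ _

theorem eigVec_mixM_inr (hpq : q ≤ p) (hM : ((mixM p q X).submatrix Sum.inr Sum.inr).IsHermitian) :
    eigVec _ hM = hatPQ p q fun i => sval (blockBL p q X) i := by
  rw [eigVec_hat hpq (blockBL p q X)ᴴ hM]
  · rw [conjTranspose_conjTranspose]
  · rw [mixM_inr]; exact Matrix.charpoly_reindex _ _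

theorem LRcone_const {m n : ℕ} {l : Fin (m + n) → ℝ} {μ : Fin m → ℝ} {ν : Fin n → ℝ} (x : ℝ)
    (hl : ∀ i, l i = x) (hμ : ∀ i, μ i = x) (hν : ∀ i, ν i = x) : (l, μ, ν) ∈ LRcone m n := by
  obtain rfl : l = fun _ => x := funext hl
  obtain rfl : μ = fun _ => x := funext hμ
  obtain rfl : ν = fun _ => x := funext hν
  have h1 : ∀ {T : Type} [Fintype T] [DecidableEq T], rdiag (fun _ : T => x) = (x : ℂ) • 1 := by
    intros; rw [Matrix.smul_one_eq_diagonal]; rfl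
  have hU : IsU ((1 : SqMat (Fin m ⊕ Fin n)).submatrix (Equiv.refl _) finSumFinEquiv.symm) :=
    IsU.submatrix ⟨by simp, by simp⟩ _ _
  refine mem_LRcone_of_isU antitone_const antitone_const antitone_const hU fun i j _ => ?_
  have h2 : Sum.elim (fun _ : Fin m => x) (fun _ : Fin n => x) = fun _ => x := by
    funext i; rcases i with i | i <;> rfl
  rw [h2, h1, h1, Matrix.mul_smul, Matrix.mul_one, Matrix.smul_mul, hU.right]

theorem muVec_singleton {n r : ℕ} {A : Finset (Fin n)} {k : Fin n} (hA' : A = {k})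
    (hA : A.card = r) (i : Fin r) : muVec A hA i = k := by
  have h := (A.orderIsoOfFin hA i.rev).2
  have hr : r = 1 := by rw [← hA, hA', Finset.card_singleton]
  have hi := i.rev.2
  rw [muVec]
  subst hA'
  rw [Finset.mem_singleton.1 h]
  have : (i.rev : ℕ) = 0 := by omega
  rw [this]; simp

/-- The inequalities of the rectangular Horn problem are necessary. -/
theorem coneS_necessity (hpq : q ≤ p) {s t : Fin q → ℝ} {g : Fin (p + q) → ℝ} (h : (g, s, t) ∈ coneS p q)
    (A : Finset (Fin (p + q + (p + q)))) (B C : Finset (Fin (p + q))) (hA : A.card = B.card + C.card)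
    (hL : (muVec A hA, muVec B rfl, muVec C rfl) ∈ LRcone B.card C.card) :
    ∑ i ∈ B, hatPQ p q s i + ∑ i ∈ C, hatPQ p q t i ≤ ∑ i ∈ A, hatPQ (p + q) (p + q) g i := by
  obtain ⟨X, h1, h2, h3⟩ := h
  have hM := (mixM_isHermitian X).submatrix finSumFinEquiv.symm
  have h4 := necessity _ hM A B C hA hL
  have e1 : ∀ k : Matrix _ _ ℂ, ∀ hk : k.IsHermitian, k = (mixM p q X).submatrix Sum.inl Sum.inl →
      eigVec k hk = hatPQ p q s := by
    rintro _ hk rfl; rw [eigVec_mixM_inl X hpq]; congr 1; exact (funext h2).symm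
  have e2 : ∀ k : Matrix _ _ ℂ, ∀ hk : k.IsHermitian, k = (mixM p q X).submatrix Sum.inr Sum.inr →
      eigVec k hk = hatPQ p q t := by
    rintro _ hk rfl; rw [eigVec_mixM_inr X hpq]; congr 1; exact (funext h3).symm
  rw [e1 _ _ (by refine Matrix.ext fun i j => ?_; simp), e2 _ _ (by
      refine Matrix.ext fun i j => ?_
      simp only [submatrix_apply, finSumFinEquiv_symm_apply_natAdd]),
    eigVec_mixM] at h4
  rwa [← show g = fun i : Fin (p + q) => sval X i from funext h1] at h4

theorem coneS_le (hpq : q ≤ p) {s t : Fin q → ℝ} {g : Fin (p + q) → ℝ} (h : (g, s, t) ∈ coneS p q)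
    (k : Fin q) : s k ≤ g (Fin.castLE (Nat.le_add_left q p) k) ∧
      t k ≤ g (Fin.castLE (Nat.le_add_left q p) k) := by
  let k' : Fin (p + q) := Fin.castLE (Nat.le_add_left q p) k
  let k2 : Fin (p + q + (p + q)) := Fin.castAdd (p + q) k'
  have e0 : ∀ s : Fin q → ℝ, hatPQ p q s k' = s k := fun s => by simp [hatPQ, k']
  have e1 : hatPQ (p + q) (p + q) g k2 = g k' := by simp [hatPQ, k2]
  have h1 := coneS_necessity hpq h {k2} {k'} ∅ (by simp) (LRcone_const (k : ℝ)
    (muVec_singleton rfl _) (muVec_singleton rfl _) fun i => absurd i.2 (by simp))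
  have h2 := coneS_necessity hpq h {k2} ∅ {k'} (by simp) (LRcone_const (k : ℝ)
    (muVec_singleton rfl _) (fun i => absurd i.2 (by simp)) (muVec_singleton rfl _))
  simp only [Finset.sum_singleton, Finset.sum_empty, add_zero, zero_add, e0, e1] at h1 h2
  exact ⟨h1, h2⟩

end Mix

section FullBlock

theorem conj_rdiag_apply {P T : Type*} [Fintype P] [DecidableEq P] [Fintype T] [DecidableEq T]
    (g : Matrix P T ℂ) (l : T → ℝ) (i j : P) :
    (g * rdiag l * gᴴ) i j = ∑ k, g i k * l k * star (g j k) := by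
  rw [Matrix.mul_apply]
  refine Finset.sum_congr rfl fun k _ => ?_
  rw [rdiag, Matrix.mul_diagonal, conjTranspose_apply]

/-- A positive semidefinite matrix with a vanishing diagonal block has the spectrum of the other block. -/
theorem eq_append_zero {b c N : ℕ} (hN : b + c = N) {l : Fin N → ℝ} (hl : Antitone l) (h0 : ∀ i, 0 ≤ l i)
    {ν : Fin c → ℝ} (hν : Antitone ν) (hν0 : ∀ i, 0 ≤ ν i) {g : Matrix (Fin b ⊕ Fin c) (Fin N) ℂ}
    (hg : IsU g) (h : CompEq (g * rdiag l * gᴴ) (rdiag (Sum.elim 0 ν))) (i : Fin N) :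
    l i = if h : (i : ℕ) < c then ν ⟨i, h⟩ else 0 := by
  have h1 : ∀ i k, g (Sum.inl i) k * l k = 0 := by
    intro i k
    have h2 := h (Sum.inl i) (Sum.inl i) (Comp.refl _)
    rw [conj_rdiag_apply] at h2
    have h3 : ∑ k, Complex.normSq (g (Sum.inl i) k) * l k = 0 := by
      rw [← Complex.ofReal_inj, Complex.ofReal_sum]
      refine Eq.trans (Finset.sum_congr rfl fun k _ => ?_) (h2.trans (by simp [rdiag]))
      rw [Complex.ofReal_mul, Complex.normSq_eq_conj_mul_self, Complex.star_def]
      ring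
    have h4 := (Finset.sum_eq_zero_iff_of_nonneg fun k _ =>
      mul_nonneg (Complex.normSq_nonneg _) (h0 k)).1 h3 k (Finset.mem_univ _)
    rcases mul_eq_zero.1 h4 with h5 | h5
    · rw [Complex.normSq_eq_zero.1 h5, zero_mul]
    · rw [h5, Complex.ofReal_zero, mul_zero]
  have h2 : g * rdiag l * gᴴ = rdiag (Sum.elim 0 ν) := by
    refine Matrix.ext fun i j => ?_
    rcases i with i | i
    · rcases j with j | j
      · exact h _ _ (by simpa [Comp] using le_total i j)
      · rw [conj_rdiag_apply, rdiag, Matrix.diagonal_apply_ne _ (by simp)]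
        exact Finset.sum_eq_zero fun k _ => by rw [h1, zero_mul]
    · rcases j with j | j
      · rw [conj_rdiag_apply, rdiag, Matrix.diagonal_apply_ne _ (by simp)]
        refine Finset.sum_eq_zero fun k _ => ?_
        have h3 : (l k : ℂ) * star (g (Sum.inl j) k) = 0 := by
          rcases mul_eq_zero.1 (h1 j k) with h4 | h4
          · rw [h4, star_zero, mul_zero]
          · rw [h4, zero_mul]
        rw [mul_assoc, h3, mul_zero]
      · exact h _ _ (by simpa [Comp] using le_total i j)
  subst hN
  refine congrFun (antitone_eq_of_prod_eq (w := fun i : Fin (b + c) =>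
    if h : (i : ℕ) < c then ν ⟨i, h⟩ else 0) hl (fun i j hij => ?_) ?_) i
  · have hij' : (i : ℕ) ≤ j := hij
    dsimp only
    split_ifs with h1 h2
    exacts [hν hij, by omega, hν0 _, le_rfl]
  · rw [← charpoly_conj_rdiag finSumFinEquiv hg, h2, rdiag, Matrix.charpoly_diagonal, Fintype.prod_sum_type,
      ← Equiv.prod_comp (finCongr (Nat.add_comm c b)), Fin.prod_univ_add]
    simp [mul_comm]

theorem muVec_nonneg {N r : ℕ} (A : Finset (Fin N)) (h : A.card = r) (i : Fin r) : 0 ≤ muVec A h i := by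
  rw [← wt_opp A h ((card_opp A).trans h)]
  exact Finset.sum_nonneg fun k _ => by split_ifs; exacts [indW_nonneg _ _, le_rfl]

theorem muVec_univ {n : ℕ} {B : Finset (Fin n)} (hB : B = Finset.univ) : muVec B rfl = 0 := by
  subst hB
  have h := wt_opp (Finset.univ : Finset (Fin n)) rfl (card_opp _)
  have h2 : (opp (Finset.univ : Finset (Fin n)))ᶜ = ∅ := by ext i; simp [mem_opp]
  rw [← h, h2]
  funext k
  simp only [wt, indW, Finset.notMem_empty, if_false, ite_self, Finset.sum_const_zero, Pi.zero_apply]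

theorem sum_of_muVec {n b c N : ℕ} (hb : b = n) (hN : b + c = N) {A : Finset (Fin (n + n))} {C : Finset (Fin n)}
    (hA : A.card = N) (hC : C.card = c)
    (h : ∀ i, muVec A hA i = if h : (i : ℕ) < c then muVec C hC ⟨i, h⟩ else 0) (f : Fin (n + n) → ℝ) :
    ∑ i ∈ A, f i = ∑ i, f (Fin.castAdd n i) + ∑ j ∈ C, f (Fin.natAdd n j) := by
  subst hb hN
  have hsum : ∀ {m r : ℕ} (S : Finset (Fin m)) (hS : S.card = r) (f : Fin m → ℝ),
      ∑ i ∈ S, f i = ∑ k, f (S.orderIsoOfFin hS k) := fun S hS f => by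
    rw [← Finset.sum_coe_sort]
    exact (Equiv.sum_comp (S.orderIsoOfFin hS).toEquiv fun x : S => f x).symm
  rw [hsum A hA, hsum C hC, Fin.sum_univ_add]
  have hk : ∀ k, (((A.orderIsoOfFin hA k : Fin (b + b)) : ℕ) : ℝ) = k + muVec A hA k.rev := fun k => by
    rw [muVec, Fin.rev_rev]; ring
  congr 1
  · refine Finset.sum_congr rfl fun k _ => congrArg f (Fin.ext ?_)
    have h1 := hk (Fin.castAdd c k)
    have h2 := k.2
    rw [h, dif_neg (by rw [Fin.val_rev, Fin.val_castAdd]; omega), add_zero] at h1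
    exact_mod_cast h1
  · refine Finset.sum_congr rfl fun k _ => congrArg f (Fin.ext ?_)
    have h1 := hk (Fin.natAdd b k)
    have h2 := k.2
    have h3 : ((Fin.natAdd b k).rev : ℕ) = k.rev := by
      rw [Fin.val_rev, Fin.val_natAdd, Fin.val_rev]; omega
    rw [h, dif_pos (by rw [h3]; exact k.rev.2)] at h1
    have h4 : muVec C hC ⟨(Fin.natAdd b k).rev, by rw [h3]; exact k.rev.2⟩ =
        ((C.orderIsoOfFin hC k : Fin b) : ℕ) - (k : ℝ) := by
      rw [show (⟨(Fin.natAdd b k).rev, by rw [h3]; exact k.rev.2⟩ : Fin c) = k.rev from Fin.ext h3, muVec,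
        Fin.rev_rev]
    rw [h4] at h1
    push_cast [Fin.val_natAdd] at h1 ⊢
    have h5 : (((A.orderIsoOfFin hA (Fin.natAdd b k) : Fin (b + b)) : ℕ) : ℝ) =
      ((b + ((C.orderIsoOfFin hC k : Fin b) : ℕ) : ℕ) : ℝ) := by push_cast; linarith
    exact_mod_cast h5

/-- The inequality attached to a full block follows from the entrywise bounds. -/
theorem sum_le_of_full {p q c N : ℕ} (hpq : q ≤ p) {g : Fin (p + q) → ℝ} (hg0 : ∀ i, 0 ≤ g i) {t : Fin q → ℝ}
    (ht0 : ∀ i, 0 ≤ t i)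
    (hgt : ∀ k : Fin q, t k ≤ g (Fin.castLE (Nat.le_add_left q p) k))
    {b : ℕ} (hb : b = p + q) (hN : b + c = N) {A : Finset (Fin (p + q + (p + q)))} {C : Finset (Fin (p + q))}
    (hA : A.card = N) (hC : C.card = c) {w : Matrix (Fin b ⊕ Fin c) (Fin N) ℂ} (hw : IsU w)
    (h : CompEq (w * rdiag (muVec A hA) * wᴴ) (rdiag (Sum.elim 0 (muVec C hC)))) :
    ∑ i ∈ C, hatPQ p q t i ≤ ∑ i ∈ A, hatPQ (p + q) (p + q) g i := by
  rw [sum_of_muVec hb hN hA hC (eq_append_zero hN (muVec_antitone _ _) (muVec_nonneg _ _)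
    (muVec_antitone _ _) (muVec_nonneg _ _) hw h)]
  have h1 : ∀ j : Fin (p + q), hatPQ (p + q) (p + q) g (Fin.natAdd (p + q) j) = -g j.rev := fun j => by
    rw [← neg_neg (hatPQ _ _ _ _), ← hatPQ_rev le_rfl]
    have hr : ((Fin.natAdd (p + q) j).rev : ℕ) = j.rev := by
      rw [Fin.val_rev, Fin.val_natAdd, Fin.val_rev]; omega
    unfold hatPQ
    rw [dif_pos (by rw [hr]; exact j.rev.2)]
    congr 2; exact Fin.ext hr
  have h2 : ∀ j : Fin (p + q), hatPQ (p + q) (p + q) g (Fin.castAdd (p + q) j) = g j := fun j => by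
    simp [hatPQ]
  simp only [h1, h2]
  have h3 : ∀ j, hatPQ p q t j ≤ g j := fun j => by
    unfold hatPQ
    split_ifs with h4 h5
    exacts [hgt ⟨j, h4⟩, hg0 j, (neg_nonpos.2 (ht0 _)).trans (hg0 j)]
  have h4 : ∑ j, g j = ∑ j ∈ C, g j.rev + ∑ j ∈ Cᶜ, g j.rev := by
    rw [Finset.sum_add_sum_compl]; exact (Equiv.sum_comp Fin.revPerm g).symm
  have h5 : ∑ j ∈ C, hatPQ p q t j = ∑ j ∈ Cᶜ, hatPQ p q t j.rev := by
    have h6 : ∑ j : Fin (p + q), hatPQ p q t j.rev = ∑ j, hatPQ p q t j := Equiv.sum_comp Fin.revPerm _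
    simp only [hatPQ_rev hpq, Finset.sum_neg_distrib] at h6 ⊢
    have h7 := Finset.sum_add_sum_compl C (hatPQ p q t)
    linarith
  rw [h4, h5, Finset.sum_neg_distrib]
  have := Finset.sum_le_sum fun j (_ : j ∈ Cᶜ) => h3 j.rev
  linarith

theorem exists_isU_of_mem_LRcone {m n : ℕ} {l : Fin (m + n) → ℝ} {μ : Fin m → ℝ} {ν : Fin n → ℝ}
    (h : (l, μ, ν) ∈ LRcone m n) : ∃ g : Matrix (Fin m ⊕ Fin n) (Fin (m + n)) ℂ, IsU g ∧
      CompEq (g * rdiag l * gᴴ) (rdiag (Sum.elim μ ν)) := by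
  obtain ⟨M, hM, e1, e2, e3⟩ := h
  simp only at e1 e2 e3
  obtain ⟨g, hg, hd⟩ := exists_diagonal_blocks M hM
  rw [← e1, ← e2, ← e3] at hd
  exact ⟨g, hg, hd⟩

/-- The inequalities indexed by proper subsets imply all Horn inequalities. -/
theorem horn_of_proper {p q : ℕ} (hpq : q ≤ p) {g : Fin (p + q) → ℝ} (hg0 : ∀ i, 0 ≤ g i) {s t : Fin q → ℝ}
    (hs0 : ∀ i, 0 ≤ s i) (ht0 : ∀ i, 0 ≤ t i)
    (hgs : ∀ k : Fin q, s k ≤ g (Fin.castLE (Nat.le_add_left q p) k))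
    (hgt : ∀ k : Fin q, t k ≤ g (Fin.castLE (Nat.le_add_left q p) k))
    (hH : ∀ (A : Finset (Fin (p + q + (p + q)))) (B C : Finset (Fin (p + q))),
      B ≠ Finset.univ → C ≠ Finset.univ → ∀ hA : A.card = B.card + C.card,
      (muVec A hA, muVec B rfl, muVec C rfl) ∈ LRcone B.card C.card →
      ∑ i ∈ B, hatPQ p q s i + ∑ i ∈ C, hatPQ p q t i ≤ ∑ i ∈ A, hatPQ (p + q) (p + q) g i)
    (A : Finset (Fin (p + q + (p + q)))) (B C : Finset (Fin (p + q))) (hA : A.card = B.card + C.card)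
    (hL : (muVec A hA, muVec B rfl, muVec C rfl) ∈ LRcone B.card C.card) :
    ∑ i ∈ B, hatPQ p q s i + ∑ i ∈ C, hatPQ p q t i ≤ ∑ i ∈ A, hatPQ (p + q) (p + q) g i := by
  have h0 : ∀ s : Fin q → ℝ, ∑ i, hatPQ p q s i = 0 := fun s => by
    have h1 : ∑ j : Fin (p + q), hatPQ p q s j.rev = ∑ j, hatPQ p q s j := Equiv.sum_comp Fin.revPerm _
    simp only [hatPQ_rev hpq, Finset.sum_neg_distrib] at h1
    linarith
  have hcard : ∀ B : Finset (Fin (p + q)), B = Finset.univ → B.card = p + q := by rintro _ rfl; simp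
  by_cases hB : B = Finset.univ
  · obtain ⟨w, hw, hd⟩ := exists_isU_of_mem_LRcone hL
    rw [muVec_univ hB] at hd
    have := sum_le_of_full hpq hg0 ht0 hgt (hcard B hB) rfl hA rfl hw hd
    rwa [show ∑ i ∈ B, hatPQ p q s i = 0 by rw [hB, h0], zero_add]
  · by_cases hC : C = Finset.univ
    · obtain ⟨w, hw, hd⟩ := exists_isU_of_mem_LRcone hL
      rw [muVec_univ hC] at hd
      have := sum_le_of_full hpq hg0 hs0 hgs (hcard C hC) (Nat.add_comm _ _) hA (C := B) rfl
        (hw.submatrix (Equiv.sumComm _ _) (Equiv.refl _)) (fun i j hij => by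
          have h1 := hd i.swap j.swap (by rcases i with i | i <;> rcases j with j | j <;> simpa [Comp] using hij)
          refine Eq.trans (b := (w * rdiag (muVec A hA) * wᴴ) i.swap j.swap) rfl (h1.trans ?_)
          rcases i with i | i <;> rcases j with j | j <;> simp [rdiag, Matrix.diagonal_apply])
      rwa [show ∑ i ∈ C, hatPQ p q t i = 0 by rw [hC, h0], add_zero]
    · exact hH A B C hB hC hA hL

end FullBlock

section Reference

/-- The matrix with diagonal `f` and antidiagonal `g`. -/
noncomputable def revMat {n : ℕ} (f g : Fin n → ℝ) : Matrix (Fin n) (Fin n) ℂ :=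
  Matrix.of fun i j => (if i = j then (f i : ℂ) else 0) + if j = i.rev then (g i : ℂ) else 0

theorem revMat_mul {n : ℕ} (f g f' g' : Fin n → ℝ) :
    revMat f g * revMat f' g' = revMat (fun i => f i * f' i + g i * g' i.rev)
      fun i => f i * g' i + g i * f' i.rev := by
  refine Matrix.ext fun i j => ?_
  have he : ∀ x : Fin n, (j = x.rev) = (x = j.rev) := fun x =>
    propext ⟨fun h => by rw [h, Fin.rev_rev], fun h => by rw [h, Fin.rev_rev]⟩
  simp only [Matrix.mul_apply, revMat, Matrix.of_apply, he, add_mul, ite_mul, zero_mul, mul_add, mul_ite, mul_zero,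
    Finset.sum_add_distrib, Finset.sum_ite_eq, Finset.sum_ite_eq', Finset.mem_univ, if_true, Fin.rev_rev]
  by_cases h1 : i = j <;> by_cases h2 : i = j.rev
  · subst h1; simp [← h2]; ring
  · subst h1; simp [h2]
  · subst h2; simp [h1]; ring
  · simp [h1, h2, Ne.symm h1]

theorem revMat_conjTranspose {n : ℕ} {f g : Fin n → ℝ} (h : ∀ i, g i.rev = g i) :
    (revMat f g)ᴴ = revMat f g := by
  refine Matrix.ext fun i j => ?_
  simp only [conjTranspose_apply, revMat, Matrix.of_apply, star_add]
  have h1 : (i = j.rev) = (j = i.rev) := propext ⟨fun h => by rw [h, Fin.rev_rev], fun h => by rw [h, Fin.rev_rev]⟩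
  simp only [h1]
  by_cases h2 : i = j <;> by_cases h3 : j = i.rev
  · subst h2; simp [← h3]
  · subst h2; simp [h3]
  · rw [if_neg h2, if_neg (Ne.symm h2), if_pos h3, if_pos h3, h3, h]; simp
  · simp [h2, Ne.symm h2, h3]

theorem revMat_zero {n : ℕ} (f : Fin n → ℝ) : revMat f 0 = rdiag f := by
  refine Matrix.ext fun i j => ?_
  simp [revMat, rdiag, Matrix.diagonal_apply]

/-- The signature of the augmented matrices. -/
def sgn (p q : ℕ) (i : Fin (p + q)) : ℝ := if (i : ℕ) < p then 1 else -1

/-- The diagonal signature matrix is conjugate to a matrix supported where `hatPQ` is antisymmetric. -/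
theorem exists_conj_sgn {p q : ℕ} (hpq : q ≤ p) : ∃ K : Matrix (Fin (p + q)) (Fin (p + q)) ℂ,
    Kᴴ = K ∧ K * K = 1 ∧ ∀ i j, (K * rdiag (sgn p q) * K) i j ≠ 0 →
      ∀ s, hatPQ p q s i + hatPQ p q s j = 0 := by
  obtain ⟨r, hr⟩ : ∃ r : ℝ, r * r = 1 / 2 := ⟨√(1 / 2), Real.mul_self_sqrt (by norm_num)⟩
  let a : Fin (p + q) → ℝ := fun i => if (i : ℕ) < q then r else if (i : ℕ) < p then 1 else -r
  let b : Fin (p + q) → ℝ := fun i => if (i : ℕ) < q then r else if (i : ℕ) < p then 0 else r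
  have hrev : ∀ i : Fin (p + q), ((i : ℕ) < q ∧ ¬ (i.rev : ℕ) < p ∧ (i : ℕ) < p ∧ ¬ (i.rev : ℕ) < q) ∨
      (¬ (i : ℕ) < q ∧ (i : ℕ) < p ∧ ¬ (i.rev : ℕ) < q ∧ (i.rev : ℕ) < p) ∨
      (¬ (i : ℕ) < p ∧ (i.rev : ℕ) < q ∧ ¬ (i : ℕ) < q ∧ (i.rev : ℕ) < p) := fun i => by
    have := Fin.val_rev i
    have := i.2
    omega
  refine ⟨revMat a b, revMat_conjTranspose fun i => ?_, ?_, ?_⟩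
  · rcases hrev i with h | h | h <;> simp [b, h, -Fin.val_rev]
  · rw [revMat_mul, ← rdiag_one, ← revMat_zero]
    congr 1 <;> funext i <;> rcases hrev i with h | h | h <;> simp [a, b, h, -Fin.val_rev] <;> linarith
  · intro i j hij s
    rw [← revMat_zero, revMat_mul, revMat_mul] at hij
    by_cases hj : j = i.rev
    · rw [hj, hatPQ_rev hpq, add_neg_cancel]
    · rcases hrev i with h | h | h
      · exact absurd (by simp [revMat, hj, a, b, sgn, h, -Fin.val_rev]) hij
      · have e : i = j := by
          by_contra hne
          simp [revMat, hj, hne] at hij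
        subst e
        simp [hatPQ, h]
      · exact absurd (by simp [revMat, hj, a, b, sgn, h, -Fin.val_rev]) hij

theorem exists_layerCake_add {T : Type*} [Fintype T] [DecidableEq T] [PartialOrder T] {w : T → ℝ} (hw : Antitone w) :
    ∃ (κ : ℝ) (c : Finset T → ℝ), (∀ X, 0 ≤ c X) ∧ (∀ X, c X ≠ 0 → IsLowerSet (X : Set T)) ∧
      wt c id = fun t => w t + κ := by
  refine ⟨∑ t, |w t|, exists_layerCake _ _ (fun a b h => add_le_add_left (hw h) _) (fun t => ?_) rfl⟩
  have := Finset.single_le_sum (fun t _ => abs_nonneg (w t)) (Finset.mem_univ t)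
  have := neg_abs_le (w t)
  linarith

theorem sum_hatPQ_univ {p q : ℕ} (hpq : q ≤ p) (s : Fin q → ℝ) : ∑ i, hatPQ p q s i = 0 := by
  have h : opp (Finset.univ : Finset (Fin (p + q))) = Finset.univ := by ext i; simp [mem_opp]
  rw [sum_hatPQ hpq, h, sub_self]

end Reference

section Sufficiency

theorem exists_anticomm_of_horn {m n k : ℕ} (hk : m + n = k) {w : Fin k → ℝ} {w' : Fin m ⊕ Fin n → ℝ}
    (hw : Antitone w) (hw' : Antitone w') (hw0 : ∑ t, w t = 0) (hw0' : ∑ t, w' t = 0)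
    {J : SqMat (Fin m ⊕ Fin n)} (hJ : IsU J) (hJ' : Jᴴ = J) (hJg : GradedMat J)
    (hJw : ∀ a b, J a b ≠ 0 → w' a + w' b ≤ 0) {g : Matrix (Fin m ⊕ Fin n) (Fin k) ℂ} (hg : IsU g)
    (hgw : ∀ a b, (gᴴ * J * g) a b ≠ 0 → w a + w b ≤ 0)
    (hH : ∀ (A : Finset (Fin k)) (B : Finset (Fin m)) (C : Finset (Fin n)) (hA : A.card = B.card + C.card),
      (muVec A hA, muVec B rfl, muVec C rfl) ∈ LRcone B.card C.card →
      ∑ t ∈ opp A, w t + (∑ i ∈ B, w' (Sum.inl i) + ∑ i ∈ C, w' (Sum.inr i)) ≤ 0) :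
    ∃ (u : Matrix (Fin m ⊕ Fin n) (Fin k) ℂ) (v : SqMat (Fin m ⊕ Fin n)),
      IsU u ∧ IsU v ∧ GradedMat v ∧ u * rdiag w * uᴴ * J = -(J * (u * rdiag w * uᴴ)) ∧
      CompEq (u * rdiag w * uᴴ) (-(v * rdiag w' * vᴴ)) := by
  classical
  obtain ⟨κ₁, c, hc, hX, hwX⟩ := exists_layerCake_add hw
  obtain ⟨κ₂, c', hc', hX', hwX'⟩ := exists_layerCake_add hw'
  obtain ⟨E, hE, hgen⟩ := exists_generic_card hJ hJ' hg.left hg.right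
  have hl : (gᴴ * (J * Eᴴ * J)) * (E * g) = 1 := by
    calc (gᴴ * (J * Eᴴ * J)) * (E * g) = gᴴ * (J * (Eᴴ * J * E)) * g := by simp only [Matrix.mul_assoc]
      _ = gᴴ * (Jᴴ * J) * g := by rw [hE, hJ']
      _ = 1 := by rw [hJ.left, Matrix.mul_one, hg.left]
  have hEi : (J * Eᴴ * J) * E = 1 := by
    rw [Matrix.mul_assoc, Matrix.mul_assoc, ← Matrix.mul_assoc Eᴴ, hE]
    nth_rw 1 [← hJ']
    exact hJ.left
  have hr : (E * g) * (gᴴ * (J * Eᴴ * J)) = 1 := by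
    calc (E * g) * (gᴴ * (J * Eᴴ * J)) = E * (g * gᴴ) * (J * Eᴴ * J) := by simp only [Matrix.mul_assoc]
      _ = 1 := by rw [hg.right, Matrix.mul_one, mul_eq_one_comm.1 hEi]
  refine Semi.exists_isU_anticomm hk ⟨hc, hX⟩ ⟨hc', hX'⟩ (mulVec_injective_of_left_inv hl) ?_
    hwX hwX' hw hw' hw0 hw0' hJ hJg hJw (fun a b h => hgw a b ?_)
  · by_contra hs
    obtain ⟨B, C, A, hA, hL, hpos⟩ := exists_LRcone_of_not_semi hk ⟨hc, hX⟩ ⟨hc', hX'⟩ hl hr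
      hgen hs hwX hwX'
    exact absurd (hH A B C hA hL) (not_le.2 hpos)
  · rwa [show (E * g)ᴴ * J * (E * g) = gᴴ * J * g by
      rw [conjTranspose_mul]
      calc gᴴ * Eᴴ * J * (E * g) = gᴴ * (Eᴴ * J * E) * g := by simp only [Matrix.mul_assoc]
        _ = gᴴ * J * g := by rw [hE]] at h

/-- The signature distinguishing the two summands after applying `mix`. -/
def sgnMix (p q : ℕ) : Fin (p + q) ⊕ Fin (p + q) → ℝ := Sum.elim (sgn p q) (-sgn p q)

theorem sgnMix_mix_inl {p q : ℕ} (i : Fin (p + q)) : sgnMix p q (mix p q (Sum.inl i)) = 1 := by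
  rw [mix_inl]; split_ifs with h <;> simp [sgnMix, sgn, h]

theorem sgnMix_mix_inr {p q : ℕ} (i : Fin (p + q)) : sgnMix p q (mix p q (Sum.inr i)) = -1 := by
  rw [mix_inr]; split_ifs with h <;> simp [sgnMix, sgn, h]

theorem sgnMix_mul_self {p q : ℕ} (i) : sgnMix p q i * sgnMix p q i = 1 := by
  rcases i with i | i <;> simp only [sgnMix, Sum.elim_inl, Sum.elim_inr, Pi.neg_apply, sgn] <;> split_ifs <;> norm_num

theorem exists_reference {p q : ℕ} (hpq : q ≤ p) :
    ∃ (K : SqMat (Fin (p + q) ⊕ Fin (p + q)))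
      (g : Matrix (Fin (p + q) ⊕ Fin (p + q)) (Fin (p + q + (p + q))) ℂ),
      Kᴴ = K ∧ K * K = 1 ∧ GradedMat K ∧ IsU g ∧
      (∀ a b, (K * rdiag (sgnMix p q) * K) a b ≠ 0 → ∀ s t,
        Sum.elim (hatPQ p q s) (hatPQ p q t) a + Sum.elim (hatPQ p q s) (hatPQ p q t) b = 0) ∧
      ∀ a b, (gᴴ * (K * rdiag (sgnMix p q) * K) * g) a b ≠ 0 → ∀ s,
        hatPQ (p + q) (p + q) s a + hatPQ (p + q) (p + q) s b = 0 := by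
  obtain ⟨K, hK, hKK, hs⟩ := exists_conj_sgn hpq
  obtain ⟨K', hK', hKK', hs'⟩ := exists_conj_sgn (le_refl (p + q))
  let K₂ : SqMat (Fin (p + q) ⊕ Fin (p + q)) := fromBlocks K 0 0 K
  have h1 : K₂ᴴ = K₂ := by
    show (fromBlocks K 0 0 K)ᴴ = _
    rw [fromBlocks_conjTranspose, hK]; simp [K₂]
  have h2 : K₂ * K₂ = 1 := by
    show fromBlocks K 0 0 K * fromBlocks K 0 0 K = _
    rw [fromBlocks_multiply, hKK]; simp
  let f : Fin (p + q + (p + q)) ≃ Fin (p + q) ⊕ Fin (p + q) := finSumFinEquiv.symm.trans (mix p q)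
  have hF : IsU ((1 : SqMat (Fin (p + q) ⊕ Fin (p + q))).submatrix
    (Equiv.refl _) f) := IsU.submatrix ⟨by simp, by simp⟩ _ _
  have hD : ((1 : SqMat (Fin (p + q) ⊕ Fin (p + q))).submatrix
      (Equiv.refl _) f)ᴴ * rdiag (sgnMix p q) * ((1 : SqMat (Fin (p + q) ⊕ Fin (p + q))).submatrix
      (Equiv.refl _) f) = rdiag (sgn (p + q) (p + q)) := by
    have e1 : rdiag (sgnMix p q) = (rdiag (sgnMix p q)).submatrix (Equiv.refl _) (Equiv.refl _) := rfl
    rw [e1, conjTranspose_submatrix, submatrix_mul_equiv, submatrix_mul_equiv,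
      conjTranspose_one, Matrix.one_mul, Matrix.mul_one, rdiag, submatrix_diagonal_equiv, rdiag]
    congr 1
    funext i
    have : sgnMix p q (f i) = sgn (p + q) (p + q) i := by
      induction i using Fin.addCases with
      | left i => simp [f, sgnMix_mix_inl, sgn]
      | right i =>
        show sgnMix p q (mix p q (finSumFinEquiv.symm (Fin.natAdd (p + q) i))) = _
        rw [finSumFinEquiv_symm_apply_natAdd, sgnMix_mix_inr]
        simp [sgn]
    simp [this]
  refine ⟨K₂, K₂ * (1 : SqMat (Fin (p + q) ⊕ Fin (p + q))).submatrix
    (Equiv.refl _) f * K', h1, h2, gradedMat_fromBlocks _ _,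
    (IsU.mul ⟨by rw [h1, h2], by rw [h1, h2]⟩ hF).mul ⟨by rw [hK', hKK'], by rw [hK', hKK']⟩, ?_, ?_⟩
  · intro a b hab s t
    have e : K₂ * rdiag (sgnMix p q) * K₂ = fromBlocks (K * rdiag (sgn p q) * K) 0 0
        (-(K * rdiag (sgn p q) * K)) := by
      have e1 : rdiag (sgnMix p q) = fromBlocks (rdiag (sgn p q)) 0 0 (-rdiag (sgn p q)) := by
        rw [rdiag, rdiag, Matrix.diagonal_neg, fromBlocks_diagonal]
        congr 1
        funext i
        rcases i with i | i <;> simp [sgnMix]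
      show fromBlocks K 0 0 K * _ * fromBlocks K 0 0 K = _
      rw [e1, fromBlocks_multiply, fromBlocks_multiply]
      simp
    rw [e] at hab
    rcases a with a | a <;> rcases b with b | b
    · exact hs a b hab s
    · exact absurd rfl hab
    · exact absurd rfl hab
    · exact hs a b (fun h => hab (by simp [h])) t
  · intro a b hab
    refine hs' a b fun h => hab ?_
    rw [← h, ← hD]
    refine congrFun (congrFun ?_ a) b
    generalize (1 : SqMat (Fin (p + q) ⊕ Fin (p + q))).submatrix
      (Equiv.refl _) f = F
    rw [conjTranspose_mul, conjTranspose_mul, h1, hK']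
    calc K' * (Fᴴ * K₂) * (K₂ * rdiag (sgnMix p q) * K₂) * (K₂ * F * K') =
        K' * Fᴴ * (K₂ * K₂) * rdiag (sgnMix p q) * (K₂ * K₂) * F * K' := by simp only [Matrix.mul_assoc]
      _ = K' * (Fᴴ * rdiag (sgnMix p q) * F) * K' := by
        rw [h2, Matrix.mul_one, Matrix.mul_one]; simp only [Matrix.mul_assoc]

theorem exists_eq_mixM {p q : ℕ} {M : SqMat (Fin (p + q) ⊕ Fin (p + q))}
    (hM : Mᴴ = M) (h : M * rdiag (sgnMix p q) = -(rdiag (sgnMix p q) * M)) : ∃ X, M = mixM p q X := by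
  have h0 : ∀ i j, sgnMix p q i = sgnMix p q j → M i j = 0 := by
    intro i j hij
    have h1 := congrFun (congrFun h i) j
    rw [rdiag, Matrix.mul_diagonal, Matrix.neg_apply, Matrix.diagonal_mul, hij] at h1
    have h2 : (sgnMix p q j : ℂ) ≠ 0 := by
      intro h0
      have := sgnMix_mul_self (p := p) (q := q) j
      rw [Complex.ofReal_eq_zero.1 h0] at this
      norm_num at this
    have h3 : 2 * (M i j * sgnMix p q j) = 0 := by linear_combination h1
    simpa [h2] using h3
  refine ⟨Matrix.of fun i j => M (mix p q (Sum.inl i)) (mix p q (Sum.inr j)), ?_⟩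
  refine Matrix.ext fun i j => ?_
  obtain ⟨i, rfl⟩ := (mix p q).surjective i
  obtain ⟨j, rfl⟩ := (mix p q).surjective j
  rw [mixM, submatrix_apply, mix_mix, mix_mix]
  rcases i with i | i <;> rcases j with j | j
  · exact h0 _ _ (by rw [sgnMix_mix_inl, sgnMix_mix_inl])
  · rfl
  · show _ = star (M (mix p q (Sum.inl j)) (mix p q (Sum.inr i)))
    rw [← conjTranspose_apply, hM]
  · exact h0 _ _ (by rw [sgnMix_mix_inr, sgnMix_mix_inr])

theorem CompEq.exists_conj_blocks {m n : ℕ} {M : SqMat (Fin m ⊕ Fin n)}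
    {v : SqMat (Fin m ⊕ Fin n)} (hv : IsU v) (hvg : GradedMat v) {x : Fin m → ℝ} {y : Fin n → ℝ}
    (h : CompEq M (v * rdiag (Sum.elim x y) * vᴴ)) :
    (∃ a, IsU a ∧ M.submatrix Sum.inl Sum.inl = a * rdiag x * aᴴ) ∧
      ∃ b, IsU b ∧ M.submatrix Sum.inr Sum.inr = b * rdiag y * bᴴ := by
  have e := hvg.eq_fromBlocks
  generalize v.toBlocks₁₁ = a at e
  generalize v.toBlocks₂₂ = b at e
  subst e
  have e1 : rdiag (Sum.elim x y) = fromBlocks (rdiag x) 0 0 (rdiag y) := by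
    rw [rdiag, rdiag, rdiag, fromBlocks_diagonal]
    congr 1
    funext i
    rcases i with i | i <;> rfl
  have h1 := hv.left
  have h2 := hv.right
  rw [fromBlocks_conjTranspose, fromBlocks_multiply, ← fromBlocks_one, fromBlocks_inj] at h1 h2
  rw [e1, fromBlocks_conjTranspose, fromBlocks_multiply, fromBlocks_multiply] at h
  simp only [conjTranspose_zero, Matrix.mul_zero, Matrix.zero_mul, add_zero, zero_add] at h h1 h2
  refine ⟨⟨a, ⟨h1.1, h2.1⟩, Matrix.ext fun i j => ?_⟩, b, ⟨h1.2.2.2, h2.2.2.2⟩, Matrix.ext fun i j => ?_⟩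
  · exact h (Sum.inl i) (Sum.inl j) (by simpa [Comp] using le_total i j)
  · exact h (Sum.inr i) (Sum.inr j) (by simpa [Comp] using le_total i j)

theorem coneS_sufficiency {p q : ℕ} (hpq : q ≤ p) {g : Fin (p + q) → ℝ} (hg : Antitone g) (hg0 : ∀ i, 0 ≤ g i)
    {s t : Fin q → ℝ} (hs : Antitone s) (hs0 : ∀ i, 0 ≤ s i) (ht : Antitone t) (ht0 : ∀ i, 0 ≤ t i)
    (hH : ∀ (A : Finset (Fin (p + q + (p + q)))) (B C : Finset (Fin (p + q))) (hA : A.card = B.card + C.card),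
      (muVec A hA, muVec B rfl, muVec C rfl) ∈ LRcone B.card C.card →
      ∑ i ∈ B, hatPQ p q s i + ∑ i ∈ C, hatPQ p q t i ≤ ∑ i ∈ A, hatPQ (p + q) (p + q) g i) :
    (g, s, t) ∈ coneS p q := by
  obtain ⟨K, g₀, hK, hKK, hKg, hg₀, hJs, hgs⟩ := exists_reference hpq
  have hKU : IsU K := ⟨by rw [hK, hKK], by rw [hK, hKK]⟩
  have hD : IsU (rdiag (sgnMix p q)) := by
    have : rdiag (sgnMix p q) * rdiag (sgnMix p q) = 1 := by
      rw [rdiag_mul, ← rdiag_one]; congr 1; funext i; exact sgnMix_mul_self i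
    exact ⟨by rw [rdiag_conjTranspose, this], by rw [rdiag_conjTranspose, this]⟩
  have hDg : GradedMat (rdiag (sgnMix p q)) := fun i j h => by
    by_cases hij : i = j
    · subst hij; exact Comp.refl _
    · exact absurd (by rw [rdiag, Matrix.diagonal_apply_ne _ hij]) h
  have hgw := hatPQ_antitone (le_refl (p + q)) hg hg0
  have hs' := hatPQ_antitone hpq hs hs0
  have ht' := hatPQ_antitone hpq ht ht0
  obtain ⟨u, v, hu, hv, hvg, hac, hce⟩ := exists_anticomm_of_horn rfl (w := hatPQ (p + q) (p + q) g)
    (w' := Sum.elim (hatPQ p q s) (hatPQ p q t)) hgw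
    (by
      rintro (i | i) (j | j) h
      · exact hs' (Sum.inl_le_inl_iff.1 h)
      · exact absurd h Sum.not_inl_le_inr
      · exact absurd h Sum.not_inr_le_inl
      · exact ht' (Sum.inr_le_inr_iff.1 h))
    (sum_hatPQ_univ le_rfl g)
    (by simp only [Fintype.sum_sum_type, Sum.elim_inl, Sum.elim_inr, sum_hatPQ_univ hpq, add_zero])
    ((hKU.mul hD).mul hKU)
    (by rw [conjTranspose_mul, conjTranspose_mul, hK, rdiag_conjTranspose, Matrix.mul_assoc])
    ((hKg.mul hDg).mul hKg) (fun a b h => (hJs a b h s t).le) hg₀ (fun a b h => (hgs a b h g).le)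
    (fun A B C hA hL => by
      have := hH A B C hA hL
      rw [sum_opp_hatPQ le_rfl]
      simp only [Sum.elim_inl, Sum.elim_inr]
      linarith)
  set M := u * rdiag (hatPQ (p + q) (p + q) g) * uᴴ with hM
  have hMH : Mᴴ = M := by
    rw [hM, conjTranspose_mul, conjTranspose_mul, conjTranspose_conjTranspose,
      rdiag_conjTranspose, Matrix.mul_assoc]
  obtain ⟨X, hX⟩ : ∃ X, -(K * M * K) = mixM p q X := by
    refine exists_eq_mixM ?_ ?_
    · rw [conjTranspose_neg, conjTranspose_mul, conjTranspose_mul, hK, hMH, ← Matrix.mul_assoc]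
    · generalize rdiag (sgnMix p q) = D at *
      have e1 : K * (M * (K * D * K)) * K = K * M * K * D := by
        calc _ = K * M * K * D * (K * K) := by simp only [Matrix.mul_assoc]
          _ = _ := by rw [hKK, Matrix.mul_one]
      have e2 : K * ((K * D * K) * M) * K = D * (K * M * K) := by
        calc _ = (K * K) * D * (K * M * K) := by simp only [Matrix.mul_assoc]
          _ = _ := by rw [hKK, Matrix.one_mul]
      rw [Matrix.neg_mul, Matrix.mul_neg, neg_neg, ← e1, ← e2, hac]
      simp
  have hXc : CompEq (mixM p q X) ((K * v) * rdiag (Sum.elim (hatPQ p q s) (hatPQ p q t)) * (K * v)ᴴ) := by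
    have h1 : CompEq (K * M * K) (K * (-(v * rdiag (Sum.elim (hatPQ p q s) (hatPQ p q t)) * vᴴ)) * K) := by
      intro i j hij
      have h1 := CompEq.mul_mul (D := M - -(v * rdiag (Sum.elim (hatPQ p q s) (hatPQ p q t)) * vᴴ))
        (fun i j hij => by rw [Matrix.sub_apply, hce i j hij, sub_self, Matrix.zero_apply]) hKg hKg i j hij
      rwa [Matrix.mul_sub, Matrix.sub_mul, Matrix.sub_apply, Matrix.zero_apply, sub_eq_zero] at h1
    rw [← hX]
    intro i j hij
    rw [Matrix.neg_apply, h1 i j hij, conjTranspose_mul, hK]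
    simp [Matrix.mul_assoc]
  obtain ⟨⟨a, ha, ha'⟩, b, hb, hb'⟩ := hXc.exists_conj_blocks (hKU.mul hv) (hKg.mul hvg)
  refine ⟨X, fun i => ?_, fun i => ?_, fun i => ?_⟩
  · have h1 : mixM p q X = (K * u).submatrix (Equiv.refl _) Fin.revPerm * rdiag (hatPQ (p + q) (p + q) g) *
        ((K * u).submatrix (Equiv.refl _) Fin.revPerm)ᴴ := by
      rw [← hX]
      have e1 : rdiag (hatPQ (p + q) (p + q) g) =
          (-rdiag (hatPQ (p + q) (p + q) g)).submatrix Fin.revPerm Fin.revPerm := by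
        rw [rdiag, Matrix.diagonal_neg, submatrix_diagonal_equiv]
        congr 1
        funext i
        simp [hatPQ_rev]
      rw [e1, conjTranspose_submatrix, submatrix_mul_equiv, submatrix_mul_equiv,
        conjTranspose_mul, hK, hM]
      simp [Matrix.mul_assoc]
    have h2 := eigVec_of_isU finSumFinEquiv.symm ((hKU.mul hu).submatrix (Equiv.refl _) Fin.revPerm) hgw h1
      ((mixM_isHermitian X).submatrix _)
    rw [eigVec_mixM] at h2
    exact congrFun (hatPQ_injective _ _ h2) i |>.symm
  · have h2 := eigVec_of_isU (Equiv.refl _) ha hs' ha' ((mixM_isHermitian X).submatrix _)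
    exact congrFun (hatPQ_injective _ _ ((eigVec_mixM_inl X hpq ((mixM_isHermitian X).submatrix _)).symm.trans h2)) i |>.symm
  · have h2 := eigVec_of_isU (Equiv.refl _) hb ht' hb' ((mixM_isHermitian X).submatrix _)
    exact congrFun (hatPQ_injective _ _ ((eigVec_mixM_inr X hpq ((mixM_isHermitian X).submatrix _)).symm.trans h2)) i |>.symm

end Sufficiency

end HornRect

theorem stmt_8 (p q : ℕ) (hq : 1 ≤ q) (hpq : q ≤ p)
    (g : Fin (p + q) → ℝ) (hg : Antitone g) (hg0 : ∀ i, 0 ≤ g i)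
    (s : Fin q → ℝ) (hs : Antitone s) (hs0 : ∀ i, 0 ≤ s i)
    (t : Fin q → ℝ) (ht : Antitone t) (ht0 : ∀ i, 0 ≤ t i) :
    (g, s, t) ∈ coneS p q ↔
      ((∀ k : Fin q, g (Fin.castLE (Nat.le_add_left q p) k) ≥ s k ∧
          g (Fin.castLE (Nat.le_add_left q p) k) ≥ t k) ∧
       ∀ (A : Finset (Fin (p + q + (p + q)))) (B C : Finset (Fin (p + q))),
         B ≠ Finset.univ → C ≠ Finset.univ →
         ∀ hA : A.card = B.card + C.card,
           (muVec A hA, muVec B rfl, muVec C rfl) ∈ LRcone B.card C.card →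
           sumRestr g A - sumRestr g (opp A) ≥
             sumRestr s B - sumRestr s (opp B) + (sumRestr t C - sumRestr t (opp C))) := by
  constructor
  · intro h
    refine ⟨HornRect.coneS_le hpq h, fun A B C _ _ hA hL => ?_⟩
    rw [ge_iff_le, ← HornRect.sum_hatPQ le_rfl, ← HornRect.sum_hatPQ hpq, ← HornRect.sum_hatPQ hpq]
    exact HornRect.coneS_necessity hpq h A B C hA hL
  · rintro ⟨h, hH⟩
    refine HornRect.coneS_sufficiency hpq hg hg0 hs hs0 ht ht0 fun A B C hA hL =>
      HornRect.horn_of_proper hpq hg0 hs0 ht0 (fun k => (h k).1) (fun k => (h k).2)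
        (fun A B C hB hC hA hL => ?_) A B C hA hL
    rw [HornRect.sum_hatPQ le_rfl, HornRect.sum_hatPQ hpq, HornRect.sum_hatPQ hpq]
    exact hH A B C hB hC hA hL
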